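/- Let k be an algebraically closed field with char(k) ≠ 2. If G is a subgroup of the Cremona group Cr_k = Aut_k(k(x,y)) which is isomorphic to (ℤ/2)^r for some natural number r, then r ≤ 4. -/

import Mathlib

/-- The field `k(x,y)` of rational functions in two variables over `k`. -/
noncomputable abbrev Kxy (k : Type*) [Field k] : Type _ :=
  FractionRing (MvPolynomial (Fin 2) k)

namespace CremonaRank
open Polynomial Bivariate

/-- The homogenised value of a one-variable polynomial. -/
lemma sum_homogenize {B : Type*} [CommRing B] (p q : B) (Z : B[X]) (n : ℕ) (hn : Z.natDegree ≤ n) :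
    Z.sum (fun i c => c * p ^ i * q ^ (n - i)) = Z.coeff 0 * q ^ n + p * (Finset.range n).sum
      (fun i => Z.coeff (i + 1) * p ^ i * q ^ (n - (i + 1))) := by
  rw [Polynomial.sum_over_range' _ (by simp) (n + 1) (by omega), Finset.sum_range_succ',
    Finset.mul_sum, add_comm]
  congr 1
  · simp
  · refine Finset.sum_congr rfl fun i _ => ?_
    ring

section Kernel

variable {k F K : Type*} [Field k] [Field F] [Field K] [Algebra k F] [Algebra F K] [Algebra k K]
  [IsScalarTower k F K]

/-- Extension of scalars for bivariate polynomials. -/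
noncomputable def bmap (k F : Type*) [Field k] [Field F] [Algebra k F] : k[X][Y] →+* F[X][Y] :=
  mapRingHom (mapRingHom (algebraMap k F))

/-- Evaluation of bivariate polynomials at a pair of elements of an algebra. -/
noncomputable def ev (k : Type*) {A : Type*} [Field k] [CommRing A] [Algebra k A] (x y : A) :
    k[X][Y] →ₐ[k] A := aevalAeval x y

section
variable {A : Type*} [CommRing A] [Algebra k A]

@[simp] lemma ev_X (x y : A) : ev k x y (C X) = x := by simp [ev]
@[simp] lemma ev_Y (x y : A) : ev k x y Y = y := by simp [ev]
@[simp] lemma ev_CC (x y : A) (c : k) : ev k x y (C (C c)) = algebraMap k A c := by simp [ev]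
@[simp] lemma ev_C (x y : A) (c : k[X]) : ev k x y (C c) = aeval x c := by simp [ev]

lemma ev_ext {R : Type*} [Semiring R] {φ ψ : k[X][Y] →+* R}
    (h0 : ∀ c : k, φ (C (C c)) = ψ (C (C c))) (h1 : φ (C X) = ψ (C X)) (h2 : φ Y = ψ Y) : φ = ψ := by
  apply Polynomial.ringHom_ext' _ h2
  apply Polynomial.ringHom_ext'
  · ext c; exact h0 c
  · exact h1

lemma algHom_ev {B : Type*} [CommRing B] [Algebra k B] (φ : A →ₐ[k] B) (x y : A) (P : k[X][Y]) :
    φ (ev k x y P) = ev k (φ x) (φ y) P := by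
  have : (φ : A →+* B).comp (ev k x y : k[X][Y] →+* A) = (ev k (φ x) (φ y) : k[X][Y] →+* B) := by
    apply ev_ext
    · intro c; simp
    · simp
    · simp
  exact congrArg (fun h => h P) this

lemma ev_eq_sum (x y : A) (P : k[X][Y]) : ev k x y P = P.sum fun j c => aeval x c * y ^ j := by
  conv_lhs => rw [← P.sum_monomial_eq]
  rw [Polynomial.sum, map_sum, Polynomial.sum]
  refine Finset.sum_congr rfl fun j _ => ?_
  rw [← C_mul_X_pow_eq_monomial]; simp

end

@[simp] lemma bmap_X : bmap k F (C X) = C X := by simp [bmap]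
@[simp] lemma bmap_Y : bmap k F Y = Y := by simp [bmap]
@[simp] lemma bmap_CC (c : k) : bmap k F (C (C c)) = C (C (algebraMap k F c)) := by simp [bmap]

@[simp] lemma coeff_bmap (P : k[X][Y]) (i j : ℕ) :
    ((bmap k F P).coeff j).coeff i = algebraMap k F ((P.coeff j).coeff i) := by
  simp [bmap]

lemma ev_bmap (x y : K) (P : k[X][Y]) : ev F x y (bmap k F P) = ev k x y P := by
  have : ((ev F x y : F[X][Y] →+* K)).comp (bmap k F) = (ev k x y : k[X][Y] →+* K) := by
    apply ev_ext
    · intro c; simp [← IsScalarTower.algebraMap_apply]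
    · simp
    · simp
  exact congrArg (fun h => h P) this

lemma bmap_ev (a b : k[X][Y]) (P : k[X][Y]) :
    bmap k F (ev k a b P) = ev F (bmap k F a) (bmap k F b) (bmap k F P) := by
  have : (bmap k F).comp (ev k a b : k[X][Y] →+* k[X][Y]) =
      ((ev F (bmap k F a) (bmap k F b) : F[X][Y] →+* F[X][Y])).comp (bmap k F) := by
    apply ev_ext
    · intro c
      have : algebraMap k k[X][Y] c = C (C c) := rfl
      have h2 : ∀ c : F, algebraMap F F[X][Y] c = C (C c) := fun c => rfl
      simp [this, h2]
    · simp
    · simp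
  exact congrArg (fun h => h P) this

lemma bmap_injective : Function.Injective (bmap k F) :=
  Polynomial.map_injective _ (Polynomial.map_injective _ (algebraMap k F).injective)

/-- The generic member `p - f q` of the pencil spanned by `p` and `q`. -/
noncomputable def pencil (f : F) (p q : k[X][Y]) : F[X][Y] := bmap k F p - C (C f) * bmap k F q

lemma ev_pencil {f : F} {p q : k[X][Y]} {x y : K}
    (h : algebraMap F K f * ev k x y q = ev k x y p) : ev F x y (pencil f p q) = 0 := by
  simp [pencil, ev_bmap, h]

lemma coeff_pencil (f : F) (p q : k[X][Y]) (i j : ℕ) :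
    ((pencil f p q).coeff j).coeff i =
      algebraMap k F ((p.coeff j).coeff i) - f * algebraMap k F ((q.coeff j).coeff i) := by
  simp [pencil]

/-- Specialisation of an auxiliary variable to `f`. -/
noncomputable def spec (k : Type*) {F : Type*} [Field k] [Field F] [Algebra k F] (f : F) :
    k[X][Y][X] →+* F[X][Y] := eval₂RingHom (bmap k F) (C (C f))

@[simp] lemma spec_C (f : F) (P : k[X][Y]) : spec k f (C P) = bmap k F P := by simp [spec]
@[simp] lemma spec_X (f : F) : spec k f X = C (C f) := by simp [spec]

lemma ev_spec (f : F) (x y : K) (W : k[X][Y][X]) : ev F x y (spec k f W) =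
    eval₂ (ev k x y : k[X][Y] →+* K) (algebraMap F K f) W := by
  have : (ev F x y : F[X][Y] →+* K).comp (spec k f) =
      eval₂RingHom (ev k x y : k[X][Y] →+* K) (algebraMap F K f) := by
    apply Polynomial.ringHom_ext
    · intro P; simp [ev_bmap]
    · simp
  exact congrArg (fun h => h W) this

lemma exists_smul_mem_spec (f : F)
    (hF : ∀ z : F, ∃ a b : k[X], aeval f b ≠ 0 ∧ z * aeval f b = aeval f a) (N : F[X][Y]) :
    ∃ b : k[X], aeval f b ≠ 0 ∧ ∃ Z : k[X][Y][X], C (C (aeval f b)) * N = spec k f Z := by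
  set ι := mapRingHom ((C : k[X] →+* k[X][Y]).comp C) with hι
  have hC : ∀ a : k[X], spec k f (ι a) = C (C (aeval f a)) := by
    intro a
    have : (spec k f).comp ι =
        ((C : F[X] →+* F[X][Y]).comp C).comp (aeval f : k[X] →ₐ[k] F).toRingHom := by
      apply Polynomial.ringHom_ext'
      · ext c; simp [spec, hι]
      · simp [spec, hι]
    exact congrArg (fun h => h a) this
  have hadd : ∀ N₁ N₂ : F[X][Y],
      (∃ b : k[X], aeval f b ≠ 0 ∧ ∃ Z : k[X][Y][X], C (C (aeval f b)) * N₁ = spec k f Z) →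
      (∃ b : k[X], aeval f b ≠ 0 ∧ ∃ Z : k[X][Y][X], C (C (aeval f b)) * N₂ = spec k f Z) →
      (∃ b : k[X], aeval f b ≠ 0 ∧
        ∃ Z : k[X][Y][X], C (C (aeval f b)) * (N₁ + N₂) = spec k f Z) := by
    rintro N₁ N₂ ⟨b₁, h₁, Z₁, e₁⟩ ⟨b₂, h₂, Z₂, e₂⟩
    refine ⟨b₁ * b₂, by simp [h₁, h₂], ι b₂ * Z₁ + ι b₁ * Z₂, ?_⟩
    simp only [map_add, map_mul, hC, ← e₁, ← e₂]
    ring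
  induction N using Polynomial.induction_on' with
  | add N₁ N₂ h₁ h₂ => exact hadd _ _ h₁ h₂
  | monomial j c =>
    induction c using Polynomial.induction_on' with
    | add c₁ c₂ h₁ h₂ => rw [map_add]; exact hadd _ _ h₁ h₂
    | monomial i z =>
      obtain ⟨a, b, hb, hab⟩ := hF z
      refine ⟨b, hb, ι a * C (C (X ^ i) * Y ^ j), ?_⟩
      rw [map_mul, hC, ← hab, ← C_mul_X_pow_eq_monomial, ← C_mul_X_pow_eq_monomial]
      simp only [map_mul, map_pow, spec_C, bmap_X, bmap_Y]
      ring

lemma pencil_dvd_of_ev_spec_eq_zero {f : F} (hf : f ≠ 0) {p q : k[X][Y]} {x y : K}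
    (hinj : Function.Injective (ev k x y)) (hpq : IsRelPrime p q)
    (h : algebraMap F K f * ev k x y q = ev k x y p) (Z : k[X][Y][X])
    (hZ : ev F x y (spec k f Z) = 0) : pencil f p q ∣ spec k f Z := by
  have hfK : algebraMap F K f ≠ 0 := by simpa using hf
  induction hn : Z.natDegree using Nat.strong_induction_on generalizing Z with
  | _ n ih =>
  have hq0 : q ≠ 0 := by
    rintro rfl
    have : p = 0 := hinj (by simpa using h.symm)
    subst this
    exact not_isUnit_zero (hpq (dvd_refl 0) (dvd_refl 0))
  have hspec := ev_spec (k := k) f x y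
  have hW : Z = X * Z.divX + C (Z.coeff 0) := (X_mul_divX_add Z).symm
  by_cases hdeg : n = 0
  · have h0 : Z = C (Z.coeff 0) := eq_C_of_natDegree_eq_zero (hn.trans hdeg)
    rw [h0, hspec] at hZ
    have : Z.coeff 0 = 0 := hinj (by simpa using hZ)
    rw [h0, this]; simp
  · have hdvd : p ∣ Z.coeff 0 := by
      have h1 : p ∣ Z.coeff 0 * q ^ n := by
        have h2 : Z.sum (fun i c => c * p ^ i * q ^ (n - i)) = 0 := by
          apply hinj
          rw [map_zero, Polynomial.sum, map_sum]
          rw [hspec, eval₂_eq_sum, Polynomial.sum] at hZ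
          have h3 := congrArg (· * ev k x y q ^ n) hZ
          simp only [zero_mul, Finset.sum_mul] at h3
          rw [← h3]
          refine Finset.sum_congr rfl fun i hi => ?_
          have hi' : i ≤ n := hn ▸ le_natDegree_of_mem_supp i hi
          simp only [map_mul, map_pow, ← h, RingHom.coe_coe]
          rw [mul_pow]
          have : ev k x y q ^ n = ev k x y q ^ i * ev k x y q ^ (n - i) := by
            rw [← pow_add]; congr 1; omega
          rw [this]; ring
        rw [sum_homogenize p q Z n hn.le] at h2
        rw [eq_neg_of_add_eq_zero_left h2]
        exact (dvd_mul_right _ _).neg_right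
      exact (hpq.pow_right).dvd_of_dvd_mul_right h1
    obtain ⟨g, hg⟩ := hdvd
    have hsub : spec k f Z = pencil f p q * bmap k F g +
        C (C f) * spec k f (C (q * g) + Z.divX) := by
      conv_lhs => rw [hW]
      simp only [map_add, map_mul, spec_C, spec_X, pencil, hg]
      ring
    rw [hsub] at hZ ⊢
    refine dvd_add (dvd_mul_right _ _) (Dvd.dvd.mul_left (ih _ ?_ _ ?_ rfl) _)
    · have h5 : (Z.divX).natDegree = n - 1 := by rw [natDegree_divX_eq_natDegree_tsub_one, hn]
      have := natDegree_add_le (C (q * g)) Z.divX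
      rw [natDegree_C, h5] at this
      have h6 : max 0 (n - 1) = n - 1 := by omega
      omega
    · simpa [ev_pencil h, hfK] using hZ

/-- The kernel of evaluation over `F = k(f)` at generators of `k(x, y)` is generated by the
generic member of the pencil defining `f`. -/
lemma pencil_dvd_of_ev_eq_zero {f : F} (hf : f ≠ 0)
    (hF : ∀ z : F, ∃ a b : k[X], aeval f b ≠ 0 ∧ z * aeval f b = aeval f a)
    {p q : k[X][Y]} {x y : K}
    (hinj : Function.Injective (ev k x y)) (hpq : IsRelPrime p q)
    (h : algebraMap F K f * ev k x y q = ev k x y p) (N : F[X][Y])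
    (hN : ev F x y N = 0) : pencil f p q ∣ N := by
  obtain ⟨b, hb, Z, hZ⟩ := exists_smul_mem_spec f hF N
  have h1 : pencil f p q ∣ spec k f Z := by
    apply pencil_dvd_of_ev_spec_eq_zero hf hinj hpq h
    rw [← hZ, map_mul, hN, mul_zero]
  rw [← hZ] at h1
  have hu : IsUnit (C (C (aeval f b)) : F[X][Y]) := by
    rw [isUnit_C, isUnit_C]; exact hb.isUnit
  exact (hu.dvd_mul_left).1 h1

end Kernel
end CremonaRank

namespace CremonaRank
open Polynomial Bivariate

section Bider

variable {k K Γ : Type*} [Field k] [Field K] [Algebra k K]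

/-- Alternating biderivations over `k`. -/
structure IsBider (k : Type*) {K : Type*} [Field k] [Field K] [Algebra k K] (δ : K → K → K) :
    Prop where
  add_left : ∀ a b c, δ (a + b) c = δ a c + δ b c
  leib_left : ∀ a b c, δ (a * b) c = a * δ b c + b * δ a c
  alg_left : ∀ (c : k) b, δ (algebraMap k K c) b = 0
  self : ∀ a, δ a a = 0
  swap : ∀ a b, δ a b = - δ b a

namespace IsBider
variable {δ : K → K → K} (h : IsBider k δ)
include h

lemma add_right (a b c : K) : δ a (b + c) = δ a b + δ a c := by
  rw [h.swap, h.add_left, h.swap b, h.swap c]; ring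

lemma leib_right (a b c : K) : δ a (b * c) = b * δ a c + c * δ a b := by
  rw [h.swap, h.leib_left, h.swap c, h.swap b]; ring

lemma alg_right (c : k) (a : K) : δ a (algebraMap k K c) = 0 := by
  rw [h.swap, h.alg_left, neg_zero]

end IsBider
end Bider

section Valued

variable {k K Γ : Type*} [Field k] [Field K] [Algebra k K] [LinearOrderedCommGroupWithZero Γ]
  {v : Valuation K Γ}

lemma val_aeval_le_one (hk : ∀ c : k, v (algebraMap k K c) ≤ 1) {x : K} (hx : v x ≤ 1) (P : k[X]) :
    v (aeval x P) ≤ 1 := by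
  induction P using Polynomial.induction_on' with
  | add a b ha hb => rw [map_add]; exact v.map_add_le ha hb
  | monomial n c =>
    rw [aeval_monomial, map_mul, map_pow]
    exact mul_le_one' (hk c) (pow_le_one' hx n)

lemma val_ev_le_one (hk : ∀ c : k, v (algebraMap k K c) ≤ 1) {x y : K} (hx : v x ≤ 1)
    (hy : v y ≤ 1) (P : k[X][Y]) : v (ev k x y P) ≤ 1 := by
  induction P using Polynomial.induction_on' with
  | add a b ha hb => rw [map_add]; exact v.map_add_le ha hb
  | monomial n c =>
    rw [← C_mul_X_pow_eq_monomial, map_mul, map_pow, ev_C, ev_Y, map_mul, map_pow]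
    exact mul_le_one' (val_aeval_le_one hk hx c) (pow_le_one' hy n)

/-- An element of the polynomial ring splits as a polynomial in `Y` and a multiple of `X`. -/
lemma exists_eq_map_add_mul_X (P : k[X][Y]) :
    ∃ R : k[X][Y], P = (P.map (evalRingHom 0)).map C + C X * R := by
  induction P using Polynomial.induction_on' with
  | add a b ha hb =>
    obtain ⟨R, hR⟩ := ha; obtain ⟨S, hS⟩ := hb
    refine ⟨R + S, ?_⟩
    conv_lhs => rw [hR, hS]
    simp only [Polynomial.map_add]; ring
  | monomial n c =>
    refine ⟨monomial n c.divX, ?_⟩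
    rw [map_monomial, map_monomial, C_mul_monomial, ← map_add]
    congr 1
    conv_lhs => rw [← X_mul_divX_add c]
    simp [coeff_zero_eq_eval_zero, add_comm]

lemma ev_map_C (x y : K) (P : k[X]) : ev k x y (P.map C) = aeval y P := by
  have : ((ev k x y : k[X][Y] →+* K)).comp (mapRingHom C) = (aeval y : k[X] →ₐ[k] K).toRingHom := by
    apply Polynomial.ringHom_ext
    · intro c; simp
    · simp
  exact congrArg (fun h => h P) this

lemma val_aeval_eq_one [IsAlgClosed k] (hk : ∀ c : k, c ≠ 0 → v (algebraMap k K c) = 1) {y : K}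
    (hy : ∀ c : k, v (y - algebraMap k K c) = 1) {P : k[X]} (hP : P ≠ 0) : v (aeval y P) = 1 := by
  have hs := IsAlgClosed.splits P
  rw [hs.eq_prod_roots, map_mul, map_mul, aeval_C, hk _ (by simpa using hP), one_mul,
    map_multiset_prod, map_multiset_prod, Multiset.map_map, Multiset.map_map]
  apply Multiset.prod_eq_one
  intro a ha
  obtain ⟨c, -, rfl⟩ := Multiset.mem_map.1 ha
  simpa using hy c

end Valued

section Integral

variable {F K : Type*} [Field F] [Field K] [Algebra F K]

lemma exists_pow_mul_isIntegral (A A₁ : Subalgebra F K) {β : K} (hβ : β ∈ A)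
    (hA : ∀ u ∈ A₁, ∃ N : ℕ, IsIntegral A (β ^ N * u)) {w : K} (hw : IsIntegral A₁ w) :
    ∃ N : ℕ, IsIntegral A (β ^ N * w) := by
  obtain ⟨P, hP, hPw⟩ := hw
  have hβi : IsIntegral A β := isIntegral_algebraMap (R := A) (x := ⟨β, hβ⟩)
  choose N hN using fun i => hA (P.coeff i) (P.coeff i).2
  set M := P.support.sup N with hM
  have hM' : ∀ i, IsIntegral A (β ^ M * (P.coeff i : K)) := by
    intro i
    by_cases hi : i ∈ P.support
    · have : N i ≤ M := Finset.le_sup hi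
      rw [← Nat.sub_add_cancel this, pow_add, mul_assoc]
      exact (hβi.pow _).mul (hN i)
    · rw [notMem_support_iff.1 hi]; simpa using isIntegral_zero
  refine ⟨M, ?_⟩
  set P' : K[X] := (P.map (algebraMap A₁ K)).scaleRoots (β ^ M) with hP'
  have hPm : P'.Monic := by
    rw [hP', monic_scaleRoots_iff]; exact hP.map _
  have hroot : P'.eval (β ^ M * w) = 0 := by
    have := scaleRoots_eval₂_mul (p := P.map (algebraMap A₁ K)) (RingHom.id K) w (β ^ M)
    simp only [RingHom.id_apply, eval₂_id, eval_map] at this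
    rw [hP']
    simp only [eval₂_eq_eval_map] at this hPw ⊢
    rw [this, hPw, mul_zero]
  have hcoef : ∀ i, P'.coeff i ∈ integralClosure A K := by
    intro i
    rw [mem_integralClosure_iff, hP', coeff_scaleRoots, coeff_map]
    have hd : (P.map (algebraMap A₁ K)).natDegree = P.natDegree := hP.natDegree_map _
    rw [hd]
    rcases lt_trichotomy i P.natDegree with h | h | h
    · obtain ⟨j, hj⟩ : ∃ j, P.natDegree - i = j + 1 := ⟨P.natDegree - i - 1, by omega⟩
      rw [hj, pow_succ, mul_comm _ (β ^ M), ← mul_assoc, mul_comm _ (β ^ M)]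
      exact (hM' i).mul ((hβi.pow M).pow j)
    · subst h
      rw [hP.coeff_natDegree]; simpa using isIntegral_one
    · rw [coeff_eq_zero_of_natDegree_lt h]; simpa using isIntegral_zero
  have hl : P' ∈ lifts (algebraMap (integralClosure A K) K) := by
    rw [lifts_iff_coeff_lifts]
    intro i; exact ⟨⟨_, hcoef i⟩, rfl⟩
  obtain ⟨Q, hQ, -, hQm⟩ := lifts_and_natDegree_eq_and_monic hl hPm
  have : IsIntegral (integralClosure A K) (β ^ M * w) :=
    ⟨Q, hQm, by rw [eval₂_eq_eval_map, hQ, hroot]⟩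
  exact isIntegral_trans (A := integralClosure A K) _ this

lemma isIntegral_mul_of_relation {A : Subalgebra F K} {e : ℕ} (he : 0 < e) {β y : K} (hβ : β ∈ A)
    (b : ℕ → K) (hb : ∀ j, b j ∈ A)
    (h : ∑ j ∈ Finset.range e, b j * y ^ j + β * y ^ e = 0) : IsIntegral A (β * y) := by
  set c : ℕ → A := fun j => ⟨b j, hb j⟩ * ⟨β, hβ⟩ ^ (e - 1 - j) with hc
  refine ⟨X ^ e + ∑ j ∈ Finset.range e, C (c j) * X ^ j, ?_, ?_⟩
  · apply monic_X_pow_add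
    refine (degree_sum_le _ _).trans_lt ((Finset.sup_lt_iff (WithBot.bot_lt_coe e)).2 ?_)
    intro j hj
    exact (degree_C_mul_X_pow_le j _).trans_lt (WithBot.coe_lt_coe.2 (Finset.mem_range.1 hj))
  · have hβe : β ^ (e - 1) * β = β ^ e := by rw [← pow_succ]; congr 1; omega
    have h1 : β ^ (e - 1) * (∑ j ∈ Finset.range e, b j * y ^ j + β * y ^ e) = 0 := by
      rw [h, mul_zero]
    rw [← h1]
    simp only [eval₂_add, eval₂_X_pow, eval₂_finsetSum, eval₂_mul, eval₂_C]
    rw [mul_add, Finset.mul_sum, add_comm, ← mul_assoc, hβe, mul_pow]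
    congr 1
    refine Finset.sum_congr rfl fun j hj => ?_
    have hj := Finset.mem_range.1 hj
    have : β ^ (e - 1) = β ^ (e - 1 - j) * β ^ j := by rw [← pow_add]; congr 1; omega
    rw [this, hc]
    simp only [map_mul, map_pow, mul_pow]
    change b j * β ^ (e - 1 - j) * (β ^ j * y ^ j) = _
    ring

end Integral
end CremonaRank

namespace CremonaRank
open Polynomial Bivariate

section Order

variable {k : Type*} [Field k]

/-- The affine chart `(X, Y) ↦ (X, X Y)` of the blow-up of the origin. -/
noncomputable def chart (k : Type*) [Field k] : k[X][Y] →ₐ[k] k[X][Y] := ev k (C X) (C X * Y)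

lemma coeff_chart (P : k[X][Y]) (j : ℕ) : (chart k P).coeff j = P.coeff j * X ^ j := by
  induction P using Polynomial.induction_on' with
  | add a b ha hb => rw [map_add, coeff_add, coeff_add, ha, hb, add_mul]
  | monomial n c =>
    rw [← C_mul_X_pow_eq_monomial, chart, map_mul, map_pow, ev_C, ev_Y, mul_pow]
    have : aeval (C X : k[X][Y]) c = C c := by
      have := aeval_algebraMap_apply (k[X][Y]) (X : k[X]) c
      simpa using this
    rw [this, ← mul_assoc, ← C_pow, ← C_mul, coeff_C_mul_X_pow, coeff_C_mul_X_pow]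
    split_ifs with h
    · rw [h]
    · simp

lemma C_X_pow_dvd_iff {P : k[X][Y]} {n : ℕ} :
    (C X) ^ n ∣ P ↔ ∀ i j, i < n → (P.coeff j).coeff i = 0 := by
  rw [← C_pow, C_dvd_iff_dvd_coeff]
  simp only [X_pow_dvd_iff]
  exact ⟨fun h i j hi => h j i hi, fun h j i hi => h i j hi⟩

/-- The order of vanishing at the origin is at least `n`. -/
def OrdGE (n : ℕ) (P : k[X][Y]) : Prop := (C X) ^ n ∣ chart k P

lemma ordGE_iff {P : k[X][Y]} {n : ℕ} :
    OrdGE n P ↔ ∀ i j, i + j < n → (P.coeff j).coeff i = 0 := by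
  rw [OrdGE, C_X_pow_dvd_iff]
  simp only [coeff_chart, coeff_mul_X_pow']
  constructor
  · intro h i j hij
    have := h (i + j) j hij
    simpa using this
  · intro h i j hi
    split_ifs with hj
    · exact h _ _ (by omega)
    · rfl

lemma OrdGE.add {n : ℕ} {P Q : k[X][Y]} (hP : OrdGE n P) (hQ : OrdGE n Q) : OrdGE n (P + Q) := by
  rw [OrdGE, map_add]; exact dvd_add hP hQ

lemma OrdGE.mul {n m : ℕ} {P Q : k[X][Y]} (hP : OrdGE n P) (hQ : OrdGE m Q) :
    OrdGE (n + m) (P * Q) := by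
  rw [OrdGE, map_mul, pow_add]; exact mul_dvd_mul hP hQ

lemma OrdGE.zero (P : k[X][Y]) : OrdGE 0 P := by simp [OrdGE]

lemma OrdGE.Y_pow (n : ℕ) : OrdGE n (Y ^ n : k[X][Y]) := by
  rw [OrdGE, chart, map_pow, ev_Y, mul_pow]; exact dvd_mul_right _ _

lemma OrdGE.X_pow (n : ℕ) : OrdGE n ((C X) ^ n : k[X][Y]) := by
  rw [OrdGE, chart, map_pow, ev_X]

lemma chart_injective : Function.Injective (chart k) := by
  rw [injective_iff_map_eq_zero]
  intro P hP
  ext1 j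
  have := congrArg (fun Q => Q.coeff j) hP
  simpa [coeff_chart] using this

lemma prime_C_X : Prime (C X : k[X][Y]) := prime_C_iff.2 prime_X

lemma exists_chart_eq {P : k[X][Y]} (hP : P ≠ 0) :
    ∃ (e : ℕ) (P' : k[X][Y]), chart k P = (C X) ^ e * P' ∧ P'.map (evalRingHom 0) ≠ 0 := by
  have h0 : chart k P ≠ 0 := fun h => hP (chart_injective (h.trans (map_zero _).symm))
  obtain ⟨e, P', h1, h2⟩ := WfDvdMonoid.max_power_factor h0 prime_C_X.irreducible
  refine ⟨e, P', h2, fun h => h1 ?_⟩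
  rw [← pow_one (C X : k[X][Y]), C_X_pow_dvd_iff]
  intro i j hi
  obtain rfl : i = 0 := by omega
  have := congrArg (fun Q => Q.coeff j) h
  simpa [coeff_zero_eq_eval_zero] using this

/-- The value at the origin. -/
noncomputable def ev0 (k : Type*) [Field k] : k[X][Y] →ₐ[k] k := ev k 0 0

lemma ev0_eq (P : k[X][Y]) : ev0 k P = (P.coeff 0).coeff 0 := by
  induction P using Polynomial.induction_on' with
  | add a b ha hb => rw [map_add, coeff_add, coeff_add, ha, hb]
  | monomial n c =>
    rw [← C_mul_X_pow_eq_monomial, ev0, map_mul, map_pow, ev_C, ev_Y]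
    rw [coeff_C_mul, coeff_X_pow]
    by_cases h : n = 0
    · subst h; simp [coeff_zero_eq_aeval_zero]
    · simp [h, Ne.symm h]

lemma exists_sum_add_pow_mul (P : k[X][Y]) (e : ℕ) : ∃ B : k[X][Y],
    P = ∑ j ∈ Finset.range e, C (P.coeff j) * Y ^ j + Y ^ e * B ∧ B.coeff 0 = P.coeff e := by
  induction e with
  | zero => exact ⟨P, by simp, rfl⟩
  | succ e ih =>
    obtain ⟨B, hB, hB0⟩ := ih
    refine ⟨B.divX, ?_, ?_⟩
    · rw [Finset.sum_range_succ, add_assoc, ← hB0, pow_succ]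
      conv_lhs => rw [hB]
      congr 1
      conv_lhs => rw [← X_mul_divX_add B]
      ring
    · rw [coeff_divX]
      have := congrArg (fun Q => Q.coeff (e + 1)) hB
      simp only [coeff_add, finsetSum_coeff, coeff_C_mul, coeff_X_pow] at this
      rw [Finset.sum_eq_zero, zero_add, add_comm e 1, coeff_X_pow_mul] at this
      · rw [zero_add, ← this, add_comm]
      · intro j hj
        have := Finset.mem_range.1 hj
        rw [if_neg (by omega), mul_zero]

end Order

section OrderBase

variable {k F : Type*} [Field k] [Field F] [Algebra k F]

lemma ordGE_sum {ι : Type*} [Fintype ι] {e : ι → F} (he : LinearIndependent k e) {n : ℕ}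
    {Q : ι → k[X][Y]} (h : OrdGE n (∑ i, C (C (e i)) * bmap k F (Q i))) (i : ι) :
    OrdGE n (Q i) := by
  rw [ordGE_iff] at h ⊢
  intro a b hab
  have h1 := h a b hab
  simp only [finsetSum_coeff, coeff_C_mul, coeff_bmap] at h1
  refine Fintype.linearIndependent_iff.1 he (fun i => ((Q i).coeff b).coeff a) ?_ i
  rw [← h1]
  refine Finset.sum_congr rfl fun i _ => ?_
  rw [Algebra.smul_def, mul_comm]

lemma sub_mul_eq_zero_iff {f : F} (hf : ∀ c : k, algebraMap k F c ≠ f) {a b : k} :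
    algebraMap k F a - f * algebraMap k F b = 0 ↔ a = 0 ∧ b = 0 := by
  constructor
  · intro h
    by_cases hb : b = 0
    · subst hb; simpa using h
    · exfalso
      apply hf (a / b)
      rw [map_div₀, sub_eq_zero.1 h]
      field_simp [(map_ne_zero (algebraMap k F)).2 hb]
  · rintro ⟨rfl, rfl⟩; simp

lemma ordGE_pencil {f : F} (hf : ∀ c : k, algebraMap k F c ≠ f) {p q : k[X][Y]} {n : ℕ} :
    OrdGE n (pencil f p q) ↔ OrdGE n p ∧ OrdGE n q := by
  simp only [ordGE_iff, coeff_pencil, sub_mul_eq_zero_iff hf]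
  exact ⟨fun h => ⟨fun i j hij => (h i j hij).1, fun i j hij => (h i j hij).2⟩,
    fun h i j hij => ⟨h.1 i j hij, h.2 i j hij⟩⟩

lemma pencil_eq_zero {f : F} (hf : ∀ c : k, algebraMap k F c ≠ f) {p q : k[X][Y]} :
    pencil f p q = 0 ↔ p = 0 ∧ q = 0 := by
  constructor
  · intro h
    have h1 : ∀ i j, (p.coeff j).coeff i = 0 ∧ (q.coeff j).coeff i = 0 := by
      intro i j
      rw [← sub_mul_eq_zero_iff hf, ← coeff_pencil, h]; simp
    constructor
    · ext j i; simpa using (h1 i j).1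
    · ext j i; simpa using (h1 i j).2
  · rintro ⟨rfl, rfl⟩; simp [pencil]

end OrderBase
end CremonaRank

namespace CremonaRank
open Polynomial Bivariate

section Local

variable {k F K Γ : Type*} [Field k] [Field F] [Field K] [Algebra k F] [Algebra F K] [Algebra k K]
  [IsScalarTower k F K] [LinearOrderedCommGroupWithZero Γ] {v : Valuation K Γ}

lemma mem_adjoin_pair {x y u : K} : u ∈ Algebra.adjoin F {x, y} ↔ ∃ N, ev F x y N = u := by
  constructor
  · intro hu
    have : Algebra.adjoin F {x, y} ≤ (ev F x y).range := by
      rw [Algebra.adjoin_le_iff]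
      rintro z (rfl | rfl)
      · exact ⟨C X, by simp⟩
      · exact ⟨Y, by simp⟩
    exact this hu
  · rintro ⟨N, rfl⟩
    rw [ev_eq_sum]
    refine Subalgebra.sum_mem _ fun j _ => Subalgebra.mul_mem _ ?_ (Subalgebra.pow_mem _ ?_ _)
    · exact Algebra.adjoin_mono (by simp) (aeval_mem_adjoin_singleton F x)
    · exact Algebra.subset_adjoin (by simp)

/-- Elements of the local ring of `F[x, y]` at the origin. -/
def Loc (F : Type*) {K : Type*} [Field F] [Field K] [Algebra F K] (x y u : K) : Prop :=
  ∃ s a : F[X][Y], ev0 F s ≠ 0 ∧ ev F x y s * u = ev F x y a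

namespace Loc
variable {x y u w : K}

lemma add (hu : Loc F x y u) (hw : Loc F x y w) : Loc F x y (u + w) := by
  obtain ⟨s, a, hs, ha⟩ := hu
  obtain ⟨t, b, ht, hb⟩ := hw
  refine ⟨s * t, t * a + s * b, by simp [hs, ht], ?_⟩
  simp only [map_add, map_mul, ← ha, ← hb]; ring

lemma ev_mul (hu : Loc F x y u) (N : F[X][Y]) : Loc F x y (ev F x y N * u) := by
  obtain ⟨s, a, hs, ha⟩ := hu
  exact ⟨s, N * a, hs, by simp only [map_mul, ← ha]; ring⟩

lemma of_ev (N : F[X][Y]) : Loc F x y (ev F x y N) := ⟨1, N, by simp, by simp⟩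

lemma of_mul {B : F[X][Y]} (hB : ev0 F B ≠ 0) (hu : Loc F x y (ev F x y B * u)) : Loc F x y u := by
  obtain ⟨s, a, hs, ha⟩ := hu
  exact ⟨s * B, a, by simp [hs, hB], by rw [← ha, map_mul]; ring⟩

lemma sum {ι : Type*} (t : Finset ι) (g : ι → K) (h : ∀ i ∈ t, Loc F x y (g i)) :
    Loc F x y (∑ i ∈ t, g i) :=
  Finset.sum_induction g (Loc F x y) (fun _ _ => add) (by simpa using of_ev (F := F) (x := x) (y := y) 0) h

lemma neg (hu : Loc F x y u) : Loc F x y (-u) := by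
  simpa using ev_mul hu (-1)

lemma sub (hu : Loc F x y u) (hw : Loc F x y w) : Loc F x y (u - w) := by
  rw [sub_eq_add_neg]; exact hu.add hw.neg

end Loc

section Transversal

variable {x y y₁ : K} {Φ : F[X][Y]} {e : ℕ}

/-- The integral equation for `y / x` over the local ring at a point of multiplicity `e`
with transversal coordinate `x`. -/
lemma exists_blowup_relation (hx : x ≠ 0) (hy : y = x * y₁) (hΦ : ev F x y Φ = 0) (he : OrdGE e Φ)
    (ht : (Φ.coeff e).coeff 0 ≠ 0) :
    ∃ (B : F[X][Y]) (b : ℕ → F[X][Y]), ev0 F B ≠ 0 ∧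
      ∑ j ∈ Finset.range e, ev F x y (b j) * y₁ ^ j + ev F x y B * y₁ ^ e = 0 := by
  obtain ⟨B, hB, hB0⟩ := exists_sum_add_pow_mul Φ e
  have hd : ∀ j, ∃ c : F[X], j < e → Φ.coeff j = X ^ (e - j) * c := by
    intro j
    by_cases hj : j < e
    · have : X ^ (e - j) ∣ Φ.coeff j := by
        rw [X_pow_dvd_iff]
        intro i hi
        exact ordGE_iff.1 he i j (by omega)
      obtain ⟨c, hc⟩ := this
      exact ⟨c, fun _ => hc⟩
    · exact ⟨0, fun h => absurd h hj⟩
  choose c hc using hd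
  refine ⟨B, fun j => C (c j), by rwa [ev0_eq, hB0], ?_⟩
  have h1 : x ^ e * (∑ j ∈ Finset.range e, ev F x y (C (c j)) * y₁ ^ j + ev F x y B * y₁ ^ e) = 0 := by
    rw [← hΦ]
    conv_rhs => rw [hB]
    rw [map_add, map_sum, mul_add, Finset.mul_sum]
    congr 1
    · refine Finset.sum_congr rfl fun j hj => ?_
      have hj := Finset.mem_range.1 hj
      rw [hc j hj]
      simp only [map_mul, map_pow, ev_X, ev_Y]
      have : x ^ e = x ^ (e - j) * x ^ j := by rw [← pow_add]; congr 1; omega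
      rw [this, hy, mul_pow]; ring
    · rw [map_mul, map_pow, ev_Y, hy, mul_pow]; ring
  exact (mul_eq_zero.1 h1).resolve_left (pow_ne_zero _ hx)

lemma loc_pow_mul_pow (hy : y = x * y₁) {B : F[X][Y]} {b : ℕ → F[X][Y]} (hB : ev0 F B ≠ 0)
    (he : 0 < e)
    (h : ∑ j ∈ Finset.range e, ev F x y (b j) * y₁ ^ j + ev F x y B * y₁ ^ e = 0) (m : ℕ) :
    Loc F x y (x ^ (e - 1) * y₁ ^ m) := by
  induction m using Nat.strong_induction_on with
  | _ m ih =>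
  by_cases hm : m < e
  · have : x ^ (e - 1) * y₁ ^ m = ev F x y ((C X) ^ (e - 1 - m) * Y ^ m) := by
      simp only [map_mul, map_pow, ev_X, ev_Y, hy, mul_pow]
      rw [← mul_assoc, ← pow_add]; congr 2; omega
    rw [this]; exact Loc.of_ev _
  · apply Loc.of_mul hB
    have : ev F x y B * (x ^ (e - 1) * y₁ ^ m) =
        -∑ j ∈ Finset.range e, ev F x y (b j) * (x ^ (e - 1) * y₁ ^ (m - e + j)) := by
      have h2 : ev F x y B * y₁ ^ e = -∑ j ∈ Finset.range e, ev F x y (b j) * y₁ ^ j :=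
        eq_neg_of_add_eq_zero_right h
      have h3 : y₁ ^ m = y₁ ^ e * y₁ ^ (m - e) := by rw [← pow_add]; congr 1; omega
      rw [h3]
      calc _ = (ev F x y B * y₁ ^ e) * (x ^ (e - 1) * y₁ ^ (m - e)) := by ring
        _ = _ := by
          rw [h2, neg_mul, Finset.sum_mul]
          congr 1
          refine Finset.sum_congr rfl fun j _ => ?_
          rw [pow_add]; ring
    rw [this]
    refine (Loc.sum _ _ fun j hj => Loc.ev_mul (ih _ ?_) _).neg
    have := Finset.mem_range.1 hj
    omega

/-- Polynomials which multiply all powers of `y / x` into the local ring vanish to order `e - 1`. -/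
lemma ordGE_of_loc (hy : y = x * y₁) (he : 0 < e)
    (hker : ∀ N, ev F x y N = 0 → Φ ∣ N) (hord : OrdGE e Φ)
    (hloc : ∀ m, Loc F x y (x ^ (e - 1) * y₁ ^ m))
    (n : ℕ) : ∀ (i : ℕ) (_ : i + n = e - 1) (a : F[X][Y])
      (_ : ∀ j, Loc F x y (x ^ i * ev F x y a * y₁ ^ j)), OrdGE n a := by
  induction n with
  | zero => intro i _ a _; exact OrdGE.zero a
  | succ n ih =>
    intro i hi a ha
    obtain ⟨s, U, hs, hU⟩ := ha (i + 1)
    have hN : ev F x y (s * a * Y ^ (i + 1) - C X * U) = 0 := by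
      simp only [map_sub, map_mul, map_pow, ev_X, ev_Y, ← hU]
      rw [hy]; ring
    obtain ⟨G, hG⟩ := hker _ hN
    have h0 := congrArg (Polynomial.map (evalRingHom (0 : F))) hG
    simp only [Polynomial.map_sub, Polynomial.map_mul, Polynomial.map_pow, map_X, map_C,
      coe_evalRingHom, eval_X, C_0, zero_mul, sub_zero] at h0
    have hd : (X : F[X]) ^ e ∣ Φ.map (evalRingHom 0) := by
      rw [X_pow_dvd_iff]
      intro j hj
      rw [coeff_map, coe_evalRingHom, ← coeff_zero_eq_eval_zero]
      exact ordGE_iff.1 hord 0 j (by omega)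
    have h1 : (X : F[X]) ^ (i + 1) * X ^ (n + 1) ∣
        X ^ (i + 1) * (s.map (evalRingHom 0) * a.map (evalRingHom 0)) := by
      rw [← pow_add, mul_comm _ (s.map _ * _), h0]
      have : i + 1 + (n + 1) = e := by omega
      rw [this]
      exact Dvd.dvd.mul_right hd _
    have h2 := (mul_dvd_mul_iff_left (pow_ne_zero _ X_ne_zero)).1 h1
    have h3 : (X : F[X]) ^ (n + 1) ∣ a.map (evalRingHom 0) := by
      apply Prime.pow_dvd_of_dvd_mul_left prime_X _ _ h2
      rw [X_dvd_iff, coeff_map, coe_evalRingHom, ← coeff_zero_eq_eval_zero, ← ev0_eq]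
      exact hs
    obtain ⟨R, hR⟩ := exists_eq_map_add_mul_X a
    obtain ⟨c, hc⟩ := h3
    rw [hc] at hR
    have h4 : OrdGE n R := by
      apply ih (i + 1) (by omega)
      intro j
      have : x ^ (i + 1) * ev F x y R * y₁ ^ j = x ^ i * ev F x y a * y₁ ^ j -
          ev F x y (c.map C) * (x ^ (e - 1) * y₁ ^ (n + 1 + j)) := by
        have h5 : ev F x y a = y ^ (n + 1) * ev F x y (c.map C) + x * ev F x y R := by
          conv_lhs => rw [hR]
          simp
        have h6 : e - 1 = i + (n + 1) := by omega
        rw [h5, h6, hy]; ring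
      rw [this]
      exact (ha j).sub ((hloc _).ev_mul _)
    rw [hR]
    refine OrdGE.add ?_ ?_
    · rw [Polynomial.map_mul, Polynomial.map_pow, map_X]
      have := (OrdGE.Y_pow (k := F) (n + 1)).mul (OrdGE.zero (c.map C))
      simpa using this
    · have := (OrdGE.X_pow (k := F) 1).mul h4
      rw [pow_one, add_comm] at this
      exact this

end Transversal
end Local
end CremonaRank

namespace CremonaRank
open Polynomial Bivariate

section Change

variable {k : Type*} [Field k]

lemma algebraMap_CC (c : k) : algebraMap k k[X][Y] c = C (C c) := rfl

lemma ev_X_Y (P : k[X][Y]) : ev k (C X : k[X][Y]) (Y : k[X][Y]) P = P := by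
  have : ((ev k (C X) Y : k[X][Y] →ₐ[k] k[X][Y]) : k[X][Y] →+* k[X][Y]) = RingHom.id _ := by
    apply ev_ext <;> simp
  exact congrArg (fun h => h P) this

lemma aeval_C_X (a : k[X]) : aeval (C X : k[X][Y]) a = C a := by
  rw [← ev_C (k := k) (C X : k[X][Y]) (Y : k[X][Y]) a, ev_X_Y]

lemma OrdGE.sum {ι : Type*} (t : Finset ι) (g : ι → k[X][Y]) (n : ℕ) (h : ∀ i ∈ t, OrdGE n (g i)) :
    OrdGE n (∑ i ∈ t, g i) := by
  rw [OrdGE, map_sum]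
  exact Finset.dvd_sum h

lemma OrdGE.pow {P : k[X][Y]} (h : OrdGE 1 P) (n : ℕ) : OrdGE n (P ^ n) := by
  rw [OrdGE, map_pow]
  rw [OrdGE, pow_one] at h
  exact pow_dvd_pow_of_dvd h n

lemma OrdGE.mono {P : k[X][Y]} {m n : ℕ} (h : OrdGE n P) (hm : m ≤ n) : OrdGE m P :=
  (pow_dvd_pow _ hm).trans h

lemma OrdGE.ev {P U V : k[X][Y]} {n : ℕ} (h : OrdGE n P) (hU : OrdGE 1 U) (hV : OrdGE 1 V) :
    OrdGE n (ev k U V P) := by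
  rw [ev_eq_sum, Polynomial.sum]
  refine OrdGE.sum _ _ _ fun j _ => ?_
  rw [aeval_eq_sum_range, Finset.sum_mul]
  refine OrdGE.sum _ _ _ fun i _ => ?_
  rcases lt_or_ge (i + j) n with hij | hij
  · rw [ordGE_iff.1 h i j hij]; simp [OrdGE]
  · refine OrdGE.mono ?_ hij
    rw [Algebra.smul_def]
    have := (OrdGE.zero (algebraMap k k[X][Y] ((P.coeff j).coeff i))).mul ((hU.pow i).mul (hV.pow j))
    rwa [zero_add, ← mul_assoc] at this

/-- The linear substitution `X ↦ Y`, `Y ↦ X + s Y`. -/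
noncomputable def lin (s : k) : k[X][Y] →ₐ[k] k[X][Y] := ev k Y (C X + C (C s) * Y)

/-- The inverse of the linear substitution `lin s`. -/
noncomputable def linInv (s : k) : k[X][Y] →ₐ[k] k[X][Y] := ev k (Y - C (C s) * C X) (C X)

lemma lin_linInv (s : k) (P : k[X][Y]) : lin s (linInv s P) = P := by
  have : ((lin s : k[X][Y] →ₐ[k] k[X][Y]) : k[X][Y] →+* k[X][Y]).comp (linInv s : k[X][Y] →ₐ[k] k[X][Y])
      = RingHom.id _ := by
    apply ev_ext <;> simp [lin, linInv]
  exact congrArg (fun h => h P) this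

variable {A : Type*} [CommRing A] [Algebra k A]

lemma ev_lin (s : k) (x y : A) (P : k[X][Y]) :
    ev k (y - algebraMap k A s * x) x (lin s P) = ev k x y P := by
  rw [lin, algHom_ev]; simp

lemma ev_linInv (s : k) (x y : A) (P : k[X][Y]) :
    ev k x y (linInv s P) = ev k (y - algebraMap k A s * x) x P := by
  rw [← ev_lin s, lin_linInv]

lemma ev0_lin (s : k) (P : k[X][Y]) : ev0 k (lin s P) = ev0 k P := by
  simpa [ev0] using ev_lin s (0 : k) 0 P

lemma ordGE_lin {s : k} {n : ℕ} {P : k[X][Y]} (h : OrdGE n P) : OrdGE n (lin s P) := by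
  have h1 : OrdGE 1 (Y : k[X][Y]) := by simpa using OrdGE.Y_pow (k := k) 1
  have h2 : OrdGE 1 (C X : k[X][Y]) := by simpa using OrdGE.X_pow (k := k) 1
  refine h.ev h1 (h2.add ?_)
  simpa using (OrdGE.zero (C (C s))).mul h1

lemma coeff_lin (s : k) {P P' : k[X][Y]} {e : ℕ} (h : chart k P = (C X) ^ e * P') :
    ((lin s P).coeff e).coeff 0 = (P'.map (evalRingHom 0)).eval s := by
  have h1 : (lin s P).map (evalRingHom 0) = ev k X (C s) (chart k P) := by
    have : (mapRingHom (evalRingHom (0 : k))).comp (lin s : k[X][Y] →ₐ[k] k[X][Y]) =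
        ((ev k X (C s) : k[X][Y] →ₐ[k] k[X]) : k[X][Y] →+* k[X]).comp
          (chart k : k[X][Y] →+* k[X][Y]) := by
      apply ev_ext
      · intro c
        simp [lin, chart]
      · simp [lin, chart]
      · simp only [lin, chart, RingHom.comp_apply, RingHom.coe_coe, ev_Y, ev_X, map_mul,
          map_add, coe_mapRingHom, map_X, map_C, coe_evalRingHom, eval_X, eval_C, C_0, zero_add]
        ring
    exact congrArg (fun h => h P) this
  have h2 : ((lin s P).coeff e).coeff 0 = ((lin s P).map (evalRingHom 0)).coeff e := by
    rw [coeff_map, coe_evalRingHom, coeff_zero_eq_eval_zero]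
  rw [h2, h1, h, map_mul, map_pow, ev_X, coeff_X_pow_mul', if_pos le_rfl, Nat.sub_self]
  have : (evalRingHom (0 : k)).comp ((ev k X (C s) : k[X][Y] →ₐ[k] k[X]) : k[X][Y] →+* k[X]) =
      (evalRingHom s).comp (mapRingHom (evalRingHom (0 : k))) := by
    apply ev_ext
    · intro c; simp
    · simp
    · simp
  rw [coeff_zero_eq_eval_zero]
  exact congrArg (fun h => h P') this

/-- The blow-up chart centred at slope `c`. -/
noncomputable def chartAt (c : k) : k[X][Y] →ₐ[k] k[X][Y] := ev k (C X) (C X * (Y + C (C c)))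

/-- Vertical translation. -/
noncomputable def shift (c : k) : k[X][Y] →ₐ[k] k[X][Y] := ev k (C X) (Y + C (C c))

lemma shift_chart (c : k) (P : k[X][Y]) : shift c (chart k P) = chartAt c P := by
  rw [shift, chart, algHom_ev]; simp [chartAt]

lemma ev_shift (c : k) (x y : A) (P : k[X][Y]) :
    ev k x y (shift c P) = ev k x (y + algebraMap k A c) P := by
  rw [shift, algHom_ev]; simp

lemma ev_chart (x y : A) (P : k[X][Y]) : ev k x y (chart k P) = ev k x (x * y) P := by
  rw [chart, algHom_ev]; simp

lemma shift_neg (c : k) (P : k[X][Y]) : shift (-c) (shift c P) = P := by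
  rw [shift, ev_shift]
  simp only [algebraMap_CC, map_neg, neg_add_cancel_right, ev_X_Y]

lemma exists_chartAt_eq (c : k) (N : k[X][Y]) :
    ∃ (M : ℕ) (N' : k[X][Y]), chartAt c N' = (C X) ^ M * N := by
  induction N using Polynomial.induction_on' with
  | add a b ha hb =>
    obtain ⟨m, a', ha⟩ := ha
    obtain ⟨n, b', hb⟩ := hb
    refine ⟨m + n, (C X) ^ n * a' + (C X) ^ m * b', ?_⟩
    rw [map_add, map_mul, map_mul, ha, hb, map_pow, map_pow, chartAt, ev_X]; ring
  | monomial n a =>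
    refine ⟨n, C a * (Y - C (C c) * C X) ^ n, ?_⟩
    have h1 : chartAt c (C a) = C a := by
      rw [chartAt, ev_C]
      exact aeval_C_X a
    rw [map_mul, h1, map_pow, map_sub, map_mul, ← C_mul_X_pow_eq_monomial]
    have : chartAt c Y - chartAt c (C (C c)) * chartAt c (C X) = C X * Y := by
      simp only [chartAt, ev_X, ev_Y, ev_CC, algebraMap_CC]; ring
    rw [this]; ring

end Change
end CremonaRank

namespace CremonaRank
open Polynomial Bivariate

section Base

variable {k F K Γ ι : Type*} [Field k] [Field F] [Field K] [Algebra k F] [Algebra F K] [Algebra k K]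
  [IsScalarTower k F K] [LinearOrderedCommGroupWithZero Γ] [Fintype ι]

lemma bmap_lin (s : k) (P : k[X][Y]) :
    bmap k F (lin s P) = lin (algebraMap k F s) (bmap k F P) := by
  rw [lin, bmap_ev, lin]; simp

lemma bmap_chartAt (s : k) (P : k[X][Y]) :
    bmap k F (chartAt s P) = chartAt (algebraMap k F s) (bmap k F P) := by
  rw [chartAt, bmap_ev, chartAt]; simp

lemma lin_CC (s c : k) : lin s (C (C c)) = C (C c) := by simp [lin]

lemma chartAt_CC (s c : k) : chartAt s (C (C c)) = C (C c) := by simp [chartAt]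

lemma lin_pencil (s : k) (f : F) (p q : k[X][Y]) :
    lin (algebraMap k F s) (pencil f p q) = pencil f (lin s p) (lin s q) := by
  simp only [pencil, map_sub, map_mul, bmap_lin, lin_CC]

lemma chartAt_pencil (s : k) (f : F) (p q : k[X][Y]) :
    chartAt (algebraMap k F s) (pencil f p q) = pencil f (chartAt s p) (chartAt s q) := by
  simp only [pencil, map_sub, map_mul, bmap_chartAt, chartAt_CC]

/-- The polynomial over `F` with coordinates `Q` in the family `e`. -/
noncomputable def fam (e : ι → F) (Q : ι → k[X][Y]) : F[X][Y] := ∑ i, C (C (e i)) * bmap k F (Q i)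

lemma lin_fam (s : k) (e : ι → F) (Q : ι → k[X][Y]) :
    lin (algebraMap k F s) (fam e Q) = fam e (fun i => lin s (Q i)) := by
  simp only [fam, map_sum, map_mul, bmap_lin, lin_CC]

/-- The local data attached to a base point of the pencil `p - f q`. -/
structure BaseData (v : Valuation K Γ) (f : F) (e : ι → F) (x y : K) (p q : k[X][Y])
    (Q : ι → k[X][Y]) : Prop where
  ker : ∀ N, ev F x y N = 0 → pencil f p q ∣ N
  rel : algebraMap F K f * ev k x y q = ev k x y p
  vx : v x < 1
  vy : v y < 1
  lc : ∀ w : K, IsIntegral (Algebra.adjoin F {x, y}) w →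
    ∃ s a, ev0 F s ≠ 0 ∧ ev F x y s * (ev F x y (fam e Q) * w) = ev F x y a

variable {v : Valuation K Γ} {f : F} {e : ι → F} {x y : K} {p q : k[X][Y]} {Q : ι → k[X][Y]}

lemma adjoin_lin (s : k) : Algebra.adjoin F {y - algebraMap k K s * x, x} = Algebra.adjoin F {x, y} := by
  apply le_antisymm <;> rw [Algebra.adjoin_le_iff]
  · rintro z (rfl | rfl)
    · exact mem_adjoin_pair.2 ⟨Y - C (C (algebraMap k F s)) * C X, by
        simp [← IsScalarTower.algebraMap_apply]⟩
    · exact Algebra.subset_adjoin (by simp)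
  · rintro z (rfl | rfl)
    · exact Algebra.subset_adjoin (by simp)
    · exact mem_adjoin_pair.2 ⟨C X + C (C (algebraMap k F s)) * Y, by
        simp [← IsScalarTower.algebraMap_apply]⟩

lemma ev_lin' (s : k) (x y : K) (P : F[X][Y]) :
    ev F (y - algebraMap k K s * x) x (lin (algebraMap k F s) P) = ev F x y P := by
  have := ev_lin (algebraMap k F s) x y P
  rwa [← IsScalarTower.algebraMap_apply] at this

lemma BaseData.linear (h : BaseData v f e x y p q Q) (hk : ∀ c : k, v (algebraMap k K c) ≤ 1) (s : k) :
    BaseData v f e (y - algebraMap k K s * x) x (lin s p) (lin s q) (fun i => lin s (Q i)) where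
  ker N hN := by
    have h1 : ev F x y (linInv (algebraMap k F s) N) = 0 := by
      rw [ev_linInv, ← IsScalarTower.algebraMap_apply, hN]
    have h2 := map_dvd (lin (algebraMap k F s)) (h.ker _ h1)
    rwa [lin_linInv, lin_pencil] at h2
  rel := by rw [ev_lin, ev_lin, h.rel]
  vx := by
    refine v.map_sub_lt h.vy ?_
    rw [map_mul]
    exact (mul_le_of_le_one_left' (hk s)).trans_lt h.vx
  vy := h.vx
  lc w hw := by
    rw [adjoin_lin] at hw
    obtain ⟨t, a, ht, ha⟩ := h.lc w hw
    refine ⟨lin (algebraMap k F s) t, lin (algebraMap k F s) a, by rwa [ev0_lin], ?_⟩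
    rw [← lin_fam, ev_lin', ev_lin', ev_lin', ha]

lemma fam_ordGE {n : ℕ} (he : LinearIndependent k e) (h : OrdGE n (fam e Q)) (i : ι) :
    OrdGE n (Q i) := ordGE_sum he h i

section Step

variable {y₁ : K} {m : ℕ}

lemma BaseData.exists_integral (h : BaseData v f e x y p q Q) (hx : x ≠ 0) (hy : y = x * y₁)
    (hm : 0 < m) (hord : OrdGE m (pencil f p q)) (ht : ((pencil f p q).coeff m).coeff 0 ≠ 0) :
    ∃ B : F[X][Y], ev0 F B ≠ 0 ∧ IsIntegral (Algebra.adjoin F {x, y}) (ev F x y B * y₁) ∧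
      (∀ n, Loc F x y (x ^ (m - 1) * y₁ ^ n)) := by
  obtain ⟨B, b, hB, hb⟩ := exists_blowup_relation hx hy (ev_pencil h.rel) hord ht
  exact ⟨B, hB, isIntegral_mul_of_relation hm (mem_adjoin_pair.2 ⟨_, rfl⟩) (fun j => ev F x y (b j))
    (fun j => mem_adjoin_pair.2 ⟨_, rfl⟩) hb, loc_pow_mul_pow hy hB hm hb⟩

omit [IsScalarTower k F K] in
lemma BaseData.ordGE_of_integral (h : BaseData v f e x y p q Q) (hy : y = x * y₁)
    (hm : 0 < m) (hord : OrdGE m (pencil f p q)) {B : F[X][Y]} (hB : ev0 F B ≠ 0)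
    (hi : IsIntegral (Algebra.adjoin F {x, y}) (ev F x y B * y₁))
    (hl : ∀ n, Loc F x y (x ^ (m - 1) * y₁ ^ n)) {w : K}
    (hw : IsIntegral (Algebra.adjoin F {x, y}) w) {t a : F[X][Y]}
    (ha : ev F x y t * (ev F x y (fam e Q) * w) = ev F x y a) : OrdGE (m - 1) a := by
  refine ordGE_of_loc hy hm h.ker hord hl (m - 1) 0 (by omega) a fun j => ?_
  obtain ⟨s, c, hs, hc⟩ := h.lc (w * (ev F x y B * y₁) ^ j) (hw.mul (hi.pow j))
  rw [pow_zero, one_mul]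
  apply Loc.of_mul (B := B ^ j) (by rw [map_pow]; exact pow_ne_zero _ hB)
  refine ⟨s, t * c, hs, ?_⟩
  rw [map_mul, ← hc, ← ha, map_pow, mul_pow]; ring

omit [IsScalarTower k F K] in
lemma BaseData.ordGE (h : BaseData v f e x y p q Q) (hy : y = x * y₁)
    (hm : 0 < m) (hord : OrdGE m (pencil f p q)) {B : F[X][Y]} (hB : ev0 F B ≠ 0)
    (hi : IsIntegral (Algebra.adjoin F {x, y}) (ev F x y B * y₁))
    (hl : ∀ n, Loc F x y (x ^ (m - 1) * y₁ ^ n)) (he : LinearIndependent k e) (i : ι) :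
    OrdGE (m - 1) (Q i) :=
  fam_ordGE he (h.ordGE_of_integral hy hm hord hB hi hl (isIntegral_one) (t := 1) (by simp)) i

/-- Passing to an infinitely near point. -/
lemma BaseData.blowup (h : BaseData v f e x y p q Q) (hx : x ≠ 0) (hy : y = x * y₁)
    (hm : 0 < m) (hord : OrdGE m (pencil f p q)) (ht : ((pencil f p q).coeff m).coeff 0 ≠ 0)
    {B : F[X][Y]} (hB : ev0 F B ≠ 0)
    (hi : IsIntegral (Algebra.adjoin F {x, y}) (ev F x y B * y₁))
    (hl : ∀ n, Loc F x y (x ^ (m - 1) * y₁ ^ n)) {c : k} (hc : v (y₁ - algebraMap k K c) < 1)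
    {p' q' : k[X][Y]} {Q' : ι → k[X][Y]} (hp : chartAt c p = C X ^ m * p')
    (hq : chartAt c q = C X ^ m * q') (hQ : ∀ i, chartAt c (Q i) = C X ^ (m - 1) * Q' i) :
    BaseData v f e x (y₁ - algebraMap k K c) p' q' Q' := by
  set z := y₁ - algebraMap k K c with hz
  have hyz : y = x * (z + algebraMap k K c) := by rw [hy, hz]; ring
  have hev : ∀ P : k[X][Y], ev k x z (chartAt c P) = ev k x y P := fun P => by
    rw [chartAt, algHom_ev, hyz]; simp
  have hevF : ∀ P : F[X][Y], ev F x z (chartAt (algebraMap k F c) P) = ev F x y P := fun P => by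
    rw [chartAt, algHom_ev, hyz]; simp [← IsScalarTower.algebraMap_apply]
  have hpen : chartAt (algebraMap k F c) (pencil f p q) = C X ^ m * pencil f p' q' := by
    rw [chartAt_pencil, hp, hq]; simp only [pencil, map_mul, map_pow, bmap_X]; ring
  have hndvd : ¬ (C X : F[X][Y]) ∣ pencil f p' q' := by
    rintro ⟨W, hW⟩
    have h1 : OrdGE (m + 1) (pencil f p q) := by
      rw [hW, ← shift_chart] at hpen
      have h2 := congrArg (shift (-(algebraMap k F c))) hpen
      rw [shift_neg, ← mul_assoc, ← pow_succ, map_mul, map_pow] at h2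
      rw [OrdGE, h2]
      simp [shift]
    exact ht (ordGE_iff.1 h1 0 m (by omega))
  refine ⟨fun N hN => ?_, ?_, h.vx, hc, fun w hw => ?_⟩
  · obtain ⟨M, N', hN'⟩ := exists_chartAt_eq (algebraMap k F c) N
    have h1 : ev F x y N' = 0 := by rw [← hevF, hN', map_mul, hN, mul_zero]
    have h2 := map_dvd (chartAt (algebraMap k F c)) (h.ker _ h1)
    rw [hN', hpen] at h2
    obtain ⟨G, hG⟩ := (Dvd.intro_left _ rfl : pencil f p' q' ∣ C X ^ m * pencil f p' q').trans h2
    have h3 : (C X : F[X][Y]) ^ M ∣ G :=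
      prime_C_X.pow_dvd_of_dvd_mul_left _ hndvd ⟨N, hG.symm⟩
    obtain ⟨G', rfl⟩ := h3
    refine ⟨G', mul_left_cancel₀ (pow_ne_zero M (prime_C_X (k := F)).ne_zero) ?_⟩
    rw [hG]; ring
  · have h1 := h.rel
    rw [← hev p, ← hev q, hp, hq] at h1
    simp only [map_mul, map_pow, ev_X] at h1
    refine mul_left_cancel₀ (pow_ne_zero m hx) ?_
    rw [← h1]; ring
  · have hw' : ∃ n : ℕ, IsIntegral (Algebra.adjoin F {x, y}) ((ev F x y B) ^ n * w) := by
      refine exists_pow_mul_isIntegral _ _ (mem_adjoin_pair.2 ⟨B, rfl⟩) (fun u hu => ?_) hw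
      have hBi : IsIntegral (Algebra.adjoin F {x, y}) (ev F x y B) :=
        isIntegral_algebraMap (R := Algebra.adjoin F {x, y}) (A := K)
          (x := ⟨_, mem_adjoin_pair.2 ⟨B, rfl⟩⟩)
      have hkey : ∀ u ∈ Algebra.adjoin F {x, z}, ∃ n : ℕ,
          IsIntegral (Algebra.adjoin F {x, y}) ((ev F x y B) ^ n * u) := by
        intro u hu
        induction hu using Algebra.adjoin_induction with
        | mem u hu =>
          rcases hu with rfl | rfl
          · exact ⟨0, by
              simpa using isIntegral_algebraMap (R := Algebra.adjoin F {u, y}) (A := K)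
                (x := ⟨u, Algebra.subset_adjoin (by simp)⟩)⟩
          · refine ⟨1, ?_⟩
            rw [pow_one, mul_sub]
            refine hi.sub (hBi.mul ?_)
            rw [IsScalarTower.algebraMap_apply k F K]
            exact isIntegral_algebraMap (R := Algebra.adjoin F {x, y}) (A := K)
              (x := algebraMap F _ (algebraMap k F c))
        | algebraMap r =>
          exact ⟨0, by
            simpa using isIntegral_algebraMap (R := Algebra.adjoin F {x, y}) (A := K)
              (x := algebraMap F _ r)⟩
        | add a b _ _ ha hb =>
          obtain ⟨m, ha⟩ := ha
          obtain ⟨n, hb⟩ := hb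
          refine ⟨m + n, ?_⟩
          have := ((hBi.pow n).mul ha).add ((hBi.pow m).mul hb)
          rwa [show ev F x y B ^ (m + n) * (a + b) = ev F x y B ^ n * (ev F x y B ^ m * a) +
            ev F x y B ^ m * (ev F x y B ^ n * b) by ring]
        | mul a b _ _ ha hb =>
          obtain ⟨m, ha⟩ := ha
          obtain ⟨n, hb⟩ := hb
          refine ⟨m + n, ?_⟩
          rw [show ev F x y B ^ (m + n) * (a * b) = ev F x y B ^ m * a * (ev F x y B ^ n * b) by ring]
          exact ha.mul hb
      exact hkey u hu
    obtain ⟨n, hn⟩ := hw'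
    obtain ⟨s, a, hs, ha⟩ := h.lc _ hn
    have hord' := h.ordGE_of_integral hy hm hord hB hi hl hn ha
    obtain ⟨a', ha'⟩ := hord'
    have ha1 : chartAt (algebraMap k F c) a = C X ^ (m - 1) * shift (algebraMap k F c) a' := by
      rw [← shift_chart, ha', map_mul, map_pow]; simp [shift]
    refine ⟨chartAt (algebraMap k F c) (s * B ^ n), shift (algebraMap k F c) a', ?_, ?_⟩
    · rw [chartAt, ev0, algHom_ev]
      simp only [ev_X, map_mul, zero_mul]
      rw [← map_mul, ← ev0, map_mul, map_pow]
      exact mul_ne_zero hs (pow_ne_zero _ hB)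
    · have hfam : ev F x y (fam e Q) = x ^ (m - 1) * ev F x z (fam e Q') := by
        rw [← hevF]
        simp only [fam, map_sum, map_mul, chartAt_CC, ← bmap_chartAt, hQ, map_pow, bmap_X, ev_X,
          Finset.mul_sum]
        refine Finset.sum_congr rfl fun i _ => ?_
        ring
      refine mul_left_cancel₀ (pow_ne_zero (m - 1) hx) ?_
      have h5 : x ^ (m - 1) * ev F x z (shift (algebraMap k F c) a') = ev F x y a := by
        rw [← hevF, ha1, map_mul, map_pow, ev_X]
      rw [h5, ← ha, hevF, hfam, map_mul, map_pow]; ring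

end Step
end Base
end CremonaRank

namespace CremonaRank
open Polynomial Bivariate

section Main

variable {k F K Γ ι : Type*} [Field k] [Field F] [Field K] [Algebra k F] [Algebra F K] [Algebra k K]
  [IsScalarTower k F K] [LinearOrderedCommGroupWithZero Γ] [Fintype ι]
  {v : Valuation K Γ} {f : F} {e : ι → F} {x y : K} {p q : k[X][Y]} {Q : ι → k[X][Y]}

lemma val_aeval_lt_one (hk : ∀ c : k, v (algebraMap k K c) ≤ 1) (hx : v x < 1) {P : k[X]}
    (h : P.coeff 0 = 0) : v (aeval x P) < 1 := by
  obtain ⟨R, rfl⟩ := X_dvd_iff.2 h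
  rw [map_mul, aeval_X, map_mul]
  exact (mul_le_of_le_one_right' (val_aeval_le_one hk hx.le R)).trans_lt hx

lemma val_ev_lt_one (hk : ∀ c : k, v (algebraMap k K c) ≤ 1) (hx : v x < 1) (hy : v y < 1)
    {P : k[X][Y]} (h : ev0 k P = 0) : v (ev k x y P) < 1 := by
  obtain ⟨R, hR⟩ := exists_eq_map_add_mul_X P
  rw [hR, map_add, ev_map_C, map_mul, ev_X]
  refine v.map_add_lt (val_aeval_lt_one hk hy ?_) ?_
  · rwa [coeff_map, coe_evalRingHom, ← coeff_zero_eq_eval_zero, ← ev0_eq]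
  · rw [map_mul]
    exact (mul_le_of_le_one_right' (val_ev_le_one hk hx.le hy.le R)).trans_lt hx

lemma val_ev_eq_one (hk : ∀ c : k, c ≠ 0 → v (algebraMap k K c) = 1) (hx : v x < 1) (hy : v y < 1)
    {P : k[X][Y]} (h : ev0 k P ≠ 0) : v (ev k x y P) = 1 := by
  have hk' : ∀ c : k, v (algebraMap k K c) ≤ 1 := fun c => by
    rcases eq_or_ne c 0 with rfl | hc
    · simp
    · exact (hk c hc).le
  have h1 : v (ev k x y (P - C (C (ev0 k P)))) < 1 := by
    refine val_ev_lt_one hk' hx hy ?_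
    simp [ev0]
  have h2 : ev k x y P = ev k x y (P - C (C (ev0 k P))) + algebraMap k K (ev0 k P) := by simp
  rw [h2, Valuation.map_add_eq_of_lt_right, hk _ h]
  rwa [hk _ h]

omit [Fintype ι] [Algebra F K] [IsScalarTower k F K] in
lemma exists_transversal [Infinite k] (hf : ∀ c : k, algebraMap k F c ≠ f)
    (hpq : p ≠ 0 ∨ q ≠ 0) (hk : ∀ c : k, c ≠ 0 → v (algebraMap k K c) = 1)
    (hxy : x ≠ 0 ∨ y ≠ 0) :
    ∃ (m : ℕ) (s : k), OrdGE m (pencil f (lin s p) (lin s q)) ∧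
      ((pencil f (lin s p) (lin s q)).coeff m).coeff 0 ≠ 0 ∧
      v x ≤ v (y - algebraMap k K s * x) ∧ y - algebraMap k K s * x ≠ 0 := by
  have h0 : pencil f p q ≠ 0 := by
    rw [Ne, pencil_eq_zero hf]; tauto
  obtain ⟨m, P', hP, hP0⟩ := exists_chart_eq h0
  have hinj : Function.Injective (algebraMap k F) := (algebraMap k F).injective
  have hfin : {s : k | (P'.map (evalRingHom 0)).IsRoot (algebraMap k F s)}.Finite :=
    (finite_setOfPred_isRoot hP0).preimage hinj.injOn
  have hbad : {s : k | v (y - algebraMap k K s * x) < v x}.Subsingleton := by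
    intro s hs t ht
    by_contra hst
    have h1 : v ((y - algebraMap k K t * x) - (y - algebraMap k K s * x)) < v x := v.map_sub_lt ht hs
    have h2 : (y - algebraMap k K t * x) - (y - algebraMap k K s * x) = algebraMap k K (s - t) * x := by
      rw [map_sub]; ring
    rw [h2, map_mul, hk _ (sub_ne_zero.2 hst), one_mul] at h1
    exact lt_irrefl _ h1
  obtain ⟨s, hs⟩ := (hfin.union hbad.finite).exists_notMem
  have hs1 : ¬ (P'.map (evalRingHom 0)).IsRoot (algebraMap k F s) := fun h => hs (Or.inl h)
  have hs2 : v x ≤ v (y - algebraMap k K s * x) := not_lt.1 fun h => hs (Or.inr h)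
  refine ⟨m, s, ?_, ?_, hs2, fun h => ?_⟩
  · rw [← lin_pencil]; exact ordGE_lin ⟨P', hP⟩
  · rw [← lin_pencil, coeff_lin _ hP]; exact hs1
  · rw [h, map_zero, le_zero_iff, map_eq_zero] at hs2
    subst hs2
    simp at h
    simp [h] at hxy

lemma BaseData.val_mul_le_of_transversal [IsAlgClosed k] (hf : ∀ c : k, algebraMap k F c ≠ f)
    (he : LinearIndependent k e) (hk : ∀ c : k, c ≠ 0 → v (algebraMap k K c) = 1)
    {ϖ : K} (hϖ : ∀ a, v a < 1 → v a ≤ v ϖ)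
    {δ : K → K → K} (hδ : IsBider k δ) (hδ1 : ∀ a b, v a ≤ 1 → v b ≤ 1 → v (δ a b) ≤ 1) (n : ℕ)
    (ih : ∀ (x y : K) (p q : k[X][Y]) (Q : ι → k[X][Y]), BaseData v f e x y p q Q →
      v ϖ ^ n ≤ max (v (ev k x y p)) (v (ev k x y q)) → ∀ i,
      v (ev k x y (Q i) * δ x y) ≤ max (v (ev k x y p)) (v (ev k x y q)))
    (h : BaseData v f e x y p q Q) (hn : v ϖ ^ (n + 1) ≤ max (v (ev k x y p)) (v (ev k x y q)))
    (hx : x ≠ 0) (hyx : v y ≤ v x) {m : ℕ} (hm : 0 < m) (hord : OrdGE m (pencil f p q))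
    (ht : ((pencil f p q).coeff m).coeff 0 ≠ 0) (i : ι) :
    v (ev k x y (Q i) * δ x y) ≤ max (v (ev k x y p)) (v (ev k x y q)) := by
  have hk' : ∀ c : k, v (algebraMap k K c) ≤ 1 := fun c => by
    rcases eq_or_ne c 0 with rfl | hc
    · simp
    · exact (hk c hc).le
  obtain ⟨y₁, hy⟩ : ∃ y₁, y = x * y₁ := ⟨y / x, by field_simp⟩
  have hvx : 0 < v x := by rw [zero_lt_iff, Ne, map_eq_zero]; exact hx
  have hvxm : 0 < v x ^ m := pow_pos hvx m
  have hy₁ : v y₁ ≤ 1 := by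
    rw [hy, map_mul] at hyx
    exact (mul_le_iff_le_one_right hvx).1 hyx
  obtain ⟨B, hB, hi, hl⟩ := h.exists_integral hx hy hm hord ht
  have hQ := h.ordGE hy hm hord hB hi hl he
  choose Q₁ hQ₁ using hQ
  obtain ⟨⟨p₁, hp₁⟩, ⟨q₁, hq₁⟩⟩ := (ordGE_pencil hf).1 hord
  have hδx : ∀ c : k, δ x y = x * δ x (y₁ - algebraMap k K c) := fun c => by
    rw [hy, hδ.leib_right, hδ.self, sub_eq_add_neg, hδ.add_right, ← map_neg, hδ.alg_right]; ring
  have hpow : v x ^ m = v x ^ (m - 1) * v x := by rw [← pow_succ]; congr 1; omega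
  by_cases hc : ∃ c : k, v (y₁ - algebraMap k K c) < 1
  · obtain ⟨c, hc⟩ := hc
    have hsh : ∀ {j : ℕ} {P P' : k[X][Y]}, chart k P = C X ^ j * P' →
        chartAt c P = C X ^ j * shift c P' := fun {j P P'} hP => by
      rw [← shift_chart, hP, map_mul, map_pow]; simp [shift]
    have hnew := h.blowup hx hy hm hord ht hB hi hl hc (hsh hp₁) (hsh hq₁) (fun i => hsh (hQ₁ i))
    have hev : ∀ {j : ℕ} {P P' : k[X][Y]}, chart k P = C X ^ j * P' →
        ev k x y P = x ^ j * ev k x (y₁ - algebraMap k K c) (shift c P') := fun {j P P'} hP => by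
      rw [ev_shift, sub_add_cancel, hy, ← ev_chart, hP, map_mul, map_pow, ev_X]
    rw [hev hp₁, hev hq₁] at hn ⊢
    rw [hev (hQ₁ i), hδx c]
    have hmax : ∀ a b : K, max (v (x ^ m * a)) (v (x ^ m * b)) = v x ^ m * max (v a) (v b) := by
      intro a b
      rw [map_mul, map_mul, map_pow]
      exact (Monotone.map_max (f := fun t => v x ^ m * t) fun s t hst => mul_le_mul_right hst _).symm
    rw [hmax] at hn ⊢
    have hvϖ : 0 < v ϖ := hvx.trans_le (hϖ x h.vx)
    have hxm : v x ^ m ≤ v ϖ := by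
      rw [hpow]
      exact (mul_le_of_le_one_left' (pow_le_one' h.vx.le _)).trans (hϖ x h.vx)
    have h1 := ih _ _ _ _ _ hnew (by
      have h2 : v ϖ * v ϖ ^ n ≤ v ϖ * max (v (ev k x (y₁ - algebraMap k K c) (shift c p₁)))
          (v (ev k x (y₁ - algebraMap k K c) (shift c q₁))) := by
        rw [← pow_succ']
        exact hn.trans (mul_le_mul_left hxm _)
      exact (mul_le_mul_iff_right₀ hvϖ).1 h2) i
    refine le_trans (le_of_eq ?_) (mul_le_mul_right h1 (v x ^ m))
    rw [hpow, ← map_pow, ← map_mul, ← map_mul]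
    congr 1; ring
  · push Not at hc
    have hc' : ∀ c : k, v (y₁ - algebraMap k K c) = 1 := fun c =>
      le_antisymm (v.map_sub_le hy₁ (hk' c)) (hc c)
    have hev : ∀ {j : ℕ} {P P' : k[X][Y]}, chart k P = C X ^ j * P' →
        ev k x y P = x ^ j * ev k x y₁ P' := fun {j P P'} hP => by
      rw [hy, ← ev_chart, hP, map_mul, map_pow, ev_X]
    have hone : ∀ P : k[X][Y], P.map (evalRingHom 0) ≠ 0 → v (ev k x y₁ P) = 1 := by
      intro P hP
      obtain ⟨R, hR⟩ := exists_eq_map_add_mul_X P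
      have h1 : v (ev k x y₁ (C X * R)) < 1 := by
        rw [map_mul, ev_X, map_mul]
        exact (mul_le_of_le_one_right' (val_ev_le_one hk' h.vx.le hy₁ R)).trans_lt h.vx
      have h2 := val_aeval_eq_one hk hc' hP
      rw [hR, map_add, ev_map_C, Valuation.map_add_eq_of_lt_left, h2]
      rwa [h2]
    have hpq : p₁.map (evalRingHom 0) ≠ 0 ∨ q₁.map (evalRingHom 0) ≠ 0 := by
      by_contra! hcon
      apply ht
      have h3 : ∀ {P P' : k[X][Y]}, chart k P = C X ^ m * P' → P'.map (evalRingHom 0) = 0 →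
          (P.coeff m).coeff 0 = 0 := by
        intro P P' hP hP'
        have h4 := congrArg (fun W => (W.coeff m).coeff m) hP
        simp only [coeff_chart, ← C_pow, coeff_C_mul] at h4
        rw [coeff_mul_X_pow', if_pos le_rfl, Nat.sub_self, coeff_X_pow_mul', if_pos le_rfl,
          Nat.sub_self] at h4
        rw [h4]
        have h5 := congrArg (fun W => W.coeff m) hP'
        simpa [coeff_zero_eq_eval_zero] using h5
      rw [coeff_pencil, h3 hp₁ hcon.1, h3 hq₁ hcon.2]; simp
    have hle : v x ^ m ≤ max (v (ev k x y p)) (v (ev k x y q)) := by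
      rcases hpq with h1 | h1
      · refine le_trans (le_of_eq ?_) (le_max_left _ _)
        rw [hev hp₁, map_mul, map_pow, hone _ h1, mul_one]
      · refine le_trans (le_of_eq ?_) (le_max_right _ _)
        rw [hev hq₁, map_mul, map_pow, hone _ h1, mul_one]
    refine le_trans ?_ hle
    have h6 := hδx 0
    rw [map_zero, sub_zero] at h6
    rw [hev (hQ₁ i), h6, show x ^ (m - 1) * ev k x y₁ (Q₁ i) * (x * δ x y₁) =
      x ^ (m - 1) * x * (ev k x y₁ (Q₁ i) * δ x y₁) by ring, hpow, map_mul, map_mul, map_pow]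
    refine mul_le_of_le_one_right' ?_
    rw [map_mul]
    exact mul_le_one' (val_ev_le_one hk' h.vx.le hy₁ _) (hδ1 _ _ h.vx.le hy₁)

/-- The adjoint condition at a base point of a pencil. -/
theorem BaseData.val_mul_le [IsAlgClosed k] (hf : ∀ c : k, algebraMap k F c ≠ f)
    (he : LinearIndependent k e) (hk : ∀ c : k, c ≠ 0 → v (algebraMap k K c) = 1)
    {ϖ : K} (hϖ0 : ϖ ≠ 0) (hϖ : ∀ a, v a < 1 → v a ≤ v ϖ)
    {δ : K → K → K} (hδ : IsBider k δ) (hδ1 : ∀ a b, v a ≤ 1 → v b ≤ 1 → v (δ a b) ≤ 1) (n : ℕ) :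
    ∀ (x y : K) (p q : k[X][Y]) (Q : ι → k[X][Y]), BaseData v f e x y p q Q →
      v ϖ ^ n ≤ max (v (ev k x y p)) (v (ev k x y q)) → ∀ i,
      v (ev k x y (Q i) * δ x y) ≤ max (v (ev k x y p)) (v (ev k x y q)) := by
  have hk' : ∀ c : k, v (algebraMap k K c) ≤ 1 := fun c => by
    rcases eq_or_ne c 0 with rfl | hc
    · simp
    · exact (hk c hc).le
  have : Infinite k := IsAlgClosed.instInfinite
  induction n with
  | zero => 
    intro x y p q Q h hn i
    rw [pow_zero] at hn
    refine le_trans ?_ hn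
    rw [map_mul]
    exact mul_le_one' (val_ev_le_one hk' h.vx.le h.vy.le _) (hδ1 _ _ h.vx.le h.vy.le)
  | succ n ih =>
  intro x y p q Q h hn i
  have hpos : 0 < v ϖ ^ (n + 1) := by
    rw [← map_pow, zero_lt_iff, Ne, map_eq_zero]; exact pow_ne_zero _ hϖ0
  have hpos' := hpos.trans_le hn
  have hpq : p ≠ 0 ∨ q ≠ 0 := by
    by_contra! hc
    rw [hc.1, hc.2] at hpos'
    simp at hpos'
  by_cases h00 : ev0 k p ≠ 0 ∨ ev0 k q ≠ 0
  · have h1 : 1 ≤ max (v (ev k x y p)) (v (ev k x y q)) := by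
      rcases h00 with h0 | h0
      · exact (val_ev_eq_one hk h.vx h.vy h0).ge.trans (le_max_left _ _)
      · exact (val_ev_eq_one hk h.vx h.vy h0).ge.trans (le_max_right _ _)
    refine le_trans ?_ h1
    rw [map_mul]
    exact mul_le_one' (val_ev_le_one hk' h.vx.le h.vy.le _) (hδ1 _ _ h.vx.le h.vy.le)
  push Not at h00
  have hxy : x ≠ 0 ∨ y ≠ 0 := by
    by_contra! hc
    obtain ⟨rfl, rfl⟩ := hc
    have h2 : ∀ P, ev k (0 : K) 0 P = algebraMap k K (ev0 k P) := fun P => by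
      have := algHom_ev (Algebra.ofId k K) (0 : k) 0 P
      simp only [map_zero] at this
      rw [← this]; rfl
    rw [h2, h2, h00.1, h00.2] at hpos'
    simp at hpos'
  obtain ⟨m, s, hord, ht, hxv, hx0⟩ := exists_transversal (v := v) hf hpq hk hxy
  have hδ' : δ (y - algebraMap k K s * x) x = - δ x y := by
    rw [hδ.swap, sub_eq_add_neg, hδ.add_right, ← neg_mul, hδ.leib_right, ← map_neg, hδ.alg_right,
      hδ.self]
    ring
  have hm : 0 < m := by
    by_contra! hm
    obtain rfl : m = 0 := by omega
    apply ht
    rw [coeff_pencil, ← ev0_eq, ← ev0_eq, ev0_lin, ev0_lin, h00.1, h00.2]; simp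
  have hmain := (h.linear hk' s).val_mul_le_of_transversal hf he hk hϖ hδ hδ1 n ih
    (by rwa [ev_lin, ev_lin]) hx0 hxv hm hord ht i
  rwa [ev_lin, ev_lin, ev_lin, hδ', mul_neg, v.map_neg] at hmain

end Main
end CremonaRank

namespace CremonaRank
open Polynomial Bivariate

section Homog

variable {k : Type*} [Field k]

/-- The total degree is at most `d`. -/
def TDegLE (d : ℕ) (P : k[X][Y]) : Prop := ∀ i j, d < i + j → (P.coeff j).coeff i = 0

/-- Homogenisation to degree `d` followed by dehomogenisation in the other chart. -/
noncomputable def hom (d : ℕ) (P : k[X][Y]) : k[X][Y] :=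
  ∑ j ∈ Finset.range (d + 1), ∑ i ∈ Finset.range (d + 1 - j),
    C (C ((P.coeff j).coeff (d - j - i))) * (C X ^ i * Y ^ j)

lemma TDegLE.eq_sum {d : ℕ} {P : k[X][Y]} (h : TDegLE d P) : P =
    ∑ j ∈ Finset.range (d + 1), ∑ i ∈ Finset.range (d + 1 - j),
      C (C ((P.coeff j).coeff i)) * (C X ^ i * Y ^ j) := by
  ext j i
  simp only [finsetSum_coeff, coeff_C_mul, ← C_pow, coeff_X_pow, mul_ite, mul_one, mul_zero]
  by_cases hij : i + j ≤ d
  · rw [Finset.sum_eq_single j, Finset.sum_eq_single i]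
    · simp
    · intro b _ hb; simp [coeff_X_pow, hb.symm]
    · intro hi; exact absurd (Finset.mem_range.2 (by omega)) hi
    · intro b _ hb; simp [hb.symm]
    · intro hi; exact absurd (Finset.mem_range.2 (by omega)) hi
  · rw [h i j (by omega)]
    symm
    refine Finset.sum_eq_zero fun b hb => Finset.sum_eq_zero fun a ha => ?_
    have hb := Finset.mem_range.1 hb
    have ha := Finset.mem_range.1 ha
    by_cases hjb : j = b
    · have : i ≠ a := by omega
      simp [hjb, coeff_X_pow, this]
    · simp [hjb]

lemma coeff_hom (d : ℕ) (P : k[X][Y]) (i j : ℕ) :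
    ((hom d P).coeff j).coeff i = if i + j ≤ d then (P.coeff j).coeff (d - j - i) else 0 := by
  simp only [hom, finsetSum_coeff, coeff_C_mul, ← C_pow, coeff_X_pow, mul_ite, mul_one, mul_zero]
  by_cases hij : i + j ≤ d
  · rw [if_pos hij, Finset.sum_eq_single j, Finset.sum_eq_single i]
    · simp
    · intro b _ hb; simp [coeff_X_pow, hb.symm]
    · intro hi; exact absurd (Finset.mem_range.2 (by omega)) hi
    · intro b _ hb; simp [hb.symm]
    · intro hi; exact absurd (Finset.mem_range.2 (by omega)) hi
  · rw [if_neg hij]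
    refine Finset.sum_eq_zero fun b hb => Finset.sum_eq_zero fun a ha => ?_
    have hb := Finset.mem_range.1 hb
    have ha := Finset.mem_range.1 ha
    by_cases hjb : j = b
    · have : i ≠ a := by omega
      simp [hjb, coeff_X_pow, this]
    · simp [hjb]

lemma tdegLE_hom (d : ℕ) (P : k[X][Y]) : TDegLE d (hom d P) := fun i j hij => by
  rw [coeff_hom, if_neg (by omega)]

lemma hom_hom {d : ℕ} {P : k[X][Y]} (h : TDegLE d P) : hom d (hom d P) = P := by
  ext j i
  rw [coeff_hom]
  split_ifs with hij
  · rw [coeff_hom, if_pos (by omega)]; congr 1; omega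
  · exact (h i j (by omega)).symm

lemma ev_hom {A : Type*} [CommRing A] [Algebra k A] {d : ℕ} {P : k[X][Y]} (h : TDegLE d P)
    {u x z : A} (hu : u * x = 1) : ev k u z (hom d P) = u ^ d * ev k x (x * z) P := by
  conv_rhs => rw [h.eq_sum]
  simp only [hom, map_sum, map_mul, map_pow, ev_X, ev_Y, ev_CC, Finset.mul_sum]
  refine Finset.sum_congr rfl fun j hj => ?_
  have hj := Finset.mem_range.1 hj
  rw [← Finset.sum_range_reflect]
  refine Finset.sum_congr rfl fun i hi => ?_
  have hi := Finset.mem_range.1 hi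
  have h1 : d - j - (d + 1 - j - 1 - i) = i := by omega
  have h2 : d + 1 - j - 1 - i = d - j - i := by omega
  rw [h1, h2]
  have h3 : u ^ d = u ^ (d - j - i) * u ^ i * u ^ j := by
    rw [← pow_add, ← pow_add]; congr 1; omega
  rw [h3]
  have h4 : u ^ i * x ^ i = 1 := by rw [← mul_pow, hu, one_pow]
  have h5 : u ^ j * x ^ j = 1 := by rw [← mul_pow, hu, one_pow]
  calc _ = algebraMap k A ((P.coeff j).coeff i) * u ^ (d - j - i) * z ^ j * (u ^ i * x ^ i) *
        (u ^ j * x ^ j) := by rw [h4, h5]; ring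
    _ = _ := by ring

/-- The form of degree `d`, dehomogenised. -/
noncomputable def top (d : ℕ) (P : k[X][Y]) : k[X] := (hom d P).map (evalRingHom 0)

lemma coeff_top (d : ℕ) (P : k[X][Y]) (j : ℕ) :
    (top d P).coeff j = if j ≤ d then (P.coeff j).coeff (d - j) else 0 := by
  rw [top, coeff_map, coe_evalRingHom, ← coeff_zero_eq_eval_zero, coeff_hom]; simp

lemma coeff_lin_zero (P : k[X][Y]) (i j : ℕ) :
    ((lin 0 P).coeff j).coeff i = (P.coeff i).coeff j := by
  induction P using Polynomial.induction_on' with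
  | add a b ha hb => simp only [map_add, coeff_add, ha, hb]
  | monomial n a =>
    induction a using Polynomial.induction_on' with
    | add a b ha hb => simp only [map_add, coeff_add, ha, hb]
    | monomial m c =>
      rw [← C_mul_X_pow_eq_monomial, ← C_mul_X_pow_eq_monomial, map_mul, map_pow, C_mul, map_mul,
        C_pow, map_pow, lin_CC]
      simp only [lin, ev_X, ev_Y, C_0, zero_mul, add_zero, mul_assoc, coeff_C_mul, ← C_pow]
      rw [coeff_mul_C, coeff_X_pow, coeff_X_pow]
      split_ifs <;> simp_all [coeff_X_pow]

lemma TDegLE.lin_zero {d : ℕ} {P : k[X][Y]} (h : TDegLE d P) : TDegLE d (lin 0 P) := fun i j hij => by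
  rw [coeff_lin_zero]; exact h _ _ (by omega)

end Homog

section Coprime

variable {k : Type*} [Field k]

lemma exists_map_eq_C_mul {R L : Type*} [CommRing R] [IsDomain R] [Field L] [Algebra R L]
    [IsFractionRing R L] (u : L[X]) :
    ∃ (b : R) (U : R[X]), b ≠ 0 ∧ U.map (algebraMap R L) = C (algebraMap R L b) * u := by
  obtain ⟨b, hb, h⟩ := IsLocalization.integerNormalization_spec (nonZeroDivisors R) u
  exact ⟨b, _, nonZeroDivisors.ne_zero hb, by rw [h, ← algebraMap_smul L, smul_eq_C_mul]⟩

/-- Relatively prime bivariate polynomials generate an ideal containing a nonzero polynomial in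
one variable. -/
lemma exists_C_mem_of_isRelPrime {p q : k[X][Y]} (h : IsRelPrime p q) :
    ∃ (r : k[X]) (a b : k[X][Y]), r ≠ 0 ∧ a * p + b * q = C r := by
  classical
  let L := FractionRing k[X]
  let _ : NormalizedGCDMonoid k[X] := Classical.choice inferInstance
  have hinj : Function.Injective (Polynomial.map (algebraMap k[X] L)) :=
    Polynomial.map_injective _ (IsFractionRing.injective k[X] L)
  have hco : IsCoprime (p.map (algebraMap k[X] L)) (q.map (algebraMap k[X] L)) := by
    apply isCoprime_of_prime_dvd
    · rintro ⟨h1, h2⟩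
      rw [Polynomial.map_eq_zero_iff (IsFractionRing.injective k[X] L)] at h1 h2
      subst h1 h2
      exact not_isUnit_zero (h dvd_rfl dvd_rfl)
    · intro g hg hgp hgq
      obtain ⟨b, G, hb, hG'⟩ := exists_map_eq_C_mul (R := k[X]) g
      have hb0 : algebraMap k[X] L b ≠ 0 := by simpa using hb
      have hbu : IsUnit (C (algebraMap k[X] L b)) := isUnit_C.2 hb0.isUnit
      have hG0 : G ≠ 0 := by
        intro h0
        rw [h0, Polynomial.map_zero] at hG'
        exact mul_ne_zero hbu.ne_zero hg.ne_zero hG'.symm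
      have hdvd : ∀ P : k[X][Y], g ∣ P.map (algebraMap k[X] L) → G.primPart ∣ P := by
        intro P hP
        apply (isPrimitive_primPart G).dvd_of_fraction_map_dvd_fraction_map (K := L)
        have h1 : G.primPart.map (algebraMap k[X] L) ∣ G.map (algebraMap k[X] L) :=
          Polynomial.map_dvd _ (primPart_dvd G)
        rw [hG'] at h1
        exact (hbu.dvd_mul_left.1 h1).trans hP
      have hu := h (hdvd p hgp) (hdvd q hgq)
      have h2 : G.natDegree = g.natDegree := by
        rw [← natDegree_map_eq_of_injective (IsFractionRing.injective k[X] L) G, hG',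
          natDegree_C_mul hb0]
      have h3 : G.primPart.natDegree = 0 := natDegree_eq_zero_of_isUnit hu
      rw [natDegree_primPart, h2] at h3
      exact hg.not_isUnit (isUnit_iff_degree_eq_zero.2 (by
        rw [degree_eq_natDegree hg.ne_zero, h3]; rfl))
  obtain ⟨u, w, huw⟩ := hco
  obtain ⟨b, U, hb, hb'⟩ := exists_map_eq_C_mul (R := k[X]) u
  obtain ⟨c, W, hc, hc'⟩ := exists_map_eq_C_mul (R := k[X]) w
  refine ⟨b * c, C c * U, C b * W, mul_ne_zero hb hc, hinj ?_⟩
  simp only [Polynomial.map_add, Polynomial.map_mul, map_C, hb', hc', map_mul]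
  linear_combination (C (algebraMap k[X] L b) * C (algebraMap k[X] L c)) * huw
end Coprime
end CremonaRank

namespace CremonaRank
open Polynomial Bivariate

section Trans

variable {k : Type*} [Field k] {A : Type*} [CommRing A] [Algebra k A]

/-- Translation of the variables. -/
noncomputable def trans (a b : k) : k[X][Y] →ₐ[k] k[X][Y] := ev k (C (X + C a)) (Y + C (C b))

lemma ev_trans (a b : k) (x y : A) (P : k[X][Y]) :
    ev k x y (trans a b P) = ev k (x + algebraMap k A a) (y + algebraMap k A b) P := by
  rw [trans, algHom_ev]; simp

lemma trans_trans (a b : k) (P : k[X][Y]) : trans a b (trans (-a) (-b) P) = P := by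
  have h := algHom_ev (trans a b) (C (X + C (-a))) (Y + C (C (-b))) P
  rw [← trans] at h
  rw [h]
  conv_rhs => rw [← ev_X_Y P]
  congr 2 <;> simp [trans]

lemma trans_CC (a b c : k) : trans a b (C (C c)) = C (C c) := by
  simp [trans]

variable {F : Type*} [Field F] [Algebra k F]

lemma bmap_trans (a b : k) (P : k[X][Y]) :
    bmap k F (trans a b P) = trans (algebraMap k F a) (algebraMap k F b) (bmap k F P) := by
  rw [trans, bmap_ev, trans]; congr 2 <;> simp [bmap]

lemma trans_pencil (a b : k) (f : F) (p q : k[X][Y]) :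
    trans (algebraMap k F a) (algebraMap k F b) (pencil f p q) =
      pencil f (trans a b p) (trans a b q) := by
  simp only [pencil, map_sub, map_mul, bmap_trans, trans_CC]

lemma trans_fam {ι : Type*} [Fintype ι] (a b : k) (e : ι → F) (Q : ι → k[X][Y]) :
    trans (algebraMap k F a) (algebraMap k F b) (fam e Q) = fam e (fun i => trans a b (Q i)) := by
  simp only [fam, map_sum, map_mul, bmap_trans, trans_CC]

end Trans

section Good

variable {k K : Type*} [Field k] [Field K] [Algebra k K]

/-- A discrete valuation ring containing the constants together with an alternating biderivation
for which it is stable. -/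
structure Good (k : Type*) {K : Type*} [Field k] [Field K] [Algebra k K] (O : ValuationSubring K)
    (δ : K → K → K) : Prop where
  bider : IsBider k δ
  const : ∀ c : k, algebraMap k K c ∈ O
  int : ∀ a b, a ∈ O → b ∈ O → δ a b ∈ O
  unif : ∃ ϖ ≠ 0, (∀ a, O.valuation a < 1 → O.valuation a ≤ O.valuation ϖ) ∧
    ∀ a ≠ 0, ∃ n : ℕ, O.valuation ϖ ^ n ≤ O.valuation a

namespace Good
variable {O : ValuationSubring K} {δ : K → K → K} (h : Good k O δ)
include h

lemma val_const {c : k} (hc : c ≠ 0) : O.valuation (algebraMap k K c) = 1 := by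
  refine le_antisymm ((O.valuation_le_one_iff _).2 (h.const c)) ?_
  have h1 := (O.valuation_le_one_iff _).2 (h.const c⁻¹)
  calc (1 : O.ValueGroup) = O.valuation (algebraMap k K c) * O.valuation (algebraMap k K c⁻¹) := by
        rw [← map_mul, ← map_mul, mul_inv_cancel₀ hc, map_one, map_one]
    _ ≤ _ := mul_le_of_le_one_right' h1

lemma val_const_le (c : k) : O.valuation (algebraMap k K c) ≤ 1 :=
  (O.valuation_le_one_iff _).2 (h.const c)

end Good
end Good

section Key

variable {k F K ι : Type*} [Field k] [Field F] [Field K] [Algebra k F] [Algebra F K] [Algebra k K]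
  [IsScalarTower k F K] [Fintype ι]

lemma exists_val_sub_lt_one [IsAlgClosed k] {Γ : Type*} [LinearOrderedCommGroupWithZero Γ]
    {v : Valuation K Γ} (hk : ∀ c : k, c ≠ 0 → v (algebraMap k K c) = 1)
    {x y : K} (hx : v x ≤ 1) (hy : v y ≤ 1) {p q : k[X][Y]} (hpq : IsRelPrime p q)
    (hp : v (ev k x y p) < 1) (hq : v (ev k x y q) < 1) : ∃ c : k, v (x - algebraMap k K c) < 1 := by
  have hk' : ∀ c : k, v (algebraMap k K c) ≤ 1 := fun c => by
    rcases eq_or_ne c 0 with rfl | hc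
    · simp
    · exact (hk c hc).le
  by_contra! hcon
  obtain ⟨r, a, b, hr, hab⟩ := exists_C_mem_of_isRelPrime hpq
  have h1 : v (aeval x r) = 1 := val_aeval_eq_one hk
    (fun c => le_antisymm (v.map_sub_le hx (hk' c)) (hcon c)) hr
  have h2 : v (aeval x r) < 1 := by
    rw [← ev_C x y r, ← hab, map_add, map_mul, map_mul]
    refine v.map_add_lt ?_ ?_ <;> rw [map_mul]
    · exact (mul_le_of_le_one_left' (val_ev_le_one hk' hx hy a)).trans_lt hp
    · exact (mul_le_of_le_one_left' (val_ev_le_one hk' hx hy b)).trans_lt hq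
  exact h2.ne h1

lemma lin_zero_lin_zero (P : k[X][Y]) : lin 0 (lin 0 P) = P := by
  ext j i
  rw [coeff_lin_zero, coeff_lin_zero]

lemma isRelPrime_lin_zero {p q : k[X][Y]} (h : IsRelPrime p q) : IsRelPrime (lin 0 p) (lin 0 q) := by
  intro g hp hq
  have := h (by simpa [lin_zero_lin_zero] using map_dvd (lin (0 : k)) hp)
    (by simpa [lin_zero_lin_zero] using map_dvd (lin (0 : k)) hq)
  simpa [lin_zero_lin_zero] using this.map (lin (0 : k))

lemma ev_lin_zero {A : Type*} [CommRing A] [Algebra k A] (x y : A) (P : k[X][Y]) :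
    ev k y x (lin 0 P) = ev k x y P := by
  have := ev_lin 0 x y P
  simpa using this

variable {O : ValuationSubring K} {δ : K → K → K}

lemma val_mul_le_of_infinite (hO : Good k O δ) {x y : K} {p q Q : k[X][Y]} {d : ℕ} (hd : 3 ≤ d)
    (hp : TDegLE d p) (hq : TDegLE d q) (hQ : TDegLE (d - 3) Q) (hx : 1 < O.valuation x)
    (hy : O.valuation y ≤ O.valuation x)
    (hmax : 1 ≤ max (O.valuation (ev k x⁻¹ (y / x) (hom d p)))
      (O.valuation (ev k x⁻¹ (y / x) (hom d q)))) :
    O.valuation (ev k x y Q * δ x y) ≤ max (O.valuation (ev k x y p)) (O.valuation (ev k x y q)) := by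
  set v := O.valuation with hv
  have hx0 : x ≠ 0 := by rintro rfl; simp at hx
  have hvx0 : v x ≠ 0 := by simpa using hx0
  have hu : x⁻¹ * x = 1 := inv_mul_cancel₀ hx0
  have hz : x * (y / x) = y := mul_div_cancel₀ y hx0
  have hvu : v x⁻¹ ≤ 1 := by rw [map_inv₀]; exact inv_le_one_of_one_le₀ hx.le
  have hvz : v (y / x) ≤ 1 := by rw [map_div₀]; exact div_le_one_of_le₀ hy zero_le
  rw [ev_hom hp hu, ev_hom hq hu, hz] at hmax
  have hQ1 : v (x⁻¹ ^ (d - 3) * ev k x y Q) ≤ 1 := by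
    have := val_ev_le_one (v := v) hO.val_const_le hvu hvz (hom (d - 3) Q)
    rwa [ev_hom hQ hu, hz] at this
  have hδ1 : v (δ x⁻¹ (y / x)) ≤ 1 := (O.valuation_le_one_iff _).2
    (hO.int _ _ ((O.valuation_le_one_iff _).1 hvu) ((O.valuation_le_one_iff _).1 hvz))
  have e1 : δ x y = x * δ x (y / x) := by
    conv_lhs => rw [← hz]
    rw [hO.bider.leib_right, hO.bider.self]; ring
  have e2 : x⁻¹ * δ x (y / x) + x * δ x⁻¹ (y / x) = 0 := by
    rw [← hO.bider.leib_left, hu, ← map_one (algebraMap k K), hO.bider.alg_left]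
  have e3 : ev k x y Q * δ x y =
      - (x ^ d * ((x⁻¹ ^ (d - 3) * ev k x y Q) * δ x⁻¹ (y / x))) := by
    have e4 : δ x (y / x) = - (x * x * δ x⁻¹ (y / x)) := by
      linear_combination x * e2 - δ x (y / x) * hu
    have e5 : x ^ d * x⁻¹ ^ (d - 3) = x ^ 3 := by
      have e6 : x ^ d = x ^ (d - 3) * x ^ 3 := by rw [← pow_add, Nat.sub_add_cancel hd]
      rw [e6, mul_right_comm, ← mul_pow, mul_inv_cancel₀ hx0, one_pow, one_mul]
    rw [e1, e4]
    linear_combination (ev k x y Q * δ x⁻¹ (y / x)) * e5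
  have h4 : v (ev k x y Q * δ x y) ≤ v x ^ d := by
    rw [e3, Valuation.map_neg, map_mul, map_pow, map_mul]
    exact mul_le_of_le_one_right' (mul_le_one' hQ1 hδ1)
  refine h4.trans ?_
  have h5 : ∀ w : K, 1 ≤ v (x⁻¹ ^ d * w) → v x ^ d ≤ v w := fun w hw => by
    rw [map_mul, map_pow, map_inv₀, inv_pow] at hw
    have := mul_le_mul_right hw (v x ^ d)
    rwa [mul_one, mul_inv_cancel_left₀ (pow_ne_zero _ hvx0)] at this
  rcases le_max_iff.1 hmax with h6 | h6
  · exact (h5 _ h6).trans (le_max_left _ _)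
  · exact (h5 _ h6).trans (le_max_right _ _)

lemma one_le_max_of_isCoprime_top (hO : Good k O δ) {u z : K} {p q : k[X][Y]} {d : ℕ}
    (htop : IsCoprime (top d p) (top d q)) (hu : O.valuation u < 1) (hz : O.valuation z ≤ 1) :
    1 ≤ max (O.valuation (ev k u z (hom d p))) (O.valuation (ev k u z (hom d q))) := by
  by_contra! hlt
  obtain ⟨h1, h2⟩ := max_lt_iff.1 hlt
  have key : ∀ P : k[X][Y], O.valuation (ev k u z (hom d P)) < 1 →
      O.valuation (aeval z (top d P)) < 1 := fun P hP => by
    obtain ⟨R, hR⟩ := exists_eq_map_add_mul_X (hom d P)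
    have : aeval z (top d P) = ev k u z (hom d P) - u * ev k u z R := by
      rw [top, eq_sub_iff_add_eq]
      conv_rhs => rw [hR]
      rw [map_add, ev_map_C, map_mul, ev_X]
    rw [this]
    refine O.valuation.map_sub_lt hP ?_
    rw [map_mul]
    exact (mul_le_of_le_one_right' (val_ev_le_one hO.val_const_le hu.le hz R)).trans_lt hu
  obtain ⟨a, b, hab⟩ := htop
  have h3 : O.valuation (1 : K) < 1 := by
    rw [← map_one (aeval (R := k) z), ← hab, map_add, map_mul, map_mul]
    refine O.valuation.map_add_lt ?_ ?_ <;> rw [map_mul]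
    · exact (mul_le_of_le_one_left' (val_aeval_le_one hO.val_const_le hz a)).trans_lt (key _ h1)
    · exact (mul_le_of_le_one_left' (val_aeval_le_one hO.val_const_le hz b)).trans_lt (key _ h2)
  simp at h3

/-- Adjoint polynomials of degree `d - 3` satisfy the adjunction inequality at every good
valuation. -/
theorem val_mul_le_of_conductor [IsAlgClosed k] {f : F} {e : ι → F} {x y : K} {p q : k[X][Y]}
    {Q : ι → k[X][Y]} {d : ℕ} (hf : ∀ c : k, algebraMap k F c ≠ f) (he : LinearIndependent k e)
    (hinj : Function.Injective (ev k x y))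
    (hker : ∀ N, ev F x y N = 0 → pencil f p q ∣ N)
    (hrel : algebraMap F K f * ev k x y q = ev k x y p)
    (hcond : ∀ w : K, IsIntegral (Algebra.adjoin F {x, y}) w →
      ∃ a, ev F x y (fam e Q) * w = ev F x y a)
    (hpq : IsRelPrime p q) (hp : TDegLE d p) (hq : TDegLE d q)
    (htop : IsCoprime (top d p) (top d q))
    (hY : (p.coeff d).coeff 0 ≠ 0 ∨ (q.coeff d).coeff 0 ≠ 0) (hd : 3 ≤ d)
    (hQ : ∀ i, TDegLE (d - 3) (Q i)) (hO : Good k O δ) (i : ι) :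
    O.valuation (ev k x y (Q i) * δ x y) ≤
      max (O.valuation (ev k x y p)) (O.valuation (ev k x y q)) := by
  set v := O.valuation with hv
  have hmem : ∀ a, v a ≤ 1 ↔ a ∈ O := O.valuation_le_one_iff
  by_cases hfin : v x ≤ 1 ∧ v y ≤ 1
  · obtain ⟨hx, hy⟩ := hfin
    by_cases hlt : v (ev k x y p) < 1 ∧ v (ev k x y q) < 1
    swap
    · have h1 : v (ev k x y (Q i) * δ x y) ≤ 1 := by
        rw [map_mul]
        exact mul_le_one' (val_ev_le_one hO.val_const_le hx hy _)
          ((hmem _).2 (hO.int _ _ ((hmem _).1 hx) ((hmem _).1 hy)))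
      refine h1.trans ?_
      rw [le_max_iff]
      rw [not_and_or, not_lt, not_lt] at hlt
      exact hlt
    obtain ⟨a, ha⟩ := exists_val_sub_lt_one (fun c hc => hO.val_const hc) hx hy hpq hlt.1 hlt.2
    obtain ⟨b, hb⟩ := exists_val_sub_lt_one (fun c hc => hO.val_const hc) hy hx
      (isRelPrime_lin_zero hpq) (by rw [ev_lin_zero]; exact hlt.1) (by rw [ev_lin_zero]; exact hlt.2)
    set x' := x - algebraMap k K a with hx'
    set y' := y - algebraMap k K b with hy'
    have hevk : ∀ P : k[X][Y], ev k x' y' (trans a b P) = ev k x y P := fun P => by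
      rw [ev_trans]; simp [hx', hy']
    have hevF : ∀ P : F[X][Y],
        ev F x' y' (trans (algebraMap k F a) (algebraMap k F b) P) = ev F x y P := fun P => by
      rw [ev_trans]; simp [hx', hy', ← IsScalarTower.algebraMap_apply]
    have hevF' : ∀ P : F[X][Y],
        ev F x y (trans (-algebraMap k F a) (-algebraMap k F b) P) = ev F x' y' P := fun P => by
      rw [← hevF, trans_trans]
    have hB : BaseData v f e x' y' (trans a b p) (trans a b q) (fun i => trans a b (Q i)) :=
      { ker := fun N hN => by
          have h1 := hker (trans (-algebraMap k F a) (-algebraMap k F b) N) (by rw [hevF', hN])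
          have h2 := map_dvd (trans (algebraMap k F a) (algebraMap k F b)) h1
          rwa [trans_trans, trans_pencil] at h2
        rel := by rw [hevk, hevk, hrel]
        vx := ha
        vy := hb
        lc := fun w hw => by
          have : Algebra.adjoin F {x', y'} = Algebra.adjoin F {x, y} := by
            ext u
            rw [mem_adjoin_pair, mem_adjoin_pair]
            exact ⟨fun ⟨N, hN⟩ => ⟨_, (hevF' N).trans hN⟩, fun ⟨N, hN⟩ => ⟨_, (hevF N).trans hN⟩⟩
          rw [this] at hw
          obtain ⟨A, hA⟩ := hcond w hw
          refine ⟨1, trans (algebraMap k F a) (algebraMap k F b) A, by simp, ?_⟩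
          rw [hevF, map_one, one_mul, ← hA, ← trans_fam, hevF] }
    obtain ⟨ϖ, hϖ0, hϖ, hn⟩ := hO.unif
    have hne : ∃ n : ℕ, v ϖ ^ n ≤ max (v (ev k x y p)) (v (ev k x y q)) := by
      by_cases h0 : ev k x y p = 0
      · have h1 : ev k x y q ≠ 0 := fun h1 => by
          obtain ⟨r, s, t, hr, hst⟩ := exists_C_mem_of_isRelPrime hpq
          have : ev k x y (C r) = 0 := by rw [← hst]; simp [h0, h1]
          exact hr (C_eq_zero.1 ((map_eq_zero_iff _ hinj).1 this))
        obtain ⟨n, hn⟩ := hn _ h1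
        exact ⟨n, hn.trans (le_max_right _ _)⟩
      · obtain ⟨n, hn⟩ := hn _ h0
        exact ⟨n, hn.trans (le_max_left _ _)⟩
    obtain ⟨n, hn⟩ := hne
    have key := BaseData.val_mul_le hf he (fun c hc => hO.val_const hc) hϖ0 hϖ hO.bider
      (fun a b ha hb => (hmem _).2 (hO.int _ _ ((hmem _).1 ha) ((hmem _).1 hb))) n x' y' _ _ _ hB
      (by rwa [hevk, hevk]) i
    rw [hevk, hevk, hevk] at key
    have hδ : δ x' y' = δ x y := by
      have e1 : x = x' + algebraMap k K a := by simp [hx']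
      have e2 : y = y' + algebraMap k K b := by simp [hy']
      rw [e1, e2, hO.bider.add_left, hO.bider.add_right, hO.bider.alg_right, hO.bider.alg_left]
      simp
    rwa [hδ] at key
  · rcases le_or_gt (v y) (v x) with hyx | hxy
    · have hx : 1 < v x := by
        by_contra! hx
        exact hfin ⟨hx, hyx.trans hx⟩
      refine val_mul_le_of_infinite hO hd hp hq (hQ i) hx hyx ?_
      refine one_le_max_of_isCoprime_top hO htop ?_ ?_
      · rw [map_inv₀]; exact inv_lt_one_of_one_lt₀ hx
      · rw [map_div₀]; exact div_le_one_of_le₀ hyx zero_le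
    · have hy : 1 < v y := by
        by_contra! hy
        exact hfin ⟨hxy.le.trans hy, hy⟩
      have h1 : v y⁻¹ < 1 := by rw [map_inv₀]; exact inv_lt_one_of_one_lt₀ hy
      have h2 : v (x / y) < 1 := by
        rw [map_div₀]; exact (div_lt_one₀ (zero_lt_one.trans hy)).2 hxy
      have h3 := val_mul_le_of_infinite hO hd hp.lin_zero hq.lin_zero (hQ i).lin_zero hy hxy.le (by
        have key : ∀ P : k[X][Y], (P.coeff d).coeff 0 ≠ 0 →
            1 ≤ v (ev k y⁻¹ (x / y) (hom d (lin 0 P))) := fun P hP => by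
          rw [val_ev_eq_one (fun c hc => hO.val_const hc) h1 h2]
          rw [ev0_eq, coeff_hom, if_pos (by omega), coeff_lin_zero]
          exact hP
        rw [le_max_iff]
        exact hY.imp (key p) (key q))
      rw [ev_lin_zero, ev_lin_zero, ev_lin_zero, hO.bider.swap, mul_neg, Valuation.map_neg] at h3
      exact h3

end Key
end CremonaRank

namespace CremonaRank
open Polynomial Bivariate

section Moebius

variable {E L Γ : Type*} [Field E] [Field L] [Algebra E L]

/-- The Möbius transformation given by the matrix `A` takes `f` to `w`. -/
def Mob (A : Matrix (Fin 2) (Fin 2) E) (f w : L) : Prop :=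
  algebraMap E L (A 1 0) * f + algebraMap E L (A 1 1) ≠ 0 ∧
    w * (algebraMap E L (A 1 0) * f + algebraMap E L (A 1 1)) =
      algebraMap E L (A 0 0) * f + algebraMap E L (A 0 1)

lemma quadratic_eq_zero {f : L} (hf : Transcendental E f) {a b c : E}
    (h : algebraMap E L a * f ^ 2 + algebraMap E L b * f + algebraMap E L c = 0) :
    a = 0 ∧ b = 0 ∧ c = 0 := by
  have h1 : (C a * X ^ 2 + C b * X + C c : E[X]) = 0 := by
    by_contra hne
    exact hf ⟨_, hne, by simpa using h⟩
  refine ⟨?_, ?_, ?_⟩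
  · simpa using congrArg (fun P : E[X] => P.coeff 2) h1
  · simpa [coeff_X, coeff_X_pow, coeff_C] using congrArg (fun P : E[X] => P.coeff 1) h1
  · simpa using congrArg (fun P : E[X] => P.coeff 0) h1

lemma Mob.mul {A B : Matrix (Fin 2) (Fin 2) E} {f w w' : L} (h : L ≃ₐ[E] L) (hA : Mob A f w)
    (hB : Mob B f (h f)) (hw : h w = w') : Mob (A * B) f w' := by
  have h1 := congrArg h hA.2
  have h2 : h (algebraMap E L (A 1 0) * f + algebraMap E L (A 1 1)) ≠ 0 :=
    (map_ne_zero_iff h h.injective).2 hA.1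
  simp only [map_mul, map_add, AlgEquiv.commutes, hw] at h1 h2
  have h3 : algebraMap E L ((A * B) 1 0) * f + algebraMap E L ((A * B) 1 1) =
      (algebraMap E L (A 1 0) * h f + algebraMap E L (A 1 1)) *
        (algebraMap E L (B 1 0) * f + algebraMap E L (B 1 1)) := by
    simp only [Matrix.mul_apply, Fin.sum_univ_two, map_add, map_mul]
    linear_combination -(algebraMap E L (A 1 0)) * hB.2
  refine ⟨by rw [h3]; exact mul_ne_zero h2 hB.1, ?_⟩
  rw [h3]
  simp only [Matrix.mul_apply, Fin.sum_univ_two, map_add, map_mul]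
  linear_combination (algebraMap E L (B 1 0) * f + algebraMap E L (B 1 1)) * h1 +
    algebraMap E L (A 0 0) * hB.2

lemma Mob.eq_smul_one {A : Matrix (Fin 2) (Fin 2) E} {f : L} (hf : Transcendental E f)
    (hA : Mob A f f) : ∃ s : E, s ≠ 0 ∧ A = s • 1 := by
  have h1 : algebraMap E L (A 1 0) * f ^ 2 + algebraMap E L (A 1 1 - A 0 0) * f +
      algebraMap E L (-A 0 1) = 0 := by
    simp only [map_sub, map_neg]; linear_combination hA.2
  obtain ⟨h2, h3, h4⟩ := quadratic_eq_zero hf h1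
  refine ⟨A 1 1, ?_, ?_⟩
  · intro h5
    apply hA.1
    rw [h2, h5]; simp
  · ext i j
    fin_cases i <;> fin_cases j <;> simp
    · exact (sub_eq_zero.1 h3).symm
    · exact neg_eq_zero.1 h4
    · exact h2

lemma Mob.eq_of_smul_one {s : E} {f w : L} (h : Mob (s • 1 : Matrix (Fin 2) (Fin 2) E) f w) :
    w = f := by
  have h1 := h.1
  have h2 := h.2
  simp only [Matrix.smul_apply, ne_eq, one_ne_zero, not_false_eq_true, Matrix.one_apply_ne,
    mul_zero, map_zero, zero_mul, Matrix.one_apply_eq, smul_eq_mul, mul_one, zero_add,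
    zero_ne_one, add_zero] at h1 h2
  rw [mul_comm] at h2
  exact mul_left_cancel₀ h1 h2

lemma isScalar_mul_of_commute (h2 : (2 : E) ≠ 0) {A B : Matrix (Fin 2) (Fin 2) E}
    (hA : ∃ s : E, A * A = s • 1) (hB : ∃ s : E, B * B = s • 1) (hAB : A * B = B * A)
    (hA' : ∀ s : E, A ≠ s • 1) (hB' : ∀ s : E, B ≠ s • 1) : ∃ s : E, A * B = s • 1 := by
  have htr : ∀ A : Matrix (Fin 2) (Fin 2) E, (∃ s : E, A * A = s • 1) → (∀ s : E, A ≠ s • 1) →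
      A 1 1 = -A 0 0 := fun A ⟨s, hs⟩ hA' => by
    by_contra hne
    have htr : A 0 0 + A 1 1 ≠ 0 := fun h => hne (by linear_combination h)
    have e := fun i j => congrFun (congrFun hs i) j
    have e00 := e 0 0
    have e01 := e 0 1
    have e10 := e 1 0
    have e11 := e 1 1
    simp [Matrix.mul_apply, Fin.sum_univ_two] at e00 e01 e10 e11
    apply hA' (A 0 0)
    ext i j
    fin_cases i <;> fin_cases j <;> simp
    · exact (mul_eq_zero.1 (show (A 0 0 + A 1 1) * A 0 1 = 0 by linear_combination e01)).resolve_left htr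
    · exact (mul_eq_zero.1 (show (A 0 0 + A 1 1) * A 1 0 = 0 by linear_combination e10)).resolve_left htr
    · have := (mul_eq_zero.1 (show (A 0 0 + A 1 1) * (A 1 1 - A 0 0) = 0 by
        linear_combination e11 - e00)).resolve_left htr
      exact sub_eq_zero.1 this
  have tA := htr A hA hA'
  have tB := htr B hB hB'
  have e := fun i j => congrFun (congrFun hAB i) j
  have e00 := e 0 0
  have e01 := e 0 1
  have e10 := e 1 0
  simp only [Matrix.mul_apply, Fin.sum_univ_two] at e00 e01 e10
  refine ⟨(A * B) 0 0, ?_⟩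
  ext i j
  fin_cases i <;> fin_cases j <;>
    simp only [Matrix.mul_apply, Fin.sum_univ_two, Fin.zero_eta, Fin.mk_one, Matrix.smul_apply,
      Matrix.one_apply_eq, smul_eq_mul, mul_one, ne_eq, zero_ne_one, not_false_eq_true,
      Matrix.one_apply_ne, one_ne_zero, mul_zero]
  · refine (mul_eq_zero.1 (?_ : (2 : E) * _ = 0)).resolve_left h2
    rw [tA, tB] at *
    linear_combination e01
  · refine (mul_eq_zero.1 (?_ : (2 : E) * _ = 0)).resolve_left h2
    rw [tA, tB] at *
    linear_combination e10
  · rw [tA, tB] at *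
    linear_combination -e00

variable [Group Γ]

/-- A group of exponent two acting on a field and taking `f` to Möbius transforms of `f`. -/
structure MobRep (φ : Γ →* (L ≃ₐ[E] L)) (f : L) (A : Γ → Matrix (Fin 2) (Fin 2) E) : Prop where
  sq : ∀ g : Γ, g * g = 1
  tr : Transcendental E f
  two : (2 : E) ≠ 0
  mob : ∀ g, Mob (A g) f (φ g f)

namespace MobRep

variable {φ : Γ →* (L ≃ₐ[E] L)} {f : L} {A : Γ → Matrix (Fin 2) (Fin 2) E} (hR : MobRep φ f A)
include hR

lemma comm (g h : Γ) : g * h = h * g := by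
  have h1 := hR.sq (g * h)
  have : ∀ x : Γ, x⁻¹ = x := fun x => inv_eq_of_mul_eq_one_left (hR.sq x)
  rw [← this (g * h), mul_inv_rev, this, this]

lemma eq_one_or (g : Γ) : φ g f = f ↔ ∃ s : E, A g = s • 1 := by
  constructor
  · intro h
    have := hR.mob g
    rw [h] at this
    obtain ⟨s, -, hs⟩ := this.eq_smul_one hR.tr
    exact ⟨s, hs⟩
  · rintro ⟨s, hs⟩
    have := hR.mob g
    rw [hs] at this
    exact this.eq_of_smul_one

lemma exists_sq (g : Γ) : ∃ s : E, s ≠ 0 ∧ A g * A g = s • 1 := by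
  apply Mob.eq_smul_one hR.tr
  exact (hR.mob g).mul (φ g) (hR.mob g) (by rw [← AlgEquiv.mul_apply, ← map_mul, hR.sq]; simp)

lemma exists_cocycle (g h : Γ) : ∃ s : E, s ≠ 0 ∧ A h * A g = s • A (g * h) := by
  have h1 : Mob (A h * A g) f (φ (g * h) f) :=
    (hR.mob h).mul (φ g) (hR.mob g) (by rw [← AlgEquiv.mul_apply, ← map_mul])
  have h2 : Mob (A h * A g * A (g * h)) f f :=
    h1.mul (φ (g * h)) (hR.mob _) (by rw [← AlgEquiv.mul_apply, ← map_mul, hR.sq]; simp)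
  obtain ⟨s, hs, e⟩ := h2.eq_smul_one hR.tr
  obtain ⟨t, ht, e'⟩ := hR.exists_sq (g * h)
  refine ⟨s / t, div_ne_zero hs ht, ?_⟩
  have h3 : t • (A h * A g) = s • A (g * h) := by
    calc t • (A h * A g) = A h * A g * (t • 1) := by simp
      _ = A h * A g * A (g * h) * A (g * h) := by rw [← e', mul_assoc _ (A (g * h))]
      _ = _ := by rw [e]; simp
  rw [div_eq_inv_mul, mul_smul, ← h3, smul_smul, inv_mul_cancel₀ ht, one_smul]

lemma exists_comm (g h : Γ) : ∃ s : E, (s = 1 ∨ s = -1) ∧ A g * A h = s • (A h * A g) := by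
  obtain ⟨s, hs, e⟩ := hR.exists_cocycle g h
  obtain ⟨t, ht, e'⟩ := hR.exists_cocycle h g
  rw [hR.comm h g] at e'
  have h1 : A g * A h = (t / s) • (A h * A g) := by
    rw [e', e, smul_smul, div_mul_cancel₀ _ hs]
  refine ⟨t / s, ?_, h1⟩
  obtain ⟨u, hu, eu⟩ := hR.exists_sq g
  obtain ⟨w, hw, ew⟩ := hR.exists_sq h
  have h2 : A g * (A g * A h) * A h = ((t / s) ^ 2) • (A h * (A g * A g) * A h) := by
    rw [h1, Matrix.mul_smul, ← mul_assoc, h1]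
    simp only [Matrix.smul_mul, smul_smul, mul_assoc, pow_two]
  have h3 : (u * w) • (1 : Matrix (Fin 2) (Fin 2) E) = ((t / s) ^ 2 * (u * w)) • 1 := by
    have e1 : A g * (A g * A h) * A h = (u * w) • 1 := by
      rw [← mul_assoc, eu, mul_assoc, ew]; simp [smul_smul, mul_comm]
    have e2 : A h * (A g * A g) * A h = (u * w) • 1 := by
      rw [eu]; simp [ew, smul_smul]
    rw [← e1, h2, e2, smul_smul]
  have h4 := congrFun (congrFun h3 0) 0
  simp only [Matrix.smul_apply, Matrix.one_apply_eq, smul_eq_mul, mul_one] at h4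
  have h5 : (t / s) ^ 2 = 1 := mul_right_cancel₀ (mul_ne_zero hu hw) (by rw [← h4, one_mul])
  rcases mul_eq_zero.1 (show (t / s - 1) * (t / s + 1) = 0 by linear_combination h5) with h | h
  · exact Or.inl (sub_eq_zero.1 h)
  · exact Or.inr (eq_neg_of_add_eq_zero_left h)

lemma fix_or_fix_of_commute {g h : Γ} (hc : A g * A h = A h * A g) (hg : φ g f ≠ f) :
    φ h f = f ∨ φ (g * h) f = f := by
  by_contra! hcon
  obtain ⟨s, hs⟩ := isScalar_mul_of_commute hR.two ((hR.exists_sq g).imp fun _ h => h.2)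
    ((hR.exists_sq h).imp fun _ h => h.2) hc
    (fun s hs => hg ((hR.eq_one_or g).2 ⟨s, hs⟩))
    (fun s hs => hcon.1 ((hR.eq_one_or h).2 ⟨s, hs⟩))
  obtain ⟨t, ht, e⟩ := hR.exists_cocycle g h
  apply hcon.2
  rw [hR.eq_one_or]
  refine ⟨t⁻¹ * s, ?_⟩
  rw [← smul_smul, ← hs, hc, e, smul_smul, inv_mul_cancel₀ ht, one_smul]

lemma cover_of_commute {a : Γ} (ha : φ a f ≠ f) (hc : ∀ h, A a * A h = A h * A a) (h : Γ) :
    φ h f = f ∨ φ (a * h) f = f :=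
  hR.fix_or_fix_of_commute (hc h) ha

lemma cover_of_anticommute {a b : Γ} (ha : φ a f ≠ f) (hab : A a * A b = -(A b * A a)) (h : Γ) :
    φ h f = f ∨ φ (a * h) f = f ∨ φ (b * h) f = f ∨ φ (a * (b * h)) f = f := by
  obtain ⟨s, hs | hs, e⟩ := hR.exists_comm a h
  · rw [hs, one_smul] at e
    rcases hR.fix_or_fix_of_commute e ha with h | h
    · exact Or.inl h
    · exact Or.inr (Or.inl h)
  · rw [hs, neg_one_smul] at e
    have h3 : A a * A (b * h) = A (b * h) * A a := by
      obtain ⟨t, ht, e2⟩ := hR.exists_cocycle b h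
      have : A (b * h) = t⁻¹ • (A h * A b) := by
        rw [e2, smul_smul, inv_mul_cancel₀ ht, one_smul]
      rw [this, Matrix.mul_smul, Matrix.smul_mul, ← mul_assoc, e, neg_mul, mul_assoc, hab, mul_neg,
        neg_neg, mul_assoc]
    rcases hR.fix_or_fix_of_commute h3 ha with h | h
    · exact Or.inr (Or.inr (Or.inl h))
    · exact Or.inr (Or.inr (Or.inr h))

lemma exists_anticommute (hc : ¬ ∀ g h, A g * A h = A h * A g) :
    ∃ a b, φ a f ≠ f ∧ A a * A b = -(A b * A a) := by
  push Not at hc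
  obtain ⟨a, b, hab⟩ := hc
  refine ⟨a, b, fun ha => hab ?_, ?_⟩
  · obtain ⟨s, hs⟩ := (hR.eq_one_or a).1 ha
    simp [hs]
  · obtain ⟨s, hs | hs, e⟩ := hR.exists_comm a b
    · rw [hs, one_smul] at e; exact absurd e hab
    · rw [hs, neg_one_smul] at e; exact e

lemma exists_cover_of_commute (hc : ∀ g h, A g * A h = A h * A g) :
    ∃ a : Γ, ∀ h, φ h f = f ∨ φ (a * h) f = f := by
  by_cases h1 : ∀ h, φ h f = f
  · exact ⟨1, fun h => Or.inl (h1 h)⟩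
  push Not at h1
  obtain ⟨a, ha⟩ := h1
  exact ⟨a, hR.cover_of_commute ha (hc a)⟩

lemma exists_cover : ∃ a b : Γ, ∀ h, φ h f = f ∨ φ (a * h) f = f ∨ φ (b * h) f = f ∨
    φ (a * (b * h)) f = f := by
  by_cases hc : ∀ g h, A g * A h = A h * A g
  · obtain ⟨a, ha⟩ := hR.exists_cover_of_commute hc
    exact ⟨a, 1, fun h => (ha h).elim Or.inl fun h => Or.inr (Or.inl h)⟩
  · obtain ⟨a, b, ha, hab⟩ := hR.exists_anticommute hc
    exact ⟨a, b, hR.cover_of_anticommute ha hab⟩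

end MobRep

end Moebius
end CremonaRank

namespace CremonaRank
open Polynomial Bivariate

section Gen

variable {k K : Type*} [Field k] [Field K] [Algebra k K]

/-- The pair `x, y` is algebraically independent over `k` and generates the field `K`. -/
structure Gen (k : Type*) {K : Type*} [Field k] [Field K] [Algebra k K] (x y : K) : Prop where
  inj : Function.Injective (ev k x y)
  frac : ∀ u : K, ∃ a b : k[X][Y], ev k x y b ≠ 0 ∧ u * ev k x y b = ev k x y a

lemma Gen.of_forall {x y x' y' : K} (h : Gen k x y) (hinj : Function.Injective (ev k x' y'))
    (hx : ∃ a b : k[X][Y], ev k x' y' b ≠ 0 ∧ x * ev k x' y' b = ev k x' y' a)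
    (hy : ∃ a b : k[X][Y], ev k x' y' b ≠ 0 ∧ y * ev k x' y' b = ev k x' y' a) : Gen k x' y' := by
  refine ⟨hinj, ?_⟩
  let S : Subfield K :=
    { carrier := {u | ∃ a b : k[X][Y], ev k x' y' b ≠ 0 ∧ u * ev k x' y' b = ev k x' y' a}
      mul_mem' := by
        rintro u w ⟨a, b, hb, e⟩ ⟨c, d, hd, e'⟩
        refine ⟨a * c, b * d, by simpa using ⟨hb, hd⟩, ?_⟩
        simp only [map_mul, ← e, ← e']; ring
      one_mem' := ⟨1, 1, by simp, by simp⟩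
      add_mem' := by
        rintro u w ⟨a, b, hb, e⟩ ⟨c, d, hd, e'⟩
        refine ⟨a * d + c * b, b * d, by simpa using ⟨hb, hd⟩, ?_⟩
        simp only [map_mul, map_add, ← e, ← e']; ring
      zero_mem' := ⟨0, 1, by simp, by simp⟩
      neg_mem' := by
        rintro u ⟨a, b, hb, e⟩
        exact ⟨-a, b, hb, by simp [← e]⟩
      inv_mem' := by
        rintro u ⟨a, b, hb, e⟩
        by_cases hu : u = 0
        · exact ⟨0, 1, by simp, by simp [hu]⟩
        · refine ⟨b, a, by rw [← e]; exact mul_ne_zero hu hb, ?_⟩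
          rw [← e, inv_mul_cancel_left₀ hu] }
  have hev : ∀ P : k[X][Y], ev k x y P ∈ S := by
    intro P
    have hc : ∀ c : k, algebraMap k K c ∈ S := fun c => ⟨C (C c), 1, by simp, by simp⟩
    rw [ev_eq_sum]
    refine sum_mem fun j _ => mul_mem ?_ (pow_mem hy _)
    rw [aeval_eq_sum_range]
    refine sum_mem fun i _ => ?_
    rw [Algebra.smul_def]
    exact mul_mem (hc _) (pow_mem hx _)
  intro u
  obtain ⟨a, b, hb, e⟩ := h.frac u
  have : u = ev k x y a / ev k x y b := by rw [← e, mul_div_cancel_right₀ _ hb]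
  rw [this]
  exact S.div_mem (hev a) (hev b)

lemma Gen.exists_reduced {x y : K} (h : Gen k x y) (u : K) : ∃ a b : k[X][Y], IsRelPrime a b ∧
    ev k x y b ≠ 0 ∧ u * ev k x y b = ev k x y a := by
  obtain ⟨a, b, hb, e⟩ := h.frac u
  have hb0 : b ≠ 0 := by rintro rfl; simp at hb
  obtain ⟨b', a', c, hrel, rfl, rfl⟩ := UniqueFactorizationMonoid.exists_reduced_factors b hb0 a
  rw [map_mul] at hb e
  refine ⟨a', b', hrel.symm, right_ne_zero_of_mul hb, ?_⟩
  refine mul_left_cancel₀ (left_ne_zero_of_mul hb) ?_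
  rw [map_mul] at e
  linear_combination e

variable {x y : K} (h : Gen k x y)
include h

lemma Gen.derivation_ext {D D' : Derivation k K K} (hx : D x = D' x) (hy : D y = D' y) : D = D' := by
  have hev : ∀ P : k[X][Y], D (ev k x y P) = D' (ev k x y P) := by
    intro P
    have : ∀ a ∈ Algebra.adjoin k {x, y}, D a = D' a := by
      intro a ha
      refine Derivation.eqOn_adjoin (s := {x, y}) (D1 := D) (D2 := D') ?_ ha
      rintro z (rfl | rfl) <;> assumption
    exact this _ (mem_adjoin_pair.2 ⟨P, rfl⟩)
  ext u
  obtain ⟨a, b, hb, e⟩ := h.frac u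
  have h1 := congrArg D e
  have h2 := congrArg D' e
  rw [Derivation.leibniz, hev, hev] at h1
  rw [Derivation.leibniz, ← h1] at h2
  simp only [smul_eq_mul] at h2
  exact (mul_left_cancel₀ hb (add_left_cancel h2)).symm

lemma Gen.exists_derivation (D : Derivation k k[X][Y] k[X][Y]) :
    ∃ D' : Derivation k K K, ∀ P, D' (ev k x y P) = ev k x y (D P) := by
  choose a b hb e using h.frac
  set φ := ev k x y
  set E : K → K := fun u => (φ (D (a u)) - u * φ (D (b u))) / φ (b u) with hE
  have key : ∀ u (P Q : k[X][Y]), φ Q ≠ 0 → u * φ Q = φ P → E u * φ Q = φ (D P) - u * φ (D Q) := by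
    intro u P Q hQ eq
    have h1 : P * b u = a u * Q := h.inj (by
      simp only [map_mul]; change φ P * φ _ = φ _ * φ Q; rw [← eq, ← e]; ring)
    have h2 := congrArg (fun R => φ (D R)) h1
    simp only [Derivation.leibniz, smul_eq_mul, map_add, map_mul] at h2
    rw [← e, ← eq] at h2
    rw [hE]
    have hbu := hb u
    field_simp
    linear_combination -h2
  have key' : ∀ u w (P Q : k[X][Y]), φ Q ≠ 0 → u * φ Q = φ P → w * φ Q = φ (D P) - u * φ (D Q) →
      E u = w := fun u w P Q hQ eq eq' => mul_right_cancel₀ hQ ((key u P Q hQ eq).trans eq'.symm)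
  have hev : ∀ P, E (φ P) = φ (D P) := fun P => by
    refine key' _ _ P 1 (by simp) (by simp) (by simp)
  have hadd : ∀ u w, E (u + w) = E u + E w := fun u w => by
    refine key' _ _ (a u * b w + a w * b u) (b u * b w) ?_ ?_ ?_
    · rw [map_mul]; exact mul_ne_zero (hb _) (hb _)
    · simp only [map_mul, map_add, φ] at *; rw [← e, ← e]; ring
    · have h1 := key u _ _ (hb u) (e u)
      have h2 := key w _ _ (hb w) (e w)
      simp only [Derivation.leibniz, smul_eq_mul, map_add, map_mul, φ] at *
      rw [← e, ← e]
      linear_combination ev k x y (b w) * h1 + ev k x y (b u) * h2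
  have hmul : ∀ u w, E (u * w) = u * E w + w * E u := fun u w => by
    refine key' _ _ (a u * a w) (b u * b w) ?_ ?_ ?_
    · rw [map_mul]; exact mul_ne_zero (hb _) (hb _)
    · simp only [map_mul, φ] at *; rw [← e, ← e]; ring
    · have h1 := key u _ _ (hb u) (e u)
      have h2 := key w _ _ (hb w) (e w)
      simp only [Derivation.leibniz, smul_eq_mul, map_add, map_mul, φ] at *
      rw [← e, ← e]
      linear_combination w * ev k x y (b w) * h1 + u * ev k x y (b u) * h2
  have hc : ∀ c : k, E (algebraMap k K c) = 0 := fun c => by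
    have := hev (algebraMap k _ c)
    rwa [AlgHom.commutes, Derivation.map_algebraMap, map_zero] at this
  refine ⟨Derivation.mk' ⟨⟨E, hadd⟩, fun c u => ?_⟩ fun u w => ?_, fun P => hev P⟩
  · simp [Algebra.smul_def, hmul, hc]
  · simpa using hmul u w

lemma Gen.exists_jac : ∃ δ : K → K → K, IsBider k δ ∧ δ x y = 1 ∧
    (∀ P Q : k[X][Y], ∃ R, δ (ev k x y P) (ev k x y Q) = ev k x y R) ∧
    ∀ δ', IsBider k δ' → ∀ u w, δ' u w = δ u w * δ' x y := by
  obtain ⟨Dy, hDy⟩ := h.exists_derivation (Polynomial.derivative'.restrictScalars k)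
  let D0 : Derivation k k[X][Y] k[X][Y] := Derivation.mk'
    ((lin (0 : k)).toLinearMap ∘ₗ
      ((Polynomial.derivative' (R := k[X])).restrictScalars k).toLinearMap ∘ₗ (lin (0 : k)).toLinearMap)
    fun P Q => by
      simp [lin_zero_lin_zero]
  obtain ⟨Dx, hDx⟩ := h.exists_derivation D0
  have hx : ev k x y (C X) = x := by simp
  have hy : ev k x y Y = y := by simp
  have e1 : Dx x = 1 := by
    have := hDx (C X); rw [hx] at this; simpa [D0, lin] using this
  have e2 : Dx y = 0 := by
    have := hDx Y; rw [hy] at this; simpa [D0, lin] using this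
  have e3 : Dy x = 0 := by
    have := hDy (C X); rw [hx] at this; simpa using this
  have e4 : Dy y = 1 := by
    have := hDy Y; rw [hy] at this; simpa using this
  refine ⟨fun u w => Dx u * Dy w - Dy u * Dx w, ?_, ?_, ?_, ?_⟩
  · constructor
    · intro a b c; simp only [map_add]; ring
    · intro a b c; simp only [Derivation.leibniz, smul_eq_mul]; ring
    · intro c b; simp
    · intro a; ring
    · intro a b; ring
  · simp [e1, e2, e3, e4]
  · intro P Q
    simp only [hDx, hDy, ← map_mul, ← map_sub]
    exact ⟨_, rfl⟩
  · intro δ' hδ'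
    have hD : ∀ w, ∃ D : Derivation k K K, ∀ u, D u = δ' u w := fun w =>
      ⟨Derivation.mk' ⟨⟨fun u => δ' u w, fun a b => hδ'.add_left a b w⟩, fun c u => by
        simp [Algebra.smul_def, hδ'.leib_left, hδ'.alg_left]⟩ fun a b => by
          simpa using hδ'.leib_left a b w, fun u => rfl⟩
    have key : ∀ u w, δ' u w = Dx u * δ' x w + Dy u * δ' y w := by
      intro u w
      obtain ⟨D, hD⟩ := hD w
      have : D = δ' x w • Dx + δ' y w • Dy := by
        apply h.derivation_ext <;> simp [e1, e2, e3, e4, hD]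
      rw [← hD, this]
      simp [mul_comm]
    intro u w
    have h1 := key u w
    have h2 := key w x
    have h3 := key w y
    rw [hδ'.self] at h2 h3
    rw [h1, hδ'.swap x w, hδ'.swap y w, h2, h3, hδ'.swap y x]
    ring

end Gen
end CremonaRank

namespace CremonaRank
open Polynomial Bivariate

section PrimeVal

variable {k K : Type*} [Field k] [Field K] [Algebra k K] {x y : K}

lemma Prime.not_dvd_mul_of {R : Type*} [CommRing R] {π a b : R} (hπ : _root_.Prime π) (ha : ¬ π ∣ a)
    (hb : ¬ π ∣ b) : ¬ π ∣ a * b := fun h => (hπ.dvd_or_dvd h).elim ha hb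

/-- The localization of `k[x,y]` at a prime element, as a valuation ring. -/
def Gen.primeRing (h : Gen k x y) {π : k[X][Y]} (hπ : _root_.Prime π) : ValuationSubring K where
  carrier := {u | ∃ a b : k[X][Y], ¬ π ∣ b ∧ u * ev k x y b = ev k x y a}
  mul_mem' := by
    rintro u w ⟨a, b, hb, e⟩ ⟨c, d, hd, e'⟩
    refine ⟨a * c, b * d, Prime.not_dvd_mul_of hπ hb hd, ?_⟩
    simp only [map_mul, ← e, ← e']; ring
  one_mem' := ⟨1, 1, fun h => hπ.not_isUnit (isUnit_of_dvd_one h), by simp⟩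
  add_mem' := by
    rintro u w ⟨a, b, hb, e⟩ ⟨c, d, hd, e'⟩
    refine ⟨a * d + c * b, b * d, Prime.not_dvd_mul_of hπ hb hd, ?_⟩
    simp only [map_mul, map_add, ← e, ← e']; ring
  zero_mem' := ⟨0, 1, fun h => hπ.not_isUnit (isUnit_of_dvd_one h), by simp⟩
  neg_mem' := by
    rintro u ⟨a, b, hb, e⟩
    exact ⟨-a, b, hb, by simp [← e]⟩
  mem_or_inv_mem' := by
    intro u
    obtain ⟨a, b, hab, hb, e⟩ := h.exists_reduced u
    by_cases hπb : π ∣ b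
    · right
      by_cases hu : u = 0
      · exact ⟨0, 1, fun h => hπ.not_isUnit (isUnit_of_dvd_one h), by simp [hu]⟩
      · refine ⟨b, a, fun hπa => hπ.not_isUnit (hab hπa hπb), ?_⟩
        rw [← e, inv_mul_cancel_left₀ hu]
    · exact Or.inl ⟨a, b, hπb, e⟩

variable (h : Gen k x y) {π : k[X][Y]} (hπ : _root_.Prime π)

lemma Gen.mem_primeRing {u : K} : u ∈ h.primeRing hπ ↔
    ∃ a b : k[X][Y], ¬ π ∣ b ∧ u * ev k x y b = ev k x y a := Iff.rfl

lemma Gen.val_ev_le (P : k[X][Y]) : (h.primeRing hπ).valuation (ev k x y P) ≤ 1 := by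
  rw [ValuationSubring.valuation_le_one_iff]
  exact ⟨P, 1, fun h => hπ.not_isUnit (isUnit_of_dvd_one h), by simp⟩

lemma Gen.val_ev_eq {P : k[X][Y]} (hP : ¬ π ∣ P) : (h.primeRing hπ).valuation (ev k x y P) = 1 := by
  refine le_antisymm (h.val_ev_le hπ P) ?_
  have hP0 : ev k x y P ≠ 0 := by
    rw [map_ne_zero_iff _ h.inj]; rintro rfl; exact hP (dvd_zero _)
  have : (h.primeRing hπ).valuation (ev k x y P)⁻¹ ≤ 1 := by
    rw [ValuationSubring.valuation_le_one_iff]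
    exact ⟨1, P, hP, by simp [hP0]⟩
  rw [map_inv₀] at this
  exact (inv_le_one₀ (zero_lt_iff.2 ((Valuation.ne_zero_iff _).2 hP0))).1 this

lemma Gen.val_ev_lt {P : k[X][Y]} (hP : π ∣ P) : (h.primeRing hπ).valuation (ev k x y P) < 1 := by
  refine lt_of_le_of_ne (h.val_ev_le hπ P) fun h1 => ?_
  by_cases hP0 : ev k x y P = 0
  · rw [hP0, map_zero] at h1; exact zero_ne_one h1
  have : (ev k x y P)⁻¹ ∈ h.primeRing hπ := by
    rw [← ValuationSubring.valuation_le_one_iff, map_inv₀, h1, inv_one]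
  obtain ⟨a, b, hb, e⟩ := this
  rw [inv_mul_eq_iff_eq_mul₀ hP0, ← map_mul] at e
  exact hb (h.inj e ▸ hP.mul_right a)

/-- The canonical biderivation attached to a generating pair. -/
noncomputable def Gen.jac (h : Gen k x y) : K → K → K := h.exists_jac.choose

lemma Gen.isBider_jac : IsBider k h.jac := h.exists_jac.choose_spec.1
lemma Gen.jac_self : h.jac x y = 1 := h.exists_jac.choose_spec.2.1
lemma Gen.jac_ev (P Q : k[X][Y]) : ∃ R, h.jac (ev k x y P) (ev k x y Q) = ev k x y R :=
  h.exists_jac.choose_spec.2.2.1 P Q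
lemma Gen.bider_eq {δ : K → K → K} (hδ : IsBider k δ) (u w : K) : δ u w = h.jac u w * δ x y :=
  h.exists_jac.choose_spec.2.2.2 δ hδ u w

lemma Gen.good : Good k (h.primeRing hπ) h.jac := by
  have hJ := h.isBider_jac
  set O := h.primeRing hπ
  have hev : ∀ P, ev k x y P ∈ O := fun P => (O.valuation_le_one_iff _).1 (h.val_ev_le hπ P)
  have hinv : ∀ P, ¬ π ∣ P → (ev k x y P)⁻¹ ∈ O := fun P hP => by
    rw [← ValuationSubring.valuation_le_one_iff, map_inv₀, h.val_ev_eq hπ hP, inv_one]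
  have step : ∀ w, (∀ P, h.jac (ev k x y P) w ∈ O) → ∀ u ∈ O, h.jac u w ∈ O := by
    rintro w hw u hu
    obtain ⟨a, b, hb, e⟩ := (h.mem_primeRing hπ).1 hu
    have hb0 : ev k x y b ≠ 0 := by
      rw [map_ne_zero_iff _ h.inj]; rintro rfl; exact hb (dvd_zero _)
    have h1 := congrArg (fun z => h.jac z w) e
    simp only [hJ.leib_left] at h1
    have : h.jac u w = (h.jac (ev k x y a) w - u * h.jac (ev k x y b) w) * (ev k x y b)⁻¹ := by
      rw [eq_mul_inv_iff_mul_eq₀ hb0]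
      linear_combination h1
    rw [this]
    exact mul_mem (sub_mem (hw _) (mul_mem hu (hw _))) (hinv b hb)
  refine ⟨hJ, fun c => ?_, ?_, ?_⟩
  · have := hev (C (C c)); simpa using this
  · intro u w hu hw
    refine step w (fun P => ?_) u hu
    rw [hJ.swap]
    refine neg_mem (step _ (fun Q => ?_) w hw)
    obtain ⟨R, hR⟩ := h.jac_ev Q P
    rw [hR]; exact hev R
  · have hπ0 : ev k x y π ≠ 0 := (map_ne_zero_iff _ h.inj).2 hπ.ne_zero
    refine ⟨ev k x y π, hπ0, ?_, ?_⟩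
    · intro u hu
      obtain ⟨a, b, hb, e⟩ := (h.mem_primeRing hπ).1 ((O.valuation_le_one_iff _).1 hu.le)
      have h1 := congrArg O.valuation e
      rw [map_mul, h.val_ev_eq hπ hb, mul_one] at h1
      rw [h1] at hu ⊢
      have : π ∣ a := by
        by_contra hcon; rw [h.val_ev_eq hπ hcon] at hu; exact lt_irrefl _ hu
      obtain ⟨c, rfl⟩ := this
      rw [map_mul, map_mul]
      exact mul_le_of_le_one_right' (h.val_ev_le hπ c)
    · intro u hu
      obtain ⟨a, b, hb, e⟩ := h.frac u
      have ha0 : a ≠ 0 := by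
        rintro rfl
        rw [map_zero] at e
        exact (mul_ne_zero hu hb) e
      obtain ⟨n, c, hc, rfl⟩ := WfDvdMonoid.max_power_factor ha0 hπ.irreducible
      refine ⟨n, ?_⟩
      have h1 := congrArg O.valuation e
      rw [map_mul, map_mul, map_mul, h.val_ev_eq hπ hc, mul_one, map_pow, map_pow] at h1
      rw [← h1]
      exact mul_le_of_le_one_right' (h.val_ev_le hπ b)

end PrimeVal

lemma exists_tDegLE {k : Type*} [Field k] (P : k[X][Y]) : ∃ d, TDegLE d P := by
  refine ⟨P.support.sup (fun j => (P.coeff j).natDegree) + P.natDegree, fun i j hij => ?_⟩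
  by_cases hj : P.coeff j = 0
  · rw [hj, coeff_zero]
  · have h1 : (P.coeff j).natDegree ≤ P.support.sup (fun j => (P.coeff j).natDegree) :=
      Finset.le_sup (f := fun j => (P.coeff j).natDegree) (mem_support_iff.2 hj)
    have h2 := le_natDegree_of_ne_zero hj
    exact coeff_eq_zero_of_natDegree_lt (by omega)

section Adjoint

variable {k K : Type*} [Field k] [Field K] [Algebra k K]

/-- Functions with the divisorial bound defining twisted bicanonical forms of the pencil. -/
def adj (x y P Q : K) : Submodule k K where
  carrier := {m | ∀ (O : ValuationSubring K) (δ : K → K → K), Good k O δ →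
    O.valuation (m * δ x y) ≤ max (O.valuation P) (O.valuation Q)}
  add_mem' := fun ha hb O δ hO => by
    rw [add_mul]
    exact (Valuation.map_add _ _ _).trans (max_le (ha O δ hO) (hb O δ hO))
  zero_mem' := fun O δ hO => by simp
  smul_mem' := fun c m hm O δ hO => by
    rw [Algebra.smul_def, mul_assoc, map_mul]
    exact (mul_le_of_le_one_left' (hO.val_const_le c)).trans (hm O δ hO)

variable {x y : K} {p q : k[X][Y]} (h : Gen k x y)
include h

lemma Gen.gen_inv : Gen k (x⁻¹) (y * x⁻¹) := by
  have hx : x ≠ 0 := by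
    have := (map_ne_zero_iff _ h.inj).2 (prime_C_X (k := k)).ne_zero
    simpa using this
  refine h.of_forall ?_ ⟨1, C X, by simp [hx], by simp [hx]⟩ ⟨Y, C X, by simp [hx], by simp⟩
  rw [injective_iff_map_eq_zero]
  intro P hP
  obtain ⟨d, hd⟩ : ∃ d, TDegLE d P := exists_tDegLE P
  have h1 := ev_hom hd (u := x) (x := x⁻¹) (z := y) (mul_inv_cancel₀ hx)
  rw [mul_comm x⁻¹ y, hP, mul_zero] at h1
  have h2 := h.inj (h1.trans (map_zero _).symm)
  rw [← hom_hom hd, h2]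
  simp [hom]

lemma Gen.exists_of_mem_adj {m : K} (hm : m ∈ adj (k := k) x y (ev k x y p) (ev k x y q)) :
    ∃ P, ev k x y P = m := by
  obtain ⟨a, b, hab, hb, e⟩ := h.exists_reduced m
  have hb0 : b ≠ 0 := by rintro rfl; simp at hb
  by_cases hu : IsUnit b
  · obtain ⟨c, hc⟩ := hu.exists_right_inv
    refine ⟨a * c, ?_⟩
    rw [map_mul, ← e, mul_assoc, ← map_mul, hc]; simp
  · exfalso
    obtain ⟨π, hπ, hπb⟩ := WfDvdMonoid.exists_irreducible_factor hu hb0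
    have hπ' := hπ.prime
    have h1 := hm _ _ (h.good hπ')
    rw [h.jac_self, mul_one] at h1
    have h2 := h1.trans (max_le (h.val_ev_le hπ' p) (h.val_ev_le hπ' q))
    rw [ValuationSubring.valuation_le_one_iff, h.mem_primeRing] at h2
    obtain ⟨a', b', hb', e'⟩ := h2
    have h3 : a * b' = a' * b := h.inj (by simp only [map_mul, ← e, ← e']; ring)
    have h4 : π ∣ a * b' := h3 ▸ hπb.mul_left a'
    rcases hπ'.dvd_or_dvd h4 with h5 | h5
    · exact hπ.not_isUnit (hab h5 hπb)
    · exact hb' h5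

lemma Gen.tdegLE_of_mem_adj {d : ℕ} (hp : TDegLE d p) (hq : TDegLE d q) {P : k[X][Y]}
    (hm : ev k x y P ∈ adj (k := k) x y (ev k x y p) (ev k x y q)) {i j : ℕ}
    (hij : (P.coeff j).coeff i ≠ 0) : i + j + 3 ≤ d := by
  have hx : x ≠ 0 := by
    have := (map_ne_zero_iff _ h.inj).2 (prime_C_X (k := k)).ne_zero
    simpa using this
  obtain ⟨n, hn, hij', hnP⟩ : ∃ n, TDegLE n P ∧ i + j ≤ n ∧ ¬ (C X) ∣ hom n P := by
    classical
    have hex : ∃ n, TDegLE n P := exists_tDegLE P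
    refine ⟨Nat.find hex, Nat.find_spec hex, ?_, ?_⟩
    · by_contra! hlt
      exact hij (Nat.find_spec hex i j hlt)
    · intro hdvd
      by_cases h0 : Nat.find hex = 0
      · have h1 := Nat.find_spec hex
        rw [h0] at h1 hdvd
        have h2 : ((hom 0 P).coeff 0).coeff 0 = 0 := by
          obtain ⟨R, hR⟩ := hdvd
          rw [hR]; simp
        rw [coeff_hom] at h2
        have hi : i + j = 0 := by
          by_contra hne; exact hij (h1 i j (by omega))
        obtain ⟨rfl, rfl⟩ : i = 0 ∧ j = 0 := by omega
        simp at h2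
        exact hij h2
      · refine Nat.find_min hex (m := Nat.find hex - 1) (by omega) fun a b hab => ?_
        by_cases h1 : Nat.find hex < a + b
        · exact Nat.find_spec hex a b h1
        · have h2 : ((hom (Nat.find hex) P).coeff b).coeff 0 = 0 := by
            obtain ⟨R, hR⟩ := hdvd
            rw [hR]; simp
          rw [coeff_hom, if_pos (by omega)] at h2
          convert h2 using 2
          omega
  have h' := h.gen_inv
  have h1 := hm _ _ (h'.good prime_C_X)
  set v := (h'.primeRing (prime_C_X (k := k))).valuation
  have hu : v x⁻¹ < 1 := by
    have := h'.val_ev_lt (prime_C_X (k := k)) (dvd_refl _)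
    simpa using this
  have hu0 : 0 < v x⁻¹ := zero_lt_iff.2 ((Valuation.ne_zero_iff _).2 (inv_ne_zero hx))
  have hxx : x⁻¹ * x = 1 := inv_mul_cancel₀ hx
  have hhom : ∀ {n} {P : k[X][Y]}, TDegLE n P → ev k x⁻¹ (y * x⁻¹) (hom n P) =
      x⁻¹ ^ n * ev k x y P := fun hP => by
    have := ev_hom hP (z := y * x⁻¹) hxx
    rwa [show x * (y * x⁻¹) = y by field_simp] at this
  have hP : v x⁻¹ ^ n * v (ev k x y P) = 1 := by
    rw [← map_pow, ← map_mul, ← hhom hn]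
    exact h'.val_ev_eq _ hnP
  have hle : ∀ {P}, TDegLE d P → v x⁻¹ ^ d * v (ev k x y P) ≤ 1 := fun hP => by
    rw [← map_pow, ← map_mul, ← hhom hP]
    exact h'.val_ev_le _ _
  have hjac : h'.jac x y * x⁻¹ ^ 3 = -1 := by
    have hJ := h'.isBider_jac
    have e1 : h'.jac x⁻¹ (y * x⁻¹) = 1 := h'.jac_self
    have e2 : x⁻¹ ^ 2 * h'.jac x y = - h'.jac x⁻¹ y := by
      have := congrArg (fun z => h'.jac z y) hxx
      simp only [hJ.leib_left] at this
      have h0 : h'.jac 1 y = 0 := by simpa using hJ.alg_left 1 y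
      rw [h0] at this
      field_simp at this ⊢
      linear_combination this
    rw [hJ.leib_right, hJ.self] at e1
    linear_combination x⁻¹ * e2 - e1
  have h3 : v x⁻¹ ^ 3 * v (h'.jac x y) = 1 := by
    rw [← map_pow, ← map_mul, mul_comm (x⁻¹ ^ 3) _, hjac, Valuation.map_neg, map_one]
  rw [map_mul] at h1
  by_contra! hlt
  have h4 : v x⁻¹ ^ d * (v (ev k x y P) * v (h'.jac x y)) ≤ 1 := by
    rcases le_max_iff.1 h1 with h5 | h5
    · exact (mul_le_mul_right h5 _).trans (hle hp)
    · exact (mul_le_mul_right h5 _).trans (hle hq)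
  have h6 : v x⁻¹ ^ (n + 3) * (v (ev k x y P) * v (h'.jac x y)) = 1 := by
    rw [pow_add, mul_mul_mul_comm, hP, h3, one_mul]
  have h7 : v x⁻¹ ^ d ≤ v x⁻¹ ^ (n + 3) := by
    have h0 : 0 < v (ev k x y P) * v (h'.jac x y) := by
      rw [zero_lt_iff]; intro h0; rw [h0, mul_zero] at h6; exact zero_ne_one h6
    rw [← h6] at h4
    exact le_of_mul_le_mul_right h4 h0
  exact absurd h7 (not_le.2 (pow_lt_pow_right_of_lt_one₀ hu0 hu (by omega)))

end Adjoint
end CremonaRank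

namespace CremonaRank
open Polynomial Bivariate

section Transport

variable {k K : Type*} [Field k] [Field K] [Algebra k K]

lemma comap_valuation_le_iff (O : ValuationSubring K) (g : K ≃ₐ[k] K) (a b : K) :
    (O.comap (g : K →+* K)).valuation a ≤ (O.comap (g : K →+* K)).valuation b ↔
      O.valuation (g a) ≤ O.valuation (g b) := by
  rw [ValuationSubring.valuation_le_iff, ValuationSubring.valuation_le_iff]
  constructor
  · rintro ⟨⟨c, hc⟩, rfl⟩
    exact ⟨⟨g c, hc⟩, by simp⟩
  · rintro ⟨⟨c, hc⟩, e⟩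
    refine ⟨⟨g.symm c, by simpa [ValuationSubring.mem_comap] using hc⟩, g.injective ?_⟩
    simpa using e

lemma comap_valuation_lt_iff (O : ValuationSubring K) (g : K ≃ₐ[k] K) (a b : K) :
    (O.comap (g : K →+* K)).valuation a < (O.comap (g : K →+* K)).valuation b ↔
      O.valuation (g a) < O.valuation (g b) := by
  rw [← not_le, ← not_le, comap_valuation_le_iff]

lemma IsBider.comap {δ : K → K → K} (h : IsBider k δ) (g : K ≃ₐ[k] K) :
    IsBider k fun a b => g.symm (δ (g a) (g b)) where
  add_left a b c := by simp [h.add_left]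
  leib_left a b c := by simp [h.leib_left]
  alg_left c b := by simp [h.alg_left]
  self a := by simp [h.self]
  swap a b := by rw [h.swap, map_neg]

lemma Good.comap {O : ValuationSubring K} {δ : K → K → K} (h : Good k O δ) (g : K ≃ₐ[k] K) :
    Good k (O.comap (g : K →+* K)) fun a b => g.symm (δ (g a) (g b)) where
  bider := h.bider.comap g
  const c := by simpa [ValuationSubring.mem_comap] using h.const c
  int a b ha hb := by
    have := h.int _ _ ha hb
    simpa [ValuationSubring.mem_comap] using this
  unif := by
    obtain ⟨ϖ, h0, h1, h2⟩ := h.unif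
    refine ⟨g.symm ϖ, by simpa using h0, fun a ha => ?_, fun a ha => ?_⟩
    · rw [comap_valuation_le_iff, g.apply_symm_apply]
      apply h1
      rw [← map_one (O.comap (g : K →+* K)).valuation, comap_valuation_lt_iff] at ha
      simpa using ha
    · obtain ⟨n, hn⟩ := h2 (g a) (by simpa using ha)
      refine ⟨n, ?_⟩
      rw [← map_pow, comap_valuation_le_iff]
      simpa using hn

variable {x y : K} (h : Gen k x y)
include h

lemma Gen.jac_map (g : K ≃ₐ[k] K) (a b : K) :
    h.jac (g a) (g b) = g (h.jac a b) * h.jac (g x) (g y) := by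
  have := h.bider_eq (h.isBider_jac.comap g) a b
  simpa using congrArg g this

lemma Gen.jac_ne_zero (g : K ≃ₐ[k] K) : h.jac (g x) (g y) ≠ 0 := by
  have := h.jac_map g (g.symm x) (g.symm y)
  simp only [AlgEquiv.apply_symm_apply, h.jac_self] at this
  exact right_ne_zero_of_mul (this ▸ one_ne_zero)

variable {Γ : Type*} [Group Γ] {φ : Γ →* (K ≃ₐ[k] K)} {f : K} {A : Γ → Matrix (Fin 2) (Fin 2) k}
  {P Q : K}

lemma Gen.exists_twisted (hA : ∀ g, Mob (A g) f (φ g f)) (hQ : Q ≠ 0) (hf : f * Q = P) :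
    ∃ T : Γ → Module.End k (adj (k := k) x y P Q),
      (∀ g, ∃ r : K, r ≠ 0 ∧ ∀ m, (T g m : K) = r * φ g m) ∧
      ∀ g h' (s : k), A h' * A g = s • A (g * h') → ∀ m, T g (T h' m) = s • T (g * h') m := by
  have aux : ∀ O : ValuationSubring K, ∀ {δ}, Good k O δ → ∀ a b : k,
      O.valuation (algebraMap k K a * P + algebraMap k K b * Q) ≤
        max (O.valuation P) (O.valuation Q) := by
    intro O δ hO a b
    refine (Valuation.map_add _ _ _).trans (max_le_max ?_ ?_) <;>
    · rw [map_mul]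
      exact mul_le_of_le_one_left' (hO.val_const_le _)
  set D : Γ → K := fun g => algebraMap k K (A g 1 0) * P + algebraMap k K (A g 1 1) * Q with hD
  have hD' : ∀ g, D g = (algebraMap k K (A g 1 0) * f + algebraMap k K (A g 1 1)) * Q := fun g => by
    rw [hD, ← hf]; ring
  have hD0 : ∀ g, D g ≠ 0 := fun g => by rw [hD']; exact mul_ne_zero (hA g).1 hQ
  have hN : ∀ g, φ g f * D g = algebraMap k K (A g 0 0) * P + algebraMap k K (A g 0 1) * Q :=
    fun g => by rw [hD', ← mul_assoc, (hA g).2, ← hf]; ring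
  have hgQ : ∀ g, φ g Q ≠ 0 := fun g => by simpa using hQ
  set r : Γ → K := fun g => D g / φ g Q * h.jac (φ g x) (φ g y) with hr
  have hmem : ∀ g, ∀ m ∈ adj (k := k) x y P Q, r g * φ g m ∈ adj (k := k) x y P Q := by
    intro g m hm O δ hO
    have h1 := hm _ _ (hO.comap (φ g))
    have h2 : φ g (m * (φ g).symm (δ (φ g x) (φ g y))) =
        φ g m * (h.jac (φ g x) (φ g y) * δ x y) := by
      rw [map_mul, AlgEquiv.apply_symm_apply, h.bider_eq hO.bider]
    have h3 : r g * φ g m * δ x y = D g / φ g Q * (φ g m * (h.jac (φ g x) (φ g y) * δ x y)) := by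
      rw [hr]; ring
    rw [le_max_iff, comap_valuation_le_iff, comap_valuation_le_iff, h2] at h1
    rw [h3, map_mul]
    rcases h1 with h1 | h1
    · refine (mul_le_mul_right h1 _).trans ?_
      have h4 : D g / φ g Q * φ g P = φ g f * D g := by
        rw [← hf, map_mul]
        have := hgQ g
        field_simp
      rw [← map_mul, h4, hN]
      exact aux O hO _ _
    · refine (mul_le_mul_right h1 _).trans ?_
      rw [← map_mul, div_mul_cancel₀ _ (hgQ g)]
      exact aux O hO _ _
  refine ⟨fun g =>
    { toFun := fun m => ⟨r g * φ g m, hmem g m m.2⟩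
      map_add' := fun a b => by ext; simp [mul_add]
      map_smul' := fun c a => by ext; simp }, fun g => ⟨r g, ?_, fun m => rfl⟩, ?_⟩
  · exact mul_ne_zero (div_ne_zero (hD0 g) (hgQ g)) (h.jac_ne_zero _)
  · intro g g' s hs m
    ext
    simp only [LinearMap.coe_mk, AddHom.coe_mk, map_mul, Submodule.coe_smul]
    rw [AlgEquiv.mul_apply, Algebra.smul_def, ← mul_assoc, ← mul_assoc]
    congr 1
    have h1 : φ g (D g') * D g = algebraMap k K s * D (g * g') * φ g Q := by
      have e0 := congrFun (congrFun hs 1) 0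
      have e1 := congrFun (congrFun hs 1) 1
      simp only [Matrix.mul_apply, Fin.sum_univ_two, Matrix.smul_apply, smul_eq_mul] at e0 e1
      have e0' := congrArg (algebraMap k K) e0
      have e1' := congrArg (algebraMap k K) e1
      simp only [map_add, map_mul] at e0' e1'
      have h2 : φ g (D g') = (algebraMap k K (A g' 1 0) * φ g f + algebraMap k K (A g' 1 1)) * φ g Q := by
        rw [hD']; simp
      rw [h2]
      have h3 := hN g
      simp only [hD] at h3 ⊢
      linear_combination φ g Q * (algebraMap k K (A g' 1 0)) * h3 + φ g Q * P * e0' + φ g Q * Q * e1'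
    have h2 := h.jac_map (φ g) (φ g' x) (φ g' y)
    simp only [hr, map_mul, map_div₀, AlgEquiv.mul_apply]
    rw [h2]
    have h3 : φ g (φ g' Q) ≠ 0 := by simpa using hQ
    have h4 := hgQ g
    field_simp
    linear_combination φ g (h.jac (φ g' x) (φ g' y)) * h.jac (φ g x) (φ g y) * h1

end Transport
end CremonaRank

namespace CremonaRank
open Polynomial Bivariate

section Linear

variable {k V : Type*} [Field k] [AddCommGroup V] [Module k V]

lemma isSemisimple_of_sq_eq_smul (h2 : (2 : k) ≠ 0) {T : Module.End k V} {s : k} (hs : s ≠ 0)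
    (hT : ∀ v, T (T v) = s • v) : T.IsSemisimple := by
  refine Module.End.isSemisimple_of_squarefree_aeval_eq_zero (p := X ^ 2 - C s) ?_ ?_
  · exact (separable_X_pow_sub_C s (by exact_mod_cast h2) hs).squarefree
  · ext v
    simp [pow_two, hT, Module.algebraMap_end_apply]

lemma iSup_joint_eigenspace_eq_top [IsAlgClosed k] [FiniteDimensional k V] (h2 : (2 : k) ≠ 0)
    {ι : Type*} (T : ι → Module.End k V) (hc : ∀ i j v, T i (T j v) = T j (T i v))
    (hT : ∀ i, ∃ s : k, s ≠ 0 ∧ ∀ v, T i (T i v) = s • v) :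
    ⨆ χ : ι → k, ⨅ i, (T i).eigenspace (χ i) = ⊤ := by
  have h1 := Module.End.iSup_iInf_maxGenEigenspace_eq_top_of_iSup_maxGenEigenspace_eq_top_of_commute
    T (fun i j _ => by ext v; exact hc i j v) (fun i => Module.End.iSup_maxGenEigenspace_eq_top _)
  rw [← h1]
  congr! 4 with χ i
  obtain ⟨s, hs, h⟩ := hT i
  exact ((isSemisimple_of_sq_eq_smul h2 hs h).isFinitelySemisimple.maxGenEigenspace_eq_eigenspace _).symm

lemma exists_joint_eigenvector [IsAlgClosed k] [FiniteDimensional k V] (h2 : (2 : k) ≠ 0)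
    {ι : Type*} (T : ι → Module.End k V) (hc : ∀ i j v, T i (T j v) = T j (T i v))
    (hT : ∀ i, ∃ s : k, s ≠ 0 ∧ ∀ v, T i (T i v) = s • v) (N : Submodule k V) (hN : N ≠ ⊤) :
    ∃ (χ : ι → k) (v : V), v ∉ N ∧ ∀ i, T i v = χ i • v := by
  by_contra! hcon
  apply hN
  rw [eq_top_iff, ← iSup_joint_eigenspace_eq_top h2 T hc hT, iSup_le_iff]
  intro χ v hv
  by_contra hvN
  obtain ⟨i, hi⟩ := hcon χ v hvN
  rw [Submodule.mem_iInf] at hv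
  exact hi (Module.End.mem_eigenspace_iff.1 (hv i))

end Linear

section Pair

variable {k L V Γ : Type*} [Field k] [Field L] [Algebra k L] [AddCommGroup V] [Module k V] [Group Γ]
  {φ : Γ →* (L ≃ₐ[k] L)} {f : L} {A : Γ → Matrix (Fin 2) (Fin 2) k} (hR : MobRep φ f A)
  {T : Γ → Module.End k V} (hinj : ∀ g v, T g v = 0 → v = 0)
  (hT : ∀ g h (s : k), A h * A g = s • A (g * h) → ∀ m, T g (T h m) = s • T (g * h) m)
include hR hT

lemma MobRep.twisted_comm {g h : Γ} {c : k} (hc : A g * A h = c • (A h * A g)) (v : V) :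
    T h (T g v) = c • T g (T h v) := by
  obtain ⟨s, hs, e⟩ := hR.exists_cocycle g h
  rw [hT g h s e, smul_smul, hR.comm g h]
  refine hT h g _ ?_ v
  rw [hc, e, smul_smul, hR.comm g h]

include hinj
lemma MobRep.twisted_sq (g : Γ) : ∃ s : k, s ≠ 0 ∧ ∀ v, T g (T g v) = s • v := by
  obtain ⟨s, hs, e⟩ := hR.exists_cocycle g g
  obtain ⟨t, ht, e'⟩ := hR.exists_cocycle 1 1
  have h1 : ∀ v, T 1 v = t • v := fun v => by
    rw [← sub_eq_zero]
    apply hinj 1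
    rw [map_sub, map_smul, hT 1 1 t e', mul_one, sub_self]
  refine ⟨s * t, mul_ne_zero hs ht, fun v => ?_⟩
  rw [hT g g s e, hR.sq, h1, smul_smul]

/-- In dimension at least two there is a stable plane. -/
theorem MobRep.exists_stable_plane [IsAlgClosed k] [FiniteDimensional k V]
    (hV : 2 ≤ Module.finrank k V) :
    ∃ m₀ m₁ : V, LinearIndependent k ![m₀, m₁] ∧ ∀ g, ∃ B : Matrix (Fin 2) (Fin 2) k,
      T g m₀ = B 1 0 • m₁ + B 1 1 • m₀ ∧ T g m₁ = B 0 0 • m₁ + B 0 1 • m₀ := by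
  have hnt : ∀ v : V, Submodule.span k {v} ≠ ⊤ := fun v hv => by
    have h1 := finrank_span_le_card (R := k) ({v} : Set V)
    rw [hv, finrank_top] at h1
    simp at h1
    omega
  by_cases hc : ∀ g h, A g * A h = A h * A g
  · have hcT : ∀ i j v, T i (T j v) = T j (T i v) := fun i j v => by
      have := hR.twisted_comm hT (g := j) (h := i) (c := 1) (by rw [one_smul, hc]) v
      rwa [one_smul] at this
    obtain ⟨χ, m₀, h0, e0⟩ := exists_joint_eigenvector hR.two T hcT (hR.twisted_sq hinj hT) ⊥
      (fun h => hnt 0 (by rw [Submodule.span_zero_singleton, h]))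
    obtain ⟨ψ, m₁, h1, e1⟩ := exists_joint_eigenvector hR.two T hcT (hR.twisted_sq hinj hT)
      _ (hnt m₀)
    refine ⟨m₀, m₁, ?_, fun g => ⟨!![ψ g, 0; 0, χ g], by simp [e0], by simp [e1]⟩⟩
    rw [LinearIndependent.pair_iff' (by simpa using h0)]
    intro a ha
    exact h1 (Submodule.mem_span_singleton.2 ⟨a, ha⟩)
  · obtain ⟨a, b, ha, hab⟩ := hR.exists_anticommute hc
    let S : Set Γ := {g | φ g f = f ∨ g = a}
    have hH : ∀ {g}, φ g f = f → ∀ h, A g * A h = (1 : k) • (A h * A g) := fun hg h => by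
      obtain ⟨s, hs⟩ := (hR.eq_one_or _).1 hg
      simp [hs]
    have hHT : ∀ {g}, φ g f = f → ∀ h v, T h (T g v) = T g (T h v) := fun hg h v => by
      have := hR.twisted_comm hT (hH hg h) v
      rwa [one_smul] at this
    obtain ⟨χ, m₀, h0, e0⟩ := exists_joint_eigenvector hR.two (fun g : S => T g)
      (by
        rintro ⟨g, hg | rfl⟩ ⟨h, hh | rfl⟩ v
        · exact hHT hh g v
        · exact (hHT hg _ v).symm
        · exact hHT hh _ v
        · rfl) (fun g => hR.twisted_sq hinj hT g) ⊥
      (fun h => hnt 0 (by rw [Submodule.span_zero_singleton, h]))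
    replace h0 : m₀ ≠ 0 := h0
    have ea : T a m₀ = χ ⟨a, Or.inr rfl⟩ • m₀ := e0 ⟨a, Or.inr rfl⟩
    set l := χ ⟨a, Or.inr rfl⟩
    have hl : l ≠ 0 := by
      intro hl
      rw [hl, zero_smul] at ea
      exact h0 (hinj _ _ ea)
    have hab' : A a * A b = (-1 : k) • (A b * A a) := by rw [hab, neg_one_smul]
    have hba : ∀ v, T b (T a v) = -T a (T b v) := fun v => by
      have := hR.twisted_comm hT hab' v
      rwa [neg_one_smul] at this
    set m₁ := T b m₀ with hm₁
    have h1 : m₁ ≠ 0 := fun h => h0 (hinj _ _ h)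
    have ea1 : T a m₁ = (-l) • m₁ := by
      have := hba m₀
      rw [ea, map_smul] at this
      rw [neg_smul, this, neg_neg]
    obtain ⟨t, ht, ht'⟩ := hR.twisted_sq hinj hT b
    have eb1 : T b m₁ = t • m₀ := ht' m₀
    let P : Γ → Prop := fun g => ∃ B : Matrix (Fin 2) (Fin 2) k,
      T g m₀ = B 1 0 • m₁ + B 1 1 • m₀ ∧ T g m₁ = B 0 0 • m₁ + B 0 1 • m₀
    have hPa : P a := ⟨!![-l, 0; 0, l], by simp [ea], by simp [ea1]⟩
    have hPb : P b := ⟨!![0, t; 1, 0], by simp [hm₁], by simp [eb1]⟩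
    have hPH : ∀ g, φ g f = f → P g := fun g hg => by
      have e1 : T g m₀ = χ ⟨g, Or.inl hg⟩ • m₀ := e0 ⟨g, Or.inl hg⟩
      refine ⟨!![χ ⟨g, Or.inl hg⟩, 0; 0, χ ⟨g, Or.inl hg⟩], by simp [e1], ?_⟩
      rw [hm₁, ← hHT hg, e1]; simp
    have hPm : ∀ g h, P g → P h → P (g * h) := by
      rintro g h ⟨B, e1, e2⟩ ⟨D, e3, e4⟩
      obtain ⟨s, hs, e⟩ := hR.exists_cocycle g h
      have h3 : ∀ v, T (g * h) v = s⁻¹ • T g (T h v) := fun v => by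
        rw [hT g h s e, smul_smul, inv_mul_cancel₀ hs, one_smul]
      refine ⟨s⁻¹ • (D * B), ?_, ?_⟩
      · rw [h3, e3, map_add, map_smul, map_smul, e1, e2]
        simp only [Matrix.smul_apply, Matrix.mul_apply, Fin.sum_univ_two, smul_eq_mul]
        module
      · rw [h3, e4, map_add, map_smul, map_smul, e1, e2]
        simp only [Matrix.smul_apply, Matrix.mul_apply, Fin.sum_univ_two, smul_eq_mul]
        module
    refine ⟨m₀, m₁, ?_, fun g => ?_⟩
    · rw [LinearIndependent.pair_iff' h0]
      intro c hc
      have h3 : l • m₁ = (-l) • m₁ := by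
        rw [← ea1]
        conv_rhs => rw [← hc, map_smul, ea, smul_comm, hc]
      have h4 : (2 * l) • m₁ = 0 := by
        have : (2 * l) • m₁ = l • m₁ - (-l) • m₁ := by module
        rw [this, h3, sub_self]
      exact (smul_ne_zero (mul_ne_zero hR.two hl) h1) h4
    · have hcan : ∀ g h : Γ, g * (g * h) = h := fun g h => by rw [← mul_assoc, hR.sq, one_mul]
      rcases hR.cover_of_anticommute ha hab g with h | h | h | h
      · exact hPH g h
      · rw [← hcan a g]; exact hPm _ _ hPa (hPH _ h)
      · rw [← hcan b g]; exact hPm _ _ hPb (hPH _ h)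
      · rw [← hcan b g, ← hcan a (b * g)]
        exact hPm _ _ hPb (hPm _ _ hPa (hPH _ h))

omit hinj in
theorem MobRep.exists_cover_of_finrank_eq_one (hinj : ∀ g v, T g v = 0 → v = 0)
    (hV : Module.finrank k V = 1) : ∃ a : Γ, ∀ h, φ h f = f ∨ φ (a * h) f = f := by
  refine hR.exists_cover_of_commute fun g h => ?_
  obtain ⟨c, hc, e⟩ := hR.exists_comm g h
  obtain ⟨m, hm, hspan⟩ := finrank_eq_one_iff'.1 hV
  obtain ⟨a, ha⟩ := hspan (T g m)
  obtain ⟨b, hb⟩ := hspan (T h m)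
  have h1 := hR.twisted_comm hT e m
  have h2 : T h (T g m) = T g (T h m) := by
    rw [← ha, ← hb, map_smul, map_smul, ← ha, ← hb, smul_comm]
  have h3 : T g (T h m) ≠ 0 := fun h => hm (hinj _ _ (hinj _ _ h))
  have h4 : (c - 1) • T g (T h m) = 0 := by rw [sub_smul, one_smul, ← h1, h2, sub_self]
  have h5 : c = 1 := sub_eq_zero.1 ((smul_eq_zero.1 h4).resolve_right h3)
  rw [e, h5, one_smul]

end Pair
end CremonaRank

namespace CremonaRank
open Polynomial Bivariate

section Curve

variable {F K : Type*} [Field F] [Field K] [Algebra F K]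

/-- The field `K` is the function field of the plane curve of degree `d` over `F` with equation
`Φ`, in general position with respect to the projection to the `x`-line. -/
structure Curve (F : Type*) {K : Type*} [Field F] [Field K] [Algebra F K] (x y : K) (d : ℕ)
    (Φ : F[X][Y]) : Prop where
  monic : Φ.Monic
  deg : Φ.natDegree = d
  tdeg : TDegLE d Φ
  ker : ∀ N, ev F x y N = 0 ↔ Φ ∣ N
  frac : ∀ u : K, ∃ a b : F[X][Y], ev F x y b ≠ 0 ∧ u * ev F x y b = ev F x y a

namespace Curve
variable {x y : K} {d : ℕ} {Φ : F[X][Y]} (h : Curve F x y d Φ)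
include h

lemma degree_eq : Φ.degree = d := by rw [degree_eq_natDegree h.monic.ne_zero, h.deg]

lemma prime : _root_.Prime Φ := by
  refine ⟨h.monic.ne_zero, fun hu => ?_, fun a b hab => ?_⟩
  · have := (h.ker 1).2 hu.dvd
    simp at this
  · rw [← h.ker, ← h.ker, ← mul_eq_zero, ← map_mul, h.ker]; exact hab

lemma d_pos : 0 < d := by
  rcases Nat.eq_zero_or_pos d with h0 | h0
  · exfalso
    have h1 := h.deg
    rw [h0, Polynomial.Monic.natDegree_eq_zero h.monic] at h1
    exact h.prime.not_isUnit (h1 ▸ isUnit_one)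
  · exact h0

lemma eq_zero_of_ev {N : F[X][Y]} (hN : N.degree < d) (h0 : ev F x y N = 0) : N = 0 := by
  by_contra hne
  have := degree_le_of_dvd ((h.ker N).1 h0) hne
  rw [h.degree_eq] at this
  exact absurd hN (not_lt.2 this)

lemma eq_of_ev {N N' : F[X][Y]} (hN : N.degree < d) (hN' : N'.degree < d)
    (h0 : ev F x y N = ev F x y N') : N = N' := by
  rw [← sub_eq_zero]
  exact h.eq_zero_of_ev ((degree_sub_le _ _).trans_lt (max_lt hN hN')) (by rw [map_sub, h0, sub_self])

lemma exists_degree_lt (N : F[X][Y]) : ∃ N' : F[X][Y], N'.degree < d ∧ ev F x y N' = ev F x y N := by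
  refine ⟨N %ₘ Φ, by rw [← h.degree_eq]; exact degree_modByMonic_lt _ h.monic, ?_⟩
  conv_rhs => rw [← modByMonic_add_div N Φ]
  rw [map_add, map_mul, (h.ker Φ).2 dvd_rfl, zero_mul, add_zero]

lemma aeval_ne_zero {b : F[X]} (hb : b ≠ 0) : aeval x b ≠ 0 := by
  rw [← ev_C (y := y), Ne, h.ker]
  intro hdvd
  have := degree_le_of_dvd hdvd (C_ne_zero.2 hb)
  rw [h.degree_eq, degree_C hb] at this
  exact absurd this (not_le.2 (by exact_mod_cast h.d_pos))

lemma transcendental : Transcendental F x := by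
  rintro ⟨b, hb, h0⟩
  exact h.aeval_ne_zero hb h0

lemma exists_rep (u : K) : ∃ (b : F[X]) (a : F[X][Y]), b ≠ 0 ∧ a.degree < d ∧
    u * aeval x b = ev F x y a := by
  obtain ⟨a₀, b₀, hb₀, e⟩ := h.frac u
  have hrel : IsRelPrime Φ b₀ := by
    refine (h.prime.irreducible.isRelPrime_iff_not_dvd).2 fun hd => hb₀ ((h.ker _).2 hd)
  obtain ⟨r, s, t, hr, hst⟩ := exists_C_mem_of_isRelPrime hrel
  have h1 := congrArg (ev F x y) hst
  rw [map_add, map_mul, map_mul, (h.ker Φ).2 dvd_rfl, mul_zero, zero_add, ev_C] at h1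
  obtain ⟨a, ha, ha'⟩ := h.exists_degree_lt (t * a₀)
  refine ⟨r, a, hr, ha, ?_⟩
  rw [ha', ← h1, map_mul, ← e]; ring

/-- Any `d + 1` elements are linearly dependent over `F[x]`. -/
lemma exists_dependent (u : Fin (d + 1) → K) : ∃ c : Fin (d + 1) → F[X], c ≠ 0 ∧
    ∑ i, aeval x (c i) * u i = 0 := by
  choose b a hb ha e using fun i => h.exists_rep (u i)
  have hdep : ¬ LinearIndependent F[X] (fun (i : Fin (d + 1)) (j : Fin d) => (a i).coeff j) := by
    intro hli
    have := hli.fintype_card_le_finrank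
    simp at this
  rw [Fintype.not_linearIndependent_iff] at hdep
  obtain ⟨g, hg, i₀, hi₀⟩ := hdep
  have h1 : ∑ i, C (g i) * a i = 0 := by
    ext1 j
    by_cases hj : j < d
    · have := congrFun hg ⟨j, hj⟩
      simpa [finsetSum_coeff] using this
    · rw [finsetSum_coeff, coeff_zero]
      refine Finset.sum_eq_zero fun i _ => ?_
      rw [coeff_C_mul, coeff_eq_zero_of_degree_lt ((ha i).trans_le (by exact_mod_cast not_lt.1 hj)),
        mul_zero]
  refine ⟨fun i => g i * b i, fun h0 => ?_, ?_⟩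
  · exact mul_ne_zero hi₀ (hb i₀) (congrFun h0 i₀)
  · have h2 := congrArg (ev F x y) h1
    rw [map_sum, map_zero] at h2
    rw [← h2]
    refine Finset.sum_congr rfl fun i _ => ?_
    rw [map_mul, map_mul, ev_C, ← e]; ring

end Curve
end Curve
end CremonaRank

namespace CremonaRank
open Polynomial Bivariate

section Laurent

variable (F : Type*) [Field F]

/-- The expansion of a polynomial at infinity. -/
noncomputable def expand : F[X] →+* LaurentSeries F :=
  eval₂RingHom HahnSeries.C (HahnSeries.single (-1 : ℤ) (1 : F))

variable {F}

lemma C_mul_single_pow (c : F) (n : ℕ) : HahnSeries.C c * (HahnSeries.single (-1 : ℤ) (1 : F)) ^ n =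
    HahnSeries.single (-(n : ℤ)) c := by
  rw [HahnSeries.single_pow, HahnSeries.C_apply, HahnSeries.single_mul_single]; simp

lemma expand_eq (P : F[X]) (n : ℕ) (hn : P.natDegree < n) :
    expand F P = ∑ i ∈ Finset.range n, HahnSeries.single (-(i : ℤ)) (P.coeff i) := by
  rw [expand, coe_eval₂RingHom, eval₂_eq_sum_range' _ hn]
  exact Finset.sum_congr rfl fun i _ => C_mul_single_pow _ _

lemma coeff_expand (P : F[X]) (n : ℕ) : (expand F P).coeff (-(n : ℤ)) = P.coeff n := by
  rw [expand_eq P _ (Nat.lt_succ_of_le (le_max_left P.natDegree n)), HahnSeries.coeff_sum,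
    Finset.sum_eq_single n]
  · rw [HahnSeries.coeff_single_same]
  · intro b _ hb
    rw [HahnSeries.coeff_single_of_ne (by omega)]
  · intro h; exact absurd (Finset.mem_range.2 (by omega)) h

lemma coeff_expand_of_pos (P : F[X]) {m : ℤ} (hm : 0 < m) : (expand F P).coeff m = 0 := by
  rw [expand_eq P _ (Nat.lt_succ_self _), HahnSeries.coeff_sum]
  refine Finset.sum_eq_zero fun i _ => ?_
  rw [HahnSeries.coeff_single_of_ne (by omega)]

lemma expand_injective : Function.Injective (expand F) := by
  intro P Q h
  ext n
  rw [← coeff_expand, h, coeff_expand]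

lemma coeff_expand_X_pow_mul (n : ℕ) (s : LaurentSeries F) (m : ℤ) :
    (expand F (X ^ n) * s).coeff m = s.coeff (m + n) := by
  rw [show expand F (X ^ n) = HahnSeries.single (-(n : ℤ)) (1 : F) by
    rw [← C_mul_single_pow]; simp [expand]]
  have := HahnSeries.coeff_single_mul_add (r := (1 : F)) (x := s) (a := m + n) (b := -(n : ℤ))
  rw [one_mul] at this
  rw [← this]; congr 1; ring

lemma exists_expand_eq (s : LaurentSeries F) (hs : ∀ m : ℤ, 0 < m → s.coeff m = 0) :
    ∃ P, expand F P = s := by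
  obtain ⟨n, hn⟩ : ∃ n : ℕ, ∀ m : ℤ, m < -(n : ℤ) → s.coeff m = 0 := by
    refine ⟨s.order.natAbs, fun m hm => HahnSeries.coeff_eq_zero_of_lt_order ?_⟩
    omega
  refine ⟨∑ i ∈ Finset.range (n + 1), monomial i (s.coeff (-(i : ℤ))), ?_⟩
  ext m
  rcases lt_or_ge 0 m with h | h
  · rw [coeff_expand_of_pos _ h, hs m h]
  · obtain ⟨i, rfl⟩ : ∃ i : ℕ, m = -(i : ℤ) := ⟨m.natAbs, by omega⟩
    rw [coeff_expand, finsetSum_coeff]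
    simp only [coeff_monomial, Finset.sum_ite_eq', Finset.mem_range]
    split_ifs with hi
    · rfl
    · exact (hn _ (by omega)).symm

end Laurent

namespace Curve
variable {F K : Type*} [Field F] [Field K] [Algebra F K] {x y : K} {d : ℕ} {Φ : F[X][Y]}

section Residue
variable (h : Curve F x y d Φ)

/-- The expansion at infinity of the `y ^ (d - 1)`-coefficient of an element. -/
noncomputable def lead (u : K) : LaurentSeries F :=
  expand F ((h.exists_rep u).choose_spec.choose.coeff (d - 1)) /
    expand F (h.exists_rep u).choose

lemma lead_mul {u : K} {b : F[X]} {a : F[X][Y]} (ha : a.degree < d)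
    (e : u * aeval x b = ev F x y a) : h.lead u * expand F b = expand F (a.coeff (d - 1)) := by
  rw [lead]
  obtain ⟨hb', ha', e'⟩ := (h.exists_rep u).choose_spec.choose_spec
  set b' := (h.exists_rep u).choose
  set a' := (h.exists_rep u).choose_spec.choose
  have h3 : expand F b' ≠ 0 := by rw [Ne, map_eq_zero_iff _ expand_injective]; exact hb'
  rw [div_mul_eq_mul_div, div_eq_iff h3, ← map_mul, ← map_mul, ← coeff_mul_C, ← coeff_mul_C]
  congr 2
  have hmul : ∀ {a : F[X][Y]} (c : F[X]), a.degree < d → (a * C c).degree < d := fun c ha => by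
    by_cases hc : c = 0
    · simp [hc]
    · rwa [degree_mul_C hc]
  refine h.eq_of_ev (hmul _ ha') (hmul _ ha) ?_
  rw [map_mul, map_mul, ev_C, ev_C, ← e, ← e']; ring

lemma lead_ev_mem (N : F[X][Y]) : ∃ P, expand F P = h.lead (ev F x y N) := by
  obtain ⟨N', hN', e⟩ := h.exists_degree_lt N
  have := h.lead_mul (u := ev F x y N) (b := 1) hN' (by rw [e]; simp)
  rw [map_one, mul_one] at this
  exact ⟨_, this.symm⟩

lemma lead_eq {u : K} {b : F[X]} {s : LaurentSeries F} {a : F[X][Y]} (hb : b ≠ 0)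
    (ha : a.degree < d) (e : u * aeval x b = ev F x y a)
    (hs : s * expand F b = expand F (a.coeff (d - 1))) : h.lead u = s := by
  have h3 : expand F b ≠ 0 := by rw [Ne, map_eq_zero_iff _ expand_injective]; exact hb
  exact mul_right_cancel₀ h3 ((h.lead_mul ha e).trans hs.symm)

lemma lead_add (u v : K) : h.lead (u + v) = h.lead u + h.lead v := by
  obtain ⟨b, a, hb, ha, e⟩ := h.exists_rep u
  obtain ⟨b', a', hb', ha', e'⟩ := h.exists_rep v
  have hd : (C b' * a + C b * a').degree < d :=
    (degree_add_le _ _).trans_lt (max_lt ((degree_C_mul hb').trans_lt ha)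
      ((degree_C_mul hb).trans_lt ha'))
  refine h.lead_eq (mul_ne_zero hb hb') hd ?_ ?_
  · simp only [map_add, map_mul, ev_C, ← e, ← e']; ring
  · rw [coeff_add, coeff_C_mul, coeff_C_mul, map_add, map_mul, map_mul, map_mul, ← h.lead_mul ha e,
      ← h.lead_mul ha' e']
    ring

lemma lead_aeval_mul (c : F[X]) (u : K) : h.lead (aeval x c * u) = expand F c * h.lead u := by
  obtain ⟨b, a, hb, ha, e⟩ := h.exists_rep u
  have hd : (C c * a).degree < d := by
    by_cases hc : c = 0
    · simp [hc]
    · rwa [degree_C_mul hc]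
  refine h.lead_eq hb hd ?_ ?_
  · rw [map_mul, ev_C, ← e]; ring
  · rw [coeff_C_mul, map_mul, ← h.lead_mul ha e]; ring

/-- The residue functional. -/
noncomputable def res : K →ₗ[F] F where
  toFun u := (h.lead u).coeff 1
  map_add' u v := by rw [h.lead_add]; simp
  map_smul' c u := by
    have : c • u = aeval x (C c) * u := by rw [aeval_C, Algebra.smul_def]
    have h2 : expand F (C c) = HahnSeries.C c := by simp [expand]
    rw [this, h.lead_aeval_mul, h2, HahnSeries.C_mul_eq_smul]
    rfl

lemma res_ev (N : F[X][Y]) : h.res (ev F x y N) = 0 := by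
  obtain ⟨P, hP⟩ := h.lead_ev_mem N
  change (h.lead _).coeff 1 = 0
  rw [← hP, coeff_expand_of_pos _ one_pos]

lemma lead_mem_of_res (u : K) (hu : ∀ N, h.res (u * ev F x y N) = 0) (N : F[X][Y]) :
    ∃ P, expand F P = h.lead (u * ev F x y N) := by
  refine exists_expand_eq _ fun m hm => ?_
  obtain ⟨n, rfl⟩ : ∃ n : ℕ, m = 1 + n := ⟨(m - 1).natAbs, by omega⟩
  have := hu (C (X ^ n) * N)
  change (h.lead _).coeff 1 = 0 at this
  rw [map_mul, ev_C, mul_left_comm, h.lead_aeval_mul, coeff_expand_X_pow_mul] at this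
  exact this

/-- An element pairing trivially with `F[x, y]` lies in `F[x, y]`. -/
theorem mem_of_res (u : K) (hu : ∀ N, h.res (u * ev F x y N) = 0) : ∃ a, u = ev F x y a := by
  have key : ∀ m ≤ d, ∀ (u : K) (b : F[X]) (a : F[X][Y]), b ≠ 0 → a.degree < m →
      u * aeval x b = ev F x y a → (∀ N, h.res (u * ev F x y N) = 0) → ∃ a, u = ev F x y a := by
    intro m
    induction m with
    | zero =>
      intro _ u b a hb ha e _
      have : a = 0 := Polynomial.degree_eq_bot.1 (Nat.WithBot.lt_zero_iff.1 (by exact_mod_cast ha))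
      rw [this, map_zero, mul_eq_zero, or_iff_left (h.aeval_ne_zero hb)] at e
      exact ⟨0, by rw [e, map_zero]⟩
    | succ m ih =>
      intro hm u b a hb ha e hu
      obtain ⟨P, hP⟩ := h.lead_mem_of_res u hu ((Y : F[X][Y]) ^ (d - 1 - m))
      have hdeg : (a * (Y : F[X][Y]) ^ (d - 1 - m)).degree < d := by
        rw [degree_mul_X_pow]
        by_cases ha0 : a = 0
        · simp [ha0]
        · rw [degree_eq_natDegree ha0] at ha ⊢
          have : a.natDegree < m + 1 := by exact_mod_cast ha
          have : a.natDegree + (d - 1 - m) < d := by omega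
          exact_mod_cast this
      have h1 := h.lead_mul (u := u * ev F x y ((Y : F[X][Y]) ^ (d - 1 - m))) (b := b) hdeg (by
        rw [map_mul, ← e]; ring)
      have hc : (a * (Y : F[X][Y]) ^ (d - 1 - m)).coeff (d - 1) = a.coeff m := by
        rw [coeff_mul_X_pow', if_pos (by omega)]
        congr 1; omega
      rw [← hP, ← map_mul, hc] at h1
      have h2 := expand_injective h1
      obtain ⟨a', ha'⟩ := ih (by omega) (u - ev F x y (C P * Y ^ m)) b (a - C (P * b) * Y ^ m) hb
        (by
          rw [h2]
          rw [degree_lt_iff_coeff_zero]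
          intro j hj
          rcases hj.eq_or_lt with rfl | hj
          · simp
          · rw [coeff_sub, coeff_C_mul, coeff_X_pow, if_neg hj.ne', mul_zero, sub_zero]
            exact coeff_eq_zero_of_degree_lt (ha.trans_le (by exact_mod_cast hj)))
        (by simp only [map_sub, map_mul, sub_mul, ev_C, e]; ring)
        (fun N => by rw [sub_mul, map_sub, hu, ← map_mul, h.res_ev, sub_zero])
      exact ⟨a' + C P * Y ^ m, by rw [map_add, ← ha']; ring⟩
  obtain ⟨b, a, hb, ha, e⟩ := h.exists_rep u
  exact key d le_rfl u b a hb ha e hu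

end Residue

end Curve
end CremonaRank

namespace CremonaRank
open Polynomial Bivariate

section Monomials
variable {F : Type*} [Field F]

/-- The index set of the monomials `X ^ i * Y ^ j` with `j < d` and `i < n - j`. -/
abbrev Mon (d n : ℕ) : Type := Σ j : Fin d, Fin (n - j)

/-- The polynomial with given coefficients. -/
noncomputable def toPoly (d n : ℕ) : (Mon d n → F) →ₗ[F] F[X][Y] where
  toFun v := ∑ i, C (C (v i)) * (C X ^ (i.2 : ℕ) * Y ^ (i.1 : ℕ))
  map_add' v w := by simp [add_mul, Finset.sum_add_distrib]
  map_smul' c v := by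
    have : ∀ P : F[X][Y], c • P = C (C c) * P := fun P => by
      ext j i; simp
    simp [this, Finset.mul_sum, mul_assoc]

lemma coeff_toPoly {d n : ℕ} (v : Mon d n → F) (m : Mon d n) :
    ((toPoly d n v).coeff m.1).coeff m.2 = v m := by
  change ((∑ i : Mon d n, C (C (v i)) * (C X ^ (i.2 : ℕ) * Y ^ (i.1 : ℕ)) : F[X][Y]).coeff m.1).coeff m.2 = _
  simp only [finsetSum_coeff, coeff_C_mul, ← C_pow, coeff_X_pow, mul_ite, mul_one, mul_zero]
  rw [Finset.sum_eq_single m]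
  · simp
  · rintro ⟨j, i⟩ _ hne
    obtain ⟨j', i'⟩ := m
    by_cases h1 : (j' : ℕ) = j
    · obtain rfl := Fin.ext h1
      rw [if_pos rfl, coeff_C_mul, coeff_X_pow, if_neg, mul_zero]
      intro h2
      exact hne (by rw [show i = i' from (Fin.ext h2).symm])
    · rw [if_neg h1, coeff_zero]
  · simp

lemma coeff_toPoly_of_le {d n : ℕ} (v : Mon d n → F) {i j : ℕ} (h : n ≤ i + j ∨ d ≤ j) :
    ((toPoly d n v).coeff j).coeff i = 0 := by
  change ((∑ i : Mon d n, C (C (v i)) * (C X ^ (i.2 : ℕ) * Y ^ (i.1 : ℕ)) : F[X][Y]).coeff j).coeff i = _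
  simp only [finsetSum_coeff, coeff_C_mul, ← C_pow, coeff_X_pow, mul_ite, mul_one, mul_zero]
  refine Finset.sum_eq_zero fun m _ => ?_
  split_ifs with h1
  · rw [coeff_C_mul, coeff_X_pow, if_neg, mul_zero]
    have := m.2.2
    have := m.1.2
    omega
  · rw [coeff_zero]

lemma degree_toPoly_lt {d n : ℕ} (v : Mon d n → F) : (toPoly d n v).degree < d := by
  rw [degree_lt_iff_coeff_zero]
  intro j hj
  ext i
  rw [coeff_toPoly_of_le _ (Or.inr hj), coeff_zero]

lemma tDegLE_toPoly {d n : ℕ} (v : Mon d (n + 1) → F) : TDegLE n (toPoly d (n + 1) v) :=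
  fun _ _ hij => coeff_toPoly_of_le _ (Or.inl hij)

lemma toPoly_injective (d n : ℕ) : Function.Injective (toPoly (F := F) d n) := fun v w h => by
  ext m
  rw [← coeff_toPoly v, h, coeff_toPoly]

lemma card_mon {d n : ℕ} (hd : 0 < d) (hn : d ≤ n) :
    Fintype.card (Mon d (n + 1)) + Fintype.card (Mon d (d - 2)) = n * d + 1 := by
  simp only [Fintype.card_sigma, Fintype.card_fin]
  rw [Fin.sum_univ_eq_sum_range (fun j => n + 1 - j), Fin.sum_univ_eq_sum_range (fun j => d - 2 - j)]
  have h1 : ∑ j ∈ Finset.range d, (d - 2 - j) = ∑ j ∈ Finset.range d, (j - 1) := by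
    rw [← Finset.sum_range_reflect]
    refine Finset.sum_congr rfl fun j hj => ?_
    have := Finset.mem_range.1 hj
    omega
  rw [h1, ← Finset.sum_add_distrib]
  obtain ⟨e, rfl⟩ : ∃ e, d = e + 1 := ⟨d - 1, by omega⟩
  rw [Finset.sum_range_succ', Finset.sum_congr rfl (g := fun _ => n)]
  · simp; ring
  · intro j hj
    have := Finset.mem_range.1 hj
    omega

end Monomials

lemma exists_family_of_range {F W D : Type*} [Field F] [AddCommGroup D] [Module F D]
    [FiniteDimensional F D] [AddCommGroup W] [Module F W] (J : W →ₗ[F] D) :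
    ∃ w : Fin (Module.finrank F (LinearMap.range J)) → W,
      ∀ c : Fin (Module.finrank F (LinearMap.range J)) → F, J (∑ i, c i • w i) = 0 → c = 0 := by
  let b := Module.finBasis F (LinearMap.range J)
  choose w hw using fun i => (b i).2
  refine ⟨w, fun c hc => ?_⟩
  have h1 : ∑ i, c i • b i = 0 := by
    apply Subtype.ext
    rw [Submodule.coe_sum, ZeroMemClass.coe_zero, ← hc, map_sum]
    simp only [Submodule.coe_smul, ← hw, ← map_smul]
  exact funext (Fintype.linearIndependent_iff.1 b.linearIndependent c h1)

lemma exists_dual_family {F V W : Type*} [Field F] [AddCommGroup V] [Module F V]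
    [FiniteDimensional F V] [AddCommGroup W] [Module F W] (J : W →ₗ[F] Module.Dual F V) :
    ∃ (N : ℕ) (w : Fin N → W),
      Module.finrank F V = N + Module.finrank F (LinearMap.range J).dualCoannihilator ∧
      ∀ c : Fin N → F, J (∑ i, c i • w i) = 0 → c = 0 := by
  have hR := Subspace.finrank_add_finrank_dualCoannihilator_eq (LinearMap.range J)
  obtain ⟨w, hw⟩ := exists_family_of_range J
  exact ⟨_, w, hR.symm, hw⟩

section Valuations
variable {F K : Type*} [Field F] [Field K] [Algebra F K]

/-- A valuation ring containing the constants. -/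
def Over (F : Type*) {K : Type*} [Field F] [Field K] [Algebra F K] (O : ValuationSubring K) : Prop :=
  ∀ c, algebraMap F K c ∈ O

lemma Over.smul_mem {O : ValuationSubring K} (hO : Over F O) (c : F) {u : K} (hu : u ∈ O) :
    c • u ∈ O := by
  rw [Algebra.smul_def]; exact O.mul_mem _ _ (hO c) hu

lemma Over.aeval_mem {O : ValuationSubring K} (hO : Over F O) {x : K} (hx : x ∈ O) (P : F[X]) :
    aeval x P ∈ O := by
  rw [aeval_eq_sum_range]
  exact sum_mem fun i _ => hO.smul_mem _ (pow_mem hx _)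

lemma Over.ev_mem {O : ValuationSubring K} (hO : Over F O) {x y : K} (hx : x ∈ O) (hy : y ∈ O)
    (P : F[X][Y]) : ev F x y P ∈ O := by
  rw [ev_eq_sum]
  exact sum_mem fun i _ => O.mul_mem _ _ (hO.aeval_mem hx _) (pow_mem hy _)

lemma inv_mem_of_not_mem {O : ValuationSubring K} {x : K} (hx : x ∉ O) : x⁻¹ ∈ O :=
  (O.mem_or_inv_mem x).resolve_left hx

/-- The elements without poles over the affine `x`-line. -/
def finite (F : Type*) {K : Type*} [Field F] [Field K] [Algebra F K] (x : K) : Submodule F K where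
  carrier := {u | ∀ O : ValuationSubring K, Over F O → x ∈ O → u ∈ O}
  add_mem' hu hv O h1 h2 := O.add_mem _ _ (hu O h1 h2) (hv O h1 h2)
  zero_mem' O _ _ := O.zero_mem
  smul_mem' c _ hu O h1 h2 := h1.smul_mem c (hu O h1 h2)

/-- The elements whose pole order over `x = ∞` is at most `n`. -/
def infinite (F : Type*) {K : Type*} [Field F] [Field K] [Algebra F K] (x : K) (n : ℕ) :
    Submodule F K where
  carrier := {u | ∀ O : ValuationSubring K, Over F O → x ∉ O → x⁻¹ ^ n * u ∈ O}
  add_mem' hu hv O h1 h2 := by rw [mul_add]; exact O.add_mem _ _ (hu O h1 h2) (hv O h1 h2)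
  zero_mem' O _ _ := by rw [mul_zero]; exact O.zero_mem
  smul_mem' c _ hu O h1 h2 := by rw [mul_smul_comm]; exact h1.smul_mem c (hu O h1 h2)

lemma infinite_mono {x : K} {m n : ℕ} (h : m ≤ n) : infinite F x m ≤ infinite F x n := by
  intro u hu O h1 h2
  rw [← Nat.sub_add_cancel h, pow_add, mul_assoc]
  exact O.mul_mem _ _ (pow_mem (inv_mem_of_not_mem h2) _) (hu O h1 h2)

lemma mul_mem_finite {x u v : K} (hu : u ∈ finite F x) (hv : v ∈ finite F x) : u * v ∈ finite F x :=
  fun O h1 h2 => O.mul_mem _ _ (hu O h1 h2) (hv O h1 h2)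

lemma mem_of_monic {O : ValuationSubring K} {z : K} {P : K[X]} (hP : P.Monic)
    (hc : ∀ i, P.coeff i ∈ O) (h0 : P.eval z = 0) : z ∈ O := by
  have hz : IsIntegral O z := by
    have hl : P ∈ Polynomial.lifts (algebraMap O K) := by
      rw [Polynomial.lifts_iff_coeff_lifts]
      exact fun i => ⟨⟨_, hc i⟩, rfl⟩
    obtain ⟨Q, hQ, -, hQm⟩ := Polynomial.lifts_and_degree_eq_and_monic hl hP
    exact ⟨Q, hQm, by rw [eval₂_eq_eval_map, hQ, h0]⟩
  obtain ⟨w, rfl⟩ := IsIntegrallyClosed.isIntegral_iff.1 hz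
  exact w.2

lemma ev_eq_eval (x y : K) (P : F[X][Y]) :
    ev F x y P = (P.map (aeval x : F[X] →ₐ[F] K).toRingHom).eval y := by
  rw [ev_eq_sum, eval_map, eval₂_eq_sum]; rfl

end Valuations

namespace Curve
variable {F K : Type*} [Field F] [Field K] [Algebra F K] {x y : K} {d : ℕ} {Φ : F[X][Y]}
variable (h : Curve F x y d Φ)
include h

lemma y_mem {O : ValuationSubring K} (hO : Over F O) (hx : x ∈ O) : y ∈ O := by
  refine mem_of_monic (h.monic.map (aeval x : F[X] →ₐ[F] K).toRingHom) (fun i => ?_)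
    (by rw [← ev_eq_eval]; exact (h.ker Φ).2 dvd_rfl)
  rw [coeff_map]; exact hO.aeval_mem hx _

lemma ev_mem_finite (N : F[X][Y]) : ev F x y N ∈ finite F x :=
  fun _ h1 h2 => h1.ev_mem h2 (h.y_mem h1 h2) _

lemma coeff_top_eq : Φ.coeff d = 1 := by
  have := h.monic.coeff_natDegree; rwa [h.deg] at this

lemma hom_monic : (hom d Φ).Monic := by
  refine monic_of_degree_le d ?_ ?_
  · rw [degree_le_iff_coeff_zero]
    intro j hj
    ext i
    rw [coeff_hom, if_neg (by have : d < j := by exact_mod_cast hj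
                              omega), coeff_zero]
  · ext i
    rw [coeff_hom, h.coeff_top_eq, coeff_one, coeff_one]
    split_ifs <;> first | rfl | omega

lemma y_div_x_mem {O : ValuationSubring K} (hO : Over F O) (hx : x ∉ O) : y * x⁻¹ ∈ O := by
  have hx0 : x ≠ 0 := fun h0 => hx (h0 ▸ O.zero_mem)
  refine mem_of_monic (h.hom_monic.map (aeval x⁻¹ : F[X] →ₐ[F] K).toRingHom) (fun i => ?_) ?_
  · rw [coeff_map]; exact hO.aeval_mem (inv_mem_of_not_mem hx) _
  · rw [← ev_eq_eval, ev_hom h.tdeg (x := x) (inv_mul_cancel₀ hx0),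
      show x * (y * x⁻¹) = y by field_simp, (h.ker Φ).2 dvd_rfl, mul_zero]

lemma ev_mem_infinite {n : ℕ} {N : F[X][Y]} (hN : TDegLE n N) : ev F x y N ∈ infinite F x n := by
  intro O h1 h2
  have hx0 : x ≠ 0 := fun h0 => h2 (h0 ▸ O.zero_mem)
  have := ev_hom hN (u := x⁻¹) (x := x) (z := y * x⁻¹) (inv_mul_cancel₀ hx0)
  rw [show x * (y * x⁻¹) = y by field_simp] at this
  rw [← this]
  exact h1.ev_mem (inv_mem_of_not_mem h2) (h.y_div_x_mem h1 h2) _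

lemma exists_mem_infinite (u : K) : ∃ n, u ∈ infinite F x n := by
  obtain ⟨b, a, hb, ha, e⟩ := h.exists_rep u
  obtain ⟨n, hn⟩ := exists_tDegLE a
  refine ⟨n, fun O h1 h2 => ?_⟩
  have hx0 : x ≠ 0 := fun h0 => h2 (h0 ▸ O.zero_mem)
  have hx := inv_mem_of_not_mem h2
  have hbO : (aeval x b)⁻¹ ∈ O := by
    by_cases hdeg : b.natDegree = 0
    · rw [natDegree_eq_zero] at hdeg
      obtain ⟨c, rfl⟩ := hdeg
      rw [aeval_C, ← map_inv₀]; exact h1 _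
    · by_contra hbO
      have hb1 := (O.mem_or_inv_mem (aeval x b)).resolve_right hbO
      have hc : C b.leadingCoeff⁻¹ * b ≠ 0 := by simpa using hb
      have hm : (C b.leadingCoeff⁻¹ * b).Monic := by
        rw [Monic, leadingCoeff_mul, leadingCoeff_C, inv_mul_cancel₀ (leadingCoeff_ne_zero.2 hb)]
      have hd1 : 0 < (C b.leadingCoeff⁻¹ * b).natDegree := by
        rw [natDegree_C_mul (inv_ne_zero (leadingCoeff_ne_zero.2 hb))]; omega
      refine h2 (mem_of_monic (z := x)
        (P := (C b.leadingCoeff⁻¹ * b).map (algebraMap F K) - C (aeval x (C b.leadingCoeff⁻¹ * b)))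
        ?_ (fun i => ?_) ?_)
      · refine (hm.map _).sub_of_left (degree_C_le.trans_lt ?_)
        rw [degree_map, degree_eq_natDegree hc]
        exact_mod_cast hd1
      · rw [coeff_sub, coeff_map, coeff_C]
        refine sub_mem (h1 _) ?_
        split_ifs
        · rw [map_mul, aeval_C]; exact O.mul_mem _ _ (h1 _) hb1
        · exact O.zero_mem
      · rw [eval_sub, eval_C, eval_map_algebraMap, sub_self]
  rw [eq_div_of_mul_eq (h.aeval_ne_zero hb) e, div_eq_mul_inv, ← mul_assoc]
  exact O.mul_mem _ _ (h.ev_mem_infinite hn O h1 h2) hbO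

omit h in
variable (F x y) in
/-- The polynomials of degree at most `d - 3` in the conductor. -/
def conductor (d : ℕ) : Submodule F (Mon d (d - 2) → F) where
  carrier := {v | ∀ w ∈ finite F x, ∃ a, ev F x y (toPoly _ _ v) * w = ev F x y a}
  add_mem' hu hv w hw := by
    obtain ⟨a, ha⟩ := hu w hw
    obtain ⟨b, hb⟩ := hv w hw
    exact ⟨a + b, by rw [map_add, map_add, map_add, add_mul, ha, hb]⟩
  zero_mem' w _ := ⟨0, by simp⟩
  smul_mem' c v hv w hw := by
    obtain ⟨a, ha⟩ := hv w hw
    refine ⟨C (C c) * a, ?_⟩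
    rw [map_mul, ← ha, map_smul, map_smul, ev_CC, Algebra.smul_def, mul_assoc]

lemma exists_independent : ∃ (N : ℕ) (z : Fin N → K),
    Fintype.card (Mon d (d - 2)) ≤ N + Module.finrank F (conductor F x y d) ∧
    (∀ i, z i ∈ finite F x) ∧
    ∀ c : Fin N → F, (∃ a, ∑ i, c i • z i = ev F x y a) → c = 0 := by
  let e : (Mon d (d - 2) → F) →ₗ[F] K := (ev F x y).toLinearMap ∘ₗ toPoly d (d - 2)
  let J : finite F x →ₗ[F] Module.Dual F (Mon d (d - 2) → F) :=
    LinearMap.mk₂ F (fun w v => h.res (e v * w))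
    (fun w w' v => by simp [mul_add]) (fun c w v => by simp) (fun w v v' => by simp [add_mul])
    (fun c w v => by simp)
  have hJ : ∀ w v, J w v = h.res (e v * w) := fun _ _ => rfl
  obtain ⟨N, w, hN, hw⟩ := exists_dual_family J
  have hC : (LinearMap.range J).dualCoannihilator ≤ conductor F x y d := by
    intro v hv w hw
    rw [Submodule.mem_dualCoannihilator] at hv
    refine h.mem_of_res _ fun N => ?_
    have := hv _ ⟨⟨w * ev F x y N, mul_mem_finite hw (h.ev_mem_finite N)⟩, rfl⟩
    rw [hJ] at this
    rw [mul_assoc]; exact this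
  have hC' := Submodule.finrank_mono hC
  refine ⟨N, fun i => w i, ?_, fun i => (w i).2, ?_⟩
  · rw [← Module.finrank_fintype_fun_eq_card F]
    omega
  · rintro c ⟨a, ha⟩
    refine hw c (LinearMap.ext fun v => ?_)
    rw [hJ]
    have : ((∑ i, c i • w i : finite F x) : K) = ev F x y a := by
      rw [← ha, Submodule.coe_sum]; rfl
    rw [this]
    change h.res (ev F x y _ * ev F x y a) = 0
    rw [← map_mul, h.res_ev]

/-- A lower bound for the number of elements with poles only at infinity. -/
theorem exists_family : ∃ n₀, ∀ n ≥ n₀, ∃ (N : ℕ) (u : Fin N → K), LinearIndependent F u ∧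
    n * d + 1 ≤ N + Module.finrank F (conductor F x y d) ∧
    ∀ i, u i ∈ finite F x ⊓ infinite F x n := by
  obtain ⟨M, z, hM, hz, hli⟩ := h.exists_independent
  choose n hn using fun i => h.exists_mem_infinite (z i)
  refine ⟨max d (Finset.univ.sup n), fun n' hn' => ?_⟩
  let u : Mon d (n' + 1) ⊕ Fin M → K :=
    Sum.elim (fun m => ev F x y (toPoly d (n' + 1) (Pi.single m 1))) z
  have hsum : ∀ c : Mon d (n' + 1) → F,
      ∑ m, c m • ev F x y (toPoly d (n' + 1) (Pi.single m 1)) = ev F x y (toPoly d (n' + 1) c) := by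
    intro c
    conv_rhs => rw [← Finset.univ_sum_single c]
    rw [map_sum, map_sum]
    refine Finset.sum_congr rfl fun m _ => ?_
    rw [← map_smul, ← map_smul, ← Pi.single_smul, smul_eq_mul, mul_one]
  have hu : LinearIndependent F u := by
    rw [Fintype.linearIndependent_iff]
    intro g hg
    rw [Fintype.sum_sum_type] at hg
    simp only [u, Sum.elim_inl, Sum.elim_inr, hsum] at hg
    have h2 := hli (fun i => g (Sum.inr i)) ⟨-toPoly d (n' + 1) (fun m => g (Sum.inl m)), by
      rw [map_neg, eq_neg_iff_add_eq_zero, add_comm]; exact hg⟩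
    have h3 : ∀ i, g (Sum.inr i) = 0 := congrFun h2
    simp only [h3, zero_smul, Finset.sum_const_zero, add_zero] at hg
    have h4 := h.eq_zero_of_ev (degree_toPoly_lt _) hg
    have h5 := toPoly_injective _ _ (h4.trans (map_zero _).symm)
    rintro (m | i)
    · exact congrFun h5 m
    · exact h3 i
  let eq := (Fintype.equivFin (Mon d (n' + 1) ⊕ Fin M)).symm
  refine ⟨_, u ∘ eq, (linearIndependent_equiv eq).2 hu, ?_, fun i => ?_⟩
  · have := card_mon h.d_pos ((le_max_left _ _).trans hn')
    rw [Fintype.card_sum, Fintype.card_fin]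
    omega
  · rw [Function.comp_apply]
    rcases eq i with m | i
    · exact ⟨h.ev_mem_finite _, h.ev_mem_infinite (tDegLE_toPoly _)⟩
    · exact ⟨hz i, infinite_mono (((Finset.le_sup (Finset.mem_univ i)).trans
        (le_max_right _ _)).trans hn') (hn i)⟩

end Curve
end CremonaRank

namespace CremonaRank
open Polynomial Bivariate TensorProduct

section Coordinates
variable {k F : Type*} [Field k] [Field F] [Algebra k F]

/-- Decomposition of a polynomial with respect to a basis of the field of coefficients. -/
lemma exists_finsupp_fam {ι : Type*} (b : Module.Basis ι k F) (N : F[X][Y]) :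
    ∃ Q : ι →₀ k[X][Y], N = Q.sum fun l P => C (C (b l)) * bmap k F P := by
  have hadd : ∀ N₁ N₂ : F[X][Y],
      (∃ Q : ι →₀ k[X][Y], N₁ = Q.sum fun l P => C (C (b l)) * bmap k F P) →
      (∃ Q : ι →₀ k[X][Y], N₂ = Q.sum fun l P => C (C (b l)) * bmap k F P) →
      ∃ Q : ι →₀ k[X][Y], N₁ + N₂ = Q.sum fun l P => C (C (b l)) * bmap k F P := by
    rintro _ _ ⟨Q₁, rfl⟩ ⟨Q₂, rfl⟩
    exact ⟨Q₁ + Q₂, (Finsupp.sum_add_index' (by simp) (by simp [mul_add])).symm⟩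
  induction N using Polynomial.induction_on' with
  | add N₁ N₂ h₁ h₂ => exact hadd _ _ h₁ h₂
  | monomial j c =>
    induction c using Polynomial.induction_on' with
    | add c₁ c₂ h₁ h₂ => rw [map_add]; exact hadd _ _ h₁ h₂
    | monomial i z =>
      refine ⟨(b.repr z).mapRange (fun c => C (C c) * (C (X ^ i) * Y ^ j)) (by simp), ?_⟩
      rw [Finsupp.sum_mapRange_index (by simp)]
      have h1 : ∀ l (c : k), C (C (b l)) * bmap k F (C (C c) * (C (X ^ i) * Y ^ j)) =
          C (C (c • b l)) * (C (X ^ i) * Y ^ j) := fun l c => by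
        simp only [map_mul, bmap_CC, map_pow, bmap_X, bmap_Y, Algebra.smul_def]; ring
      simp only [h1]
      rw [Finsupp.sum, ← Finset.sum_mul, ← map_sum, ← map_sum]
      change _ = C (C ((b.repr z).sum fun l c => c • b l)) * _
      rw [← Finsupp.linearCombination_apply, b.linearCombination_repr, ← C_mul_X_pow_eq_monomial, ← C_mul_X_pow_eq_monomial]
      simp [mul_assoc]

/-- Decomposition of a polynomial with respect to independent coefficients. -/
lemma exists_fam (N : F[X][Y]) : ∃ (n : ℕ) (e : Fin n → F) (Q : Fin n → k[X][Y]),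
    LinearIndependent k e ∧ N = fam e Q := by
  obtain ⟨Q, hQ⟩ := exists_finsupp_fam (Module.Basis.ofVectorSpace k F) N
  let eq := Q.support.equivFin.symm
  refine ⟨_, fun i => Module.Basis.ofVectorSpace k F (eq i), fun i => Q (eq i), ?_, ?_⟩
  · exact (Module.Basis.ofVectorSpace k F).linearIndependent.comp (fun i => ((eq i : Q.support) : _))
      (Subtype.val_injective.comp eq.injective)
  · rw [hQ, fam, Finsupp.sum, ← Finset.sum_coe_sort Q.support]
    exact (Equiv.sum_comp eq (fun l : Q.support => C (C (Module.Basis.ofVectorSpace k F l)) *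
      bmap k F (Q l))).symm

lemma coeff_fam {ι : Type*} [Fintype ι] (e : ι → F) (Q : ι → k[X][Y]) (i j : ℕ) :
    ((fam e Q).coeff j).coeff i = ∑ l, ((Q l).coeff j).coeff i • e l := by
  simp [fam, finsetSum_coeff, coeff_C_mul, Algebra.smul_def, mul_comm]

lemma TDegLE.of_fam {ι : Type*} [Fintype ι] {e : ι → F} {Q : ι → k[X][Y]} {d : ℕ}
    (he : LinearIndependent k e) (h : TDegLE d (fam e Q)) (l : ι) : TDegLE d (Q l) := by
  intro i j hij
  have := h i j hij
  rw [coeff_fam] at this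
  exact Fintype.linearIndependent_iff.1 he _ this l

end Coordinates

section Irreducible
attribute [local instance] Polynomial.algebra
variable {F E : Type*} [Field F] [Field E] [Algebra F E]

/-- Irreducibility is preserved by extensions in which the base field is algebraically closed. -/
lemma prime_bmap (hE : ∀ u : E, IsIntegral F u → ∃ c, algebraMap F E c = u) {Φ : F[X][Y]}
    (hm : Φ.Monic) (hΦ : _root_.Prime Φ) : _root_.Prime (bmap F E Φ) := by
  have hinj : Function.Injective (mapRingHom (algebraMap F E)) :=
    Polynomial.map_injective _ (algebraMap F E).injective
  have hmm : (bmap F E Φ).Monic := hm.map _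
  have hne : bmap F E Φ ≠ 1 := fun h1 => hΦ.not_isUnit (by
    rw [bmap_injective (h1.trans (map_one (bmap F E)).symm)]; exact isUnit_one)
  have hlift : ∀ g : E[X][Y], g.Monic → g ∣ bmap F E Φ → ∃ G : F[X][Y], bmap F E G = g := by
    intro g hg hd
    have h1 : ∀ j, ∃ c : F[X], mapRingHom (algebraMap F E) c = g.coeff j := by
      intro j
      have h2 : IsIntegral F[X] (g.coeff j) := isIntegral_coeff_of_dvd Φ g hm hg hd j
      have h3 := Polynomial.isIntegral_iff_isIntegral_coeff.1 h2
      have h4 : g.coeff j ∈ Polynomial.lifts (algebraMap F E) := by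
        rw [Polynomial.lifts_iff_coeff_lifts]
        exact fun n => hE _ (h3 n)
      exact (Polynomial.mem_lifts _).1 h4
    have h5 : g ∈ Polynomial.lifts (mapRingHom (algebraMap F E)) := by
      rw [Polynomial.lifts_iff_coeff_lifts]; exact h1
    exact (Polynomial.mem_lifts _).1 h5
  have hdeg : ∀ G : F[X][Y], (bmap F E G).natDegree = G.natDegree := fun G =>
    natDegree_map_eq_of_injective hinj G
  refine Irreducible.prime ?_
  rw [hmm.irreducible_iff_natDegree]
  refine ⟨hne, fun f g hf hg e => ?_⟩
  obtain ⟨f, rfl⟩ := hlift f hf ⟨g, e.symm⟩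
  obtain ⟨g, rfl⟩ := hlift g hg ⟨_, by rw [← e, mul_comm]⟩
  rw [← map_mul] at e
  have e := bmap_injective e
  have hf' : f.Monic := by
    rw [bmap, coe_mapRingHom] at hf; exact Polynomial.monic_of_injective hinj hf
  have hg' : g.Monic := by
    rw [bmap, coe_mapRingHom] at hg; exact Polynomial.monic_of_injective hinj hg
  have hne' : Φ ≠ 1 := fun h1 => hΦ.not_isUnit (h1 ▸ isUnit_one)
  rw [hdeg, hdeg]
  exact ((hm.irreducible_iff_natDegree).1 hΦ.irreducible).2 f g hf' hg' e

end Irreducible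

namespace Curve
variable {F K E : Type*} [Field F] [Field K] [Algebra F K] [Field E] [Algebra F E]
  {x y : K} {d : ℕ} {Φ : F[X][Y]}
variable (h : Curve F x y d Φ)

section
variable (E) (x y)

/-- Evaluation at the base change of a pair of elements. -/
noncomputable def evT (F : Type*) [Field F] [Algebra F K] [Algebra F E] :
    E[X][Y] →ₐ[E] E ⊗[F] K := ev E (1 ⊗ₜ x) (1 ⊗ₜ y)

end

lemma evT_C (b : E[X]) : evT E x y F (C b) = aeval (1 ⊗ₜ[F] x : E ⊗[F] K) b := by simp [evT]

lemma evT_bmap (P : F[X][Y]) : evT E x y F (bmap F E P) = 1 ⊗ₜ[F] ev F x y P := by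
  have : ((evT E x y F : E[X][Y] →+* E ⊗[F] K)).comp (bmap F E) =
      (Algebra.TensorProduct.includeRight : K →ₐ[F] E ⊗[F] K).toRingHom.comp
        (ev F x y : F[X][Y] →+* K) := by
    apply ev_ext
    · intro c
      simp [evT, Algebra.TensorProduct.tmul_one_eq_one_tmul]
    · simp [evT]
    · simp [evT]
  exact congrArg (fun h => h P) this

include h

lemma evT_eq_zero_iff (N : E[X][Y]) : evT E x y F N = 0 ↔ bmap F E Φ ∣ N := by
  constructor
  · intro h0
    obtain ⟨Q, hQ⟩ := exists_finsupp_fam (Module.Basis.ofVectorSpace F E) N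
    have h1 : ∀ l, ev F x y (Q l) = 0 := by
      have h2 : ((Q.mapRange (ev F x y) (map_zero _)).sum fun i n =>
          Module.Basis.ofVectorSpace F E i ⊗ₜ[F] n) = 0 := by
        rw [Finsupp.sum_mapRange_index (by simp), ← h0, hQ, Finsupp.sum, Finsupp.sum, map_sum]
        refine Finset.sum_congr rfl fun l _ => ?_
        rw [map_mul, evT_bmap, evT_C, aeval_C, Algebra.TensorProduct.algebraMap_apply,
          Algebra.TensorProduct.tmul_mul_tmul]
        simp
      have h3 := TensorProduct.sum_tmul_basis_left_eq_zero _ _ h2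
      intro l
      simpa using DFunLike.congr_fun h3 l
    rw [hQ]
    exact Finset.dvd_sum fun l _ => dvd_mul_of_dvd_right (map_dvd _ ((h.ker _).1 (h1 l))) _
  · rintro ⟨M, rfl⟩
    rw [map_mul, evT_bmap, (h.ker Φ).2 dvd_rfl, tmul_zero, zero_mul]

end Curve
end CremonaRank

namespace CremonaRank
open Polynomial Bivariate TensorProduct

namespace Curve
variable {F K E : Type*} [Field F] [Field K] [Algebra F K] [Field E] [Algebra F E]
  {x y : K} {d : ℕ} {Φ : F[X][Y]}
variable (h : Curve F x y d Φ)
include h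

lemma exists_rep_tensor (s : E ⊗[F] K) : ∃ (b : F[X]) (P : E[X][Y]), b ≠ 0 ∧
    evT E x y F P = evT E x y F (bmap F E (C b)) * s := by
  induction s using TensorProduct.induction_on with
  | zero => exact ⟨1, 0, one_ne_zero, by simp⟩
  | tmul e u =>
    obtain ⟨b, a, hb, -, hu⟩ := h.exists_rep u
    refine ⟨b, C (C e) * bmap F E a, hb, ?_⟩
    rw [map_mul, evT_bmap, evT_bmap, evT_C, aeval_C, Algebra.TensorProduct.algebraMap_apply,
      Algebra.TensorProduct.tmul_mul_tmul, Algebra.TensorProduct.tmul_mul_tmul, ev_C, ← hu]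
    simp [mul_comm]
  | add s t hs ht =>
    obtain ⟨b, P, hb, hP⟩ := hs
    obtain ⟨c, Q, hc, hQ⟩ := ht
    refine ⟨b * c, bmap F E (C c) * P + bmap F E (C b) * Q, mul_ne_zero hb hc, ?_⟩
    rw [map_add, map_mul, map_mul, hP, hQ, C_mul, map_mul, map_mul]
    ring

lemma isUnit_evT {b : F[X]} (hb : b ≠ 0) : IsUnit (evT E x y F (bmap F E (C b))) := by
  rw [evT_bmap, ev_C]
  exact (IsUnit.mk0 _ (h.aeval_ne_zero hb)).map
    (Algebra.TensorProduct.includeRight : K →ₐ[F] E ⊗[F] K)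

/-- A geometrically irreducible curve stays irreducible after base change. -/
lemma isDomain_tensor (hE : ∀ u : E, IsIntegral F u → ∃ c, algebraMap F E c = u) :
    IsDomain (E ⊗[F] K) := by
  have hp := prime_bmap hE h.monic h.prime
  have : Nontrivial (E ⊗[F] K) := by
    refine ⟨⟨0, 1, fun h0 => hp.not_isUnit ?_⟩⟩
    rw [isUnit_iff_dvd_one, ← h.evT_eq_zero_iff (E := E), map_one, h0]
  have : NoZeroDivisors (E ⊗[F] K) := by
    refine ⟨fun {s t} hst => ?_⟩
    obtain ⟨b, P, hb, hP⟩ := h.exists_rep_tensor s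
    obtain ⟨c, Q, hc, hQ⟩ := h.exists_rep_tensor t
    have h0 : evT E x y F (P * Q) = 0 := by
      rw [map_mul, hP, hQ, mul_mul_mul_comm, hst, mul_zero]
    rw [h.evT_eq_zero_iff] at h0
    rcases hp.dvd_or_dvd h0 with h0 | h0
    · left
      rw [← h.evT_eq_zero_iff, hP] at h0
      exact (h.isUnit_evT hb).mul_right_eq_zero.1 h0
    · right
      rw [← h.evT_eq_zero_iff, hQ] at h0
      exact (h.isUnit_evT hc).mul_right_eq_zero.1 h0
  exact NoZeroDivisors.to_isDomain _

section BaseChange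
variable {L : Type*} [Field L] [Algebra (E ⊗[F] K) L] [IsFractionRing (E ⊗[F] K) L]
  [Algebra E L] [IsScalarTower E (E ⊗[F] K) L]

omit h [IsFractionRing (E ⊗[F] K) L] in
lemma algebraMap_evT (P : E[X][Y]) : algebraMap (E ⊗[F] K) L (evT E x y F P) =
    ev E (algebraMap (E ⊗[F] K) L (1 ⊗ₜ x)) (algebraMap (E ⊗[F] K) L (1 ⊗ₜ y)) P :=
  algHom_ev (IsScalarTower.toAlgHom E (E ⊗[F] K) L) _ _ P

variable (E L) in
/-- Base change of a plane curve. -/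
lemma baseChange : Curve E (algebraMap (E ⊗[F] K) L (1 ⊗ₜ x)) (algebraMap (E ⊗[F] K) L (1 ⊗ₜ y)) d
    (bmap F E Φ) where
  monic := h.monic.map _
  deg := by
    rw [← h.deg]
    exact natDegree_map_eq_of_injective
      (Polynomial.map_injective _ (algebraMap F E).injective) Φ
  tdeg i j hij := by rw [coeff_bmap, h.tdeg i j hij, map_zero]
  ker N := by
    rw [← algebraMap_evT, ← h.evT_eq_zero_iff]
    exact map_eq_zero_iff _ (IsFractionRing.injective (E ⊗[F] K) L)
  frac u := by
    obtain ⟨s, t, ht, rfl⟩ := IsFractionRing.div_surjective (E ⊗[F] K) u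
    obtain ⟨b, P, hb, hP⟩ := h.exists_rep_tensor s
    obtain ⟨c, Q, hc, hQ⟩ := h.exists_rep_tensor t
    have hb' := (h.isUnit_evT (E := E) hb).map (algebraMap (E ⊗[F] K) L)
    have hc' := (h.isUnit_evT (E := E) hc).map (algebraMap (E ⊗[F] K) L)
    have ht' : algebraMap (E ⊗[F] K) L t ≠ 0 := IsFractionRing.to_map_ne_zero_of_mem_nonZeroDivisors ht
    refine ⟨bmap F E (C c) * P, bmap F E (C b) * Q, ?_, ?_⟩
    · rw [← algebraMap_evT, map_mul, hQ, map_mul, map_mul]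
      exact mul_ne_zero hb'.ne_zero (mul_ne_zero hc'.ne_zero ht')
    · rw [← algebraMap_evT, ← algebraMap_evT, map_mul (evT E x y F), map_mul (evT E x y F), hP, hQ]
      simp only [map_mul]
      field_simp

omit h [IsFractionRing (E ⊗[F] K) L] in
lemma Over.comap_tensor {O : ValuationSubring L} (hO : Over E O) :
    Over F (O.comap ((algebraMap (E ⊗[F] K) L).comp
      (Algebra.TensorProduct.includeRight : K →ₐ[F] E ⊗[F] K).toRingHom)) := by
  intro c
  have := hO (algebraMap F E c)
  rw [ValuationSubring.mem_comap]
  rw [IsScalarTower.algebraMap_apply E (E ⊗[F] K) L] at this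
  simpa [Algebra.TensorProduct.tmul_one_eq_one_tmul] using this

omit h [IsFractionRing (E ⊗[F] K) L] in
lemma mem_finite_tensor {u : K} (hu : u ∈ finite F x) :
    algebraMap (E ⊗[F] K) L (1 ⊗ₜ u) ∈ finite E (algebraMap (E ⊗[F] K) L (1 ⊗ₜ x)) :=
  fun _ hO hx => hu _ (Over.comap_tensor hO) hx

omit h [IsFractionRing (E ⊗[F] K) L] in
lemma mem_infinite_tensor [Nontrivial (E ⊗[F] K)] {u : K} {n : ℕ} (hu : u ∈ infinite F x n) :
    algebraMap (E ⊗[F] K) L (1 ⊗ₜ u) ∈ infinite E (algebraMap (E ⊗[F] K) L (1 ⊗ₜ x)) n := by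
  intro O hO hx
  have := hu _ (Over.comap_tensor hO) hx
  rw [ValuationSubring.mem_comap, map_mul, map_pow, map_inv₀] at this
  exact this

variable (L) in
omit h in
/-- Base change of a family of functions with poles only at infinity. -/
lemma exists_family_baseChange [Nontrivial (E ⊗[F] K)] {n γ : ℕ} (hfam : ∃ (N : ℕ) (u : Fin N → K), LinearIndependent F u ∧
      n * d + 1 ≤ N + γ ∧ ∀ i, u i ∈ finite F x ⊓ infinite F x n) :
    ∃ (N : ℕ) (u : Fin N → L), LinearIndependent E u ∧ n * d + 1 ≤ N + γ ∧
      ∀ i, u i ∈ finite E (algebraMap (E ⊗[F] K) L (1 ⊗ₜ x)) ⊓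
        infinite E (algebraMap (E ⊗[F] K) L (1 ⊗ₜ x)) n := by
  obtain ⟨N, u, hu, hN, hmem⟩ := hfam
  refine ⟨N, fun i => algebraMap (E ⊗[F] K) L (1 ⊗ₜ u i), ?_, hN, fun i =>
    ⟨mem_finite_tensor (hmem i).1, mem_infinite_tensor (hmem i).2⟩⟩
  exact (Module.Flat.linearIndependent_one_tmul (S := E) hu).map'
    (IsScalarTower.toAlgHom E (E ⊗[F] K) L).toLinearMap
    (LinearMap.ker_eq_bot.2 (IsFractionRing.injective (E ⊗[F] K) L))

variable (g : K →ₐ[F] E)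

omit h in
/-- Evaluation at the point of the base change given by an embedding. -/
noncomputable def point (g : K →ₐ[F] E) : E ⊗[F] K →ₐ[E] E :=
  Algebra.TensorProduct.lift (AlgHom.id E E) g fun _ _ => Commute.all _ _

omit h in
@[simp] lemma point_tmul (e : E) (u : K) : point g (e ⊗ₜ u) = e * g u := by
  simp [point]

omit h in
lemma point_evT (P : E[X][Y]) : point g (evT E x y F P) = ev E (g x) (g y) P := by
  rw [evT, algHom_ev]; simp

omit [IsFractionRing (E ⊗[F] K) L] in
lemma mem_local_iff (u : L) :
    (∃ M N : E[X][Y], ev E (g x) (g y) M ≠ 0 ∧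
      u * ev E (algebraMap (E ⊗[F] K) L (1 ⊗ₜ x)) (algebraMap (E ⊗[F] K) L (1 ⊗ₜ y)) M =
      ev E (algebraMap (E ⊗[F] K) L (1 ⊗ₜ x)) (algebraMap (E ⊗[F] K) L (1 ⊗ₜ y)) N) ↔
    ∃ t s : E ⊗[F] K, point g t ≠ 0 ∧
      u * algebraMap (E ⊗[F] K) L t = algebraMap (E ⊗[F] K) L s := by
  constructor
  · rintro ⟨M, N, hM, e⟩
    refine ⟨evT E x y F M, evT E x y F N, by rwa [point_evT], ?_⟩
    rw [algebraMap_evT, algebraMap_evT, e]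
  · rintro ⟨t, s, ht, e⟩
    obtain ⟨b, P, hb, hP⟩ := h.exists_rep_tensor s
    obtain ⟨c, Q, hc, hQ⟩ := h.exists_rep_tensor t
    refine ⟨bmap F E (C b) * Q, bmap F E (C c) * P, ?_, ?_⟩
    · rw [← point_evT, map_mul, hQ, map_mul, map_mul]
      exact mul_ne_zero ((h.isUnit_evT hb).map (point g)).ne_zero
        (mul_ne_zero ((h.isUnit_evT hc).map (point g)).ne_zero ht)
    · rw [← algebraMap_evT, ← algebraMap_evT, map_mul (evT E x y F), map_mul (evT E x y F), hP, hQ]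
      simp only [map_mul]
      rw [← e]; ring

omit h [Algebra E L] [IsScalarTower E (E ⊗[F] K) L] in
lemma not_mem_local_of_ne {g g' : K →ₐ[F] E} (hne : g ≠ g') :
    ∃ u : L, (∃ t s : E ⊗[F] K, point g' t ≠ 0 ∧
        u * algebraMap (E ⊗[F] K) L t = algebraMap (E ⊗[F] K) L s) ∧
      ¬ ∃ t s : E ⊗[F] K, point g t ≠ 0 ∧
        u * algebraMap (E ⊗[F] K) L t = algebraMap (E ⊗[F] K) L s := by
  obtain ⟨v, hv⟩ := DFunLike.ne_iff.1 hne
  let z : E ⊗[F] K := 1 ⊗ₜ v - g v ⊗ₜ 1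
  have hz : point g z = 0 := by simp [z]
  have hz' : point g' z ≠ 0 := by simpa [z, sub_eq_zero] using hv.symm
  have hz0 : algebraMap (E ⊗[F] K) L z ≠ 0 := by
    rw [Ne, map_eq_zero_iff _ (IsFractionRing.injective (E ⊗[F] K) L)]
    rintro h0
    rw [h0, map_zero] at hz'
    exact hz' rfl
  refine ⟨(algebraMap (E ⊗[F] K) L z)⁻¹, ⟨z, 1, hz', by rw [inv_mul_cancel₀ hz0, map_one]⟩, ?_⟩
  rintro ⟨t, s, ht, e⟩
  rw [inv_mul_eq_iff_eq_mul₀ hz0, ← map_mul] at e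
  rw [IsFractionRing.injective (E ⊗[F] K) L e, map_mul, hz, zero_mul] at ht
  exact ht rfl

variable (E L) in
omit h in
/-- Extension of scalars of a group of automorphisms. -/
noncomputable def extend {Γ : Type*} [Group Γ] (φ : Γ →* (K ≃ₐ[F] K)) : Γ →* (L ≃ₐ[E] L) where
  toFun g := IsFractionRing.fieldEquivOfAlgEquiv E L L
    (Algebra.TensorProduct.congr (AlgEquiv.refl : E ≃ₐ[E] E) (φ g))
  map_one' := by
    ext u
    obtain ⟨s, t, ht, rfl⟩ := IsFractionRing.div_surjective (E ⊗[F] K) u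
    have h1 : ∀ s : E ⊗[F] K,
        Algebra.TensorProduct.congr (AlgEquiv.refl : E ≃ₐ[E] E) (φ 1) s = s := by
      intro s
      induction s using TensorProduct.induction_on with
      | zero => simp
      | tmul e u => simp
      | add s t hs ht => rw [map_add, hs, ht]
    rw [AlgEquiv.one_apply]
    simp only [map_div₀, IsFractionRing.fieldEquivOfAlgEquiv_algebraMap, h1]
  map_mul' a b := by
    ext u
    obtain ⟨s, t, ht, rfl⟩ := IsFractionRing.div_surjective (E ⊗[F] K) u
    have h1 : ∀ s : E ⊗[F] K, Algebra.TensorProduct.congr (AlgEquiv.refl : E ≃ₐ[E] E) (φ (a * b)) s =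
        Algebra.TensorProduct.congr (AlgEquiv.refl : E ≃ₐ[E] E) (φ a)
          (Algebra.TensorProduct.congr (AlgEquiv.refl : E ≃ₐ[E] E) (φ b) s) := by
      intro s
      induction s using TensorProduct.induction_on with
      | zero => simp
      | tmul e u => simp
      | add s t hs ht => rw [map_add, map_add, map_add, hs, ht]
    rw [AlgEquiv.mul_apply]
    simp only [map_div₀, IsFractionRing.fieldEquivOfAlgEquiv_algebraMap, h1]

omit h in
lemma extend_algebraMap {Γ : Type*} [Group Γ] (φ : Γ →* (K ≃ₐ[F] K)) (a : Γ) (s : E ⊗[F] K) :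
    extend E L φ a (algebraMap (E ⊗[F] K) L s) = algebraMap (E ⊗[F] K) L
      (Algebra.TensorProduct.congr (AlgEquiv.refl : E ≃ₐ[E] E) (φ a) s) :=
  IsFractionRing.fieldEquivOfAlgEquiv_algebraMap ..

omit h in
lemma point_comp (a : K ≃ₐ[F] K) (s : E ⊗[F] K) :
    point (g.comp (a : K →ₐ[F] K)) s =
      point g (Algebra.TensorProduct.congr (AlgEquiv.refl : E ≃ₐ[E] E) a s) := by
  induction s using TensorProduct.induction_on with
  | zero => simp
  | tmul e u => simp
  | add s t hs ht => rw [map_add, map_add, map_add, hs, ht]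

omit h in
lemma mem_local_comp {Γ : Type*} [Group Γ] (φ : Γ →* (K ≃ₐ[F] K)) (a : Γ) (u : L) :
    (∃ t s : E ⊗[F] K, point (g.comp (φ a : K →ₐ[F] K)) t ≠ 0 ∧
      u * algebraMap (E ⊗[F] K) L t = algebraMap (E ⊗[F] K) L s) ↔
    ∃ t s : E ⊗[F] K, point g t ≠ 0 ∧
      extend E L φ a u * algebraMap (E ⊗[F] K) L t = algebraMap (E ⊗[F] K) L s := by
  have key : ∀ t s : E ⊗[F] K, (u * algebraMap (E ⊗[F] K) L t = algebraMap (E ⊗[F] K) L s ↔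
      extend E L φ a u * algebraMap (E ⊗[F] K) L
        (Algebra.TensorProduct.congr (AlgEquiv.refl : E ≃ₐ[E] E) (φ a) t) =
      algebraMap (E ⊗[F] K) L
        (Algebra.TensorProduct.congr (AlgEquiv.refl : E ≃ₐ[E] E) (φ a) s)) := by
    intro t s
    rw [← extend_algebraMap, ← extend_algebraMap, ← map_mul, (extend E L φ a).injective.eq_iff]
  constructor
  · rintro ⟨t, s, ht, e⟩
    exact ⟨_, _, by rwa [← point_comp], (key t s).1 e⟩
  · rintro ⟨t, s, ht, e⟩
    obtain ⟨t, rfl⟩ := (Algebra.TensorProduct.congr (AlgEquiv.refl : E ≃ₐ[E] E) (φ a)).surjective t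
    obtain ⟨s, rfl⟩ := (Algebra.TensorProduct.congr (AlgEquiv.refl : E ≃ₐ[E] E) (φ a)).surjective s
    exact ⟨t, s, by rwa [point_comp], (key t s).2 e⟩

end BaseChange
end Curve
end CremonaRank

namespace CremonaRank
open Polynomial Bivariate

section Points
variable {F K : Type*} [Field F] [Field K] [Algebra F K]

/-- A rational smooth point of a curve, viewed as a valuation ring, at which `x` is regular. -/
structure IsPoint (F : Type*) {K : Type*} [Field F] [Field K] [Algebra F K] (x : K)
    (O : ValuationSubring K) : Prop where
  isOver : Over F O
  mem : x ∈ O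
  res : ∀ u ∈ O, ∃ c : F, O.valuation (u - algebraMap F K c) < 1
  unif : ∃ ϖ : K, ϖ ≠ 0 ∧ O.valuation ϖ < 1 ∧ (∀ u, O.valuation u < 1 → ∃ v ∈ O, u = ϖ * v) ∧
    ∃ f : K, ϖ * f ∈ O ∧ f ∉ O ∧ ∀ O', Over F O' → x ∈ O' → O' ≠ O → f ∈ O'

lemma exists_taylor (s t : F) (B : F[X][Y]) : ∃ B₁ B₂ : F[X][Y],
    B = C (C (ev F s t B)) + C (X - C s) * B₁ + (Y - C (C t)) * B₂ := by
  obtain ⟨B₂, h2⟩ := X_sub_C_dvd_sub_C_eval (p := B) (a := C t)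
  obtain ⟨b, h1⟩ := X_sub_C_dvd_sub_C_eval (p := B.eval (C t)) (a := s)
  have h3 : ev F s t B = (B.eval (C t)).eval s := by
    have : ∀ B : F[X][Y], ev F s t B = (B.eval (C t)).eval s := by
      intro B
      induction B using Polynomial.induction_on' with
      | add P Q hP hQ => rw [map_add, hP, hQ, eval_add, eval_add]
      | monomial j c =>
        rw [← C_mul_X_pow_eq_monomial, map_mul, map_pow, ev_C, ev_Y]
        simp [aeval_def, eval₂_eq_eval_map]
    exact this B
  refine ⟨C b, B₂, ?_⟩
  have h1' : B.eval (C t) = C (ev F s t B) + (X - C s) * b := by rw [h3, ← h1]; ring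
  have h2' : B = C (B.eval (C t)) + (Y - C (C t)) * B₂ := by rw [← h2]; ring
  conv_lhs => rw [h2', h1']
  simp only [map_add, map_mul]

namespace Curve
variable {x y : K} {d : ℕ} {Φ : F[X][Y]} (h : Curve F x y d Φ)
  {s t : F} (h0 : ev F s t Φ = 0)
include h h0

lemma ev_eq_of_ev {M N : F[X][Y]} (e : ev F x y M = ev F x y N) : ev F s t M = ev F s t N := by
  rw [← sub_eq_zero, ← map_sub, h.ker] at e
  obtain ⟨Q, hQ⟩ := e
  rw [← sub_eq_zero, ← map_sub, hQ, map_mul, h0, zero_mul]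

/-- Local expansion at a smooth point. -/
lemma exists_psi : ∃ Ψ Φ₁ : F[X][Y], ev F s t Ψ = ev F s t (derivative Φ) ∧
    (y - algebraMap F K t) * ev F x y Ψ = (x - algebraMap F K s) * ev F x y Φ₁ := by
  obtain ⟨Φ₁, Ψ, e⟩ := exists_taylor s t Φ
  rw [h0] at e
  refine ⟨Ψ, -Φ₁, ?_, ?_⟩
  · conv_rhs => rw [e]
    simp
  · have := (h.ker Φ).2 dvd_rfl
    rw [e] at this
    simp only [map_add, map_mul, map_sub, ev_C, ev_Y, map_zero, zero_add, aeval_X, aeval_C] at this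
    rw [map_neg]
    linear_combination this

lemma exists_factor (h1 : ev F s t (derivative Φ) ≠ 0) {B : F[X][Y]} (hB : ev F x y B ≠ 0) :
    ∃ (n : ℕ) (M N : F[X][Y]), ev F s t M ≠ 0 ∧ ev F s t N ≠ 0 ∧
      ev F x y B * ev F x y M = (x - algebraMap F K s) ^ n * ev F x y N := by
  obtain ⟨Ψ, Φ₁, hΨ, hrel⟩ := h.exists_psi h0
  by_contra hcon
  push Not at hcon
  have key : ∀ n, ∃ M N : F[X][Y], ev F s t M ≠ 0 ∧
      ev F x y B * ev F x y M = (x - algebraMap F K s) ^ n * ev F x y N := by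
    intro n
    induction n with
    | zero => exact ⟨1, B, by simp, by simp⟩
    | succ n ih =>
      obtain ⟨M, N, hM, e⟩ := ih
      have hN : ev F s t N = 0 := by
        by_contra hN
        exact hcon n M N hM hN e
      obtain ⟨N₁, N₂, e'⟩ := exists_taylor s t N
      rw [hN] at e'
      refine ⟨M * Ψ, N₁ * Ψ + N₂ * Φ₁, ?_, ?_⟩
      · rw [map_mul, hΨ]; exact mul_ne_zero hM h1
      · have e2 : ev F x y N = (x - algebraMap F K s) * ev F x y N₁ +
            (y - algebraMap F K t) * ev F x y N₂ := by
          conv_lhs => rw [e']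
          simp
        rw [map_mul, ← mul_assoc, e, e2]
        simp only [map_add, map_mul]
        linear_combination (x - algebraMap F K s) ^ n * ev F x y N₂ * hrel
  obtain ⟨b, C', hb, -, hC⟩ := h.exists_rep (ev F x y B)⁻¹
  obtain ⟨c, hc, hcs⟩ := exists_eq_pow_rootMultiplicity_mul_and_not_dvd b hb s
  obtain ⟨M, N, hM, e⟩ := key (rootMultiplicity s b + 1)
  have hxs : x - algebraMap F K s ≠ 0 := by
    have := h.aeval_ne_zero (X_sub_C_ne_zero s)
    simpa using this
  have e1 : ev F x y (C c * M) = ev F x y (C (X - C s) * N * C') := by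
    have hC' : aeval x b = ev F x y B * ev F x y C' := by
      rw [← hC]; field_simp
    rw [hc] at hC'
    simp only [map_mul, map_pow, map_sub, aeval_X, aeval_C, ev_C] at hC' ⊢
    have hp : (x - algebraMap F K s) ^ rootMultiplicity s b ≠ 0 := pow_ne_zero _ hxs
    apply mul_left_cancel₀ hp
    rw [pow_succ] at e
    linear_combination ev F x y M * hC' + ev F x y C' * e
  have e2 := h.ev_eq_of_ev h0 e1
  simp only [map_mul, ev_C, map_sub, aeval_X, aeval_C, Algebra.algebraMap_self, RingHom.id_apply, sub_self,
    zero_mul] at e2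
  rcases mul_eq_zero.1 e2 with e3 | e3
  · apply hcs
    rw [dvd_iff_isRoot, IsRoot, ← coe_aeval_eq_eval]; exact e3
  · exact hM e3

/-- The local ring of a smooth rational point. -/
lemma exists_isPoint (h1 : ev F s t (derivative Φ) ≠ 0) : ∃ O : ValuationSubring K, IsPoint F x O ∧
    ∀ u, u ∈ O ↔ ∃ M N : F[X][Y], ev F s t M ≠ 0 ∧ u * ev F x y M = ev F x y N := by
  have hne : ∀ {M : F[X][Y]}, ev F s t M ≠ 0 → ev F x y M ≠ 0 := by
    intro M hM hM'
    have := h.ev_eq_of_ev h0 (N := 0) (hM'.trans (map_zero _).symm)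
    exact hM (this.trans (map_zero _))
  have hxs : x - algebraMap F K s ≠ 0 := by
    have := h.aeval_ne_zero (X_sub_C_ne_zero s)
    simpa using this
  have hxs' : x - algebraMap F K s = ev F x y (C (X - C s)) := by simp
  have hxs0 : ev F s t (C (X - C s)) = 0 := by simp
  let S : Set K := {u | ∃ M N : F[X][Y], ev F s t M ≠ 0 ∧ u * ev F x y M = ev F x y N}
  let O : ValuationSubring K :=
    { carrier := S
      mul_mem' := by
        rintro u v ⟨M, N, hM, e⟩ ⟨M', N', hM', e'⟩
        exact ⟨M * M', N * N', by rw [map_mul]; exact mul_ne_zero hM hM', by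
          rw [map_mul, map_mul, ← e, ← e']; ring⟩
      one_mem' := ⟨1, 1, by simp, by simp⟩
      add_mem' := by
        rintro u v ⟨M, N, hM, e⟩ ⟨M', N', hM', e'⟩
        exact ⟨M * M', N * M' + N' * M, by rw [map_mul]; exact mul_ne_zero hM hM', by
          rw [map_mul, map_add, map_mul, map_mul, ← e, ← e']; ring⟩
      zero_mem' := ⟨1, 0, by simp, by simp⟩
      neg_mem' := by
        rintro u ⟨M, N, hM, e⟩
        exact ⟨M, -N, hM, by rw [neg_mul, e, map_neg]⟩
      mem_or_inv_mem' := by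
        intro u
        by_cases hu : u = 0
        · left; exact ⟨1, 0, by simp, by simp [hu]⟩
        obtain ⟨a, b, hb, e⟩ := h.frac u
        have ha : ev F x y a ≠ 0 := by rw [← e]; exact mul_ne_zero hu hb
        obtain ⟨n, M, N, hM, hN, eN⟩ := h.exists_factor h0 h1 ha
        obtain ⟨n', M', N', hM', hN', eN'⟩ := h.exists_factor h0 h1 hb
        have e4 : u * (x - algebraMap F K s) ^ n' * ev F x y (N' * M) =
            (x - algebraMap F K s) ^ n * ev F x y (N * M') := by
          rw [map_mul, map_mul]
          linear_combination ev F x y M' * eN - u * ev F x y M * eN' + ev F x y M * ev F x y M' * e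
        rcases le_total n' n with hn | hn
        · left
          refine ⟨N' * M, C (X - C s) ^ (n - n') * (N * M'), by
            rw [map_mul]; exact mul_ne_zero hN' hM, ?_⟩
          apply mul_left_cancel₀ (pow_ne_zero n' hxs)
          rw [map_mul _ (C (X - C s) ^ (n - n')), map_pow, ← hxs', ← mul_assoc, ← mul_assoc, ← pow_add,
            Nat.add_sub_cancel' hn, ← e4]
          ring
        · right
          refine ⟨N * M', C (X - C s) ^ (n' - n) * (N' * M), by
            rw [map_mul]; exact mul_ne_zero hN hM', ?_⟩
          apply mul_left_cancel₀ (pow_ne_zero n hxs)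
          apply mul_left_cancel₀ hu
          rw [map_mul _ (C (X - C s) ^ (n' - n)), map_pow, ← hxs', ← mul_assoc _ (_ ^ (n' - n)), ← pow_add,
            Nat.add_sub_cancel' hn, ← mul_assoc u (_ ^ n'), e4]
          field_simp }
  have hO : ∀ u, u ∈ O ↔ ∃ M N : F[X][Y], ev F s t M ≠ 0 ∧ u * ev F x y M = ev F x y N :=
    fun u => Iff.rfl
  have hev : ∀ N, ev F x y N ∈ O := fun N => ⟨1, N, by simp, by simp⟩
  have hover : Over F O := fun c => by simpa using hev (C (C c))
  have hval : ∀ B, ev F s t B = 0 → O.valuation (ev F x y B) < 1 := by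
    intro B hB
    refine lt_of_le_of_ne ((O.valuation_le_one_iff _).2 (hev _)) fun h1 => ?_
    have hB0 : ev F x y B ≠ 0 := by rintro h2; rw [h2, map_zero] at h1; exact zero_ne_one h1
    have h2 : (ev F x y B)⁻¹ ∈ O := by
      rw [← O.valuation_le_one_iff, map_inv₀, h1, inv_one]
    obtain ⟨M, N, hM, e⟩ := h2
    rw [inv_mul_eq_iff_eq_mul₀ hB0, ← map_mul] at e
    apply hM
    rw [h.ev_eq_of_ev h0 e, map_mul, hB, zero_mul]
  have hϖ : O.valuation (x - algebraMap F K s) < 1 := hxs' ▸ hval _ hxs0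
  have hunit : ∀ M, ev F s t M ≠ 0 → (ev F x y M)⁻¹ ∈ O := fun M hM =>
    ⟨M, 1, hM, by rw [inv_mul_cancel₀ (hne hM), map_one]⟩
  obtain ⟨Ψ, Φ₁, hΨ, hrel⟩ := h.exists_psi h0
  have hloc : ∀ u, O.valuation u < 1 → ∃ v ∈ O, u = (x - algebraMap F K s) * v := by
    intro u hu
    obtain ⟨M, N, hM, e⟩ := (hO u).1 ((O.valuation_le_one_iff _).1 hu.le)
    have hN : ev F s t N = 0 := by
      by_contra hN
      have h3 : u * (ev F x y M * (ev F x y N)⁻¹) = 1 := by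
        rw [← mul_assoc, e, mul_inv_cancel₀ (hne hN)]
      have h4 := congrArg O.valuation h3
      rw [map_mul, map_one] at h4
      have h5 := (O.valuation_le_one_iff _).2 (O.mul_mem _ _ (hev M) (hunit N hN))
      exact absurd h4 (mul_lt_one_of_lt_of_le hu h5).ne
    obtain ⟨N₁, N₂, e'⟩ := exists_taylor s t N
    rw [hN] at e'
    have e2 : ev F x y N = (x - algebraMap F K s) * ev F x y N₁ +
        (y - algebraMap F K t) * ev F x y N₂ := by
      conv_lhs => rw [e']
      simp
    refine ⟨ev F x y (N₁ * Ψ + N₂ * Φ₁) * ((ev F x y M)⁻¹ * (ev F x y Ψ)⁻¹),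
      O.mul_mem _ _ (hev _) (O.mul_mem _ _ (hunit M hM) (hunit Ψ (hΨ ▸ h1))), ?_⟩
    have hM' := hne hM
    have hΨ' : ev F x y Ψ ≠ 0 := hne (hΨ ▸ h1)
    field_simp
    rw [e, e2, map_add, map_mul, map_mul]
    linear_combination ev F x y N₂ * hrel
  refine ⟨O, ⟨hover, by simpa using hev (C X), ?_, x - algebraMap F K s, hxs, hϖ, hloc,
    ev F x y Ψ * (x - algebraMap F K s)⁻¹, ?_, ?_, ?_⟩, hO⟩
  · rintro u ⟨M, N, hM, e⟩
    refine ⟨ev F s t N / ev F s t M, ?_⟩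
    have e1 : u - algebraMap F K (ev F s t N / ev F s t M) =
        ev F x y (N - C (C (ev F s t N / ev F s t M)) * M) * (ev F x y M)⁻¹ := by
      rw [eq_mul_inv_iff_mul_eq₀ (hne hM), map_sub, map_mul, ev_CC, ← e]; ring
    rw [e1, map_mul]
    refine mul_lt_one_of_lt_of_le (hval _ ?_) ((O.valuation_le_one_iff _).2 (hunit M hM))
    rw [map_sub, map_mul, ev_CC, Algebra.algebraMap_self, RingHom.id_apply, div_mul_cancel₀ _ hM, sub_self]
  · rw [mul_left_comm, mul_inv_cancel₀ hxs, mul_one]; exact hev _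
  · intro hf
    have h3 := O.mul_mem _ _ hf (hunit Ψ (hΨ ▸ h1))
    have h4 : O.valuation ((x - algebraMap F K s) * (ev F x y Ψ * (x - algebraMap F K s)⁻¹ *
        (ev F x y Ψ)⁻¹)) < 1 := by
      rw [map_mul]
      exact mul_lt_one_of_lt_of_le hϖ ((O.valuation_le_one_iff _).2 h3)
    have hΨ' : ev F x y Ψ ≠ 0 := hne (hΨ ▸ h1)
    have h5 : (x - algebraMap F K s) * (ev F x y Ψ * (x - algebraMap F K s)⁻¹ *
        (ev F x y Ψ)⁻¹) = 1 := by field_simp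
    rw [h5, map_one] at h4
    exact lt_irrefl _ h4
  · intro O' hO' hx hOO'
    by_contra hf
    apply hOO'
    have hev' : ∀ N, ev F x y N ∈ O' := fun N => hO'.ev_mem hx (h.y_mem hO' hx) N
    have hlt : ∀ {u v : K}, u ∈ O' → v ∈ O' → u * (ev F x y Ψ * (x - algebraMap F K s)⁻¹) = v →
        O'.valuation u < 1 := by
      intro u v hu hv e
      refine lt_of_le_of_ne ((O'.valuation_le_one_iff _).2 hu) fun h1 => hf ?_
      have hu0 : u ≠ 0 := by rintro rfl; rw [map_zero] at h1; exact zero_ne_one h1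
      rw [← eq_inv_mul_iff_mul_eq₀ hu0] at e
      rw [e]
      refine O'.mul_mem _ _ ?_ hv
      rw [← O'.valuation_le_one_iff, map_inv₀, h1, inv_one]
    have hx1 : O'.valuation (x - algebraMap F K s) < 1 :=
      hlt (hxs' ▸ hev' _) (hev' Ψ) (by field_simp)
    have hy1 : O'.valuation (y - algebraMap F K t) < 1 :=
      hlt (by have := hev' (Y - C (C t)); rwa [map_sub, ev_Y, ev_CC] at this) (hev' Φ₁) (by rw [← mul_assoc, hrel]; field_simp)
    have hunit' : ∀ M, ev F s t M ≠ 0 → (ev F x y M)⁻¹ ∈ O' := by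
      intro M hM
      rw [← O'.valuation_le_one_iff, map_inv₀]
      refine inv_le_one_of_one_le₀ (not_lt.1 fun hlt => ?_)
      obtain ⟨M₁, M₂, e'⟩ := exists_taylor s t M
      have e2 : algebraMap F K (ev F s t M) = ev F x y M - ((x - algebraMap F K s) * ev F x y M₁ +
          (y - algebraMap F K t) * ev F x y M₂) := by
        conv_rhs => rw [e']
        simp only [map_add, map_mul, map_sub, ev_C, ev_Y, aeval_X, aeval_C]
        ring
      have h3 : O'.valuation (algebraMap F K (ev F s t M)) < 1 := by
        rw [e2]
        refine (O'.valuation.map_sub _ _).trans_lt (max_lt hlt ?_)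
        refine (O'.valuation.map_add _ _).trans_lt (max_lt ?_ ?_)
        · rw [map_mul]
          exact mul_lt_one_of_lt_of_le hx1 ((O'.valuation_le_one_iff _).2 (hev' _))
        · rw [map_mul]
          exact mul_lt_one_of_lt_of_le hy1 ((O'.valuation_le_one_iff _).2 (hev' _))
      have h4 := (O'.valuation_le_one_iff _).2 (hO' (ev F s t M)⁻¹)
      have h5 := mul_lt_one_of_lt_of_le h3 h4
      rw [← map_mul, ← map_mul, mul_inv_cancel₀ hM, map_one, map_one] at h5
      exact lt_irrefl _ h5
    have hle : ∀ u ∈ O, u ∈ O' := by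
      rintro u ⟨M, N, hM, e⟩
      rw [← eq_mul_inv_iff_mul_eq₀ (hne hM)] at e
      rw [e]
      exact O'.mul_mem _ _ (hev' _) (hunit' M hM)
    refine le_antisymm (fun u hu => ?_) hle
    by_contra huO
    have hu0 : u ≠ 0 := by rintro rfl; exact huO O.zero_mem
    have h3 : O.valuation u⁻¹ < 1 := by
      rw [map_inv₀]
      exact inv_lt_one_of_one_lt₀ (not_le.1 fun hle => huO ((O.valuation_le_one_iff _).1 hle))
    obtain ⟨v, hv, e⟩ := hloc _ h3
    have h4 : O'.valuation ((x - algebraMap F K s) * v * u) < 1 := by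
      rw [mul_assoc, map_mul]
      exact mul_lt_one_of_lt_of_le hx1 ((O'.valuation_le_one_iff _).2 (O'.mul_mem _ _ (hle v hv) hu))
    rw [← e, inv_mul_cancel₀ hu0, map_one] at h4
    exact lt_irrefl _ h4

end Curve
end Points
end CremonaRank

namespace CremonaRank
open Polynomial Bivariate

section Divisors
variable {F K : Type*} [Field F] [Field K] [Algebra F K]

lemma rank_le_add_of_combination {W S : Submodule F K} {d : ℕ}
    (h : ∀ w : Fin (d + 1) → K, (∀ i, w i ∈ W) → ∃ c : Fin (d + 1) → F, c ≠ 0 ∧ ∑ i, c i • w i ∈ S) :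
    Module.rank F W ≤ d + Module.rank F (W ⊓ S : Submodule F K) := by
  let f := S.mkQ.comp W.subtype
  rw [← LinearMap.rank_range_add_rank_ker f]
  refine add_le_add ?_ ?_
  · refine rank_le fun s hs => ?_
    by_contra hlt
    obtain ⟨t, ht, hcard⟩ := Finset.exists_subset_card_eq (Nat.succ_le_of_lt (not_le.1 hlt))
    let e := (t.equivFinOfCardEq hcard).symm
    choose w hw using fun i : Fin (d + 1) => ((e i : t) : LinearMap.range f).2
    obtain ⟨c, hc, hcS⟩ := h (fun i => w i) fun i => (w i).2
    apply hc
    have hli : LinearIndependent F fun i : Fin (d + 1) => ((e i : t) : LinearMap.range f) :=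
      hs.comp (fun i => (⟨e i, ht (e i).2⟩ : s)) fun i j hij => e.injective (Subtype.ext (by
        simpa using hij))
    refine funext (Fintype.linearIndependent_iff.1 hli c ?_)
    apply Subtype.ext
    rw [Submodule.coe_sum, ZeroMemClass.coe_zero]
    have : S.mkQ (∑ i, c i • (w i : K)) = 0 := (Submodule.Quotient.mk_eq_zero _).2 hcS
    rw [map_sum] at this
    rw [← this]
    refine Finset.sum_congr rfl fun i _ => ?_
    rw [Submodule.coe_smul, ← hw, map_smul]; rfl
  · let g : LinearMap.ker f →ₗ[F] (W ⊓ S : Submodule F K) :=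
      { toFun := fun u => ⟨((u : W) : K), (u : W).2, (Submodule.Quotient.mk_eq_zero _).1 u.2⟩
        map_add' := fun _ _ => rfl
        map_smul' := fun _ _ => rfl }
    exact LinearMap.rank_le_of_injective g fun u v huv => Subtype.ext (Subtype.ext (congrArg
      (fun z : (W ⊓ S : Submodule F K) => (z : K)) huv))

open Classical in
/-- The functions whose poles at a place are bounded by a divisor. -/
def Bdd (D : Multiset (ValuationSubring K)) (O : ValuationSubring K) (u : K) : Prop :=
  ∀ ϖ, O.valuation ϖ < 1 → ϖ ^ D.count O * u ∈ O

section
variable {D : Multiset (ValuationSubring K)} {O : ValuationSubring K} {u v : K}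

lemma Bdd.add (hu : Bdd D O u) (hv : Bdd D O v) : Bdd D O (u + v) := fun ϖ h => by
  rw [mul_add]; exact O.add_mem _ _ (hu ϖ h) (hv ϖ h)

lemma Bdd.zero : Bdd D O 0 := fun _ _ => by rw [mul_zero]; exact O.zero_mem

lemma Bdd.of_mem (hu : u ∈ O) : Bdd D O u := fun _ h =>
  O.mul_mem _ _ (pow_mem ((O.valuation_le_one_iff _).1 h.le) _) hu

lemma Bdd.smul (hO : Over F O) (c : F) (hu : Bdd D O u) : Bdd D O (c • u) := fun ϖ h => by
  rw [mul_smul_comm]; exact hO.smul_mem c (hu ϖ h)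

lemma Bdd.mul {D' : Multiset (ValuationSubring K)} (hu : Bdd D O u) (hv : Bdd D' O v) :
    Bdd (D + D') O (u * v) := fun ϖ h => by
  classical
  rw [Multiset.count_add, pow_add, mul_mul_mul_comm]; exact O.mul_mem _ _ (hu ϖ h) (hv ϖ h)

lemma Bdd.mono {D' : Multiset (ValuationSubring K)} (hu : Bdd D O u) (hD : D ≤ D') : Bdd D' O u := by
  obtain ⟨D'', rfl⟩ := Multiset.le_iff_exists_add.1 hD
  simpa using hu.mul (Bdd.of_mem (D := D'') O.one_mem)

lemma Bdd.mem (hD : O ∉ D) (hu : Bdd D O u) : u ∈ O := by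
  classical
  have := hu 0 (by simp)
  rwa [Multiset.count_eq_zero.2 hD, pow_zero, one_mul] at this

end

variable (F) in
/-- The Riemann–Roch space of a divisor. -/
def rr (D : Multiset (ValuationSubring K)) : Submodule F K where
  carrier := {u | ∀ O, Over F O → Bdd D O u}
  add_mem' hu hv O hO := (hu O hO).add (hv O hO)
  zero_mem' _ _ := Bdd.zero
  smul_mem' c _ hu O hO := (hu O hO).smul hO c

variable (F) in
/-- The elements with poles over the affine line bounded by a divisor. -/
def finRR (x : K) (D : Multiset (ValuationSubring K)) : Submodule F K where
  carrier := {u | ∀ O, Over F O → x ∈ O → Bdd D O u}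
  add_mem' hu hv O hO hx := (hu O hO hx).add (hv O hO hx)
  zero_mem' _ _ _ := Bdd.zero
  smul_mem' c _ hu O hO hx := (hu O hO hx).smul hO c

lemma rr_mono {D D' : Multiset (ValuationSubring K)} (h : D ≤ D') : rr F D ≤ rr F D' :=
  fun _ hu O hO => (hu O hO).mono h

lemma mul_mem_rr {D D' : Multiset (ValuationSubring K)} {u v : K} (hu : u ∈ rr F D)
    (hv : v ∈ rr F D') : u * v ∈ rr F (D + D') := fun O hO => (hu O hO).mul (hv O hO)

lemma algebraMap_mem_rr (D : Multiset (ValuationSubring K)) (c : F) : algebraMap F K c ∈ rr F D :=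
  fun _ hO => Bdd.of_mem (hO c)

lemma finRR_inf_le {x : K} {D : Multiset (ValuationSubring K)} :
    finRR F x D ⊓ infinite F x 0 ≤ rr F D := by
  rintro u ⟨h1, h2⟩ O hO
  by_cases hx : x ∈ O
  · exact h1 O hO hx
  · exact Bdd.of_mem (by simpa using h2 O hO hx)

namespace IsPoint
variable {x : K} {O : ValuationSubring K} (hO : IsPoint F x O)
include hO

lemma eq_algebraMap {u : K} (hu : IsIntegral F u) : ∃ c : F, algebraMap F K c = u := by
  have hmem : ∀ z : K, IsIntegral F z → z ∈ O := by
    rintro z ⟨P, hP, h0⟩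
    refine mem_of_monic (P := P.map (algebraMap F K)) (hP.map _) (fun i => ?_) ?_
    · rw [coeff_map]; exact hO.isOver _
    · rwa [eval_map]
  obtain ⟨c, hc⟩ := hO.res u (hmem u hu)
  refine ⟨c, ?_⟩
  by_contra hne
  have hz : IsIntegral F (u - algebraMap F K c) := hu.sub isIntegral_algebraMap
  have h2 := hmem _ hz.inv
  have h0 : u - algebraMap F K c ≠ 0 := sub_ne_zero.2 (Ne.symm hne)
  have h3 := mul_lt_one_of_lt_of_le hc ((O.valuation_le_one_iff _).2 h2)
  rw [← map_mul, mul_inv_cancel₀ h0, map_one] at h3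
  exact lt_irrefl _ h3

lemma exists_of_mem_rr_zero {u : K} (hu : u ∈ rr F (0 : Multiset (ValuationSubring K))) :
    ∃ c : F, algebraMap F K c = u := by
  apply hO.eq_algebraMap
  have h1 : u ∈ (⨅ V : {V : ValuationSubring K // Set.range (algebraMap F K) ⊆ V.toSubring},
      V.1.toSubring) := by
    rw [Subring.mem_iInf]
    rintro ⟨V, hV⟩
    exact (hu V fun c => hV ⟨c, rfl⟩).mem (by simp)
  rw [iInf_valuationSubring_superset] at h1
  obtain ⟨P, hP, h0⟩ := h1
  have hcl : ∀ z : Subring.closure (Set.range (algebraMap F K)), ∃ c : F, algebraMap F K c = z := by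
    rintro ⟨z, hz⟩
    have : Subring.closure (Set.range (algebraMap F K)) ≤ (algebraMap F K).range :=
      Subring.closure_le.2 fun _ h => h
    exact this hz
  have hl : P.map (algebraMap _ K) ∈ Polynomial.lifts (algebraMap F K) := by
    rw [Polynomial.lifts_iff_coeff_lifts]
    intro i
    rw [coeff_map]
    exact hcl _
  obtain ⟨Q, hQ, -, hQm⟩ := Polynomial.lifts_and_degree_eq_and_monic hl (hP.map _)
  exact ⟨Q, hQm, by rw [eval₂_eq_eval_map, hQ, eval_map]; exact h0⟩

lemma finrank_zero : Module.finrank F (rr F (0 : Multiset (ValuationSubring K))) = 1 := by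
  have : rr F (0 : Multiset (ValuationSubring K)) = F ∙ (1 : K) := by
    ext u
    rw [Submodule.mem_span_singleton]
    constructor
    · intro hu
      obtain ⟨c, rfl⟩ := hO.exists_of_mem_rr_zero hu
      exact ⟨c, by rw [Algebra.smul_def, mul_one]⟩
    · rintro ⟨c, rfl⟩
      rw [Algebra.smul_def, mul_one]; exact algebraMap_mem_rr _ _
  rw [this]; exact finrank_span_singleton one_ne_zero

omit hO [Field F] [Algebra F K] in
lemma bdd_iff {D : Multiset (ValuationSubring K)} {u ϖ : K} (hϖ : O.valuation ϖ < 1)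
    (hloc : ∀ u, O.valuation u < 1 → ∃ v ∈ O, u = ϖ * v) [DecidableEq (ValuationSubring K)] :
    Bdd D O u ↔ ϖ ^ D.count O * u ∈ O := by
  constructor
  · intro h
    convert h ϖ hϖ
  · intro h z hz
    obtain ⟨v, hv, rfl⟩ := hloc z hz
    rw [mul_pow, mul_assoc, mul_left_comm]
    refine O.mul_mem _ _ (pow_mem hv _) ?_
    convert h

lemma rank_cons_le (D : Multiset (ValuationSubring K)) :
    Module.rank F (rr F (O ::ₘ D)) ≤ 1 + Module.rank F (rr F D) := by
  classical
  have hle : rr F D ≤ rr F (O ::ₘ D) := rr_mono (Multiset.le_cons_self D O)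
  have := rank_le_add_of_combination (W := rr F (O ::ₘ D)) (S := rr F D) (d := 1) ?_
  · rwa [inf_eq_right.2 hle, Nat.cast_one] at this
  intro w hw
  obtain ⟨ϖ, hϖ0, hϖ, hloc, -⟩ := hO.unif
  have h1 : ∀ i, ϖ ^ (D.count O + 1) * w i ∈ O := by
    intro i
    have := (bdd_iff hϖ hloc).1 (hw i O hO.isOver)
    rwa [Multiset.count_cons_self] at this
  choose c hc using fun i => hO.res _ (h1 i)
  have key : ∀ a : Fin 2 → F, O.valuation (ϖ ^ (D.count O + 1) * ∑ i, a i • w i) < 1 →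
      ∑ i, a i • w i ∈ rr F D := by
    intro a ha O' hO'
    by_cases hOO' : O' = O
    · subst hOO'
      rw [bdd_iff hϖ hloc]
      obtain ⟨v, hv, e⟩ := hloc _ ha
      rw [pow_succ', mul_assoc] at e
      rwa [mul_left_cancel₀ hϖ0 e]
    · intro z hz
      have := (sum_mem fun i _ => (rr F (O ::ₘ D)).smul_mem (a i) (hw i) :
        ∑ i, a i • w i ∈ rr F (O ::ₘ D)) O' hO' z hz
      convert this using 3
      rw [Multiset.count_cons_of_ne hOO']
  by_cases h0 : c 0 = 0
  · refine ⟨![1, 0], by simp, key _ ?_⟩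
    have := hc 0
    rw [h0, map_zero, sub_zero] at this
    simpa using this
  · refine ⟨![c 1, - c 0], by simp [h0], key _ ?_⟩
    have e : ϖ ^ (D.count O + 1) * ∑ i, (![c 1, - c 0] : Fin 2 → F) i • w i =
        c 1 • (ϖ ^ (D.count O + 1) * w 0 - algebraMap F K (c 0)) -
        c 0 • (ϖ ^ (D.count O + 1) * w 1 - algebraMap F K (c 1)) := by
      simp only [Fin.sum_univ_two, Algebra.smul_def, Matrix.cons_val_zero, Matrix.cons_val_one, map_neg]
      ring
    have hs : ∀ (b : F) (z : K), O.valuation z < 1 → O.valuation (b • z) < 1 := by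
      intro b z hz
      rw [Algebra.smul_def, map_mul, mul_comm]
      exact mul_lt_one_of_lt_of_le hz ((O.valuation_le_one_iff _).2 (hO.isOver b))
    rw [e]
    exact (O.valuation.map_sub _ _).trans_lt (max_lt (hs _ _ (hc 0)) (hs _ _ (hc 1)))

lemma rank_le (D : Multiset (ValuationSubring K)) (hD : ∀ O ∈ D, IsPoint F x O) :
    Module.rank F (rr F D) ≤ D.card + 1 := by
  induction D using Multiset.induction_on with
  | empty =>
    rw [Multiset.card_zero, Nat.cast_zero, zero_add]
    have := hO.finrank_zero
    exact (Module.rank_eq_one_iff_finrank_eq_one.2 this).le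
  | cons P D ih =>
    refine ((hD P (Multiset.mem_cons_self _ _)).rank_cons_le D).trans ?_
    rw [Multiset.card_cons, Nat.cast_add, Nat.cast_one, add_comm (D.card : Cardinal) 1, add_assoc]
    gcongr
    exact ih fun O h => hD O (Multiset.mem_cons_of_mem h)

lemma finiteDimensional (D : Multiset (ValuationSubring K)) (hD : ∀ O ∈ D, IsPoint F x O) :
    FiniteDimensional F (rr F D) := by
  apply Module.rank_lt_aleph0_iff.1
  refine (hO.rank_le D hD).trans_lt ?_
  exact_mod_cast Cardinal.natCast_lt_aleph0 (n := D.card + 1)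

lemma finrank_le (D : Multiset (ValuationSubring K)) (hD : ∀ O ∈ D, IsPoint F x O) :
    Module.finrank F (rr F D) ≤ D.card + 1 := by
  apply Module.finrank_le_of_rank_le
  exact_mod_cast hO.rank_le D hD

end IsPoint

end Divisors
end CremonaRank

namespace CremonaRank
open Polynomial Bivariate

section LowerBound
variable {F K : Type*} [Field F] [Field K] [Algebra F K]

lemma leading_mem {x : K} {O : ValuationSubring K} (hO : Over F O) (hx : x ∉ O) {m : ℕ} {c : F[X]}
    (hc : c.natDegree ≤ m) : x * (algebraMap F K (c.coeff m) - x⁻¹ ^ m * aeval x c) ∈ O := by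
  have hx0 : x ≠ 0 := fun h0 => hx (h0 ▸ O.zero_mem)
  have hxi := inv_mem_of_not_mem hx
  rw [aeval_eq_sum_range' (Nat.lt_succ_of_le hc), Finset.sum_range_succ, mul_add,
    Algebra.smul_def (c.coeff m), mul_left_comm (x⁻¹ ^ m) (algebraMap F K _), ← mul_pow,
    inv_mul_cancel₀ hx0, one_pow, mul_one, sub_add_cancel_right, mul_neg, Finset.mul_sum, Finset.mul_sum]
  refine neg_mem (sum_mem fun j hj => ?_)
  have hj := Finset.mem_range.1 hj
  obtain ⟨l, rfl⟩ := Nat.exists_eq_add_of_lt hj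
  have e : x * (x⁻¹ ^ (j + l + 1) * c.coeff j • x ^ j) = c.coeff j • x⁻¹ ^ l := by
    rw [Algebra.smul_def, Algebra.smul_def, pow_succ, pow_add, inv_pow, inv_pow]
    field_simp
  rw [e]
  exact hO.smul_mem _ (pow_mem hxi _)

namespace Curve
variable {x y : K} {d : ℕ} {Φ : F[X][Y]} (h : Curve F x y d Φ)
include h

lemma rank_infinite_le (V : Submodule F K) (n : ℕ) (hV : V ≤ infinite F x n) :
    Module.rank F V ≤ (n * d : ℕ) + Module.rank F (V ⊓ infinite F x 0 : Submodule F K) := by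
  induction n generalizing V with
  | zero => rw [inf_eq_left.2 hV]; simp
  | succ n ih =>
    have h1 := rank_le_add_of_combination (W := V) (S := infinite F x n) (d := d) ?_
    · refine h1.trans ?_
      have h2 := ih (V ⊓ infinite F x n) inf_le_right
      rw [inf_assoc, inf_eq_right.2 (infinite_mono (Nat.zero_le n))] at h2
      refine (add_le_add le_rfl h2).trans (le_of_eq ?_)
      rw [← add_assoc]
      congr 1
      push_cast; ring
    · intro w hw
      obtain ⟨c, hc, hsum⟩ := h.exists_dependent w
      let m := Finset.univ.sup fun i => (c i).natDegree
      have hm : ∀ i, (c i).natDegree ≤ m := fun i => Finset.le_sup (f := fun i => (c i).natDegree)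
        (Finset.mem_univ i)
      refine ⟨fun i => (c i).coeff m, fun h0 => ?_, fun O hO hx => ?_⟩
      · obtain ⟨i, -, hi⟩ := Finset.exists_mem_eq_sup Finset.univ ⟨0, Finset.mem_univ _⟩
          fun i => (c i).natDegree
        have h2 : c i = 0 := by
          rw [← leadingCoeff_eq_zero, leadingCoeff, ← hi]; exact congrFun h0 i
        have h3 : m = 0 := by change Finset.univ.sup _ = 0; rw [hi, h2, natDegree_zero]
        apply hc
        funext j
        have h4 := hm j
        rw [h3, Nat.le_zero] at h4
        rw [eq_C_of_natDegree_eq_zero h4]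
        have h5 := congrFun h0 j
        rw [h3] at h5
        simpa using h5
      · have hx0 : x ≠ 0 := fun h0 => hx (h0 ▸ O.zero_mem)
        have e : x⁻¹ ^ n * ∑ i, (c i).coeff m • w i =
            ∑ i, (x * (algebraMap F K ((c i).coeff m) - x⁻¹ ^ m * aeval x (c i))) *
              (x⁻¹ ^ (n + 1) * w i) := by
          have e2 : ∀ i, (x * (algebraMap F K ((c i).coeff m) - x⁻¹ ^ m * aeval x (c i))) *
              (x⁻¹ ^ (n + 1) * w i) = x⁻¹ ^ n * ((c i).coeff m • w i) -
                x⁻¹ ^ n * x⁻¹ ^ m * (aeval x (c i) * w i) := by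
            intro i
            have : x * x⁻¹ = 1 := mul_inv_cancel₀ hx0
            rw [Algebra.smul_def, pow_succ]
            linear_combination (algebraMap F K ((c i).coeff m) - x⁻¹ ^ m * aeval x (c i)) *
              x⁻¹ ^ n * w i * this
          simp only [e2]
          rw [Finset.sum_sub_distrib, ← Finset.mul_sum, ← Finset.mul_sum, hsum, mul_zero, sub_zero]
        rw [e]
        exact sum_mem fun i _ => O.mul_mem _ _ (leading_mem hO hx (hm i)) (hV (hw i) O hO hx)

/-- There are enough functions with prescribed poles and further poles only at infinity. -/
lemma exists_family_points {γ : ℕ} (hfam : ∃ n₀, ∀ n ≥ n₀, ∃ (N : ℕ) (u : Fin N → K),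
      LinearIndependent F u ∧ n * d + 1 ≤ N + γ ∧ ∀ i, u i ∈ finite F x ⊓ infinite F x n)
    (D : Multiset (ValuationSubring K)) (hD : ∀ O ∈ D, IsPoint F x O) :
    ∃ n₀, ∀ n ≥ n₀, ∃ (N : ℕ) (u : Fin N → K), LinearIndependent F u ∧
      n * d + D.card + 1 ≤ N + γ ∧ ∀ i, u i ∈ finRR F x D ⊓ infinite F x n := by
  classical
  induction D using Multiset.induction_on with
  | empty =>
    obtain ⟨n₀, hn₀⟩ := hfam
    refine ⟨n₀, fun n hn => ?_⟩
    obtain ⟨N, u, hu, hN, hmem⟩ := hn₀ n hn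
    exact ⟨N, u, hu, by simpa using hN, fun i =>
      ⟨fun O h1 h2 => Bdd.of_mem ((hmem i).1 O h1 h2), (hmem i).2⟩⟩
  | cons P D ih =>
    obtain ⟨n₀, hn₀⟩ := ih fun O h => hD O (Multiset.mem_cons_of_mem h)
    have hP := hD P (Multiset.mem_cons_self _ _)
    obtain ⟨ϖ, hϖ0, hϖ, hloc, f, hf1, hf2, hf3⟩ := hP.unif
    obtain ⟨n₁, hn₁⟩ := h.exists_mem_infinite (f ^ (D.count P + 1))
    refine ⟨max n₀ n₁, fun n hn => ?_⟩
    obtain ⟨N, u, hu, hN, hmem⟩ := hn₀ n ((le_max_left _ _).trans hn)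
    have hle : finRR F x D ≤ finRR F x (P ::ₘ D) :=
      fun _ hu O h1 h2 => (hu O h1 h2).mono (Multiset.le_cons_self D P)
    have hg : f ^ (D.count P + 1) ∈ finRR F x (P ::ₘ D) := by
      intro O h1 h2
      by_cases hOP : O = P
      · subst hOP
        rw [IsPoint.bdd_iff hϖ hloc, Multiset.count_cons_self, ← mul_pow]
        exact pow_mem hf1 _
      · exact Bdd.of_mem (pow_mem (hf3 O h1 h2 hOP) _)
    have hg' : f ^ (D.count P + 1) ∉ finRR F x D := by
      intro hmem
      have h1 := (IsPoint.bdd_iff hϖ hloc).1 (hmem P hP.isOver hP.mem)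
      rw [pow_succ, ← mul_assoc, ← mul_pow] at h1
      have h2 : P.valuation (ϖ * f) = 1 := by
        refine le_antisymm ((P.valuation_le_one_iff _).2 hf1) (not_lt.1 fun h3 => hf2 ?_)
        obtain ⟨v, hv, e⟩ := hloc _ h3
        rwa [mul_left_cancel₀ hϖ0 e]
      apply hf2
      rw [← P.valuation_le_one_iff] at h1 ⊢
      rwa [map_mul, map_pow, h2, one_pow, one_mul] at h1
    refine ⟨N + 1, Fin.cons (f ^ (D.count P + 1)) u, ?_, ?_, ?_⟩
    · rw [linearIndependent_finCons]
      refine ⟨hu, fun hs => hg' ?_⟩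
      have : Submodule.span F (Set.range u) ≤ finRR F x D :=
        Submodule.span_le.2 (by rintro _ ⟨i, rfl⟩; exact (hmem i).1)
      exact this hs
    · rw [Multiset.card_cons]; omega
    · intro i
      refine Fin.cases ?_ (fun i => ?_) i
      · exact ⟨hg, infinite_mono ((le_max_right _ _).trans hn) hn₁⟩
      · exact ⟨hle (hmem i).1, (hmem i).2⟩

/-- The Riemann inequality. -/
theorem le_finrank_rr {γ : ℕ} (hfam : ∃ n₀, ∀ n ≥ n₀, ∃ (N : ℕ) (u : Fin N → K),
      LinearIndependent F u ∧ n * d + 1 ≤ N + γ ∧ ∀ i, u i ∈ finite F x ⊓ infinite F x n)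
    (D : Multiset (ValuationSubring K)) (hD : ∀ O ∈ D, IsPoint F x O)
    [FiniteDimensional F (rr F D)] :
    D.card + 1 ≤ Module.finrank F (rr F D) + γ := by
  obtain ⟨n, hn⟩ := h.exists_family_points hfam D hD
  obtain ⟨N, u, hu, hN, hmem⟩ := hn n le_rfl
  let V := Submodule.span F (Set.range u)
  have hV : V ≤ finRR F x D ⊓ infinite F x n :=
    Submodule.span_le.2 (by rintro _ ⟨i, rfl⟩; exact hmem i)
  have h1 := h.rank_infinite_le V n (hV.trans inf_le_right)
  have h2 : Module.rank F V = N := by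
    rw [rank_eq_card_basis (Module.Basis.span hu), Fintype.card_fin]
  have h3 : Module.rank F (V ⊓ infinite F x 0 : Submodule F K) ≤ Module.rank F (rr F D) :=
    Submodule.rank_mono ((inf_le_inf_right _ (hV.trans inf_le_left)).trans finRR_inf_le)
  rw [h2] at h1
  have h4 := h1.trans (add_le_add le_rfl h3)
  rw [← Module.finrank_eq_rank, ← Nat.cast_add, Nat.cast_le] at h4
  omega

end Curve
end LowerBound
end CremonaRank

namespace CremonaRank
open Polynomial Bivariate

section Dependence
variable {E L : Type*} [Field E] [Field L] [Algebra E L]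

/-- Any `m + 1` elements are linearly dependent over `E[ξ]`. -/
def Dep (E : Type*) {L : Type*} [Field E] [Field L] [Algebra E L] (ξ : L) (m : ℕ) : Prop :=
  ∀ u : Fin (m + 1) → L, ∃ c : Fin (m + 1) → E[X], c ≠ 0 ∧ ∑ i, aeval ξ (c i) * u i = 0

lemma Dep.isAlgebraic {ξ : L} {m : ℕ} (h : Dep E ξ m) (ht : Transcendental E ξ) :
    Algebra.IsAlgebraic (Algebra.adjoin E {ξ}) L := by
  refine ⟨fun u => ?_⟩
  obtain ⟨c, hc, hsum⟩ := h fun i => u ^ (i : ℕ)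
  let c' : Fin (m + 1) → Algebra.adjoin E {ξ} := fun i =>
    ⟨aeval ξ (c i), aeval_mem_adjoin_singleton E ξ⟩
  refine ⟨∑ i, C (c' i) * X ^ (i : ℕ), fun h0 => hc ?_, ?_⟩
  · funext i
    have h1 := congrArg (fun P => P.coeff (i : ℕ)) h0
    simp only [finsetSum_coeff, coeff_C_mul, coeff_X_pow, coeff_zero] at h1
    rw [Finset.sum_eq_single i (fun j _ hj => by
      rw [if_neg (fun h => hj (Fin.ext h.symm)), mul_zero]) (by simp), if_pos rfl, mul_one] at h1
    have h2 : aeval ξ (c i) = 0 := congrArg Subtype.val h1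
    by_contra hne
    exact ht ⟨c i, hne, h2⟩
  · rw [← hsum, map_sum]
    refine Finset.sum_congr rfl fun i _ => ?_
    simp [c']

lemma isAlgebraic_adjoin_of_transcendental {x f : L} [Algebra.IsAlgebraic (Algebra.adjoin E {x}) L]
    (hf : Transcendental E f) : Algebra.IsAlgebraic (Algebra.adjoin E {f}) L := by
  have h1 := Algebra.IsAlgebraic.trdeg_le_cardinalMk E ({x} : Set L)
  have h2 : AlgebraicIndependent E (fun _ : Unit => f) :=
    algebraicIndependent_unique_type_iff.2 hf
  have h3 := h2.isTranscendenceBasis_of_lift_trdeg_le_of_finite (by simpa using h1)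
  have h4 := h3.isAlgebraic
  rwa [Set.range_const] at h4

lemma mul_aeval_mem {O : ValuationSubring L} (hO : Over E O) {f : L} (hf : f ∉ O) {m : ℕ} {q : E[X]}
    (hq : q.natDegree ≤ m) : aeval f q * f⁻¹ ^ m ∈ O := by
  have h0 : f ≠ 0 := fun h => hf (h ▸ O.zero_mem)
  have h1 := O.mul_mem _ _ (inv_mem_of_not_mem hf) (leading_mem hO hf hq)
  rw [inv_mul_cancel_left₀ h0] at h1
  have h2 := sub_mem (hO (q.coeff m)) h1
  rwa [sub_sub_cancel, mul_comm] at h2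

lemma pow_mem_rr {D : Multiset (ValuationSubring L)} {f : L} (hf : f ∈ rr E D) (j : ℕ) :
    f ^ j ∈ rr E (j • D) := by
  induction j with
  | zero => rw [pow_zero]; rw [← map_one (algebraMap E L)]; exact algebraMap_mem_rr _ _
  | succ j ih => rw [pow_succ, succ_nsmul]; exact mul_mem_rr ih hf

lemma exists_mem_rr_of_isIntegral {D : Multiset (ValuationSubring L)} {f v : L} (hf : f ∈ rr E D)
    (hv : IsIntegral (Algebra.adjoin E {f}) v) : ∃ c : ℕ, v ∈ rr E (c • D) := by
  classical
  obtain ⟨P, hP, h0⟩ := hv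
  have hq : ∀ i, ∃ q : E[X], aeval f q = (P.coeff i : L) := by
    intro i
    exact (SetLike.ext_iff.1 (Algebra.adjoin_singleton_eq_range_aeval E f) _).1 (P.coeff i).2
  choose q hq using hq
  let c := (Finset.range (P.natDegree + 1)).sup fun i => (q i).natDegree
  have hc : ∀ i, i ≤ P.natDegree → (q i).natDegree ≤ c := fun i hi =>
    Finset.le_sup (f := fun i => (q i).natDegree) (Finset.mem_range.2 (Nat.lt_succ_of_le hi))
  rw [eval₂_eq_eval_map] at h0
  set Q := P.map (algebraMap (Algebra.adjoin E {f}) L) with hQ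
  have hQm : Q.Monic := hP.map _
  have hQc : ∀ i, Q.coeff i = aeval f (q i) := fun i => by rw [hQ, coeff_map, hq]; rfl
  have hQd : Q.natDegree = P.natDegree := hP.natDegree_map _
  refine ⟨c, fun O hO => ?_⟩
  by_cases hfO : f ∈ O
  · exact Bdd.of_mem (mem_of_monic hQm (fun i => by rw [hQc]; exact hO.aeval_mem hfO _) h0)
  · have h1 : f⁻¹ ^ c * v ∈ O := by
      refine mem_of_monic ((monic_scaleRoots_iff (f⁻¹ ^ c)).2 hQm) (fun i => ?_) ?_
      · rw [coeff_scaleRoots]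
        rcases lt_trichotomy i Q.natDegree with hi | hi | hi
        · obtain ⟨l, hl⟩ := Nat.exists_eq_add_of_lt hi
          rw [hl, show i + l + 1 - i = l + 1 by omega, pow_succ', ← mul_assoc, hQc]
          exact O.mul_mem _ _ (mul_aeval_mem hO hfO (hc i (by omega)))
            (pow_mem (pow_mem (inv_mem_of_not_mem hfO) _) _)
        · rw [hi, Nat.sub_self, pow_zero, mul_one]
          change Q.leadingCoeff ∈ O
          rw [hQm.leadingCoeff]; exact O.one_mem
        · rw [coeff_eq_zero_of_natDegree_lt hi, zero_mul]; exact O.zero_mem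
      · have := scaleRoots_eval₂_eq_zero (p := Q) (RingHom.id L) (r := v) (s := f⁻¹ ^ c) (by simpa [eval₂_id] using h0)
        simpa [eval₂_id] using this
    intro ϖ hϖ
    have h2 := O.mul_mem _ _ (pow_mem (hf O hO ϖ hϖ) c) h1
    have h0 : f ≠ 0 := fun h => hfO (h ▸ O.zero_mem)
    convert h2 using 1
    rw [Multiset.count_nsmul, mul_pow, ← pow_mul, mul_comm c, inv_pow]
    field_simp

/-- A function with at most `m` poles has degree at most `m`. -/
theorem dep_of_mem_rr {x f : L} {m d : ℕ} (hdep : Dep E x d) (hx : Transcendental E x)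
    {O : ValuationSubring L} (hO : IsPoint E x O) {D : Multiset (ValuationSubring L)}
    (hD : ∀ O ∈ D, IsPoint E x O) (hm : D.card = m) (hf : f ∈ rr E D) (ht : Transcendental E f) :
    Dep E f m := by
  have := hdep.isAlgebraic hx
  have halg := isAlgebraic_adjoin_of_transcendental (x := x) ht
  have hm0 : 0 < m := by
    rcases Nat.eq_zero_or_pos m with h0 | h0
    · rw [h0, Multiset.card_eq_zero] at hm
      rw [hm] at hf
      obtain ⟨c, hc⟩ := hO.exists_of_mem_rr_zero hf
      exact absurd (isAlgebraic_algebraMap c) (hc ▸ ht)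
    · exact h0
  intro u
  have h1 : ∀ i, ∃ b : E[X], b ≠ 0 ∧ ∃ c : ℕ, aeval f b * u i ∈ rr E (c • D) := by
    intro i
    obtain ⟨⟨y, hy⟩, hy0, hwint⟩ := (halg.isAlgebraic (u i)).exists_integral_multiple
    obtain ⟨b, rfl⟩ := (SetLike.ext_iff.1 (Algebra.adjoin_singleton_eq_range_aeval E f) _).1 hy
    refine ⟨b, ?_, exists_mem_rr_of_isIntegral hf hwint⟩
    rintro rfl
    apply hy0
    ext
    simp
  choose b hb c hc using h1
  let n := Finset.univ.sup c
  have hn : ∀ i, aeval f (b i) * u i ∈ rr E (n • D) := fun i =>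
    rr_mono (nsmul_le_nsmul_left (Multiset.zero_le _) (Finset.le_sup (f := c) (Finset.mem_univ i))) (hc i)
  have hmem : ∀ p : Fin (m + 1) × Fin (m * n + 1),
      f ^ (p.2 : ℕ) * (aeval f (b p.1) * u p.1) ∈ rr E ((m * n + n) • D) := by
    intro p
    rw [add_nsmul]
    refine mul_mem_rr (rr_mono (nsmul_le_nsmul_left (Multiset.zero_le _) (Nat.le_of_lt_succ p.2.2))
      (pow_mem_rr hf _)) (hn _)
  have hD' : ∀ O ∈ (m * n + n) • D, IsPoint E x O := fun O h => hD O (Multiset.mem_of_mem_nsmul h)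
  have hfin := hO.finiteDimensional _ hD'
  have hle := hO.finrank_le _ hD'
  have hdep : ¬ LinearIndependent E (fun p : Fin (m + 1) × Fin (m * n + 1) =>
      (⟨_, hmem p⟩ : rr E ((m * n + n) • D))) := by
    intro hli
    have := hli.fintype_card_le_finrank.trans hle
    rw [Multiset.card_nsmul, hm, Fintype.card_prod, Fintype.card_fin, Fintype.card_fin] at this
    nlinarith
  rw [Fintype.not_linearIndependent_iff] at hdep
  obtain ⟨g, hg, p₀, hp₀⟩ := hdep
  refine ⟨fun i => (∑ j : Fin (m * n + 1), C (g (i, j)) * X ^ (j : ℕ)) * b i, fun h0 => hp₀ ?_, ?_⟩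
  · have h1 := (mul_eq_zero.1 (congrFun h0 p₀.1)).resolve_right (hb _)
    have h2 := congrArg (fun P => P.coeff (p₀.2 : ℕ)) h1
    simp only [finsetSum_coeff, coeff_C_mul, coeff_X_pow, coeff_zero] at h2
    rwa [Finset.sum_eq_single p₀.2 (fun j _ hj => by
      rw [if_neg (fun h => hj (Fin.ext h.symm)), mul_zero]) (by simp), if_pos rfl, mul_one] at h2
  · have h1 := congrArg Subtype.val hg
    simp only [AddSubmonoidClass.coe_finsetSum, Submodule.coe_smul, ZeroMemClass.coe_zero] at h1
    rw [← h1, Fintype.sum_prod_type]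
    refine Finset.sum_congr rfl fun i _ => ?_
    rw [map_mul, map_sum, mul_assoc, Finset.sum_mul]
    refine Finset.sum_congr rfl fun j _ => ?_
    rw [map_mul, map_pow, aeval_C, aeval_X, Algebra.smul_def, mul_assoc]

lemma Dep.finrank_le {ξ : L} {m : ℕ} (h : Dep E ξ m) (ht : Transcendental E ξ) :
    FiniteDimensional (IntermediateField.adjoin E {ξ}) L ∧
      Module.finrank (IntermediateField.adjoin E {ξ}) L ≤ m := by
  have key : Module.rank (IntermediateField.adjoin E {ξ}) L ≤ m := by
    apply rank_le
    intro s hs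
    by_contra! hcard
    obtain ⟨t, hts, ht'⟩ := Finset.exists_subset_card_eq (Nat.succ_le_of_lt hcard)
    let e := (t.equivFinOfCardEq ht').symm
    have hli : LinearIndependent (IntermediateField.adjoin E {ξ}) fun i => ((e i : t) : L) := by
      have := hs.comp (fun i => (⟨e i, hts (e i).2⟩ : s)) (fun i j hij => by
        have := congrArg (fun z : s => (z : L)) hij
        exact e.injective (Subtype.ext this))
      exact this
    obtain ⟨c, hc, hsum⟩ := h fun i => (e i : L)
    apply hc
    rw [Fintype.linearIndependent_iff] at hli
    funext i
    have h1 := hli (fun i => ⟨aeval ξ (c i), IntermediateField.algebra_adjoin_le_adjoin E _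
      (aeval_mem_adjoin_singleton E ξ)⟩) hsum i
    have h2 : aeval ξ (c i) = 0 := congrArg Subtype.val h1
    by_contra hne
    exact ht ⟨c i, hne, h2⟩
  refine ⟨Module.rank_lt_aleph0_iff.1 (key.trans_lt (Cardinal.natCast_lt_aleph0)), ?_⟩
  exact Module.finrank_le_of_rank_le key

lemma mob_of_dependent {ξ w : L} (ht : Transcendental E ξ) {c : Fin 4 → E} (hc : c ≠ 0)
    (h : c 0 • (1 : L) + c 1 • ξ + c 2 • w + c 3 • (ξ * w) = 0) :
    ∃ A : Matrix (Fin 2) (Fin 2) E, Mob A ξ w := by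
  simp only [Algebra.smul_def, mul_one] at h
  refine ⟨!![-c 1, -c 0; c 3, c 2], fun h0 => hc ?_, ?_⟩
  · simp only [Matrix.of_apply, Matrix.cons_val', Matrix.cons_val_zero, Matrix.cons_val_one,
      Matrix.cons_val_fin_one] at h0
    obtain ⟨-, h3, h2⟩ := quadratic_eq_zero ht (a := 0) (b := c 3) (c := c 2) (by simpa using h0)
    rw [h3, h2] at h
    obtain ⟨-, h1, h0⟩ := quadratic_eq_zero ht (a := 0) (b := c 1) (c := c 0) (by
      simp only [map_zero] at h ⊢; linear_combination h)
    funext i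
    fin_cases i <;> assumption
  · simp only [Matrix.of_apply, Matrix.cons_val', Matrix.cons_val_zero, Matrix.cons_val_one,
      Matrix.cons_val_fin_one, map_neg]
    linear_combination h

/-- A group of exponent two acting faithfully and by Möbius transformations on a function of
degree `m`. -/
theorem card_le_of_mob {Γ : Type*} [Group Γ] [Finite Γ] {φ : Γ →* (L ≃ₐ[E] L)}
    (hinj : Function.Injective φ) (hsq : ∀ g : Γ, g * g = 1) (two : (2 : E) ≠ 0) {ξ : L} {m : ℕ}
    (ht : Transcendental E ξ) (hdep : Dep E ξ m) 
    (hmob : ∀ g, ∃ A : Matrix (Fin 2) (Fin 2) E, Mob A ξ (φ g ξ)) :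
    Nat.card Γ ≤ 4 * m := by
  choose A hA using hmob
  obtain ⟨a, b, hab⟩ := (MobRep.mk hsq ht two hA).exists_cover
  let S : Set Γ := {g | φ g ξ = ξ}
  obtain ⟨hfin, hle⟩ := hdep.finrank_le ht
  have hS : S.ncard ≤ m := by
    refine le_trans ?_ hle
    let ι : S → (L ≃ₐ[IntermediateField.adjoin E {ξ}] L) := fun g =>
      { (φ g.1).toRingEquiv with
        commutes' := fun r => by
          have h1 : IntermediateField.adjoin E {ξ} ≤
              IntermediateField.fixedField (Subgroup.zpowers (φ g.1)) := by
            rw [IntermediateField.adjoin_simple_le_iff]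
            rintro ⟨σ, hσ⟩
            have hS : σ ∈ MulAction.stabilizer (L ≃ₐ[E] L) ξ :=
              (Subgroup.zpowers_le.2 (show φ g.1 ∈ MulAction.stabilizer (L ≃ₐ[E] L) ξ from g.2)) hσ
            exact hS
          exact h1 r.2 ⟨φ g.1, Subgroup.mem_zpowers _⟩ }
    have hι : Function.Injective ι := fun g h hgh => Subtype.ext (hinj (by
      ext z
      exact congrArg (fun σ : L ≃ₐ[IntermediateField.adjoin E {ξ}] L => σ z) hgh))
    have h2 := Nat.card_le_card_of_injective ι hι
    rw [Set.ncard_def] at *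
    exact h2.trans (by rw [Nat.card_eq_fintype_card]; exact AlgEquiv.card_le)
  have hcov : (Set.univ : Set Γ) ⊆ S ∪ (a * ·) ⁻¹' S ∪ ((b * ·) ⁻¹' S ∪ (fun h => a * (b * h)) ⁻¹' S) := by
    intro h _
    rcases hab h with h1 | h1 | h1 | h1
    · exact Or.inl (Or.inl h1)
    · exact Or.inl (Or.inr h1)
    · exact Or.inr (Or.inl h1)
    · exact Or.inr (Or.inr h1)
  have hpre : ∀ F : Γ → Γ, Function.Injective F → (F ⁻¹' S).ncard ≤ S.ncard := fun F hF =>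
    Set.ncard_le_ncard_of_injOn F (fun _ h => h) hF.injOn (Set.toFinite _)
  rw [← Set.ncard_univ]
  have h1 := Set.ncard_le_ncard hcov (Set.toFinite _)
  have h2 := Set.ncard_union_le (S ∪ (a * ·) ⁻¹' S) ((b * ·) ⁻¹' S ∪ (fun h => a * (b * h)) ⁻¹' S)
  have h3 := Set.ncard_union_le S ((a * ·) ⁻¹' S)
  have h4 := Set.ncard_union_le ((b * ·) ⁻¹' S) ((fun h => a * (b * h)) ⁻¹' S)
  have h5 := hpre _ (mul_right_injective a)
  have h6 := hpre _ (mul_right_injective b)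
  have h7 := hpre (fun h => a * (b * h)) ((mul_right_injective a).comp (mul_right_injective b))
  omega

end Dependence
end CremonaRank

namespace CremonaRank
open Polynomial Bivariate

section PointAction
variable {E L Γ : Type*} [Field E] [Field L] [Algebra E L] [Group Γ]

/-- A group of exponent two acting freely on a set of rational smooth points of a curve whose
genus is at most `γ`. -/
structure PointAction (φ : Γ →* (L ≃ₐ[E] L)) (Pl : Γ → ValuationSubring L) (x : L) (m γ : ℕ) :
    Prop where
  inj : Function.Injective φ
  sq : ∀ g : Γ, g * g = 1
  two : (2 : E) ≠ 0
  point : ∀ a, IsPoint E x (Pl a)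
  injPl : Function.Injective Pl
  mem_iff : ∀ h a u, φ h u ∈ Pl (h * a) ↔ u ∈ Pl a
  tr : Transcendental E x
  dep : Dep E x m
  le_finrank : ∀ D : Multiset (ValuationSubring L), (∀ O ∈ D, IsPoint E x O) →
    D.card + 1 ≤ Module.finrank E (rr E D) + γ

namespace PointAction
variable {φ : Γ →* (L ≃ₐ[E] L)} {Pl : Γ → ValuationSubring L} {x : L} {m γ : ℕ}

/-- The Riemann–Roch space of a divisor supported on the orbit. -/
abbrev space (E : Type*) {L : Type*} [Field E] [Field L] [Algebra E L] (Pl : Γ → ValuationSubring L)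
    (D : Multiset Γ) : Submodule E L := rr E (D.map Pl)

variable (h : PointAction φ Pl x m γ)
include h

lemma comm (a b : Γ) : a * b = b * a := by
  have h1 := h.sq (a * b)
  have : ∀ x : Γ, x⁻¹ = x := fun x => inv_eq_of_mul_eq_one_left (h.sq x)
  rw [← this (a * b), mul_inv_rev, this, this]

lemma isPoint_of_mem (D : Multiset Γ) : ∀ O ∈ D.map Pl, IsPoint E x O := by
  intro O hO
  obtain ⟨a, -, rfl⟩ := Multiset.mem_map.1 hO
  exact h.point a

lemma finite (D : Multiset Γ) : FiniteDimensional E (space E Pl D) :=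
  (h.point 1).finiteDimensional _ (h.isPoint_of_mem D)

lemma finrank_le (D : Multiset Γ) : Module.finrank E (space E Pl D) ≤ D.card + 1 := by
  simpa using (h.point 1).finrank_le _ (h.isPoint_of_mem D)

lemma mem_space_inter {D D' : Multiset Γ} [DecidableEq Γ] {u : L} (hu : u ∈ space E Pl D)
    (hu' : u ∈ space E Pl D') : u ∈ space E Pl (D ∩ D') := by
  classical
  intro O hO
  by_cases hOP : O ∈ Set.range Pl
  · obtain ⟨a, rfl⟩ := hOP
    have h1 := hu _ hO
    have h2 := hu' _ hO
    intro ϖ hϖ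
    have h1 := h1 ϖ hϖ
    have h2 := h2 ϖ hϖ
    rw [Multiset.count_map_eq_count' _ _ h.injPl] at h1 h2 ⊢
    rw [Multiset.count_inter]
    rcases min_choice (D.count a) (D'.count a) with e | e <;> rw [e] <;> assumption
  · refine Bdd.of_mem ((hu O hO).mem fun hmem => hOP ?_)
    obtain ⟨a, -, rfl⟩ := Multiset.mem_map.1 hmem
    exact ⟨a, rfl⟩

lemma exists_of_mem_zero {u : L} (hu : u ∈ space E Pl (0 : Multiset Γ)) :
    ∃ c : E, algebraMap E L c = u :=
  (h.point 1).exists_of_mem_rr_zero hu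

lemma transcendental {u : L} (hu : ∀ c : E, algebraMap E L c ≠ u) : Transcendental E u := by
  intro halg
  obtain ⟨c, hc⟩ := (h.point 1).eq_algebraMap halg.isIntegral
  exact hu c hc

lemma map_mem {D : Multiset Γ} {u : L} (hu : u ∈ space E Pl D) (g : Γ) :
    φ g u ∈ space E Pl (D.map (g * ·)) := by
  classical
  have hφ : ∀ z, φ g (φ g z) = z := fun z => by
    rw [← AlgEquiv.mul_apply, ← map_mul, h.sq, map_one, AlgEquiv.one_apply]
  intro O hO ϖ hϖ
  let O' : ValuationSubring L := O.comap (φ g : L →+* L)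
  have hmem : ∀ z, z ∈ O' ↔ φ g z ∈ O := fun z => Iff.rfl
  have hlt : ∀ (O : ValuationSubring L) (z : L), O.valuation z < 1 ↔ z = 0 ∨ (z ∈ O ∧ z⁻¹ ∉ O) := by
    intro O z
    rcases eq_or_ne z 0 with rfl | hz
    · simp
    · rw [← O.valuation_le_one_iff z⁻¹, map_inv₀, not_le, ← O.valuation_le_one_iff z,
        one_lt_inv₀ (by rw [zero_lt_iff]; exact (Valuation.ne_zero_iff _).2 hz)]
      exact ⟨fun h => Or.inr ⟨h.le, h⟩, fun h => (h.resolve_left hz).2⟩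
  have hO' : Over E O' := fun c => by rw [hmem, AlgEquiv.commutes]; exact hO c
  have h1 := hu O' hO' (φ g ϖ) (by
    rw [hlt] at hϖ ⊢
    rcases hϖ with rfl | ⟨h1, h2⟩
    · exact Or.inl (map_zero _)
    · refine Or.inr ⟨by rwa [hmem, hφ], by rwa [hmem, map_inv₀, hφ]⟩)
  rw [hmem, map_mul, map_pow, hφ] at h1
  convert h1 using 3
  have hPl : ∀ a, (Pl (g * a)).comap (φ g : L →+* L) = Pl a := fun a => by
    ext z; exact h.mem_iff g a z
  have hc : Function.Injective fun O : ValuationSubring L => O.comap (φ g : L →+* L) := by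
    intro O₁ O₂ he
    ext z
    have := SetLike.ext_iff.1 he (φ g z)
    change φ g (φ g z) ∈ O₁ ↔ φ g (φ g z) ∈ O₂ at this
    rwa [hφ] at this
  rw [← Multiset.count_map_eq_count' _ _ hc, Multiset.map_map, Multiset.map_map]
  congr 1
  · apply Multiset.map_congr rfl
    intro a _
    exact hPl a

omit [Group Γ] h in
/-- Nonconstant functions transform projectively when their products with their transforms lie in
a small enough space. -/
lemma exists_mob {f w : L} (ht : Transcendental E f) (V : Submodule E L) [FiniteDimensional E V]
    (hV : Module.finrank E V ≤ 3) (h1 : (1 : L) ∈ V) (hf : f ∈ V) (hw : w ∈ V) (hfw : f * w ∈ V) :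
    ∃ A : Matrix (Fin 2) (Fin 2) E, Mob A f w := by
  have hdep : ¬ LinearIndependent E (![⟨1, h1⟩, ⟨f, hf⟩, ⟨w, hw⟩, ⟨f * w, hfw⟩] : Fin 4 → V) := by
    intro hli
    have := hli.fintype_card_le_finrank
    rw [Fintype.card_fin] at this
    omega
  rw [Fintype.not_linearIndependent_iff] at hdep
  obtain ⟨c, hc, i, hi⟩ := hdep
  refine mob_of_dependent ht (c := c) (fun h0 => hi (congrFun h0 i)) ?_
  have := congrArg Subtype.val hc
  simpa [Fin.sum_univ_four] using this

omit [Group Γ] h in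
lemma one_mem (D : Multiset Γ) : (1 : L) ∈ space E Pl D := by
  rw [← map_one (algebraMap E L)]; exact algebraMap_mem_rr _ _

omit [Group Γ] h in
lemma mono {D D' : Multiset Γ} (hD : D ≤ D') : space E Pl D ≤ space E Pl D' :=
  rr_mono (Multiset.map_le_map hD)

omit [Group Γ] h in
lemma mul_mem {D D' : Multiset Γ} {u v : L} (hu : u ∈ space E Pl D) (hv : v ∈ space E Pl D') :
    u * v ∈ space E Pl (D + D') := by
  rw [space, Multiset.map_add]; exact mul_mem_rr hu hv

lemma dep_of_mem {D : Multiset Γ} {f : L} (hf : f ∈ space E Pl D) (ht : Transcendental E f) :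
    Dep E f D.card :=
  dep_of_mem_rr h.dep h.tr (h.point 1) (h.isPoint_of_mem D) (by simp) hf ht

variable [Finite Γ]

lemma card_le_four {f : L} {a : Γ} (hf : f ∈ space E Pl {a}) (ht : Transcendental E f) :
    Nat.card Γ ≤ 4 := by
  refine card_le_of_mob h.inj h.sq h.two ht (h.dep_of_mem hf ht) fun g => ?_
  have := h.finite ({a} + {g * a})
  have h1 : φ g f ∈ space E Pl {g * a} := by simpa using h.map_mem hf g
  exact exists_mob ht _ (h.finrank_le _) (one_mem _) (mono (by simp) hf)
    (mono (by simp) h1) (mul_mem hf h1)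

omit [Finite Γ] in
lemma exists_transcendental {D : Multiset Γ} (hD : γ < D.card) :
    ∃ f ∈ space E Pl D, Transcendental E f := by
  by_contra! hcon
  have h1 : space E Pl D ≤ E ∙ (1 : L) := by
    intro u hu
    by_contra hne
    refine hcon u hu (h.transcendental fun c hc => hne ?_)
    rw [Submodule.mem_span_singleton]
    exact ⟨c, by rw [Algebra.smul_def, mul_one, hc]⟩
  have h2 := Submodule.finrank_mono h1
  rw [finrank_span_singleton one_ne_zero] at h2
  have h3 := h.le_finrank _ (h.isPoint_of_mem D)
  rw [Multiset.card_map] at h3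
  have : Module.finrank E (rr E (D.map Pl)) ≤ 1 := h2
  omega

theorem card_le_four_of_eq_zero (hγ : γ = 0) : Nat.card Γ ≤ 4 := by
  obtain ⟨f, hf, ht⟩ := h.exists_transcendental (D := {1}) (by simp [hγ])
  exact h.card_le_four hf ht

omit [Finite Γ] in
lemma finrank_le_card (hP : ∀ u ∈ space E Pl {(1 : Γ)}, ∃ c : E, algebraMap E L c = u)
    (D : Multiset Γ) : Module.finrank E (space E Pl (1 ::ₘ D)) ≤ D.card + 1 := by
  induction D using Multiset.induction_on with
  | empty =>
    have h1 : space E Pl {(1 : Γ)} ≤ E ∙ (1 : L) := by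
      intro u hu
      obtain ⟨c, rfl⟩ := hP u hu
      rw [Submodule.mem_span_singleton]
      exact ⟨c, by rw [Algebra.smul_def, mul_one]⟩
    have h2 := Submodule.finrank_mono h1
    rw [finrank_span_singleton one_ne_zero] at h2
    simpa using h2
  | cons a D ih =>
    have h1 := (h.point a).rank_cons_le ((1 ::ₘ D).map Pl)
    rw [← Multiset.map_cons] at h1
    have := h.finite (1 ::ₘ D)
    have := h.finite (a ::ₘ 1 ::ₘ D)
    rw [Multiset.cons_swap, Multiset.card_cons]
    change Module.finrank E (rr E _) ≤ _
    rw [← Module.finrank_eq_rank, ← Module.finrank_eq_rank] at h1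
    have h1' : Module.finrank E (rr E ((a ::ₘ 1 ::ₘ D).map Pl)) ≤
        1 + Module.finrank E (rr E ((1 ::ₘ D).map Pl)) := by exact_mod_cast h1
    change Module.finrank E (rr E ((1 ::ₘ D).map Pl)) ≤ _ at ih
    omega

omit [Finite Γ] in
/-- The invariants of an involution on a space containing enough anti-invariants. -/
lemma finrank_invariants_le (V : Submodule E L) [FiniteDimensional E V] (a : Γ) {n : ℕ}
    (w : Fin n → L) (hw : LinearIndependent E w) (hwV : ∀ i, w i ∈ V) (hwa : ∀ i, φ a (w i) = -w i) :
    Module.finrank E (V ⊓ LinearMap.eqLocus (φ a).toLinearMap LinearMap.id : Submodule E L) + n ≤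
      Module.finrank E V := by
  let V₁ : Submodule E L := V ⊓ LinearMap.eqLocus (φ a).toLinearMap LinearMap.id
  let V₂ : Submodule E L := Submodule.span E (Set.range w)
  have h2 : V₂ ≤ V := Submodule.span_le.2 (by rintro _ ⟨i, rfl⟩; exact hwV i)
  have : FiniteDimensional E V₁ := Submodule.finiteDimensional_of_le inf_le_left
  have : FiniteDimensional E V₂ := Submodule.finiteDimensional_of_le h2
  have hV₂ : ∀ u ∈ V₂, φ a u = -u := by
    have : V₂ ≤ LinearMap.eqLocus (φ a).toLinearMap (-LinearMap.id) :=
      Submodule.span_le.2 (by rintro _ ⟨i, rfl⟩; exact hwa i)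
    exact fun u hu => this hu
  have hdisj : V₁ ⊓ V₂ = ⊥ := by
    rw [eq_bot_iff]
    rintro u ⟨h1, h2⟩
    have e1 : φ a u = u := h1.2
    have e2 := hV₂ u h2
    rw [e1] at e2
    have e3 : algebraMap E L 2 * u = 0 := by
      rw [map_ofNat]; linear_combination e2
    rw [Submodule.mem_bot]
    exact (mul_eq_zero.1 e3).resolve_left fun h0 => h.two (by simpa using h0)
  have h3 := Submodule.finrank_sup_add_finrank_inf_eq V₁ V₂
  rw [hdisj, finrank_bot, add_zero, finrank_span_eq_card hw, Fintype.card_fin] at h3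
  have h4 : Module.finrank E (V₁ ⊔ V₂ : Submodule E L) ≤ Module.finrank E V :=
    Submodule.finrank_mono (sup_le inf_le_left h2)
  exact (h3.symm.le).trans h4

omit [Finite Γ] in
lemma apply_apply (a : Γ) (u : L) : φ a (φ a u) = u := by
  rw [← AlgEquiv.mul_apply, ← map_mul, h.sq, map_one, AlgEquiv.one_apply]

omit [Finite Γ] in
lemma apply_comm (a b : Γ) (u : L) : φ a (φ b u) = φ b (φ a u) := by
  rw [← AlgEquiv.mul_apply, ← map_mul, h.comm, map_mul, AlgEquiv.mul_apply]

lemma card_le_of_invariant (hP : ∀ u ∈ space E Pl {(1 : Γ)}, ∃ c : E, algebraMap E L c = u)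
    {a : Γ} (ha : a ≠ 1) (hγ : γ ≤ 1) {f : L} (hf : f ∈ space E Pl {1, a}) (ht : Transcendental E f)
    (hfa : φ a f = f) : Nat.card Γ ≤ 8 := by
  classical
  refine (card_le_of_mob h.inj h.sq h.two ht (h.dep_of_mem hf ht) fun g => ?_).trans (by simp)
  have h1 : φ g f ∈ space E Pl {g, g * a} := by simpa using h.map_mem hf g
  have := h.finite ({1, a} + {g, g * a})
  have hV : Module.finrank E (space E Pl ({1, a} + {g, g * a})) ≤ 4 := h.finrank_le_card hP {a, g, g * a}
  by_cases hga : g = 1 ∨ g = a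
  · have e : φ g f = f := by
      rcases hga with rfl | rfl
      · simp
      · exact hfa
    rw [e]
    refine ⟨1, by simp, by simp⟩
  push Not at hga
  obtain ⟨w, hw, hwt⟩ := h.exists_transcendental (D := {1, g}) (by simp; omega)
  have hwa : φ a w ∈ space E Pl {a, a * g} := by simpa using h.map_mem hw a
  have hne : w - φ a w ≠ 0 := by
    intro h0
    rw [← sub_eq_zero.1 h0] at hwa
    have h2 := h.mem_space_inter hw hwa
    have h3 : ({1, g} : Multiset Γ) ∩ {a, a * g} = 0 := by
      refine Multiset.eq_zero_iff_forall_notMem.2 fun z hzz => ?_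
      obtain ⟨hz, hz'⟩ := Multiset.mem_inter.1 hzz
      simp only [Multiset.insert_eq_cons, Multiset.mem_cons, Multiset.mem_singleton] at hz hz'
      rcases hz with rfl | rfl <;> rcases hz' with e | e
      · exact ha e.symm
      · exact hga.2 (by rw [← mul_one a, e, ← mul_assoc, h.sq, one_mul])
      · exact hga.2 e
      · exact ha (by simpa using e)
    rw [h3] at h2
    obtain ⟨c, hc⟩ := h.exists_of_mem_zero h2
    exact hwt (hc ▸ isAlgebraic_algebraMap c)
  have hinv := h.finrank_invariants_le (space E Pl ({1, a} + {g, g * a})) a (n := 1)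
    (fun _ => w - φ a w) (by rw [linearIndependent_unique_iff]; exact hne)
    (fun _ => sub_mem (mono (by
        rw [Multiset.le_iff_count]; intro z; simp [Multiset.count_cons, Multiset.count_singleton]; omega) hw)
      (mono (by
        rw [h.comm a g, Multiset.le_iff_count]; intro z; simp [Multiset.count_cons, Multiset.count_singleton]; omega) hwa))
    (fun _ => by rw [map_sub, h.apply_apply]; ring)
  set V := space E Pl ({1, a} + {g, g * a}) with hVdef
  let V₁ : Submodule E L := V ⊓ LinearMap.eqLocus (φ a).toLinearMap LinearMap.id
  have hfin : FiniteDimensional E V₁ := Submodule.finiteDimensional_of_le inf_le_left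
  have hV₁ : Module.finrank E V₁ ≤ 3 := by
    change Module.finrank E V₁ + 1 ≤ _ at hinv
    omega
  refine exists_mob ht V₁ hV₁ ⟨one_mem _, map_one (φ a)⟩
    ⟨mono (Multiset.le_add_right _ _) hf, hfa⟩ ⟨mono (Multiset.le_add_left _ _) h1, ?_⟩
    ⟨mul_mem hf h1, ?_⟩
  · change φ a (φ g f) = φ g f
    rw [h.apply_comm, hfa]
  · change φ a (f * φ g f) = f * φ g f
    rw [map_mul, h.apply_comm, hfa]

theorem card_le_eight (hγ : γ = 1) : Nat.card Γ ≤ 8 := by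
  classical
  by_cases hP : ∀ u ∈ space E Pl {(1 : Γ)}, ∃ c : E, algebraMap E L c = u
  swap
  · push Not at hP
    obtain ⟨f, hf, hc⟩ := hP
    exact (h.card_le_four hf (h.transcendental hc)).trans (by norm_num)
  by_cases hinv : ∃ a ≠ 1, ∃ f ∈ space E Pl {1, a}, Transcendental E f ∧ φ a f = f
  · obtain ⟨a, ha, f, hf, ht, hfa⟩ := hinv
    exact h.card_le_of_invariant hP ha hγ.le hf ht hfa
  push Not at hinv
  obtain ⟨ξ, hξ, ht⟩ := h.exists_transcendental (D := {1, 1}) (by simp [hγ])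
  refine (card_le_of_mob h.inj h.sq h.two ht (h.dep_of_mem hξ ht) fun g => ?_).trans (by simp)
  by_cases hg : g = 1
  · rw [hg, map_one]
    exact ⟨1, by simp, by simp⟩
  have hξg : φ g ξ ∈ space E Pl {g, g} := by simpa using h.map_mem hξ g
  obtain ⟨f, hf, hft⟩ := h.exists_transcendental (D := {1, g}) (by simp [hγ])
  have hfg : φ g f ∈ space E Pl {1, g} := by
    have := h.map_mem hf g
    rw [Multiset.insert_eq_cons, Multiset.map_cons, Multiset.map_singleton, h.sq, mul_one] at this
    rwa [Multiset.pair_comm]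
  have hplus : ∃ c : E, algebraMap E L c = f + φ g f := by
    by_contra! hcon
    refine hinv g hg _ (add_mem hf hfg) (h.transcendental hcon) ?_
    rw [map_add, h.apply_apply, add_comm]
  obtain ⟨c, hc⟩ := hplus
  have hminus : f - φ g f ≠ 0 := by
    intro h0
    exact hinv g hg f hf hft (sub_eq_zero.1 h0).symm
  have := h.finite ({1, 1} + {g, g})
  have hV : Module.finrank E (space E Pl ({1, 1} + {g, g})) ≤ 4 := h.finrank_le_card hP {1, g, g}
  have hle : ({1, g} : Multiset Γ) ≤ {1, 1} + {g, g} := by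
    rw [Multiset.le_iff_count]; intro z; simp [Multiset.count_cons, Multiset.count_singleton]; omega
  have hindep : LinearIndependent E ![f - φ g f, ξ - φ g ξ] := by
    rw [LinearIndependent.pair_iff' hminus]
    intro s hs
    have h1 : ξ ∈ space E Pl {1, g, g} := by
      have e : ξ = s • (f - φ g f) + φ g ξ := by rw [hs]; ring
      rw [e]
      refine add_mem (Submodule.smul_mem _ _ (sub_mem (mono ?_ hf) (mono ?_ hfg))) (mono ?_ hξg)
      all_goals rw [Multiset.le_iff_count]; intro z; simp [Multiset.count_cons]
    have h2 := h.mem_space_inter hξ h1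
    have h3 : ({1, 1} : Multiset Γ) ∩ {1, g, g} = {1} := by
      ext z
      simp only [Multiset.count_inter, Multiset.insert_eq_cons, Multiset.count_cons,
        Multiset.count_singleton]
      have : ¬ (z = 1 ∧ z = g) := fun hh => hg (hh.2.symm.trans hh.1)
      split_ifs <;> simp_all
    rw [h3] at h2
    obtain ⟨c, hc⟩ := hP _ h2
    exact ht (hc ▸ isAlgebraic_algebraMap c)
  have hdim := h.finrank_invariants_le (space E Pl ({1, 1} + {g, g})) g (n := 2) _ hindep
    (by
      intro i
      fin_cases i
      · exact sub_mem (mono hle hf) (mono hle hfg)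
      · exact sub_mem (mono (Multiset.le_add_right _ _) hξ) (mono (Multiset.le_add_left _ _) hξg))
    (by
      intro i
      fin_cases i
      · change φ g (f - φ g f) = -(f - φ g f)
        rw [map_sub, h.apply_apply]; ring
      · change φ g (ξ - φ g ξ) = -(ξ - φ g ξ)
        rw [map_sub, h.apply_apply]; ring)
  set V := space E Pl ({1, 1} + {g, g}) with hVdef
  let V₁ : Submodule E L := V ⊓ LinearMap.eqLocus (φ g).toLinearMap LinearMap.id
  have hfin : FiniteDimensional E V₁ := Submodule.finiteDimensional_of_le inf_le_left
  have m1 : (1 : L) ∈ V₁ := ⟨one_mem _, map_one (φ g)⟩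
  have m2 : ξ + φ g ξ ∈ V₁ := ⟨add_mem (mono (Multiset.le_add_right _ _) hξ) (mono (Multiset.le_add_left _ _) hξg), by
    change φ g (ξ + φ g ξ) = _
    rw [map_add, h.apply_apply, add_comm]; rfl⟩
  have m3 : ξ * φ g ξ ∈ V₁ := ⟨mul_mem hξ hξg, by
    change φ g (ξ * φ g ξ) = _
    rw [map_mul, h.apply_apply, mul_comm]; rfl⟩
  have hdep : ¬ LinearIndependent E (![⟨1, m1⟩, ⟨_, m2⟩, ⟨_, m3⟩] : Fin 3 → V₁) := by
    intro hli
    have := hli.fintype_card_le_finrank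
    rw [Fintype.card_fin] at this
    change Module.finrank E V₁ + 2 ≤ _ at hdim
    omega
  rw [Fintype.not_linearIndependent_iff] at hdep
  obtain ⟨c, hc, i, hi⟩ := hdep
  refine mob_of_dependent ht (c := ![c 0, c 1, c 1, c 2]) (fun h0 => hi ?_) ?_
  · have e0 := congrFun h0 0
    have e1 := congrFun h0 1
    have e2 := congrFun h0 3
    fin_cases i <;> simpa
  · have := congrArg Subtype.val hc
    simp only [Fin.sum_univ_three, Matrix.cons_val_zero, Matrix.cons_val_one, Matrix.cons_val,
      Submodule.coe_add, Submodule.coe_smul, ZeroMemClass.coe_zero, smul_add] at this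
    simp only [Matrix.cons_val_zero, Matrix.cons_val_one, Matrix.cons_val]
    rw [← this]; ring

end PointAction
end PointAction
end CremonaRank

namespace CremonaRank
open Polynomial Bivariate TensorProduct

namespace Curve
variable {F K E : Type*} [Field F] [Field K] [Algebra F K] [Field E] [Algebra F E]
  {x y : K} {d : ℕ} {Φ : F[X][Y]}

/-- After base change to the function field, a group of exponent two of automorphisms of a curve
acts freely on the orbit of the generic point. -/
lemma exists_pointAction {Γ : Type*} [Group Γ] (h : Curve F x y d Φ) (φ : Γ →* (K ≃ₐ[F] K))
    (hφ : Function.Injective φ) (hsq : ∀ g : Γ, g * g = 1) (two : (2 : F) ≠ 0)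
    (hE : ∀ u : E, IsIntegral F u → ∃ c, algebraMap F E c = u) (g₀ : K →ₐ[F] E)
    (hΦ : ev F x y (derivative Φ) ≠ 0) {γ : ℕ}
    (hfam : ∃ n₀, ∀ n ≥ n₀, ∃ (N : ℕ) (u : Fin N → K), LinearIndependent F u ∧
      n * d + 1 ≤ N + γ ∧ ∀ i, u i ∈ finite F x ⊓ infinite F x n)
    (L : Type*) [Field L] [Algebra (E ⊗[F] K) L] [IsFractionRing (E ⊗[F] K) L]
    [Algebra E L] [IsScalarTower E (E ⊗[F] K) L] :
    ∃ Pl : Γ → ValuationSubring L, PointAction (extend E L φ) Pl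
      (algebraMap (E ⊗[F] K) L (1 ⊗ₜ x)) d γ := by
  have := h.isDomain_tensor hE
  have hb := h.baseChange E L
  have hpt : ∀ a : Γ, ∃ O : ValuationSubring L,
      IsPoint E (algebraMap (E ⊗[F] K) L (1 ⊗ₜ x)) O ∧
      ∀ u, u ∈ O ↔ ∃ t s : E ⊗[F] K, point (g₀.comp (φ a : K →ₐ[F] K)) t ≠ 0 ∧
        u * algebraMap (E ⊗[F] K) L t = algebraMap (E ⊗[F] K) L s := by
    intro a
    have e : ∀ P : F[X][Y], ev E ((g₀.comp (φ a : K →ₐ[F] K)) x) ((g₀.comp (φ a : K →ₐ[F] K)) y)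
        (bmap F E P) = (g₀.comp (φ a : K →ₐ[F] K)) (ev F x y P) := by
      intro P
      rw [ev_bmap, algHom_ev]
    have hder : derivative (bmap F E Φ) = bmap F E (derivative Φ) := by
      simp [bmap, derivative_map]
    obtain ⟨O, hO, hmem⟩ := hb.exists_isPoint
      (s := (g₀.comp (φ a : K →ₐ[F] K)) x) (t := (g₀.comp (φ a : K →ₐ[F] K)) y)
      (by rw [e, (h.ker _).2 dvd_rfl, map_zero])
      (by rw [hder, e]; exact (_root_.map_ne_zero _).2 hΦ)
    exact ⟨O, hO, fun u => (hmem u).trans (h.mem_local_iff _ u)⟩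
  choose Pl hPl hmem using hpt
  have hmem' : ∀ a u, u ∈ Pl a ↔ ∃ t s : E ⊗[F] K, point g₀ t ≠ 0 ∧
      extend E L φ a u * algebraMap (E ⊗[F] K) L t = algebraMap (E ⊗[F] K) L s := fun a u =>
    (hmem a u).trans (mem_local_comp g₀ φ a u)
  have hinv : ∀ x : Γ, x⁻¹ = x := fun x => inv_eq_of_mul_eq_one_left (hsq x)
  have hcomm : ∀ a b : Γ, a * b = b * a := fun a b => by
    rw [← hinv (a * b), mul_inv_rev, hinv, hinv]
  have hiff : ∀ g a u, extend E L φ g u ∈ Pl (g * a) ↔ u ∈ Pl a := by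
    intro g a u
    have e : extend E L φ (g * a) (extend E L φ g u) = extend E L φ a u := by
      rw [← AlgEquiv.mul_apply, ← map_mul, hcomm g a, mul_assoc, hsq, mul_one]
    rw [hmem', hmem', e]
  have hPlinj : Function.Injective Pl := by
    intro a b hab
    by_contra hne
    have hne' : g₀.comp (φ a : K →ₐ[F] K) ≠ g₀.comp (φ b : K →ₐ[F] K) := by
      intro e
      refine hne (hφ (AlgEquiv.ext fun u => g₀.injective ?_))
      exact DFunLike.congr_fun e u
    obtain ⟨u, hu, hu'⟩ := not_mem_local_of_ne (L := L) hne'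
    rw [← hmem, ← hab] at hu
    rw [← hmem] at hu'
    exact hu' hu
  refine ⟨Pl, ?_, hsq, fun h2 => two ?_, hPl, hPlinj, hiff, hb.transcendental,
    hb.exists_dependent, ?_⟩
  · refine (injective_iff_map_eq_one _).2 fun a ha => hPlinj (SetLike.ext fun u => ?_)
    have := hiff a 1 u
    rwa [ha, mul_one, AlgEquiv.one_apply] at this
  · apply (algebraMap F E).injective
    rw [map_ofNat, map_zero, h2]
  · intro D hD
    have := (hPl 1).finiteDimensional D hD
    obtain ⟨n₀, hn⟩ := hfam
    exact hb.le_finrank_rr ⟨n₀, fun n hn' => exists_family_baseChange L (hn n hn')⟩ D hD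

section Bounds
variable {Γ : Type*} [Group Γ] [Finite Γ] (h : Curve F x y d Φ) (φ : Γ →* (K ≃ₐ[F] K))
    (hφ : Function.Injective φ) (hsq : ∀ g : Γ, g * g = 1) (two : (2 : F) ≠ 0)
    (hK : ∀ u : K, IsIntegral F u → ∃ c, algebraMap F K c = u)
    (hΦ : ev F x y (derivative Φ) ≠ 0)
include h hφ hsq two hK hΦ

/-- A group of exponent two of automorphisms of a curve of genus zero has at most four elements. -/
theorem card_le_four (hγ : Module.finrank F (conductor F x y d) = 0) : Nat.card Γ ≤ 4 := by
  have := h.isDomain_tensor hK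
  obtain ⟨Pl, hPl⟩ := h.exists_pointAction φ hφ hsq two hK (AlgHom.id F K) hΦ h.exists_family
    (FractionRing (K ⊗[F] K))
  exact hPl.card_le_four_of_eq_zero hγ

/-- A group of exponent two of automorphisms of a curve of genus one has at most eight elements. -/
theorem card_le_eight (hγ : Module.finrank F (conductor F x y d) = 1) : Nat.card Γ ≤ 8 := by
  have := h.isDomain_tensor hK
  obtain ⟨Pl, hPl⟩ := h.exists_pointAction φ hφ hsq two hK (AlgHom.id F K) hΦ h.exists_family
    (FractionRing (K ⊗[F] K))
  exact hPl.card_le_eight hγ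

end Bounds
end Curve
end CremonaRank

namespace CremonaRank
open Polynomial Bivariate

section Adjoint
variable {k K : Type*} [Field k] [Field K] [Algebra k K] {x y : K}

lemma Gen.adj_finiteDimensional (h : Gen k x y) {p q : k[X][Y]} {d : ℕ} (hp : TDegLE d p)
    (hq : TDegLE d q) : FiniteDimensional k (adj (k := k) x y (ev k x y p) (ev k x y q)) := by
  classical
  let s : Finset K := (Finset.range (d + 1) ×ˢ Finset.range (d + 1)).image
    fun ij => ev k x y (C X ^ ij.1 * Y ^ ij.2)
  refine Submodule.finiteDimensional_of_le (S₂ := Submodule.span k (s : Set K)) ?_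
  intro m hm
  obtain ⟨P, rfl⟩ := h.exists_of_mem_adj hm
  have hP : TDegLE d P := fun i j hij => by
    by_contra h0
    have := h.tdegLE_of_mem_adj hp hq hm h0
    omega
  rw [ev_eq_sum, Polynomial.sum_def]
  refine Submodule.sum_mem _ fun j hj => ?_
  rw [Polynomial.aeval_eq_sum_range, Finset.sum_mul]
  refine Submodule.sum_mem _ fun i hi => ?_
  rw [smul_mul_assoc]
  by_cases h0 : (P.coeff j).coeff i = 0
  · rw [h0, zero_smul]; exact Submodule.zero_mem _
  refine Submodule.smul_mem _ _ (Submodule.subset_span ?_)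
  have := h.tdegLE_of_mem_adj hp hq hm h0
  exact Finset.mem_coe.2 (Finset.mem_image.2 ⟨(i, j), Finset.mem_product.2 ⟨Finset.mem_range.2 (by omega),
    Finset.mem_range.2 (by omega)⟩, by rw [map_mul, map_pow, map_pow, ev_X, ev_Y]⟩)

variable {F : Type*} [Field F] [Algebra k F] [Algebra F K] [IsScalarTower k F K]

/-- The genus is bounded by the dimension of the space of adjoint polynomials. -/
theorem finrank_conductor_le [IsAlgClosed k] (h : Gen k x y) {f : F} {p q : k[X][Y]} {d : ℕ}
    {Φ : F[X][Y]} (hC : Curve F x y d Φ) (hf : ∀ c : k, algebraMap k F c ≠ f)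
    (hker : ∀ N, ev F x y N = 0 → pencil f p q ∣ N)
    (hrel : algebraMap F K f * ev k x y q = ev k x y p)
    (hpq : IsRelPrime p q) (hp : TDegLE d p) (hq : TDegLE d q)
    (htop : IsCoprime (top d p) (top d q))
    (hY : (p.coeff d).coeff 0 ≠ 0 ∨ (q.coeff d).coeff 0 ≠ 0) :
    Module.finrank F (Curve.conductor F x y d) ≤
      Module.finrank k (adj (k := k) x y (ev k x y p) (ev k x y q)) := by
  by_cases hd : d < 3
  · have : IsEmpty (Mon d (d - 2)) := ⟨fun m => by
      have := m.2.2
      omega⟩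
    have : Subsingleton (Curve.conductor F x y d) := inferInstance
    rw [Module.finrank_zero_of_subsingleton]
    exact Nat.zero_le _
  obtain ⟨n, rfl⟩ : ∃ n, d = n + 3 := ⟨d - 3, by omega⟩
  have := h.adj_finiteDimensional hp hq
  let M := adj (k := k) x y (ev k x y p) (ev k x y q)
  let b := Module.finBasis k M
  choose B hB using fun l => h.exists_of_mem_adj (b l).2
  let vec : k[X][Y] → (Mon (n + 3) (n + 3 - 2) → F) := fun P m =>
    algebraMap k F ((P.coeff m.1).coeff m.2)
  have hle : Curve.conductor F x y (n + 3) ≤ Submodule.span F (Set.range fun l => vec (B l)) := by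
    intro v hv
    obtain ⟨N, e, Q, he, hQ⟩ := exists_fam (k := k) (toPoly (n + 3) (n + 3 - 2) v)
    have hdeg : ∀ i, TDegLE n (Q i) := TDegLE.of_fam he (by
      rw [← hQ]; exact tDegLE_toPoly (n := n) v)
    have hcond : ∀ w : K, IsIntegral (Algebra.adjoin F {x, y}) w →
        ∃ a, ev F x y (fam e Q) * w = ev F x y a := by
      intro w hw
      rw [← hQ]
      refine hv w fun O hO hx => ?_
      have hsub : ∀ a ∈ Algebra.adjoin F {x, y}, a ∈ O := by
        intro a ha
        obtain ⟨P, rfl⟩ := mem_adjoin_pair.1 ha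
        exact hO.ev_mem hx (hC.y_mem hO hx) P
      let g : Algebra.adjoin F {x, y} →+* O :=
        { toFun := fun a => ⟨a, hsub a a.2⟩
          map_one' := rfl
          map_mul' := fun _ _ => rfl
          map_zero' := rfl
          map_add' := fun _ _ => rfl }
      obtain ⟨P, hP, hPw⟩ := hw
      have hwint : IsIntegral O w := ⟨P.map g, hP.map g, by
        rw [eval₂_map]; exact hPw⟩
      obtain ⟨z, rfl⟩ := IsIntegrallyClosed.isIntegral_iff.1 hwint
      exact z.2
    have hmem : ∀ i, ev k x y (Q i) ∈ M := fun i O δ hO =>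
      val_mul_le_of_conductor hf he h.inj hker hrel hcond hpq hp hq htop hY (by omega)
        (by simpa using hdeg) hO i
    have hlin : ∀ i, Q i = ∑ l, C (C (b.repr ⟨_, hmem i⟩ l)) * B l := by
      intro i
      apply h.inj
      have := congrArg (Subtype.val) (b.sum_repr ⟨_, hmem i⟩)
      simp only [Submodule.coe_sum, Submodule.coe_smul] at this
      refine this.symm.trans ?_
      rw [map_sum]
      refine Finset.sum_congr rfl fun l _ => ?_
      rw [map_mul, hB, ev_CC, Algebra.smul_def]
    have hv' : v = ∑ l, (∑ i, b.repr ⟨_, hmem i⟩ l • e i) • vec (B l) := by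
      ext m
      rw [← coeff_toPoly v m, hQ, coeff_fam, Finset.sum_apply]
      have : ∀ i, (((Q i).coeff m.1).coeff m.2) • e i =
          ∑ l, (b.repr ⟨_, hmem i⟩ l * ((B l).coeff m.1).coeff m.2) • e i := by
        intro i
        conv_lhs => rw [hlin i]
        simp [finsetSum_coeff, coeff_C_mul, Finset.sum_smul]
      rw [Finset.sum_congr rfl fun i _ => this i, Finset.sum_comm]
      refine Finset.sum_congr rfl fun l _ => ?_
      rw [Pi.smul_apply, smul_eq_mul, Finset.sum_mul]
      refine Finset.sum_congr rfl fun i _ => ?_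
      simp only [vec, Algebra.smul_def, map_mul]
      ring
    rw [hv']
    exact Submodule.sum_mem _ fun l _ =>
      Submodule.smul_mem _ _ (Submodule.subset_span ⟨l, rfl⟩)
  refine (Submodule.finrank_mono hle).trans ((finrank_range_le_card _).trans ?_)
  rw [Fintype.card_fin]

end Adjoint
end CremonaRank

namespace CremonaRank
open Polynomial Bivariate

section Core
variable {k K Γ : Type*} [Field k] [Field K] [Algebra k K] [Group Γ]

/-- The group permutes, up to projectivities, the members of a pencil of curves of degree `d`. -/
def HasPencil (φ : Γ →* (K ≃ₐ[k] K)) (d : ℕ) : Prop :=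
  ∃ (x y : K) (p q : k[X][Y]) (f : K) (A : Γ → Matrix (Fin 2) (Fin 2) k), Gen k x y ∧
    TDegLE d p ∧ TDegLE d q ∧ ev k x y q ≠ 0 ∧ f * ev k x y q = ev k x y p ∧
    Transcendental k f ∧ ∀ g, Mob (A g) f (φ g f)

lemma transcendental_of_forall_ne [IsAlgClosed k] {f : K} (hf : ∀ c : k, algebraMap k K c ≠ f) :
    Transcendental k f := by
  intro halg
  obtain ⟨c, hc⟩ := minpoly.mem_range_of_degree_eq_one k f
    (IsAlgClosed.degree_eq_one_of_irreducible k (minpoly.irreducible halg.isIntegral))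
  exact hf c hc

lemma card_le_of_cover [Finite Γ] (H : Subgroup Γ) {n : ℕ} (c : Fin n → Γ)
    (hc : ∀ h, ∃ i, c i * h ∈ H) : Nat.card Γ ≤ n * Nat.card H := by
  choose i hi using hc
  have hinj : Function.Injective fun h : Γ => ((i h, ⟨c (i h) * h, hi h⟩) : Fin n × H) := by
    intro a b hab
    have h1 := congrArg Prod.fst hab
    have h2 := congrArg (fun z : Fin n × H => (z.2 : Γ)) hab
    simp only at h1 h2
    rw [h1] at h2
    exact mul_left_cancel h2
  have := Nat.card_le_card_of_injective _ hinj
  rwa [Nat.card_prod, Nat.card_fin] at this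

variable {F : Type*} [Field F] [Algebra k F] [Algebra F K] [IsScalarTower k F K]

/-- The pencil in general position gives a plane curve over the field generated by `f`. -/
lemma exists_curve {x y : K} (h : Gen k x y) {f : F} {p q : k[X][Y]} {d : ℕ}
    (hf : ∀ c : k, algebraMap k F c ≠ f)
    (hF : ∀ z : F, ∃ a b : k[X], aeval f b ≠ 0 ∧ z * aeval f b = aeval f a)
    (hrel : algebraMap F K f * ev k x y q = ev k x y p)
    (hpq : IsRelPrime p q) (hp : TDegLE d p) (hq : TDegLE d q)
    (hY : (p.coeff d).coeff 0 ≠ 0 ∨ (q.coeff d).coeff 0 ≠ 0)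
    (hder : ev F x y (derivative (pencil f p q)) ≠ 0) :
    ∃ Φ, Curve F x y d Φ ∧ ev F x y (derivative Φ) ≠ 0 := by
  have hf0 : f ≠ 0 := fun e => hf 0 (by rw [map_zero, e])
  set c : F := algebraMap k F ((p.coeff d).coeff 0) - f * algebraMap k F ((q.coeff d).coeff 0)
    with hc
  have hc0 : c ≠ 0 := by
    intro h0
    have h1 : algebraMap k F ((p.coeff d).coeff 0) = f * algebraMap k F ((q.coeff d).coeff 0) :=
      sub_eq_zero.1 h0
    by_cases hq0 : (q.coeff d).coeff 0 = 0
    · rw [hq0, map_zero, mul_zero, map_eq_zero] at h1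
      exact hY.elim (· h1) (· hq0)
    · refine hf ((p.coeff d).coeff 0 / (q.coeff d).coeff 0) ?_
      rw [map_div₀, h1, mul_div_cancel_right₀]
      rwa [Ne, map_eq_zero]
  have hu : IsUnit (C (C c⁻¹) : F[X][Y]) := by
    rw [isUnit_C, isUnit_C]; exact (inv_ne_zero hc0).isUnit
  have hcoeff : ∀ i j, ((C (C c⁻¹) * pencil f p q).coeff j).coeff i = c⁻¹ *
      (algebraMap k F ((p.coeff j).coeff i) - f * algebraMap k F ((q.coeff j).coeff i)) := by
    intro i j
    rw [coeff_C_mul, coeff_C_mul, coeff_pencil]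
  have ht : TDegLE d (C (C c⁻¹) * pencil f p q) := by
    intro i j hij
    rw [hcoeff, hp i j hij, hq i j hij]; simp
  have hd : (C (C c⁻¹) * pencil f p q).coeff d = 1 := by
    ext i
    rcases Nat.eq_zero_or_pos i with rfl | hi
    · rw [hcoeff, ← hc, inv_mul_cancel₀ hc0, coeff_one_zero]
    · rw [ht _ _ (by omega), coeff_one, if_neg hi.ne']
  have hle : (C (C c⁻¹) * pencil f p q).natDegree ≤ d := by
    rw [natDegree_le_iff_coeff_eq_zero]
    intro j hj
    ext i
    rw [ht _ _ (by omega), coeff_zero]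
  refine ⟨C (C c⁻¹) * pencil f p q, ⟨monic_of_natDegree_le_of_coeff_eq_one d hle hd,
    le_antisymm hle (le_natDegree_of_ne_zero (by rw [hd]; exact one_ne_zero)), ht, fun N => ?_,
    fun u => ?_⟩, ?_⟩
  · rw [hu.mul_left_dvd]
    refine ⟨pencil_dvd_of_ev_eq_zero hf0 hF h.inj hpq hrel N, ?_⟩
    rintro ⟨M, rfl⟩
    rw [map_mul, ev_pencil hrel, zero_mul]
  · obtain ⟨a, b, hb, e⟩ := h.frac u
    exact ⟨bmap k F a, bmap k F b, by rwa [ev_bmap], by rwa [ev_bmap, ev_bmap]⟩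
  · rw [derivative_C_mul, map_mul, ev_CC]
    exact mul_ne_zero (by rw [Ne, map_eq_zero]; exact inv_ne_zero hc0) hder

/-- The action of the stabilizer of `f` on the field `K` over the field generated by `f`. -/
lemma exists_hom_of_fixes {f : F}
    (hF : ∀ z : F, ∃ a b : k[X], aeval f b ≠ 0 ∧ z * aeval f b = aeval f a)
    (φ : Γ →* (K ≃ₐ[k] K)) (hφ : Function.Injective φ)
    (hfix : ∀ g, φ g (algebraMap F K f) = algebraMap F K f) :
    ∃ ψ : Γ →* (K ≃ₐ[F] K), Function.Injective ψ := by
  have hcomm : ∀ g z, φ g (algebraMap F K z) = algebraMap F K z := by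
    intro g z
    obtain ⟨a, b, hb, e⟩ := hF z
    have h1 : ∀ a : k[X], φ g (algebraMap F K (aeval f a)) = algebraMap F K (aeval f a) := by
      intro a
      rw [← aeval_algebraMap_apply]
      have := aeval_algHom_apply (φ g : K →ₐ[k] K) (algebraMap F K f) a
      rw [AlgEquiv.coe_toAlgHom, hfix] at this
      exact this.symm
    have h2 := congrArg (fun z => φ g (algebraMap F K z)) e
    simp only [map_mul, h1] at h2
    rw [← e, map_mul] at h2
    exact mul_right_cancel₀ (by rwa [Ne, map_eq_zero]) h2
  refine ⟨{ toFun := fun g => AlgEquiv.ofRingEquiv (f := (φ g : K ≃+* K)) (hcomm g)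
            map_one' := ?_
            map_mul' := ?_ }, ?_⟩
  · ext u
    change φ 1 u = u
    rw [map_one]; rfl
  · intro a b
    ext u
    change φ (a * b) u = φ a (φ b u)
    rw [map_mul]; rfl
  · intro a b hab
    refine hφ (AlgEquiv.ext fun u => ?_)
    exact DFunLike.congr_fun hab u

/-- The inductive step for a pencil in general position. -/
theorem card_le_or_hasPencil [IsAlgClosed k] [Finite Γ] {x y : K} (h : Gen k x y) {f : F}
    {p q : k[X][Y]} {d : ℕ} {φ : Γ →* (K ≃ₐ[k] K)} {A : Γ → Matrix (Fin 2) (Fin 2) k}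
    (hφ : Function.Injective φ) (hR : MobRep φ (algebraMap F K f) A)
    (hF : ∀ z : F, ∃ a b : k[X], aeval f b ≠ 0 ∧ z * aeval f b = aeval f a)
    (hK : ∀ u : K, IsIntegral F u → ∃ c, algebraMap F K c = u)
    (hq0 : ev k x y q ≠ 0) (hrel : algebraMap F K f * ev k x y q = ev k x y p)
    (hpq : IsRelPrime p q) (hp : TDegLE d p) (hq : TDegLE d q)
    (htop : IsCoprime (top d p) (top d q))
    (hY : (p.coeff d).coeff 0 ≠ 0 ∨ (q.coeff d).coeff 0 ≠ 0)
    (hder : ev F x y (derivative (pencil f p q)) ≠ 0) :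
    Nat.card Γ ≤ 16 ∨ ∃ d' < d, HasPencil φ d' := by
  have hf : ∀ c : k, algebraMap k F c ≠ f := by
    rintro c rfl
    refine hR.tr ?_
    rw [← IsScalarTower.algebraMap_apply]
    exact isAlgebraic_algebraMap c
  have hf0 : f ≠ 0 := fun e => hf 0 (by rw [map_zero, e])
  obtain ⟨Φ, hC, hΦ⟩ := exists_curve h hf hF hrel hpq hp hq hY hder
  have := h.adj_finiteDimensional hp hq
  have hγ := finrank_conductor_le h hC hf (fun N hN => pencil_dvd_of_ev_eq_zero hf0 hF h.inj hpq hrel N hN)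
    hrel hpq hp hq htop hY
  obtain ⟨T, hT, hTmul⟩ := h.exists_twisted hR.mob hq0 hrel
  have hTinj : ∀ g v, T g v = 0 → v = 0 := by
    intro g v hv
    obtain ⟨r, hr, e⟩ := hT g
    have h1 := e v
    rw [hv] at h1
    have h2 : φ g (v : K) = 0 := by
      simpa [hr] using h1.symm
    exact Subtype.ext ((map_eq_zero_iff _ (φ g).injective).1 h2)
  let H : Subgroup Γ :=
    { carrier := {g | φ g (algebraMap F K f) = algebraMap F K f}
      mul_mem' := fun {a b} ha hb => by
        change φ (a * b) _ = _
        rw [map_mul, AlgEquiv.mul_apply, show φ b _ = _ from hb, show φ a _ = _ from ha]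
      one_mem' := by
        change φ 1 _ = _
        rw [map_one]; rfl
      inv_mem' := fun {a} ha => by
        have : a⁻¹ = a := inv_eq_of_mul_eq_one_left (hR.sq a)
        rw [this]; exact ha }
  obtain ⟨ψ, hψ⟩ := exists_hom_of_fixes hF (φ.comp H.subtype)
    (hφ.comp H.subtype_injective) (fun g => g.2)
  have hsq : ∀ g : H, g * g = 1 := fun g => Subtype.ext (hR.sq g)
  have two : (2 : F) ≠ 0 := by
    intro h2
    apply hR.two
    apply (algebraMap k F).injective
    rw [map_ofNat, map_zero, h2]
  have h8 := hC.card_le_eight ψ hψ hsq two hK hΦ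
  have h4 := hC.card_le_four ψ hψ hsq two hK hΦ
  rcases Nat.lt_or_ge (Module.finrank k (adj (k := k) x y (ev k x y p) (ev k x y q))) 2 with hlt | hge
  · left
    rcases Nat.lt_or_ge (Module.finrank k (adj (k := k) x y (ev k x y p) (ev k x y q))) 1 with h0 | h1
    · obtain ⟨a, b, hab⟩ := hR.exists_cover
      have := card_le_of_cover H ![1, a, b, a * b] fun h => by
        rcases hab h with h1 | h1 | h1 | h1
        · exact ⟨0, by rw [Matrix.cons_val_zero, one_mul]; exact h1⟩
        · exact ⟨1, h1⟩
        · exact ⟨2, h1⟩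
        · exact ⟨3, by rw [← mul_assoc] at h1; exact h1⟩
      have := h4 (by omega)
      omega
    · obtain ⟨a, hab⟩ := hR.exists_cover_of_finrank_eq_one hTmul hTinj (by omega)
      have := card_le_of_cover H ![1, a] fun h => by
        rcases hab h with h1 | h1
        · exact ⟨0, by rw [Matrix.cons_val_zero, one_mul]; exact h1⟩
        · exact ⟨1, h1⟩
      have : Nat.card H ≤ 8 := by
        rcases Nat.lt_or_ge (Module.finrank F (Curve.conductor F x y d)) 1 with h0 | h0
        · exact (h4 (by omega)).trans (by norm_num)
        · exact h8 (by omega)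
      omega
  · right
    obtain ⟨m₀, m₁, hli, hB⟩ := hR.exists_stable_plane hTinj hTmul hge
    choose B hB using hB
    obtain ⟨q', hq'⟩ := h.exists_of_mem_adj m₀.2
    obtain ⟨p', hp'⟩ := h.exists_of_mem_adj m₁.2
    have hm₀ : (m₀ : K) ≠ 0 := by
      have := hli.ne_zero 0
      simpa using this
    have hdeg : ∀ {P : k[X][Y]}, ev k x y P ∈ adj (k := k) x y (ev k x y p) (ev k x y q) →
        TDegLE (d - 3) P := by
      intro P hP i j hij
      by_contra h0
      have := h.tdegLE_of_mem_adj hp hq hP h0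
      omega
    refine ⟨d - 3, ?_, x, y, p', q', m₁ / m₀, B, h, hdeg (by rw [hp']; exact m₁.2),
      hdeg (by rw [hq']; exact m₀.2), by rwa [hq'], by rw [hq', hp', div_mul_cancel₀ _ hm₀],
      transcendental_of_forall_ne ?_, ?_⟩
    · have := hC.d_pos
      omega
    · intro c hc
      rw [eq_div_iff hm₀] at hc
      rw [LinearIndependent.pair_iff] at hli
      have := (hli c (-1) (Subtype.ext (by simp [Algebra.smul_def, hc]))).2
      simp at this
    · intro g
      obtain ⟨r, hr, e⟩ := hT g
      obtain ⟨h0, h1⟩ := hB g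
      have e0 : r * φ g m₀ = algebraMap k K (B g 1 0) * m₁ + algebraMap k K (B g 1 1) * m₀ := by
        rw [← e, h0]; simp [Algebra.smul_def]
      have e1 : r * φ g m₁ = algebraMap k K (B g 0 0) * m₁ + algebraMap k K (B g 0 1) * m₀ := by
        rw [← e, h1]; simp [Algebra.smul_def]
      have hφ0 : φ g (m₀ : K) ≠ 0 := (map_ne_zero_iff _ (φ g).injective).2 hm₀
      have e2 : algebraMap k K (B g 1 0) * (m₁ / m₀) + algebraMap k K (B g 1 1) = r * φ g m₀ / m₀ := by
        rw [e0]; field_simp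
      have e3 : algebraMap k K (B g 0 0) * (m₁ / m₀) + algebraMap k K (B g 0 1) = r * φ g m₁ / m₀ := by
        rw [e1]; field_simp
      refine ⟨?_, ?_⟩
      · rw [e2]
        exact div_ne_zero (mul_ne_zero hr hφ0) hm₀
      · rw [e2, e3, map_div₀]
        field_simp

end Core
end CremonaRank

namespace CremonaRank
open Polynomial Bivariate

section Grading
variable {k : Type*} [Field k]

/-- The substitution `X ↦ X Z`, `Y ↦ Y Z` recording the total degree. -/
noncomputable def gr (k : Type*) [Field k] : k[X][Y] →ₐ[k] k[X][Y][X] :=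
  ev k (C (C X) * X : k[X][Y][X]) (C Y * X : k[X][Y][X])

lemma coeff_gr (P : k[X][Y]) (i j n : ℕ) : (((gr k P).coeff n).coeff j).coeff i =
    if i + j = n then (P.coeff j).coeff i else 0 := by
  induction P using Polynomial.induction_on' with
  | add a b ha hb =>
    rw [map_add, coeff_add, coeff_add, coeff_add, ha, hb, coeff_add, coeff_add]
    split_ifs <;> simp
  | monomial m a =>
    induction a using Polynomial.induction_on' with
    | add a b ha hb =>
      rw [map_add, map_add, coeff_add, coeff_add, coeff_add, ha, hb, coeff_add, coeff_add]
      split_ifs <;> simp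
    | monomial l c =>
      have e : (monomial m (monomial l c) : k[X][Y]) = C (C c) * (C X ^ l * Y ^ m) := by
        rw [← C_mul_X_pow_eq_monomial, ← C_mul_X_pow_eq_monomial]; simp [mul_assoc]
      have e2 : gr k (monomial m (monomial l c)) =
          C (monomial m (monomial l c)) * X ^ (l + m) := by
        rw [e]
        simp only [gr, map_mul, map_pow, ev_X, ev_Y, ev_CC]
        rw [show algebraMap k k[X][Y][X] c = C (C (C c)) from rfl]
        ring
      rw [e2, coeff_C_mul, coeff_X_pow, mul_ite, mul_one, mul_zero]
      by_cases hj : m = j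
      · by_cases hi : l = i
        · subst hj hi
          by_cases hn : l + m = n
          · rw [if_pos hn, if_pos hn.symm]
          · rw [if_neg hn, if_neg (Ne.symm hn)]; simp
        · split_ifs <;> simp [hj, coeff_monomial, hi]
      · split_ifs <;> simp [hj, coeff_monomial]

lemma gr_injective : Function.Injective (gr k) := fun P Q h => by
  ext j i
  have := coeff_gr P i j (i + j)
  rw [if_pos rfl] at this
  rw [← this, h, coeff_gr, if_pos rfl]

lemma tDegLE_iff {d : ℕ} {P : k[X][Y]} : TDegLE d P ↔ (gr k P).natDegree ≤ d := by
  rw [natDegree_le_iff_coeff_eq_zero]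
  constructor
  · intro h n hn
    ext j i
    rw [coeff_gr]
    split_ifs with hij
    · rw [h i j (by omega)]; simp
    · simp
  · intro h i j hij
    have := coeff_gr P i j (i + j)
    rw [if_pos rfl, h _ hij] at this
    simpa using this.symm

lemma gr_natDegree_mul {P Q : k[X][Y]} (hP : P ≠ 0) (hQ : Q ≠ 0) :
    (gr k (P * Q)).natDegree = (gr k P).natDegree + (gr k Q).natDegree := by
  rw [map_mul, natDegree_mul] <;> rwa [Ne, map_eq_zero_iff _ gr_injective]

lemma isUnit_of_gr_natDegree_eq_zero {P : k[X][Y]} (hP : P ≠ 0)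
    (h : (gr k P).natDegree = 0) : IsUnit P := by
  have h0 : TDegLE 0 P := tDegLE_iff.2 h.le
  have e : P = C (C ((P.coeff 0).coeff 0)) := by
    ext j i
    by_cases hij : 0 < i + j
    · rw [h0 i j hij]
      rcases Nat.eq_zero_or_pos j with rfl | hj
      · rw [coeff_C_zero, coeff_C, if_neg (by omega)]
      · rw [coeff_C, if_neg (by omega), coeff_zero]
    · obtain ⟨rfl, rfl⟩ : i = 0 ∧ j = 0 := by omega
      simp
  rw [e, isUnit_C, isUnit_C]
  refine IsUnit.mk0 _ fun h0 => hP ?_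
  rw [e, h0, C_0, C_0]

/-- Homogenized evaluation of a polynomial in one variable at a pair of elements. -/
noncomputable def homEval {R : Type*} [CommRing R] [Algebra k R] (n : ℕ) (a : k[X]) (s t : R) : R :=
  ∑ i ∈ Finset.range (n + 1), algebraMap k R (a.coeff i) * (s ^ i * t ^ (n - i))

lemma map_homEval {R S : Type*} [CommRing R] [Algebra k R] [CommRing S] [Algebra k S]
    (φ : R →ₐ[k] S) (n : ℕ) (a : k[X]) (s t : R) :
    φ (homEval n a s t) = homEval n a (φ s) (φ t) := by
  simp [homEval]

lemma homEval_mul {R : Type*} [CommRing R] [Algebra k R] {n : ℕ} {a : k[X]} (ha : a.natDegree ≤ n)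
    (s t : R) : homEval n a (s * t) t = aeval s a * t ^ n := by
  rw [aeval_eq_sum_range' (Nat.lt_succ_of_le ha), homEval, Finset.sum_mul]
  refine Finset.sum_congr rfl fun i hi => ?_
  have := Finset.mem_range.1 hi
  rw [Algebra.smul_def, mul_pow]
  conv_rhs => rw [show n = i + (n - i) by omega, pow_add]
  ring

lemma homEval_zero {R : Type*} [CommRing R] [Algebra k R] (n : ℕ) (a : k[X]) (s : R) :
    homEval n a s 0 = algebraMap k R (a.coeff n) * s ^ n := by
  rw [homEval, Finset.sum_eq_single n]
  · simp
  · intro i hi hne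
    have := Finset.mem_range.1 hi
    rw [zero_pow (by omega)]; simp
  · simp

lemma coeff_homEval {R : Type*} [CommRing R] [Algebra k R] (n : ℕ) (a : k[X]) {s t : R[X]} {e : ℕ}
    (hs : s.natDegree ≤ e) (ht : t.natDegree ≤ e) :
    (homEval n a s t).coeff (n * e) = homEval n a (s.coeff e) (t.coeff e) := by
  rw [homEval, finsetSum_coeff, homEval]
  refine Finset.sum_congr rfl fun i hi => ?_
  have := Finset.mem_range.1 hi
  rw [IsScalarTower.algebraMap_apply k R R[X], Polynomial.algebraMap_eq, coeff_C_mul]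
  congr 1
  conv_lhs => rw [show n * e = i * e + (n - i) * e by rw [← add_mul]; congr 1; omega]
  rw [coeff_mul_add_eq_of_natDegree_le (natDegree_pow_le_of_le i hs) (natDegree_pow_le_of_le _ ht),
    coeff_pow_of_natDegree_le hs, coeff_pow_of_natDegree_le ht]

/-- Coprime forms have no common zeros. -/
lemma eq_zero_of_homEval {R : Type*} [CommRing R] [IsDomain R] [Algebra k R] {n : ℕ} {a b : k[X]}
    (ha : a.natDegree ≤ n) (hb : b.natDegree ≤ n) (hn : a.coeff n ≠ 0 ∨ b.coeff n ≠ 0)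
    (hab : IsCoprime a b) {s t : R} (h1 : homEval n a s t = 0) (h2 : homEval n b s t = 0) :
    s = 0 ∧ t = 0 := by
  have ht : t = 0 := by
    by_contra ht
    let S := FractionRing R
    have ht' : algebraMap R S t ≠ 0 := by
      rwa [Ne, map_eq_zero_iff _ (IsFractionRing.injective R S)]
    have key : ∀ {a : k[X]}, a.natDegree ≤ n → homEval n a s t = 0 →
        aeval (algebraMap R S s / algebraMap R S t) a = 0 := by
      intro a ha h
      have h3 := congrArg (IsScalarTower.toAlgHom k R S) h
      rw [map_homEval, map_zero] at h3
      have h4 := homEval_mul ha (algebraMap R S s / algebraMap R S t) (algebraMap R S t)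
      rw [div_mul_cancel₀ _ ht'] at h4
      exact (mul_eq_zero.1 (h4.symm.trans h3)).resolve_right (pow_ne_zero _ ht')
    obtain ⟨u, v, e⟩ := hab
    have := congrArg (aeval (algebraMap R S s / algebraMap R S t)) e
    rw [map_add, map_mul, map_mul, key ha h1, key hb h2, map_one] at this
    simp at this
  refine ⟨?_, ht⟩
  subst ht
  rw [homEval_zero] at h1 h2
  by_contra hs
  rcases hn with h | h
  · exact (mul_ne_zero ((map_ne_zero_iff _ (FaithfulSMul.algebraMap_injective k R)).2 h)
      (pow_ne_zero n hs)) h1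
  · exact (mul_ne_zero ((map_ne_zero_iff _ (FaithfulSMul.algebraMap_injective k R)).2 h)
      (pow_ne_zero n hs)) h2

/-- The degree of a composition of rational functions. -/
lemma mul_le_of_homEval {s t p q : k[X][Y]} {a b : k[X]} {n e d : ℕ} (hst : IsRelPrime s t)
    (ha : a.natDegree ≤ n) (hb : b.natDegree ≤ n)
    (hn : a.coeff n ≠ 0 ∨ b.coeff n ≠ 0) (hab : IsCoprime a b)
    (hs : TDegLE e s) (ht : TDegLE e t) (he : (gr k s).coeff e ≠ 0 ∨ (gr k t).coeff e ≠ 0)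
    (hp : TDegLE d p) (hq : TDegLE d q) (hp0 : p ≠ 0) (hq0 : q ≠ 0)
    (h : p * homEval n b s t = q * homEval n a s t) : n * e ≤ d := by
  have hrel : IsRelPrime (homEval n a s t) (homEval n b s t) := by
    refine WfDvdMonoid.isRelPrime_of_no_irreducible_factors ?_ ?_
    · rintro ⟨h1, h2⟩
      obtain ⟨rfl, rfl⟩ := eq_zero_of_homEval ha hb hn hab h1 h2
      simp at he
    · intro π hπ h1 h2
      have hπ' := (Ideal.span_singleton_prime hπ.ne_zero).2 hπ.prime
      have hdom : IsDomain (k[X][Y] ⧸ Ideal.span {π}) := Ideal.Quotient.isDomain _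
      have key : ∀ u : k[X][Y], π ∣ u ↔ Ideal.Quotient.mkₐ k (Ideal.span {π}) u = 0 := fun u => by
        rw [Ideal.Quotient.mkₐ_eq_mk, Ideal.Quotient.eq_zero_iff_mem, Ideal.mem_span_singleton]
      rw [key, map_homEval (R := k[X][Y]) (S := k[X][Y] ⧸ Ideal.span {π})] at h1 h2
      obtain ⟨h3, h4⟩ := eq_zero_of_homEval ha hb hn hab h1 h2
      exact hπ.not_isUnit (hst ((key s).2 h3) ((key t).2 h4))
  have h1 : homEval n a s t ∣ p := hrel.dvd_of_dvd_mul_right ⟨q, by rw [h, mul_comm]⟩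
  have h2 : homEval n b s t ∣ q := hrel.symm.dvd_of_dvd_mul_right ⟨p, by rw [← h, mul_comm]⟩
  have key : ∀ {u p : k[X][Y]}, p ≠ 0 → TDegLE d p → u ∣ p → (gr k u).coeff (n * e) ≠ 0 →
      n * e ≤ d := by
    rintro u p hp0 hp ⟨w, rfl⟩ hu
    have h3 := tDegLE_iff.1 hp
    rw [gr_natDegree_mul (left_ne_zero_of_mul hp0) (right_ne_zero_of_mul hp0)] at h3
    have := le_natDegree_of_ne_zero hu
    omega
  have hs' := tDegLE_iff.1 hs
  have ht' := tDegLE_iff.1 ht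
  by_contra hlt
  have h3 := not_imp_comm.1 (key hp0 hp h1) hlt
  have h4 := not_imp_comm.1 (key hq0 hq h2) hlt
  rw [map_homEval (R := k[X][Y]) (S := k[X][Y][X]), coeff_homEval _ _ hs' ht'] at h3 h4
  obtain ⟨h5, h6⟩ := eq_zero_of_homEval ha hb hn hab h3 h4
  exact he.elim (· h5) (· h6)

end Grading
end CremonaRank

namespace CremonaRank
open Polynomial Bivariate

section Minimal
variable {k K Γ : Type*} [Field k] [Field K] [Algebra k K] [Group Γ] {φ : Γ →* (K ≃ₐ[k] K)}
  {d : ℕ} {x y f : K} {p q : k[X][Y]} {A : Γ → Matrix (Fin 2) (Fin 2) k}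

lemma tDegLE_of_mul {d e : ℕ} {P Q : k[X][Y]} (hP : P ≠ 0) (hPu : ¬ IsUnit P)
    (h : TDegLE d (P * Q)) (he : d ≤ e + 1) : TDegLE e Q := by
  by_cases hQ : Q = 0
  · subst hQ; intro i j _; simp
  have h1 := tDegLE_iff.1 h
  rw [gr_natDegree_mul hP hQ] at h1
  have h2 : (gr k P).natDegree ≠ 0 := fun h => hPu (isUnit_of_gr_natDegree_eq_zero hP h)
  exact tDegLE_iff.2 (by omega)

/-- A pencil of minimal degree has no fixed component. -/
lemma isRelPrime_of_minimal (hmin : ∀ d' < d, ¬ HasPencil φ d') (h : Gen k x y)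
    (hp : TDegLE d p) (hq : TDegLE d q) (hq0 : ev k x y q ≠ 0)
    (hrel : f * ev k x y q = ev k x y p) (htr : Transcendental k f)
    (hA : ∀ g, Mob (A g) f (φ g f)) : IsRelPrime p q := by
  rintro c ⟨p', rfl⟩ ⟨q', rfl⟩
  by_contra hc
  rw [map_mul] at hq0
  have hc0 : c ≠ 0 := by rintro rfl; simp at hq0
  have hq0' := right_ne_zero_of_mul hq0
  have hd : 0 < d := by
    by_contra hd
    have h1 := tDegLE_iff.1 hq
    rw [gr_natDegree_mul hc0 (by rintro rfl; simp at hq0')] at h1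
    exact hc (isUnit_of_gr_natDegree_eq_zero hc0 (by omega))
  refine hmin (d - 1) (by omega) ⟨x, y, p', q', f, A, h, tDegLE_of_mul hc0 hc hp (by omega),
    tDegLE_of_mul hc0 hc hq (by omega), hq0', ?_, htr, hA⟩
  refine mul_left_cancel₀ (left_ne_zero_of_mul hq0) ?_
  rw [map_mul, map_mul] at hrel
  linear_combination hrel

/-- A pencil of minimal degree does not contain the line at infinity as a fixed component. -/
lemma gr_coeff_ne_zero_of_minimal (hmin : ∀ d' < d, ¬ HasPencil φ d') (h : Gen k x y)
    (hp : TDegLE d p) (hq : TDegLE d q) (hq0 : ev k x y q ≠ 0)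
    (hrel : f * ev k x y q = ev k x y p) (htr : Transcendental k f)
    (hA : ∀ g, Mob (A g) f (φ g f)) : (gr k p).coeff d ≠ 0 ∨ (gr k q).coeff d ≠ 0 := by
  by_contra! hcon
  have key : ∀ {P : k[X][Y]}, TDegLE d P → (gr k P).coeff d = 0 → TDegLE (d - 1) P ∧ (d = 0 → P = 0) := by
    intro P hP h0
    have h1 := tDegLE_iff.1 hP
    rcases Nat.eq_zero_or_pos d with rfl | hd
    · refine ⟨tDegLE_iff.2 h1, fun _ => gr_injective ?_⟩
      rw [eq_C_of_natDegree_le_zero h1, h0, C_0, map_zero]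
    · refine ⟨tDegLE_iff.2 ?_, fun h => by omega⟩
      exact natDegree_le_pred h1 h0
  have h1 := key hp hcon.1
  have h2 := key hq hcon.2
  have hd : 0 < d := by
    by_contra hd
    rw [h2.2 (by omega), map_zero] at hq0
    exact hq0 rfl
  exact hmin (d - 1) (by omega) ⟨x, y, p, q, f, A, h, h1.1, h2.1, hq0, hrel, htr, hA⟩

end Minimal
end CremonaRank

namespace CremonaRank
open Polynomial Bivariate

section Frob
variable {R : Type*} [CommRing R] [IsDomain R] (ℓ : ℕ) [Fact ℓ.Prime] [CharP R ℓ]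

lemma exists_pow_eq_of_derivative_eq_zero {f : R[X]} (hf : derivative f = 0)
    (hc : ∀ i, ∃ g, g ^ ℓ = f.coeff i) : ∃ g : R[X], g ^ ℓ = f := by
  suffices f ∈ (frobenius R[X] ℓ).range by
    obtain ⟨g, hg⟩ := this
    exact ⟨g, hg⟩
  rw [f.as_sum_support_C_mul_X_pow]
  refine Subring.sum_mem _ fun i _ => ?_
  obtain ⟨g, hg⟩ := hc i
  by_cases hi : ℓ ∣ i
  · obtain ⟨m, rfl⟩ := hi
    refine ⟨C g * X ^ m, ?_⟩
    rw [frobenius_def, mul_pow, ← C_pow, hg, ← pow_mul, mul_comm m]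
  · have h1 := congrArg (fun P => P.coeff (i - 1)) hf
    have hi0 : i ≠ 0 := by rintro rfl; exact hi (dvd_zero _)
    simp only [coeff_derivative, coeff_zero] at h1
    have h2 : ((i - 1 : ℕ) : R) + 1 = (i : R) := by
      rw [← Nat.cast_add_one, Nat.sub_add_cancel (by omega)]
    rw [h2, Nat.sub_add_cancel (by omega)] at h1
    have h3 : f.coeff i = 0 := by
      refine (mul_eq_zero.1 h1).resolve_right ?_
      rwa [CharP.cast_eq_zero_iff R ℓ]
    rw [h3, C_0, zero_mul]
    exact Subring.zero_mem _

end Frob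

section Lin
variable {k K : Type*} [Field k] [Field K] [Algebra k K] {x y f : K} {p q : k[X][Y]} {d : ℕ}

lemma gr_lin (s : k) (P : k[X][Y]) : gr k (lin s P) = mapAlgHom (lin s) (gr k P) := by
  rw [gr, lin, algHom_ev (A := k[X][Y]) (B := k[X][Y][X]),
    algHom_ev (A := k[X][Y][X]) (B := k[X][Y][X])]
  have e : ev k (C (C X) * X : k[X][Y][X]) (C Y * X : k[X][Y][X]) (C X + C (C s) * Y) =
    (mapAlgHom (ev k (Y : k[X][Y]) (C X + C (C s) * Y))) (C Y * X : k[X][Y][X]) := by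
    rw [map_add, map_mul, map_mul, ev_CC, ev_X, ev_Y]
    simp only [coe_mapAlgHom, Polynomial.map_C, Polynomial.map_X, RingHom.coe_coe, ev_Y]
    rw [show algebraMap k k[X][Y][X] s = C (C (C s)) from rfl]
    simp only [map_add, map_mul]
    ring
  rw [e]
  congr 1
  rw [map_mul, ev_Y]
  simp

lemma TDegLE.lin {P : k[X][Y]} (h : TDegLE d P) (s : k) : TDegLE d (lin s P) := by
  rw [tDegLE_iff] at h ⊢
  rw [gr_lin]
  exact natDegree_map_le.trans h

lemma coeff_lin_top {P : k[X][Y]} (h : TDegLE d P) (s : k) :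
    ((lin s P).coeff d).coeff 0 = (top d P).eval s := by
  have h1 : (CremonaRank.lin s P).map (evalRingHom 0) = ev k X (C s * X) P := by
    have : (mapRingHom (evalRingHom (0 : k))).comp (CremonaRank.lin s : k[X][Y] →ₐ[k] k[X][Y]) =
        ((ev k X (C s * X) : k[X][Y] →ₐ[k] k[X]) : k[X][Y] →+* k[X]) := by
      apply ev_ext
      · intro c; simp [CremonaRank.lin]
      · simp [CremonaRank.lin]
      · simp [CremonaRank.lin]
    exact congrArg (fun h => h P) this
  have h2 : ((CremonaRank.lin s P).coeff d).coeff 0 =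
      ((CremonaRank.lin s P).map (evalRingHom 0)).coeff d := by
    rw [coeff_map, coe_evalRingHom, coeff_zero_eq_eval_zero]
  have h3 : P.natDegree ≤ d := by
    rw [natDegree_le_iff_coeff_eq_zero]
    intro j hj
    ext i
    rw [h i j (by omega), coeff_zero]
  have h4 : (top d P).natDegree ≤ d := by
    rw [natDegree_le_iff_coeff_eq_zero]
    intro j hj
    rw [coeff_top, if_neg (by omega)]
  rw [h2, h1, ev_eq_sum, sum_over_range' _ (by simp) (d + 1) (by omega), finsetSum_coeff,
    eval_eq_sum_range' (n := d + 1) (by omega)]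
  refine Finset.sum_congr rfl fun j hj => ?_
  have := Finset.mem_range.1 hj
  rw [coeff_top, if_pos (by omega), mul_pow, ← C_pow, mul_left_comm, coeff_C_mul, mul_comm,
    coeff_mul_X_pow', if_pos (by omega), aeval_X_left_apply]

lemma top_ne_zero {P : k[X][Y]} (h : (gr k P).coeff d ≠ 0) : top d P ≠ 0 := by
  contrapose! h
  ext j i
  rw [coeff_gr]
  split_ifs with hij
  · have := coeff_top d P j
    rw [h, if_pos (by omega), show d - j = i by omega] at this
    simpa using this.symm
  · simp

lemma Gen.lin (h : Gen k x y) (s : k) : Gen k (y - algebraMap k K s * x) x := by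
  refine h.of_forall ?_ ⟨Y, 1, by simp, by simp⟩ ⟨C X + C (C s) * Y, 1, by simp, by simp⟩
  intro P Q e
  rw [← ev_linInv, ← ev_linInv] at e
  rw [← lin_linInv s P, h.inj e, lin_linInv]

lemma derivative_eq_zero_of_ev (h : Gen k x y) (hq0 : ev k x y q ≠ 0)
    (hrel : f * ev k x y q = ev k x y p) (hpq : IsRelPrime p q)
    (hd : ev k x y (derivative p) = f * ev k x y (derivative q)) :
    derivative p = 0 ∧ derivative q = 0 := by
  have hq : q ≠ 0 := by rintro rfl; simp at hq0
  have h1 : derivative p * q = p * derivative q := by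
    apply h.inj
    rw [map_mul, map_mul, hd, ← hrel]; ring
  have h2 : q ∣ derivative q := hpq.symm.dvd_of_dvd_mul_left ⟨derivative p, by rw [← h1, mul_comm]⟩
  have h3 : derivative q = 0 := by
    by_contra hne
    rcases Nat.eq_zero_or_pos q.natDegree with h0 | h0
    · rw [eq_C_of_natDegree_eq_zero h0, derivative_C] at hne
      exact hne rfl
    · exact absurd (natDegree_le_of_dvd h2 hne) (not_le.2 (natDegree_derivative_lt h0.ne'))
  rw [h3, mul_zero] at h1
  exact ⟨(mul_eq_zero.1 h1).resolve_right hq, h3⟩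

/-- Two different directional derivatives determine all the derivatives. -/
lemma derivative_eq_zero_of_lin (h : Gen k x y) {s t : k} (hst : s ≠ t) {P : k[X][Y]}
    (hs : derivative (lin s P) = 0) (ht : derivative (lin t P) = 0) :
    derivative P = 0 ∧ derivative (lin 0 P) = 0 := by
  obtain ⟨D, hD⟩ := h.exists_derivation (Polynomial.derivative'.restrictScalars k)
  have key : ∀ s : k, ∃ E : Derivation k K K, E x = 1 ∧ E y = algebraMap k K s ∧
      ∀ P, E (ev k x y P) = ev k (y - algebraMap k K s * x) x (derivative (CremonaRank.lin s P)) := by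
    intro s
    obtain ⟨E, hE⟩ := (h.lin s).exists_derivation (Polynomial.derivative'.restrictScalars k)
    have hE' : ∀ P, E (ev k x y P) = ev k (y - algebraMap k K s * x) x
        (derivative (CremonaRank.lin s P)) := by
      intro P
      rw [← ev_lin s, hE]; rfl
    refine ⟨E, ?_, ?_, hE'⟩
    · have := hE' (C X)
      simpa [CremonaRank.lin] using this
    · have := hE' Y
      simpa [CremonaRank.lin] using this
  have hDx : D x = 0 := by
    have := hD (C X)
    rw [ev_X] at this
    rw [this]
    change ev k x y (derivative (C X)) = 0
    simp
  have hDy : D y = 1 := by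
    have := hD Y
    rw [ev_Y] at this
    rw [this]
    change ev k x y (derivative Y) = 1
    simp
  obtain ⟨E1, h1x, h1y, h1⟩ := key s
  obtain ⟨E2, h2x, h2y, h2⟩ := key t
  obtain ⟨E0, h0x, h0y, h0⟩ := key 0
  have e1 : E1 = E0 + s • D := h.derivation_ext (by simp [h1x, h0x, hDx])
    (by simp [h1y, h0y, hDy, Algebra.smul_def])
  have e2 : E2 = E0 + t • D := h.derivation_ext (by simp [h2x, h0x, hDx])
    (by simp [h2y, h0y, hDy, Algebra.smul_def])
  have z1 := h1 P
  have z2 := h2 P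
  rw [hs, map_zero, e1] at z1
  rw [ht, map_zero, e2] at z2
  simp only [Derivation.add_apply, Derivation.smul_apply, Algebra.smul_def] at z1 z2
  have hne : algebraMap k K s - algebraMap k K t ≠ 0 := by
    rw [sub_ne_zero]; exact fun e => hst ((algebraMap k K).injective e)
  have hD0 : D (ev k x y P) = 0 := by
    refine (mul_eq_zero.1 (?_ : (algebraMap k K s - algebraMap k K t) * _ = 0)).resolve_left hne
    linear_combination z1 - z2
  rw [hD0, mul_zero, add_zero, h0] at z1
  rw [hD] at hD0
  refine ⟨h.inj (by rw [map_zero]; exact hD0), (h.lin 0).inj (by rw [z1, map_zero])⟩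

end Lin
end CremonaRank

namespace CremonaRank
open Polynomial Bivariate

section Deriv
variable {k K Γ : Type*} [Field k] [IsAlgClosed k] [Field K] [Algebra k K] [Group Γ]
  {φ : Γ →* (K ≃ₐ[k] K)}
  {d : ℕ} {x y f : K} {p q : k[X][Y]} {A : Γ → Matrix (Fin 2) (Fin 2) k}

omit [IsAlgClosed k] in
lemma coeff_mul_of_derivative_eq_zero {P : k[X][Y]} (hP : derivative P = 0) (i j : ℕ) :
    (P.coeff j).coeff i * (j : k) = 0 := by
  rcases j with _ | j
  · simp
  · have := congrArg (fun P => (P.coeff j).coeff i) hP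
    simp only [coeff_derivative, coeff_zero] at this
    rw [← Nat.cast_add_one, ← C_eq_natCast, coeff_mul_C] at this
    exact this

omit [IsAlgClosed k] in
lemma eq_CC_of_derivative_eq_zero [CharZero k] {P : k[X][Y]} (h1 : derivative P = 0)
    (h2 : derivative (lin 0 P) = 0) : P = C (C ((P.coeff 0).coeff 0)) := by
  ext j i
  rcases Nat.eq_zero_or_pos j with rfl | hj
  · rcases Nat.eq_zero_or_pos i with rfl | hi
    · simp
    · rw [coeff_C_zero, coeff_C, if_neg (by omega), ← coeff_lin_zero]
      exact (mul_eq_zero.1 (coeff_mul_of_derivative_eq_zero h2 _ _)).resolve_right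
        (by exact_mod_cast hi.ne')
  · rw [coeff_C, if_neg (by omega), coeff_zero]
    exact (mul_eq_zero.1 (coeff_mul_of_derivative_eq_zero h1 _ _)).resolve_right
      (by exact_mod_cast hj.ne')

lemma exists_pow_eq_of_derivatives {ℓ : ℕ} [Fact ℓ.Prime] [CharP k ℓ] {P : k[X][Y]}
    (h1 : derivative P = 0) (h2 : derivative (lin 0 P) = 0) : ∃ Q, Q ^ ℓ = P := by
  refine exists_pow_eq_of_derivative_eq_zero ℓ h1 fun j => ?_
  refine exists_pow_eq_of_derivative_eq_zero ℓ ?_ fun i => ?_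
  · ext i
    rw [coeff_derivative, coeff_zero, ← coeff_lin_zero, ← Nat.cast_add_one]
    exact coeff_mul_of_derivative_eq_zero h2 _ _
  · exact IsAlgClosed.exists_pow_nat_eq _ (Fact.out : ℓ.Prime).pos

/-- A pencil of minimal degree is separable. -/
lemma not_derivatives_eq_zero (hmin : ∀ d' < d, ¬ HasPencil φ d') (h : Gen k x y)
    (hp : TDegLE d p) (hq : TDegLE d q) (hq0 : ev k x y q ≠ 0)
    (hrel : f * ev k x y q = ev k x y p) (htr : Transcendental k f)
    (hA : ∀ g, Mob (A g) f (φ g f)) (h1 : derivative p = 0) (h2 : derivative (lin 0 p) = 0)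
    (h3 : derivative q = 0) (h4 : derivative (lin 0 q) = 0) : False := by
  obtain ⟨ℓ, hℓ⟩ := CharP.exists k
  have hconst : ∀ c c' : k, p = C (C c) → q = C (C c') → False := by
    rintro c c' rfl rfl
    rw [ev_CC] at hq0
    rw [ev_CC, ev_CC] at hrel
    refine htr ?_
    rw [show f = algebraMap k K (c / c') by rw [map_div₀, ← hrel, mul_div_cancel_right₀ _ hq0]]
    exact isAlgebraic_algebraMap _
  rcases CharP.char_is_prime_or_zero k ℓ with hpr | rfl
  · have : Fact ℓ.Prime := ⟨hpr⟩
    have : CharP K ℓ := charP_of_injective_algebraMap (algebraMap k K).injective ℓ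
    obtain ⟨P, rfl⟩ := exists_pow_eq_of_derivatives (ℓ := ℓ) h1 h2
    obtain ⟨Q, rfl⟩ := exists_pow_eq_of_derivatives (ℓ := ℓ) h3 h4
    have hd : 0 < d := by
      by_contra hd
      have key : ∀ {P : k[X][Y]}, TDegLE d P → P = C (C ((P.coeff 0).coeff 0)) := fun {P} hP => by
        ext j i
        by_cases hij : 0 < i + j
        · rw [hP i j (by omega)]
          rcases Nat.eq_zero_or_pos j with rfl | hj
          · rw [coeff_C_zero, coeff_C, if_neg (by omega)]
          · rw [coeff_C, if_neg (by omega), coeff_zero]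
        · obtain ⟨rfl, rfl⟩ : i = 0 ∧ j = 0 := by omega
          simp
      exact hconst _ _ (key hp) (key hq)
    have hdeg : ∀ {P : k[X][Y]}, TDegLE d (P ^ ℓ) → TDegLE (d - 1) P := by
      intro P hP
      rw [tDegLE_iff] at hP ⊢
      rw [map_pow, natDegree_pow] at hP
      have := hpr.two_le
      by_contra hlt
      have h5 : 2 * (gr k P).natDegree ≤ ℓ * (gr k P).natDegree := Nat.mul_le_mul_right _ this
      omega
    rw [map_pow] at hq0
    have hQ0 : ev k x y Q ≠ 0 := fun e => hq0 (by rw [e, zero_pow hpr.ne_zero])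
    have hf : (ev k x y P / ev k x y Q) ^ ℓ = f := by
      rw [div_pow, ← map_pow, ← map_pow, ← hrel, map_pow, mul_div_cancel_right₀ _ hq0]
    set w := ev k x y P / ev k x y Q with hw
    choose r hr using fun c : k => IsAlgClosed.exists_pow_nat_eq c hpr.pos
    refine hmin (d - 1) (by omega) ⟨x, y, P, Q, w, fun g i j => r (A g i j), h, hdeg hp, hdeg hq, hQ0,
      by rw [hw, div_mul_cancel₀ _ hQ0], ?_, ?_⟩
    · intro halg
      exact htr (hf ▸ halg.pow ℓ)
    · intro g
      obtain ⟨n1, n2⟩ := hA g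
      have e : ∀ a b : k, (algebraMap k K (r a) * w + algebraMap k K (r b)) ^ ℓ =
          algebraMap k K a * f + algebraMap k K b := by
        intro a b
        rw [add_pow_char, mul_pow, ← map_pow, ← map_pow, hr, hr, hf]
      constructor
      · intro h0
        apply n1
        rw [← e, h0, zero_pow hpr.ne_zero]
      · apply frobenius_inj K ℓ
        rw [frobenius_def, frobenius_def, mul_pow, e, e, ← n2, ← map_pow, hf]
  · have := CharP.charP_to_charZero k
    exact hconst _ _ (eq_CC_of_derivative_eq_zero h1 h2) (eq_CC_of_derivative_eq_zero h3 h4)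

/-- A general linear change of coordinates puts a pencil of minimal degree in good position with
respect to the second coordinate. -/
lemma exists_lin (hmin : ∀ d' < d, ¬ HasPencil φ d') (h : Gen k x y)
    (hp : TDegLE d p) (hq : TDegLE d q) (hq0 : ev k x y q ≠ 0)
    (hrel : f * ev k x y q = ev k x y p) (htr : Transcendental k f)
    (hA : ∀ g, Mob (A g) f (φ g f)) :
    ∃ s : k, (((lin s p).coeff d).coeff 0 ≠ 0 ∨ ((lin s q).coeff d).coeff 0 ≠ 0) ∧
      ¬ (derivative (lin s p) = 0 ∧ derivative (lin s q) = 0) := by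
  obtain ⟨u, hu0, hu⟩ : ∃ u : k[X], u ≠ 0 ∧ ∀ s, u.eval s ≠ 0 →
      ((lin s p).coeff d).coeff 0 ≠ 0 ∨ ((lin s q).coeff d).coeff 0 ≠ 0 := by
    rcases gr_coeff_ne_zero_of_minimal hmin h hp hq hq0 hrel htr hA with h1 | h1
    · exact ⟨top d p, top_ne_zero h1, fun s hs => Or.inl (by rwa [coeff_lin_top hp])⟩
    · exact ⟨top d q, top_ne_zero h1, fun s hs => Or.inr (by rwa [coeff_lin_top hq])⟩
  obtain ⟨s, hs⟩ : ∃ s, u.eval s ≠ 0 := by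
    by_contra! hcon
    exact hu0 (funext fun s => by rw [hcon, eval_zero])
  obtain ⟨t, ht⟩ : ∃ t, (u * (X - C s)).eval t ≠ 0 := by
    by_contra! hcon
    exact mul_ne_zero hu0 (X_sub_C_ne_zero s) (funext fun s => by rw [hcon, eval_zero])
  rw [eval_mul] at ht
  have hst : s ≠ t := by
    rintro rfl
    simp at ht
  by_contra! hcon
  obtain ⟨a1, a2⟩ := hcon s (hu s hs)
  obtain ⟨b1, b2⟩ := hcon t (hu t (left_ne_zero_of_mul ht))
  obtain ⟨c1, c2⟩ := derivative_eq_zero_of_lin h hst a1 b1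
  obtain ⟨c3, c4⟩ := derivative_eq_zero_of_lin h hst a2 b2
  exact not_derivatives_eq_zero hmin h hp hq hq0 hrel htr hA c1 c2 c3 c4

end Deriv
end CremonaRank

namespace CremonaRank
open Polynomial Bivariate

section Closure
open IntermediateField
variable {k K : Type*} [Field k] [Field K] [Algebra k K]
  {d : ℕ} {x y f : K} {p q : k[X][Y]}

lemma Gen.exists_residue (h : Gen k x y) {π : k[X][Y]} (hπ : _root_.Prime π) {E : Type*} [Field E]
    [Algebra k E] (θ : k[X][Y] →ₐ[k] E) (hθ : ∀ P, θ P = 0 ↔ π ∣ P) :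
    ∃ (O : ValuationSubring K) (ρ : O →+* E),
      (∀ u, u ∈ O ↔ ∃ a b : k[X][Y], ¬ π ∣ b ∧ u * ev k x y b = ev k x y a) ∧
      ∀ (u : O) (a b : k[X][Y]), (u : K) * ev k x y b = ev k x y a → ρ u * θ b = θ a := by
  choose a b hb e using fun u : h.primeRing hπ => u.2
  have hb' : ∀ u, θ (b u) ≠ 0 := fun u h0 => hb u ((hθ _).1 h0)
  have key : ∀ (u : h.primeRing hπ) (P Q : k[X][Y]),
      (u : K) * ev k x y Q = ev k x y P → θ (a u) / θ (b u) * θ Q = θ P := by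
    intro u P Q hPQ
    have h1 : a u * Q = P * b u := by
      apply h.inj
      rw [map_mul, map_mul, ← e, ← hPQ]; ring
    have h2 := congrArg θ h1
    rw [map_mul, map_mul] at h2
    rw [div_mul_eq_mul_div, div_eq_iff (hb' u), h2]
  have key' : ∀ (u : h.primeRing hπ) (P Q : k[X][Y]), θ Q ≠ 0 →
      (u : K) * ev k x y Q = ev k x y P → θ (a u) / θ (b u) = θ P / θ Q := by
    intro u P Q hQ hPQ
    rw [eq_div_iff hQ, key u P Q hPQ]
  refine ⟨h.primeRing hπ, RingHom.mk' ⟨⟨fun u => θ (a u) / θ (b u), ?_⟩, ?_⟩ ?_, fun _ => Iff.rfl, key⟩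
  · rw [key' 1 1 1 (by simp) (by simp)]; simp
  · intro u w
    change θ (a (u * w)) / θ (b (u * w)) = θ (a u) / θ (b u) * (θ (a w) / θ (b w))
    rw [key' (u * w) (a u * a w) (b u * b w) (by rw [map_mul]; exact mul_ne_zero (hb' u) (hb' w)),
      map_mul, map_mul, mul_div_mul_comm]
    rw [map_mul, map_mul, ← e, ← e, show ((u * w : h.primeRing hπ) : K) = u * w from rfl]; ring
  · intro u w
    change θ (a (u + w)) / θ (b (u + w)) = θ (a u) / θ (b u) + (θ (a w) / θ (b w))
    rw [key' (u + w) (a u * b w + b u * a w) (b u * b w)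
      (by rw [map_mul]; exact mul_ne_zero (hb' u) (hb' w)), div_add_div _ _ (hb' u) (hb' w)]
    · simp only [map_mul, map_add]
    · simp only [map_mul, map_add, ← e, show ((u + w : h.primeRing hπ) : K) = u + w from rfl]; ring

/-- Restriction of polynomials to a vertical line. -/
noncomputable def line (a : k) : k[X][Y] →ₐ[k] RatFunc k :=
  (IsScalarTower.toAlgHom k k[X] (RatFunc k)).comp (ev k (C a) X)

lemma line_eq_zero_iff (a : k) (P : k[X][Y]) : line a P = 0 ↔ C (X - C a) ∣ P := by
  have h1 : ev k (C a) X P = P.map (evalRingHom a) := by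
    have : ((ev k (C a) X : k[X][Y] →ₐ[k] k[X]) : k[X][Y] →+* k[X]) = mapRingHom (evalRingHom a) := by
      apply ev_ext <;> simp
    exact congrArg (fun h => h P) this
  rw [line, AlgHom.comp_apply, IsScalarTower.coe_toAlgHom',
    map_eq_zero_iff _ (RatFunc.algebraMap_injective k), h1, C_dvd_iff_dvd_coeff]
  simp only [Polynomial.ext_iff (p := P.map _), coeff_map, coe_evalRingHom, coeff_zero,
    dvd_iff_isRoot, IsRoot.def]

lemma prime_C_X_sub_C (a : k) : _root_.Prime (C (X - C a) : k[X][Y]) :=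
  prime_C_iff.2 (prime_X_sub_C a)

/-- On a general vertical line the members of the pencil are moving. -/
lemma exists_line [IsAlgClosed k] (hp : TDegLE d p) (hq : TDegLE d q)
    (hq0 : ev k x y q ≠ 0) (hrel : f * ev k x y q = ev k x y p) (htr : Transcendental k f)
    (hY : (p.coeff d).coeff 0 ≠ 0 ∨ (q.coeff d).coeff 0 ≠ 0) :
    ∃ a : k, line a q ≠ 0 ∧ ∀ c : k, line a p ≠ algebraMap k _ c * line a q := by
  have hC : ∀ {P : k[X][Y]}, TDegLE d P → P.coeff d = C ((P.coeff d).coeff 0) := by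
    intro P hP
    ext i
    rcases Nat.eq_zero_or_pos i with rfl | hi
    · simp
    · rw [hP _ _ (by omega), coeff_C, if_neg (by omega)]
  have hp' := hC hp
  have hq' := hC hq
  set α := (p.coeff d).coeff 0
  set β := (q.coeff d).coeff 0
  have hN : C (C β) * p - C (C α) * q ≠ 0 := by
    intro hN
    have h1 := congrArg (ev k x y) hN
    rw [map_sub, map_mul, map_mul, ev_CC, ev_CC, ← hrel, map_zero] at h1
    have h2 : (algebraMap k K β * f - algebraMap k K α) * ev k x y q = 0 := by
      linear_combination h1
    have h3 := (mul_eq_zero.1 h2).resolve_right hq0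
    have hβ : β ≠ 0 := by
      intro hβ
      rw [hβ, map_zero, zero_mul, zero_sub, neg_eq_zero, map_eq_zero] at h3
      exact hY.elim (· h3) (· hβ)
    refine htr ?_
    rw [show f = algebraMap k K (α / β) by
      rw [map_div₀, eq_div_iff (by rwa [Ne, map_eq_zero])]; linear_combination h3]
    exact isAlgebraic_algebraMap _
  have hq : q ≠ 0 := by rintro rfl; simp at hq0
  obtain ⟨a, ha⟩ : ∃ a, line a ((C (C β) * p - C (C α) * q) * q) ≠ 0 := by
    by_contra! hcon
    obtain ⟨j, hj⟩ : ∃ j, ((C (C β) * p - C (C α) * q) * q).coeff j ≠ 0 := by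
      by_contra! hz
      exact mul_ne_zero hN hq (by ext1 j; rw [hz, coeff_zero])
    refine hj (funext fun a => ?_)
    have := hcon a
    rw [line_eq_zero_iff, C_dvd_iff_dvd_coeff] at this
    rw [eval_zero]
    exact dvd_iff_isRoot.1 (this j)
  rw [map_mul] at ha
  refine ⟨a, right_ne_zero_of_mul ha, fun c hc => left_ne_zero_of_mul ha ?_⟩
  have h0 : C (X - C a) ∣ p - C (C c) * q := by
    rw [← line_eq_zero_iff, map_sub, map_mul, hc, sub_eq_zero]
    congr 1
    exact ((line a).commutes c).symm
  have h1 := (C_dvd_iff_dvd_coeff _ _).1 h0 d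
  rw [coeff_sub, coeff_C_mul, hp', hq', ← C_mul, ← C_sub, dvd_iff_isRoot, IsRoot.def, eval_C] at h1
  rw [map_sub, map_mul, map_mul, hc, sub_eq_zero.1 h1, C_mul, C_mul, map_mul]
  rw [show line a (C (C c)) = algebraMap k _ c from (line a).commutes c]
  ring

/-- The algebraic closure of `k(f)` in `K` is generated by one element. -/
lemma exists_closure_generator [IsAlgClosed k] (h : Gen k x y) (hp : TDegLE d p) (hq : TDegLE d q)
    (hq0 : ev k x y q ≠ 0) (hrel : f * ev k x y q = ev k x y p) (htr : Transcendental k f)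
    (hY : (p.coeff d).coeff 0 ≠ 0 ∨ (q.coeff d).coeff 0 ≠ 0) :
    ∃ s : K, IsAlgebraic k⟮f⟯ s ∧ ∀ u : K, IsAlgebraic k⟮f⟯ u →
      ∃ a b : k[X], aeval s b ≠ 0 ∧ u * aeval s b = aeval s a := by
  obtain ⟨a, ha, hpa⟩ := exists_line hp hq hq0 hrel htr hY
  have hπ := prime_C_X_sub_C a
  obtain ⟨O, ρ, hmem, hρ⟩ := h.exists_residue hπ (line a) (line_eq_zero_iff a)
  have hcO : ∀ c : k, algebraMap k K c ∈ O := fun c =>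
    (hmem _).2 ⟨C (C c), 1, fun h => hπ.not_isUnit (isUnit_of_dvd_one h), by simp⟩
  have hρc : ∀ c : k, ρ ⟨algebraMap k K c, hcO c⟩ = algebraMap k _ c := fun c => by
    have := hρ ⟨algebraMap k K c, hcO c⟩ (C (C c)) 1 (by simp)
    rw [map_one, mul_one] at this
    rw [this]
    exact (line a).commutes c
  have hfO : f ∈ O := (hmem _).2 ⟨p, q, fun h => ha ((line_eq_zero_iff a q).2 h), hrel⟩
  have hρf : ∀ c : k, ρ ⟨f, hfO⟩ ≠ algebraMap k _ c := fun c hc => by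
    have := hρ ⟨f, hfO⟩ p q hrel
    rw [hc] at this
    exact hpa c this.symm
  have hρtr : Transcendental k (ρ ⟨f, hfO⟩) := transcendental_of_forall_ne fun c hc => hρf c hc.symm
  have hpoly : ∀ r : k[X], ∃ hr : aeval f r ∈ O, ρ ⟨aeval f r, hr⟩ = aeval (ρ ⟨f, hfO⟩) r := by
    intro r
    induction r using Polynomial.induction_on' with
    | add r s hr hs =>
      obtain ⟨hr, er⟩ := hr
      obtain ⟨hs, es⟩ := hs
      refine ⟨by rw [map_add]; exact add_mem hr hs, ?_⟩
      rw [map_add (aeval (ρ ⟨f, hfO⟩)), ← er, ← es, ← map_add ρ]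
      congr 1
      exact Subtype.ext (map_add _ _ _)
    | monomial n c =>
      refine ⟨by rw [aeval_monomial]; exact mul_mem (hcO c) (pow_mem hfO n), ?_⟩
      rw [aeval_monomial (x := ρ ⟨f, hfO⟩), ← hρc, ← map_pow, ← map_mul]
      congr 1
      exact Subtype.ext (aeval_monomial f)
  have hFO : ∀ u ∈ k⟮f⟯, u ∈ O := by
    intro u hu
    obtain ⟨r, s, rfl⟩ := (mem_adjoin_simple_iff k u).1 hu
    obtain ⟨hr, -⟩ := hpoly r
    obtain ⟨hs, es⟩ := hpoly s
    by_cases hs0 : aeval f s = 0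
    · rw [hs0, div_zero]; exact zero_mem O
    · refine div_eq_mul_inv (aeval f r) (aeval f s) ▸ mul_mem hr ?_
      obtain ⟨P, Q, hQ, e⟩ := (hmem _).1 hs
      have h1 := hρ ⟨aeval f s, hs⟩ P Q e
      rw [es] at h1
      have hs00 : s ≠ 0 := by rintro rfl; simp at hs0
      have h2 : aeval (ρ ⟨f, hfO⟩) s ≠ 0 := fun h0 => hs00 ((transcendental_iff.1 hρtr) s h0)
      have h3 : line a P ≠ 0 := by
        rw [← h1]
        exact mul_ne_zero h2 fun h0 => hQ ((line_eq_zero_iff a Q).1 h0)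
      refine (hmem _).2 ⟨Q, P, fun hP => h3 ((line_eq_zero_iff a P).2 hP), ?_⟩
      rw [← e, inv_mul_cancel_left₀ hs0]
  let ι : k⟮f⟯ →+* O :=
    { toFun := fun u => ⟨u, hFO u u.2⟩
      map_one' := rfl
      map_zero' := rfl
      map_add' := fun _ _ => rfl
      map_mul' := fun _ _ => rfl }
  have hLO : ∀ u : K, IsAlgebraic k⟮f⟯ u → u ∈ O := by
    intro u hu
    have h1 : IsIntegral O u := hu.isIntegral.map_of_comp_eq ι (RingHom.id K) rfl
    obtain ⟨w, rfl⟩ := IsIntegrallyClosed.isIntegral_iff.1 h1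
    exact w.2
  let L : IntermediateField k K := (algebraicClosure k⟮f⟯ K).restrictScalars k
  have hL : ∀ u, u ∈ L ↔ IsAlgebraic k⟮f⟯ u := fun u => mem_algebraicClosure_iff
  let σ : L →ₐ[k] RatFunc k :=
    { toFun := fun u => ρ ⟨u, hLO u ((hL _).1 u.2)⟩
      map_one' := map_one ρ
      map_zero' := map_zero ρ
      map_add' := fun u w => map_add ρ ⟨u, hLO u ((hL _).1 u.2)⟩ ⟨w, hLO w ((hL _).1 w.2)⟩
      map_mul' := fun u w => map_mul ρ ⟨u, hLO u ((hL _).1 u.2)⟩ ⟨w, hLO w ((hL _).1 w.2)⟩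
      commutes' := fun c => hρc c }
  have hgen := RatFunc.Luroth.eq_adjoin_generator (E := σ.fieldRange)
  obtain ⟨s, hs⟩ : RatFunc.Luroth.generator σ.fieldRange ∈ σ.fieldRange :=
    RatFunc.Luroth.generator_mem
  refine ⟨s, (hL _).1 s.2, fun u hu => ?_⟩
  have h1 : σ ⟨u, (hL u).2 hu⟩ ∈ σ.fieldRange := ⟨_, rfl⟩
  rw [hgen, mem_adjoin_simple_iff] at h1
  obtain ⟨r, t, e⟩ := h1
  have hs' : σ s = RatFunc.Luroth.generator σ.fieldRange := hs
  rw [← hs', aeval_algHom_apply, aeval_algHom_apply] at e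
  have hco : ∀ r : k[X], ((aeval s r : L) : K) = aeval (s : K) r := fun r =>
    (aeval_algHom_apply L.val s r).symm
  by_cases ht : aeval s t = 0
  · rw [ht, map_zero, div_zero, map_eq_zero] at e
    refine ⟨0, 1, by simp, ?_⟩
    rw [map_zero, show u = 0 from congrArg Subtype.val e, zero_mul]
  · rw [← map_div₀] at e
    have e' := congrArg Subtype.val (σ.toRingHom.injective e)
    refine ⟨r, t, ?_, ?_⟩
    · rw [← hco]; exact fun h => ht (Subtype.ext h)
    · rw [← hco, ← hco]
      change u = _ at e'
      rw [e', ← IntermediateField.coe_mul, div_mul_cancel₀ _ ht]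

end Closure
end CremonaRank

namespace CremonaRank
open Polynomial Bivariate

section Composite
open IntermediateField
variable {k K Γ : Type*} [Field k] [Field K] [Algebra k K] [Group Γ] {φ : Γ →* (K ≃ₐ[k] K)}
  {d : ℕ} {x y f : K} {p q : k[X][Y]} {A : Γ → Matrix (Fin 2) (Fin 2) k}

lemma TDegLE.eq_CC {P : k[X][Y]} (hP : TDegLE 0 P) : P = C (C ((P.coeff 0).coeff 0)) := by
  ext j i
  by_cases hij : 0 < i + j
  · rw [hP i j hij]
    rcases Nat.eq_zero_or_pos j with rfl | hj
    · rw [coeff_C_zero, coeff_C, if_neg (by omega)]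
    · rw [coeff_C, if_neg (by omega), coeff_zero]
  · obtain ⟨rfl, rfl⟩ : i = 0 ∧ j = 0 := by omega
    simp

lemma pos_of_transcendental (hp : TDegLE d p) (hq : TDegLE d q) (hq0 : ev k x y q ≠ 0)
    (hrel : f * ev k x y q = ev k x y p) (htr : Transcendental k f) : 0 < d := by
  by_contra hd
  obtain rfl : d = 0 := by omega
  rw [hq.eq_CC, ev_CC] at hq0
  rw [hp.eq_CC, hq.eq_CC, ev_CC, ev_CC] at hrel
  refine htr ?_
  rw [show f = algebraMap k K ((p.coeff 0).coeff 0 / (q.coeff 0).coeff 0) by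
    rw [map_div₀, ← hrel, mul_div_cancel_right₀ _ hq0]]
  exact isAlgebraic_algebraMap _

lemma exists_coeff_max_ne_zero {R : Type*} [CommRing R] (a : R[X]) {b : R[X]} (hb : b ≠ 0) :
    a.coeff (max a.natDegree b.natDegree) ≠ 0 ∨ b.coeff (max a.natDegree b.natDegree) ≠ 0 := by
  rcases le_or_gt a.natDegree b.natDegree with hle | hlt
  · right
    rw [max_eq_right hle]
    exact leadingCoeff_ne_zero.2 hb
  · left
    rw [max_eq_left hlt.le]
    refine leadingCoeff_ne_zero.2 ?_
    rintro rfl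
    simp at hlt

lemma exists_coprime_ratio {s w : K} {a b : k[X]} (hb : aeval s b ≠ 0)
    (h : w * aeval s b = aeval s a) : ∃ (a b : k[X]) (n : ℕ), IsCoprime a b ∧ a.natDegree ≤ n ∧
      b.natDegree ≤ n ∧ (a.coeff n ≠ 0 ∨ b.coeff n ≠ 0) ∧ aeval s b ≠ 0 ∧
      w * aeval s b = aeval s a := by
  have hb0 : b ≠ 0 := by rintro rfl; simp at hb
  obtain ⟨b', a', c, hrel, rfl, rfl⟩ := UniqueFactorizationMonoid.exists_reduced_factors b hb0 a
  rw [map_mul] at hb h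
  have hb' := right_ne_zero_of_mul hb
  refine ⟨a', b', max a'.natDegree b'.natDegree, hrel.symm.isCoprime, le_max_left _ _,
    le_max_right _ _, exists_coeff_max_ne_zero _ (right_ne_zero_of_mul hb0), hb', ?_⟩
  refine mul_left_cancel₀ (left_ne_zero_of_mul hb) ?_
  rw [map_mul] at h
  linear_combination h

lemma map_mem_adjoin (σ : K ≃ₐ[k] K) {B : Matrix (Fin 2) (Fin 2) k} (hB : Mob B f (σ f)) {u : K}
    (hu : u ∈ k⟮f⟯) : σ u ∈ k⟮f⟯ := by
  have h1 : k⟮f⟯ ≤ (k⟮f⟯).comap (σ : K →ₐ[k] K) := by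
    rw [adjoin_simple_le_iff]
    change σ f ∈ k⟮f⟯
    obtain ⟨h0, e⟩ := hB
    rw [eq_div_of_mul_eq h0 e]
    have hf := mem_adjoin_simple_self k f
    exact div_mem (add_mem (mul_mem (_root_.algebraMap_mem _ _) hf) (_root_.algebraMap_mem _ _))
      (add_mem (mul_mem (_root_.algebraMap_mem _ _) hf) (_root_.algebraMap_mem _ _))
  exact h1 hu

lemma map_isAlgebraic (σ : K ≃ₐ[k] K) {B : Matrix (Fin 2) (Fin 2) k} (hB : Mob B f (σ f)) {u : K}
    (hu : IsAlgebraic k⟮f⟯ u) : IsAlgebraic k⟮f⟯ (σ u) := by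
  let ι : k⟮f⟯ →+* k⟮f⟯ :=
    { toFun := fun u => ⟨σ u, map_mem_adjoin σ hB u.2⟩
      map_one' := Subtype.ext (map_one σ)
      map_zero' := Subtype.ext (map_zero σ)
      map_add' := fun _ _ => Subtype.ext (map_add σ _ _)
      map_mul' := fun _ _ => Subtype.ext (map_mul σ _ _) }
  exact (hu.isIntegral.map_of_comp_eq ι (σ : K →+* K) rfl).isAlgebraic

/-- An involution given by a rational function is a Möbius transformation. -/
lemma exists_mob_of_involution {s : K} (hs : Transcendental k s) (σ : K ≃ₐ[k] K)
    (hσ : ∀ u, σ (σ u) = u) {a b : k[X]} (hb : aeval s b ≠ 0)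
    (h : σ s * aeval s b = aeval s a) : ∃ B : Matrix (Fin 2) (Fin 2) k, Mob B s (σ s) := by
  obtain ⟨a, b, n, hab, ha, hb, hn, hb0, h⟩ := exists_coprime_ratio hb h
  have h1 : s * aeval (σ s) b = aeval (σ s) a := by
    have := congrArg σ h
    rw [map_mul, hσ] at this
    have hr : ∀ r : k[X], aeval (σ s) r = σ (aeval s r) := fun r =>
      aeval_algHom_apply (σ : K →ₐ[k] K) s r
    rwa [hr, hr]
  have h2 : X * homEval n b a b = homEval n a a b := by
    apply transcendental_iff_injective.1 hs
    rw [map_mul, map_homEval (R := k[X]) (S := K), map_homEval (R := k[X]) (S := K), ← h,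
      homEval_mul hb, homEval_mul ha, aeval_X, ← h1]
    ring
  let γ : k[X] →ₐ[k] k[X][Y] := IsScalarTower.toAlgHom k k[X] k[X][Y]
  have hγ : ∀ r, γ r = C r := fun r => rfl
  have hT : ∀ {m : ℕ} {r : k[X]}, r.natDegree ≤ m → TDegLE m (C r) := by
    intro m r hr i j hij
    rw [coeff_C]
    split_ifs with hj
    · exact coeff_eq_zero_of_natDegree_lt (by omega)
    · simp
  have hG : ∀ {r : k[X]}, r.coeff n ≠ 0 → (gr k (C r)).coeff n ≠ 0 := by
    intro r hr h0
    have := coeff_gr (C r) n 0 n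
    rw [h0, if_pos (by omega), coeff_C_zero] at this
    exact hr this.symm
  have h3 : n * n ≤ 1 := by
    refine mul_le_of_homEval (s := C a) (t := C b) (p := C X) (q := 1) (hab.map C).isRelPrime ha hb hn hab
      (hT ha) (hT hb) (hn.imp hG hG) (hT natDegree_X_le) ?_ (by simp) one_ne_zero ?_
    · rw [← C_1]; exact hT (by simp)
    · have := congrArg γ h2
      rw [map_mul, map_homEval (R := k[X]) (S := k[X][Y]), map_homEval (R := k[X]) (S := k[X][Y])] at this
      rwa [one_mul]
  have hn1 : n ≤ 1 := by nlinarith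
  have hlin : ∀ {r : k[X]}, r.natDegree ≤ n →
      aeval s r = algebraMap k K (r.coeff 1) * s + algebraMap k K (r.coeff 0) := by
    intro r hr
    conv_lhs => rw [eq_X_add_C_of_natDegree_le_one (hr.trans hn1)]
    simp
  refine ⟨!![a.coeff 1, a.coeff 0; b.coeff 1, b.coeff 0], ?_⟩
  rw [hlin hb] at hb0 h
  rw [hlin ha] at h
  exact ⟨hb0, h⟩

/-- The parameter of a pencil of minimal degree generates an algebraically closed subfield. -/
theorem mem_adjoin_of_isAlgebraic [IsAlgClosed k] (hsq : ∀ g : Γ, g * g = 1)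
    (hmin : ∀ d' < d, ¬ HasPencil φ d') (h : Gen k x y)
    (hp : TDegLE d p) (hq : TDegLE d q) (hq0 : ev k x y q ≠ 0)
    (hrel : f * ev k x y q = ev k x y p) (htr : Transcendental k f)
    (hA : ∀ g, Mob (A g) f (φ g f))
    (hY : (p.coeff d).coeff 0 ≠ 0 ∨ (q.coeff d).coeff 0 ≠ 0) {u : K} (hu : IsAlgebraic k⟮f⟯ u) :
    u ∈ k⟮f⟯ := by
  obtain ⟨s, hsalg, hs⟩ := exists_closure_generator h hp hq hq0 hrel htr hY
  obtain ⟨a, b, hb, hf⟩ := hs f (isAlgebraic_algebraMap (⟨f, mem_adjoin_simple_self k f⟩ : k⟮f⟯))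
  obtain ⟨a, b, n, hab, ha, hb, hn, hb0, hf⟩ := exists_coprime_ratio hb hf
  have hconst : ∀ c : k, algebraMap k K c ≠ f := by
    rintro c rfl
    exact htr (isAlgebraic_algebraMap c)
  have hstr : Transcendental k s := by
    refine transcendental_of_forall_ne ?_
    rintro c rfl
    rw [aeval_algebraMap_apply] at hb0 hf
    rw [aeval_algebraMap_apply] at hf
    refine hconst (aeval c a / aeval c b) ?_
    rw [map_div₀, ← hf, mul_div_cancel_right₀ _ hb0]
  obtain ⟨s₁, s₂, hrel', hs₂, e⟩ := h.exists_reduced s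
  have hs₂0 : s₂ ≠ 0 := by rintro rfl; simp at hs₂
  set m := max (gr k s₁).natDegree (gr k s₂).natDegree with hm
  have hs₁d : TDegLE m s₁ := tDegLE_iff.2 (le_max_left _ _)
  have hs₂d : TDegLE m s₂ := tDegLE_iff.2 (le_max_right _ _)
  have hgr : (gr k s₁).coeff m ≠ 0 ∨ (gr k s₂).coeff m ≠ 0 :=
    exists_coeff_max_ne_zero _ ((map_ne_zero_iff _ gr_injective).2 hs₂0)
  have hq00 : q ≠ 0 := by rintro rfl; simp at hq0
  have hp00 : p ≠ 0 := by
    rintro rfl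
    rw [map_zero] at hrel
    exact hconst 0 (by rw [map_zero]; exact ((mul_eq_zero.1 hrel).resolve_right hq0).symm)
  have hle : n * m ≤ d := by
    refine mul_le_of_homEval hrel' ha hb hn hab hs₁d hs₂d hgr hp hq hp00 hq00 (h.inj ?_)
    rw [map_mul, map_mul, map_homEval (R := k[X][Y]) (S := K), map_homEval (R := k[X][Y]) (S := K),
      ← e, homEval_mul ha, homEval_mul hb, ← hf, ← hrel]
    ring
  have hm0 := pos_of_transcendental hs₁d hs₂d hs₂ e hstr
  have hn1 : n ≤ 1 := by
    by_contra hn1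
    have hlt : m < d := by nlinarith
    have hmob : ∀ g, ∃ B : Matrix (Fin 2) (Fin 2) k, Mob B s (φ g s) := by
      intro g
      obtain ⟨a', b', hb', h'⟩ := hs _ (map_isAlgebraic (φ g) (hA g) hsalg)
      refine exists_mob_of_involution hstr (φ g) (fun u => ?_) hb' h'
      rw [← AlgEquiv.mul_apply, ← map_mul, hsq, map_one, AlgEquiv.one_apply]
    choose B hB using hmob
    exact hmin m hlt ⟨x, y, s₁, s₂, s, B, h, hs₁d, hs₂d, hs₂, e, hstr, hB⟩
  have hlin : ∀ {r : k[X]}, r.natDegree ≤ n →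
      aeval s r = algebraMap k K (r.coeff 1) * s + algebraMap k K (r.coeff 0) := by
    intro r hr
    conv_lhs => rw [eq_X_add_C_of_natDegree_le_one (hr.trans hn1)]
    simp
  rw [hlin hb] at hb0 hf
  rw [hlin ha] at hf
  have hs' : s * (algebraMap k K (b.coeff 1) * f - algebraMap k K (a.coeff 1)) =
      algebraMap k K (a.coeff 0) - algebraMap k K (b.coeff 0) * f := by linear_combination hf
  have hne : algebraMap k K (b.coeff 1) * f - algebraMap k K (a.coeff 1) ≠ 0 := by
    intro h0
    have key : ∀ c c' : k, c ≠ 0 → algebraMap k K c * f ≠ algebraMap k K c' := by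
      intro c c' hc h1
      refine hconst (c' / c) ?_
      rw [map_div₀, ← h1, mul_div_cancel_left₀ _ (by rwa [Ne, map_eq_zero])]
    by_cases hb1 : b.coeff 1 = 0
    · rw [h0, mul_zero] at hs'
      have hb2 : b.coeff 0 ≠ 0 := by
        intro hb2
        rw [hb1, hb2] at hb0
        simp at hb0
      exact key _ _ hb2 (sub_eq_zero.1 hs'.symm).symm
    · exact key _ _ hb1 (sub_eq_zero.1 h0)
  have hfm := mem_adjoin_simple_self k f
  have hsm : s ∈ k⟮f⟯ := by
    rw [eq_div_of_mul_eq hne hs']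
    exact div_mem (sub_mem (_root_.algebraMap_mem _ _) (mul_mem (_root_.algebraMap_mem _ _) hfm))
      (sub_mem (mul_mem (_root_.algebraMap_mem _ _) hfm) (_root_.algebraMap_mem _ _))
  obtain ⟨a', b', hb', e'⟩ := hs u hu
  have hpm : ∀ r : k[X], aeval s r ∈ k⟮f⟯ := fun r => by
    have := aeval_algHom_apply k⟮f⟯.val ⟨s, hsm⟩ r
    exact this ▸ (aeval (⟨s, hsm⟩ : k⟮f⟯) r).2
  rw [eq_div_of_mul_eq hb' e']
  exact div_mem (hpm _) (hpm _)

end Composite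
end CremonaRank

namespace CremonaRank
open Polynomial Bivariate

section Position
open IntermediateField
variable {k K Γ : Type*} [Field k] [Field K] [Algebra k K] [Group Γ] {φ : Γ →* (K ≃ₐ[k] K)}
  {d : ℕ} {x y f : K} {p q : k[X][Y]} {A : Γ → Matrix (Fin 2) (Fin 2) k}

lemma trans_zero_eq_map (a : k) (P : k[X][Y]) :
    trans a 0 P = P.map (compRingHom (X + C a)) := by
  have : (trans a 0 : k[X][Y] →+* k[X][Y]) = mapRingHom (compRingHom (X + C a)) := by
    apply ev_ext <;> simp [trans]
  exact congrArg (fun h => h P) this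

lemma coeff_trans_zero (a : k) (P : k[X][Y]) (j : ℕ) :
    (trans a 0 P).coeff j = (P.coeff j).comp (X + C a) := by
  rw [trans_zero_eq_map, coeff_map]; rfl

lemma TDegLE.trans_zero {P : k[X][Y]} (hP : TDegLE d P) (a : k) : TDegLE d (trans a 0 P) := by
  intro i j hij
  rw [coeff_trans_zero]
  by_cases h0 : P.coeff j = 0
  · simp [h0]
  · have h1 : (P.coeff j).natDegree + j ≤ d := by
      by_contra hlt
      exact h0 (leadingCoeff_eq_zero.1 (hP _ _ (not_le.1 hlt)))
    refine coeff_eq_zero_of_natDegree_lt ?_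
    rw [natDegree_comp, natDegree_X_add_C, mul_one]
    omega

lemma TDegLE.coeff_trans_zero_top {P : k[X][Y]} (hP : TDegLE d P) (a : k) :
    ((trans a 0 P).coeff d).coeff 0 = (P.coeff d).coeff 0 := by
  have h1 : P.coeff d = C ((P.coeff d).coeff 0) := by
    ext i
    rcases Nat.eq_zero_or_pos i with rfl | hi
    · simp
    · rw [hP _ _ (by omega), coeff_C, if_neg (by omega)]
  rw [coeff_trans_zero, h1, C_comp]

lemma map_eval_trans_zero (a : k) (P : k[X][Y]) :
    (trans a 0 P).map (evalRingHom 0) = P.map (evalRingHom a) := by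
  rw [trans_zero_eq_map, Polynomial.map_map]
  congr 1
  apply Polynomial.ringHom_ext <;> simp

lemma derivative_eq_zero_of_trans_zero {a : k} {P : k[X][Y]} (h : derivative (trans a 0 P) = 0) :
    derivative P = 0 := by
  rw [trans_zero_eq_map, derivative_map, ← trans_zero_eq_map] at h
  have h1 := trans_trans (-a) 0 (derivative P)
  rw [neg_neg, neg_zero, h, map_zero] at h1
  exact h1.symm

lemma derivative_eq_zero_of_hom {P : k[X][Y]} (hP : TDegLE d P) (h : derivative (hom d P) = 0) :
    derivative P = 0 := by
  ext j i
  rw [coeff_derivative, coeff_zero]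
  by_cases hij : d < i + (j + 1)
  · rw [← Nat.cast_add_one, ← C_eq_natCast, coeff_mul_C, hP _ _ hij, zero_mul, coeff_zero]
  · have := congrArg (fun P => (P.coeff j).coeff (d - (j + 1) - i)) h
    simp only [coeff_derivative, coeff_zero] at this
    rw [← Nat.cast_add_one, ← C_eq_natCast, coeff_mul_C, coeff_hom, if_pos (by omega),
      show d - (j + 1) - (d - (j + 1) - i) = i by omega] at this
    rwa [← Nat.cast_add_one, ← C_eq_natCast, coeff_mul_C]

lemma Gen.sub_const (h : Gen k x y) (a : k) : Gen k (x - algebraMap k K a) y := by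
  have key : ∀ P, ev k (x - algebraMap k K a) y P = ev k x y (trans (-a) 0 P) := fun P => by
    rw [ev_trans]; simp [sub_eq_add_neg]
  refine h.of_forall ?_ ⟨C X + C (C a), 1, by simp, by simp⟩ ⟨Y, 1, by simp, by simp⟩
  intro P Q hPQ
  rw [key, key] at hPQ
  have h1 := congrArg (trans a 0) (h.inj hPQ)
  have h2 : ∀ P : k[X][Y], trans a 0 (trans (-a) 0 P) = P := fun P => by
    have := trans_trans a 0 P
    rwa [neg_zero] at this
  rwa [h2, h2] at h1

/-- A general vertical line can be sent to infinity. -/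
lemma exists_line_at_infinity [IsAlgClosed k] (h : Gen k x y)
    (hp : TDegLE d p) (hq : TDegLE d q) (hq0 : ev k x y q ≠ 0)
    (hrel : f * ev k x y q = ev k x y p) (hpq : IsRelPrime p q)
    (hY : (p.coeff d).coeff 0 ≠ 0 ∨ (q.coeff d).coeff 0 ≠ 0)
    (hder : ¬ (derivative p = 0 ∧ derivative q = 0)) :
    ∃ (x y : K) (p q : k[X][Y]), Gen k x y ∧ TDegLE d p ∧ TDegLE d q ∧ ev k x y q ≠ 0 ∧
      f * ev k x y q = ev k x y p ∧ IsCoprime (top d p) (top d q) ∧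
      ((p.coeff d).coeff 0 ≠ 0 ∨ (q.coeff d).coeff 0 ≠ 0) ∧
      ¬ (derivative p = 0 ∧ derivative q = 0) := by
  obtain ⟨r, m, n, hr, e⟩ := exists_C_mem_of_isRelPrime hpq
  obtain ⟨a, ha⟩ : ∃ a, r.eval a ≠ 0 := by
    by_contra! hcon
    exact hr (funext fun s => by rw [hcon, eval_zero])
  have hx : x - algebraMap k K a ≠ 0 := by
    intro h0
    have := h.inj (a₁ := C (X - C a)) (a₂ := 0) (by simpa using h0)
    rw [C_eq_zero] at this
    exact X_sub_C_ne_zero a this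
  have hev : ∀ {P}, TDegLE d P → ev k (x - algebraMap k K a)⁻¹ (y * (x - algebraMap k K a)⁻¹)
      (hom d (trans a 0 P)) = (x - algebraMap k K a)⁻¹ ^ d * ev k x y P := by
    intro P hP
    rw [ev_hom (hP.trans_zero a) (inv_mul_cancel₀ hx), ev_trans, sub_add_cancel, map_zero, add_zero,
      mul_left_comm, mul_inv_cancel₀ hx, mul_one]
  have htop : ∀ {P}, TDegLE d P → top d (hom d (trans a 0 P)) = P.map (evalRingHom a) := by
    intro P hP
    rw [top, hom_hom (hP.trans_zero a), map_eval_trans_zero]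
  have hco : ∀ {P}, TDegLE d P → ((hom d (trans a 0 P)).coeff d).coeff 0 = (P.coeff d).coeff 0 := by
    intro P hP
    rw [coeff_hom, if_pos (by omega), Nat.sub_self, Nat.zero_sub, hP.coeff_trans_zero_top]
  refine ⟨_, _, hom d (trans a 0 p), hom d (trans a 0 q), (h.sub_const a).gen_inv, tdegLE_hom _ _,
    tdegLE_hom _ _, ?_, ?_, ?_, ?_, ?_⟩
  · rw [hev hq]
    exact mul_ne_zero (pow_ne_zero _ (inv_ne_zero hx)) hq0
  · rw [hev hq, hev hp, ← hrel]; ring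
  · rw [htop hp, htop hq]
    have h1 := congrArg (mapRingHom (evalRingHom a)) e
    rw [map_add, map_mul, map_mul, coe_mapRingHom, map_C, coe_evalRingHom] at h1
    refine ⟨C (r.eval a)⁻¹ * m.map (evalRingHom a), C (r.eval a)⁻¹ * n.map (evalRingHom a), ?_⟩
    rw [mul_assoc, mul_assoc, ← mul_add, h1, ← C_mul, inv_mul_cancel₀ ha, C_1]
  · rwa [hco hp, hco hq]
  · rintro ⟨h1, h2⟩
    exact hder ⟨derivative_eq_zero_of_trans_zero (derivative_eq_zero_of_hom (hp.trans_zero a) h1),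
      derivative_eq_zero_of_trans_zero (derivative_eq_zero_of_hom (hq.trans_zero a) h2)⟩

lemma ev_derivative_pencil {F : Type*} [Field F] [Algebra k F] [Algebra F K] [IsScalarTower k F K]
    (f : F) (p q : k[X][Y]) : ev F x y (derivative (pencil f p q)) =
      ev k x y (derivative p) - algebraMap F K f * ev k x y (derivative q) := by
  have hb : ∀ P : k[X][Y], derivative (bmap k F P) = bmap k F (derivative P) := fun P =>
    derivative_map P _
  simp [pencil, hb, ev_bmap]

/-- A group of exponent two of automorphisms of a rational function field in two variables has at
most sixteen elements as soon as it preserves a pencil. -/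
theorem card_le_of_hasPencil [IsAlgClosed k] [Finite Γ] (h2 : (2 : k) ≠ 0)
    (hsq : ∀ g : Γ, g * g = 1) (hφ : Function.Injective φ) (hd : ∃ d, HasPencil φ d) :
    Nat.card Γ ≤ 16 := by
  classical
  obtain ⟨d, hd, hmin⟩ : ∃ d, HasPencil φ d ∧ ∀ d' < d, ¬ HasPencil φ d' :=
    ⟨Nat.find hd, Nat.find_spec hd, fun d' h => Nat.find_min hd h⟩
  obtain ⟨x, y, p, q, f, A, h, hp, hq, hq0, hrel, htr, hA⟩ := hd
  obtain ⟨s, hY, hder⟩ := exists_lin hmin h hp hq hq0 hrel htr hA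
  replace hp := hp.lin s
  replace hq := hq.lin s
  replace h := h.lin s
  rw [← ev_lin s] at hq0
  rw [← ev_lin s x y q, ← ev_lin s x y p] at hrel
  have hK : ∀ {u : K}, IsAlgebraic k⟮f⟯ u → u ∈ k⟮f⟯ :=
    mem_adjoin_of_isAlgebraic hsq hmin h hp hq hq0 hrel htr hA hY
  obtain ⟨x, y, p, q, h, hp, hq, hq0, hrel, htop, hY, hder⟩ := exists_line_at_infinity h hp hq hq0
    hrel (isRelPrime_of_minimal hmin h hp hq hq0 hrel htr hA) hY hder
  have hpq := isRelPrime_of_minimal hmin h hp hq hq0 hrel htr hA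
  let f' : k⟮f⟯ := ⟨f, mem_adjoin_simple_self k f⟩
  have hco : ∀ r : k[X], ((aeval f' r : k⟮f⟯) : K) = aeval f r := fun r =>
    (aeval_algHom_apply k⟮f⟯.val f' r).symm
  refine (card_le_or_hasPencil (F := k⟮f⟯) (f := f') h hφ ⟨hsq, htr, h2, hA⟩ ?_ ?_ hq0 hrel hpq hp hq
    htop hY ?_).resolve_right ?_
  · rintro ⟨z, hz⟩
    obtain ⟨a, b, rfl⟩ := (mem_adjoin_simple_iff k z).1 hz
    by_cases hb : aeval f b = 0
    · refine ⟨0, 1, by simp, Subtype.ext ?_⟩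
      simp [hb]
    · refine ⟨a, b, fun h0 => hb (by rw [← hco, h0]; rfl), Subtype.ext ?_⟩
      rw [IntermediateField.coe_mul, hco, hco, div_mul_cancel₀ _ hb]
  · intro u hu
    exact ⟨⟨u, hK hu.isAlgebraic⟩, rfl⟩
  · rw [ev_derivative_pencil]
    intro h0
    exact hder (derivative_eq_zero_of_ev h hq0 hrel hpq (sub_eq_zero.1 h0))
  · rintro ⟨d', hlt, h'⟩
    exact hmin d' hlt h'

end Position
end CremonaRank

namespace CremonaRank
open Polynomial Bivariate

section Invariant
variable {k K Γ : Type*} [Field k] [Field K] [Algebra k K] [Group Γ]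

lemma Gen.transcendental {x y : K} (h : Gen k x y) : Transcendental k x := by
  rw [transcendental_iff_injective]
  intro a b hab
  have key : ∀ r : k[X], ev k x y (C r) = aeval x r := fun r => by simp
  rw [← key, ← key] at hab
  exact C_injective (h.inj hab)

lemma exists_transcendental_fixed [IsAlgClosed k] [Finite Γ] {x y : K} (h : Gen k x y)
    (φ : Γ →* (K ≃ₐ[k] K)) : ∃ f : K, Transcendental k f ∧ ∀ g, φ g f = f := by
  let _ : MulSemiringAction Γ K := MulSemiringAction.compHom K φ
  by_contra! hcon
  have hc : ∀ u : FixedPoints.subfield Γ K, ∃ c : k, algebraMap k K c = u := by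
    intro u
    by_contra! hu
    obtain ⟨g, hg⟩ := hcon u (transcendental_of_forall_ne hu)
    exact hg (u.2 g)
  choose c hc using hc
  have hinj := (algebraMap k K).injective
  let γ : FixedPoints.subfield Γ K →+* k :=
    { toFun := c
      map_one' := hinj (by rw [hc, map_one]; rfl)
      map_zero' := hinj (by rw [hc, map_zero]; rfl)
      map_add' := fun a b => hinj (by rw [hc, map_add, hc, hc]; rfl)
      map_mul' := fun a b => hinj (by rw [hc, map_mul, hc, hc]; rfl) }
  have h1 : IsIntegral (FixedPoints.subfield Γ K) x := FixedPoints.isIntegral Γ K x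
  exact h.transcendental (h1.map_of_comp_eq γ (RingHom.id K) (RingHom.ext hc)).isAlgebraic

lemma exists_hasPencil [IsAlgClosed k] [Finite Γ] {x y : K} (h : Gen k x y)
    (φ : Γ →* (K ≃ₐ[k] K)) : ∃ d, HasPencil φ d := by
  obtain ⟨f, hf, hfix⟩ := exists_transcendental_fixed h φ
  obtain ⟨p, q, hq, e⟩ := h.frac f
  refine ⟨max (gr k p).natDegree (gr k q).natDegree, x, y, p, q, f, fun _ => 1, h,
    tDegLE_iff.2 (le_max_left _ _), tDegLE_iff.2 (le_max_right _ _), hq, e, hf, fun g => ?_⟩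
  simp [Mob, hfix]

end Invariant

lemma gen_fractionRing (k : Type*) [Field k] :
    Gen k (algebraMap (MvPolynomial (Fin 2) k) (FractionRing (MvPolynomial (Fin 2) k))
        (MvPolynomial.X 0))
      (algebraMap (MvPolynomial (Fin 2) k) (FractionRing (MvPolynomial (Fin 2) k))
        (MvPolynomial.X 1)) := by
  set x := algebraMap (MvPolynomial (Fin 2) k) (FractionRing (MvPolynomial (Fin 2) k))
    (MvPolynomial.X 0)
  set y := algebraMap (MvPolynomial (Fin 2) k) (FractionRing (MvPolynomial (Fin 2) k))
    (MvPolynomial.X 1)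
  have key : ∀ P, ev k x y P = algebraMap (MvPolynomial (Fin 2) k)
      (FractionRing (MvPolynomial (Fin 2) k)) (equivMvPolynomial k P) := by
    have : (ev k x y : k[X][Y] →+* _) = (algebraMap (MvPolynomial (Fin 2) k)
        (FractionRing (MvPolynomial (Fin 2) k))).comp (equivMvPolynomial k : k[X][Y] →+* _) := by
      apply ev_ext
      · intro c
        simpa using IsScalarTower.algebraMap_apply k (MvPolynomial (Fin 2) k) _ c
      · simp [x]
      · simp [y]
    exact fun P => congrArg (fun h => h P) this
  constructor
  · intro P Q hPQ
    rw [key, key] at hPQ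
    exact (equivMvPolynomial k).injective (IsFractionRing.injective _ _ hPQ)
  · intro u
    obtain ⟨a, b, hb, rfl⟩ := IsFractionRing.div_surjective (A := MvPolynomial (Fin 2) k) u
    refine ⟨(equivMvPolynomial k).symm a, (equivMvPolynomial k).symm b, ?_, ?_⟩
    · rw [key, AlgEquiv.apply_symm_apply]
      exact IsFractionRing.to_map_ne_zero_of_mem_nonZeroDivisors hb
    · rw [key, key, AlgEquiv.apply_symm_apply, AlgEquiv.apply_symm_apply, div_mul_cancel₀]
      exact IsFractionRing.to_map_ne_zero_of_mem_nonZeroDivisors hb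

end CremonaRank

/-- if `k` is algebraically closed with `char k ≠ 2`
and `G ≤ Cr_k = Aut_k(k(x,y))` is isomorphic to `(ℤ/2)^r`, then `r ≤ 4`. -/
theorem two_elementary_rank_le_four
    (k : Type*) [Field k] [IsAlgClosed k] (hchar : ringChar k ≠ 2)
    (r : ℕ) (G : Subgroup (Kxy k ≃ₐ[k] Kxy k))
    (hG : Nonempty (G ≃* Multiplicative (Fin r → ZMod 2))) :
    r ≤ 4 := by
  obtain ⟨e⟩ := hG
  have : Finite G := Finite.of_equiv _ e.symm.toEquiv
  have hsq : ∀ g : G, g * g = 1 := by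
    intro g
    apply e.injective
    rw [map_mul, map_one]
    apply Multiplicative.toAdd.injective
    funext i
    exact CharTwo.add_self_eq_zero _
  have h := CremonaRank.card_le_of_hasPencil (φ := G.subtype) (Ring.two_ne_zero hchar) hsq
    G.subtype_injective (CremonaRank.exists_hasPencil (CremonaRank.gen_fractionRing k) _)
  rw [Nat.card_congr (e.toEquiv.trans Multiplicative.toAdd), Nat.card_fun, Nat.card_fin,
    Nat.card_zmod] at h
  exact (Nat.pow_le_pow_iff_right (a := 2) one_lt_two).1 (h.trans_eq (by norm_num))
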